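/- For every β < β_c = (1/2)·log(1+√2) with β ≠ −β_c, and every Gibbs measure γ for the Ising model on Z²_* with parameter β, γ-almost surely the contour configuration Γ(σ) has an infinite cluster: the contours of the Ising model percolate. -/

import Mathlib

open MeasureTheory
open scoped BigOperators

noncomputable section

/-- Vertices of the square lattice `ℤ²`. -/
abbrev V : Type := ℤ × ℤ

/-- Nearest-neighbour adjacency on `ℤ²` (`ℓ¹`-distance one). -/
def latAdj (x y : V) : Prop := |x.1 - y.1| + |x.2 - y.2| = 1

/-- The edge set `E₂` of the square lattice, as a set of unordered pairs of vertices. -/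
def E2 : Set (Sym2 V) := {e | ∃ x y : V, latAdj x y ∧ e = s(x, y)}

abbrev Edge : Type := ↥E2

/-- An edge configuration: an element of `{0,1}^{E₂}` (`true` = open). -/
abbrev Config : Type := Edge → Bool

/-- The four unit directions. -/
def dir : Fin 4 → V := ![(1, 0), (-1, 0), (0, 1), (0, -1)]

/-- Spin configurations on the dual lattice `ℤ²_* = (1/2,1/2) + ℤ²`, with dual sites
indexed by `ℤ²` (the index `u` stands for the dual point `u + (1/2,1/2)`);
`true` stands for spin `+1` and `false` for spin `-1`. -/
abbrev SpinConfig : Type := V → Bool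

/-- The value `±1` of a spin. -/
def spinVal (b : Bool) : ℝ := if b then 1 else -1

/-- The two endpoints (in dual coordinates) of the dual edge `e_*` crossing the
primal edge `{x, y}`. -/
def dualSites (x y : V) : V × V :=
  let m : V := (x.1 ⊓ y.1, x.2 ⊓ y.2)
  if x.2 = y.2 then (m, (m.1, m.2 - 1)) else (m, (m.1 - 1, m.2))

lemma dualSites_comm (x y : V) : dualSites x y = dualSites y x := by
  unfold dualSites
  by_cases h : x.2 = y.2
  · rw [if_pos h, if_pos h.symm]
    simp [inf_comm]
  · rw [if_neg h, if_neg (fun hh => h hh.symm)]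
    simp [inf_comm]

def contourPair (σ : SpinConfig) (x y : V) : Bool :=
  σ (dualSites x y).1 != σ (dualSites x y).2

/-- The contour map `Γ`: the edge `e` is open in `Γ(σ)` iff the spins of `σ` at the two
endpoints of the dual edge `e_*` differ. -/
def contour (σ : SpinConfig) : Config :=
  fun e => Sym2.lift ⟨fun x y => contourPair σ x y,
    fun x y => by simp only [contourPair, dualSites_comm]⟩ e.1

/-- The dual edges meeting a finite set `Λ` of dual sites (each dual edge recorded once,
as an unordered pair of dual sites). -/
def dualEdges (Λ : Finset V) : Finset (Sym2 V) :=
  (Λ ×ˢ (Finset.univ : Finset (Fin 4))).image (fun pr => s(pr.1, pr.1 + dir pr.2))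

def pairEnergy (σ : SpinConfig) : Sym2 V → ℝ :=
  Sym2.lift ⟨fun x y => spinVal (σ x) * spinVal (σ y), fun _ _ => mul_comm _ _⟩

/-- The Hamiltonian `H_Λ(σ) = -∑ σ_x σ_y`, the sum running over dual edges meeting `Λ`. -/
def hamiltonian (Λ : Finset V) (σ : SpinConfig) : ℝ :=
  - ∑ e ∈ dualEdges Λ, pairEnergy σ e

/-- Concatenation of spin configurations. -/
def spatch (Λ : Finset V) (η : ↥Λ → Bool) (σ : SpinConfig) : SpinConfig :=
  fun x => if h : x ∈ Λ then η ⟨x, h⟩ else σ x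

/-- The partition function `Z^β_Λ(σ)`. -/
def Zpart (β : ℝ) (Λ : Finset V) (σ : SpinConfig) : ℝ :=
  ∑ η : ↥Λ → Bool, Real.exp (-β * hamiltonian Λ (spatch Λ η σ))

/-- The finite-volume Gibbs kernel `Π^β_Λ` of the Ising model. -/
def PiOp (β : ℝ) (Λ : Finset V) (f : SpinConfig → ℝ) (σ : SpinConfig) : ℝ :=
  (∑ η : ↥Λ → Bool, Real.exp (-β * hamiltonian Λ (spatch Λ η σ)) * f (spatch Λ η σ)) /
    Zpart β Λ σ

/-- `γ` is a Gibbs measure for the Ising model on the dual lattice with parameter `β`. -/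
def IsGibbsIsing (β : ℝ) (γ : Measure SpinConfig) : Prop :=
  IsProbabilityMeasure γ ∧
    ∀ f : SpinConfig → ℝ, Continuous f → ∀ Λ : Finset V,
      ∫ σ, f σ ∂γ = ∫ σ, PiOp β Λ f σ ∂γ

/-- `x` and `y` are joined by an open edge of `ω`. -/
def openAdj (ω : Config) (x y : V) : Prop :=
  ∃ h : s(x, y) ∈ E2, ω ⟨s(x, y), h⟩ = true

/-- `x` and `y` are connected by a path of open edges of `ω`. -/
def openConn (ω : Config) : V → V → Prop := Relation.ReflTransGen (openAdj ω)

/-- The cluster of `x` in `ω`: the connected component of `x` in the graph of open edges. -/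
def cluster (ω : Config) (x : V) : Set V := {y | openConn ω x y}

/-- The configuration `ω` has an infinite cluster of open edges. -/
def HasInfiniteCluster (ω : Config) : Prop := ∃ x : V, (cluster ω x).Infinite

/-- The percolation event `𝒞`: there exists an infinite open cluster. -/
def percEvent : Set Config := {ω | HasInfiniteCluster ω}

open Filter Topology Relation
set_option linter.unusedSectionVars false
open Finset (Icc Ico add_sum_erase card_le_card card_product card_univ filter_congr induction_on mem_Icc mem_coe
  mem_filter mem_image mem_insert_self mem_inter mem_powerset mem_product mem_singleton_self mem_union_right
  mem_univ mul_sum prod_congr prod_const prod_mul_distrib range single_le_sum subset_union_left sum_add_distrib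
  sum_attach sum_coe_sort sum_comm sum_congr sum_const sum_div sum_filter sum_image sum_le_card_nsmul sum_le_sum
  sum_mul sum_neg_distrib sum_nonneg sum_pos sum_product sum_range_succ sum_sub_distrib univ univ_nonempty)
open Real (cosh exp exp_add exp_le_exp exp_log exp_pos exp_sum log log_div log_le_log sqrt tanh)
open Function (update update_of_ne)
open Set (indicator_of_mem)
open Nat (cast_nonneg even_or_odd)
open Int (leInduction)
open Fintype (card card_coe sum_bool sum_equiv sum_prod_type)
open Prod (fst_sub fst_zero snd_sub snd_zero)
open Equiv (arrowCongr boolNot subRight)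

local notation "Ω" => SpinConfig

/-- Real functions of bits indexed by `α`. -/
local notation "𝓕" α:max => (α → Bool) → ℝ

section Osss
open scoped Classical

variable {E : Type} [Fintype E]

def agreeOn (F : Finset E) (ξ ω : E → Bool) : Prop := ∀ e ∈ F, ω e = ξ e

def condSum (w : 𝓕 E) (F : Finset E) (ξ : E → Bool) (g : 𝓕 E) : ℝ := ∑ ω, if agreeOn F ξ ω then w ω * g ω else 0

/-- Conditional expectation given the coordinates in `F`. -/
def condEx (w : 𝓕 E) (F : Finset E) (ξ : E → Bool) (g : 𝓕 E) : ℝ := condSum w F ξ g / condSum w F ξ 1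

/-- Expectation with respect to the normalised weight `w`. -/
def wEx {α : Type} [Fintype α] (w : α → ℝ) (g : α → ℝ) : ℝ := (∑ ω, w ω * g ω) / ∑ ω, w ω

/-- Covariance with respect to the normalised weight `w`. -/
def wCov {α : Type} [Fintype α] (w : α → ℝ) (f g : α → ℝ) : ℝ := wEx w (f * g) - wEx w f * wEx w g

def cInd (e : E) : 𝓕 E := fun ω => if ω e then 1 else 0

lemma cInd_mono (e : E) : Monotone (cInd e) := by
  intro a b h
  unfold cInd
  cases ha : a e <;> cases hb : b e <;> simp_all
  exact absurd (ha ▸ hb ▸ h e : true ≤ false) (by decide)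

structure LatWeight (w : 𝓕 E) : Prop where
  pos : ∀ ω, 0 < w ω
  lattice : ∀ a b, w a * w b ≤ w (a ⊓ b) * w (a ⊔ b)

variable {w : 𝓕 E}

lemma condSum_one_pos (hw : ∀ ω, 0 < w ω) (F : Finset E) (ξ : E → Bool) : 0 < condSum w F ξ 1 := by
  apply Finset.sum_pos'
  · intro i _
    split_ifs
    · simpa using (hw i).le
    grind
  · refine ⟨ξ, mem_univ _, ?_⟩
    simp_all [agreeOn]

lemma condEx_mono (hw : LatWeight w) (F : Finset E) {ξ ζ : E → Bool} (h : ξ ≤ ζ)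
    {g : 𝓕 E} (hg : Monotone g) : condEx w F ξ g ≤ condEx w F ζ g := by
  set a := condSum w F ξ 1 with ha
  set b := condSum w F ζ 1 with hb
  have hapos : 0 < a := condSum_one_pos hw.pos F ξ
  have hbpos : 0 < b := condSum_one_pos hw.pos F ζ
  let p : 𝓕 E := fun ω => (if agreeOn F ξ ω then w ω else 0) / a
  let q : 𝓕 E := fun ω => (if agreeOn F ζ ω then w ω else 0) / b
  let μ : 𝓕 E := fun ω => g ω - g ⊥
  have hp0 : 0 ≤ p := fun ω => by apply div_nonneg _ hapos.le; split_ifs; exacts [(hw.pos ω).le, le_rfl]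
  have hq0 : 0 ≤ q := fun ω => by apply div_nonneg _ hbpos.le; split_ifs; exacts [(hw.pos ω).le, le_rfl]
  have hps : ∑ ω, p ω = 1 := by
    rw [← sum_div, div_eq_one_iff_eq hapos.ne', ha]
    simp [condSum]
  have hqs : ∑ ω, q ω = 1 := by
    rw [← sum_div, div_eq_one_iff_eq hbpos.ne', hb]
    simp [condSum]
  have key := holley (μ := μ) (f := p) (g := q) (fun ω => by simpa [μ] using hg bot_le) hp0 hq0
    (fun x y hxy => by simpa [μ] using hg hxy) (by rw [hps, hqs]) (by
      intro x y
      by_cases hx : agreeOn F ξ x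
      · by_cases hy : agreeOn F ζ y
        · have h1 : agreeOn F ξ (x ⊓ y) := fun e he => by
            have := h e
            simp only [Pi.inf_apply, hx e he, hy e he]; simp_all
          have h2 : agreeOn F ζ (x ⊔ y) := fun e he => by
            have := h e
            simp only [Pi.sup_apply, hx e he, hy e he]; simp_all
          simp [p, q, if_pos hx, if_pos hy, if_pos h1, if_pos h2]
          rw [div_mul_div_comm, div_mul_div_comm]
          exact div_le_div_of_nonneg_right (hw.lattice x y) (mul_pos hapos hbpos).le
        · have : q y = 0 := by simp [q, hy]
          rw [this, mul_zero]; exact mul_nonneg (hp0 _) (hq0 _)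
      · have : p x = 0 := by simp [p, hx]
        rw [this, zero_mul]; exact mul_nonneg (hp0 _) (hq0 _))
  have e1 : ∑ ω, μ ω * p ω = condEx w F ξ g - g ⊥ := by
    have : ∑ ω, μ ω * p ω = ∑ ω, g ω * p ω - g ⊥ * ∑ ω, p ω := by
      rw [mul_sum, ← sum_sub_distrib]; exact sum_congr rfl fun ω _ => by linarith
    rw [this, hps, mul_one]; congr 1
    unfold condEx condSum
    rw [sum_div]; refine sum_congr rfl fun ω _ => ?_
    simp only [p]; split_ifs
    · rw [ha]; unfold condSum; ring
    · simp
  have e2 : ∑ ω, μ ω * q ω = condEx w F ζ g - g ⊥ := by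
    have : ∑ ω, μ ω * q ω = ∑ ω, g ω * q ω - g ⊥ * ∑ ω, q ω := by
      rw [mul_sum, ← sum_sub_distrib]; exact sum_congr rfl fun ω _ => by linarith
    rw [this, hqs, mul_one]; congr 1
    unfold condEx condSum
    rw [sum_div]; refine sum_congr rfl fun ω _ => ?_
    simp only [q]; split_ifs
    · rw [hb]; unfold condSum; ring
    · simp
  simp_all

lemma wEx_eq_condEx (ξ : E → Bool) (g : 𝓕 E) : wEx w g = condEx w ∅ ξ g := by simp [wEx, condEx, condSum, agreeOn]

lemma agreeOn_insert {F : Finset E} {e : E} {ξ ω : E → Bool} {b : Bool} :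
    agreeOn (insert e F) (update ξ e b) ω ↔ ω e = b ∧ ∀ x ∈ F, x ≠ e → ω x = ξ x := by
  grind [agreeOn]

lemma condSum_step_true (F : Finset E) (ξ : E → Bool) (e : E) (he : e ∉ F) (g : 𝓕 E) (b : Bool) :
    condSum w (insert e F) (update ξ e b) g =
      ∑ ω, if agreeOn F ξ ω ∧ ω e = b then w ω * g ω else 0 := by
  unfold condSum
  grind [agreeOn]

lemma condEx_step (hw : ∀ ω, 0 < w ω) (F : Finset E) (ξ : E → Bool) (e : E) (g : 𝓕 E) :
    condEx w F ξ g = condEx w F ξ (cInd e) * condEx w (insert e F) (update ξ e true) g +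
      (1 - condEx w F ξ (cInd e)) * condEx w (insert e F) (update ξ e false) g := by
  by_cases he : e ∈ F
  · have hc : condEx w F ξ (cInd e) = if ξ e then 1 else 0 := by
      unfold condEx
      rw [div_eq_iff (condSum_one_pos hw F ξ).ne']
      unfold condSum
      rw [mul_sum]
      refine sum_congr rfl fun ω _ => ?_
      split_ifs with h1 h2 h2
      · simp [cInd, h1 e he, h2]
      · simp [cInd, h1 e he, h2]
      · simp
      · simp
    rw [hc, Finset.insert_eq_of_mem he]
    cases h : ξ e
    · rw [show update ξ e false = ξ by grind]; simp
    · rw [show update ξ e true = ξ by grind]; simp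
  · have h1 := condSum_one_pos hw (insert e F) (update ξ e true)
    have h2 := condSum_one_pos hw (insert e F) (update ξ e false)
    have s1 : ∀ g, condSum w F ξ g = condSum w (insert e F) (update ξ e true) g + condSum w (insert e F) (update ξ e false) g := by
      intro g
      rw [condSum_step_true F ξ e he, condSum_step_true F ξ e he, ← sum_add_distrib]
      unfold condSum
      grind
    have s2 : condSum w F ξ (cInd e) = condSum w (insert e F) (update ξ e true) 1 := by
      rw [condSum_step_true F ξ e he]
      refine sum_congr rfl fun ω _ => ?_
      cases h : ω e <;> simp [cInd, h]
    grind [condEx]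

lemma condEx_congr (hw : ∀ ω, 0 < w ω) {F : Finset E} {ξ : E → Bool} {g : 𝓕 E} {c : ℝ}
    (h : ∀ ω, agreeOn F ξ ω → g ω = c) : condEx w F ξ g = c := by
  unfold condEx
  rw [div_eq_iff (condSum_one_pos hw F ξ).ne']
  unfold condSum
  rw [mul_sum]
  refine sum_congr rfl fun ω _ => ?_
  split_ifs with h1
  · rw [h ω h1]; simp; ring
  · simp

lemma condEx_congr_agree {F : Finset E} {ξ ζ : E → Bool} (h : ∀ e ∈ F, ξ e = ζ e) (g : 𝓕 E) : condEx w F ξ g = condEx w F ζ g := by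
  have : ∀ ω, agreeOn F ξ ω ↔ agreeOn F ζ ω := fun ω =>
    ⟨fun h1 e he => (h1 e he).trans (h e he), fun h1 e he => (h1 e he).trans (h e he).symm⟩
  grind [condEx, condSum]

lemma condEx_mono_fun (hw : ∀ ω, 0 < w ω) {F : Finset E} {ξ : E → Bool} {g g' : 𝓕 E}
    (h : ∀ ω, g ω ≤ g' ω) : condEx w F ξ g ≤ condEx w F ξ g' := by
  apply div_le_div_of_nonneg_right _ (condSum_one_pos hw F ξ).le
  grind [condSum, sum_le_sum, mul_le_mul_of_nonneg_left]

lemma condEx_const (hw : ∀ ω, 0 < w ω) (F : Finset E) (ξ : E → Bool) (c : ℝ) :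
    condEx w F ξ (fun _ => c) = c := condEx_congr hw fun _ _ => rfl

lemma condEx_nonneg (hw : ∀ ω, 0 < w ω) {F : Finset E} {ξ : E → Bool} {g : 𝓕 E} (h : ∀ ω, 0 ≤ g ω) : 0 ≤ condEx w F ξ g := by
  have := condEx_mono_fun hw (F := F) (ξ := ξ) (g := fun _ => 0) (g' := g) h
  rwa [condEx_const hw] at this

lemma condEx_coord_nonneg (hw : ∀ ω, 0 < w ω) (F : Finset E) (ξ : E → Bool) (e : E) :
    0 ≤ condEx w F ξ (cInd e) := condEx_nonneg hw fun ω => by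
  grind [cInd]

lemma condEx_coord_le_one (hw : ∀ ω, 0 < w ω) (F : Finset E) (ξ : E → Bool) (e : E) : condEx w F ξ (cInd e) ≤ 1 := by
  have := condEx_mono_fun hw (F := F) (ξ := ξ) (g := cInd e) (g' := fun _ => 1) (fun ω => by grind [cInd])
  rwa [condEx_const hw] at this

end Osss

section Osss
open scoped Classical

variable {E : Type} [Fintype E] {w : 𝓕 E}

lemma update_mono_cfg (e : E) (b : Bool) {ξ ζ : E → Bool} (h : ξ ≤ ζ) : update ξ e b ≤ update ζ e b := by
  intro x
  by_cases hx : x = e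
  · subst hx; simp
  · simpa [hx] using h x

lemma update_false_le_true (ξ : E → Bool) (e : E) : update ξ e false ≤ update ξ e true := by simp_all

/-- A function of the configuration depending only on the coordinates in `F`. -/
def dependsOnly (F : Finset E) (g : 𝓕 E) : Prop := ∀ ω ω', (∀ e ∈ F, ω e = ω' e) → g ω = g ω'

lemma wEx_condEx (hw : ∀ ω, 0 < w ω) (F : Finset E) (g : 𝓕 E) : wEx w (fun ω => condEx w F ω g) = wEx w g := by
  unfold wEx
  congr 1
  have h1 : ∀ ω, w ω * condEx w F ω g = ∑ ω', if agreeOn F ω ω' then w ω * (w ω' * g ω') / condSum w F ω' 1 else 0 := by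
    intro ω
    unfold condEx
    conv_lhs => rw [condSum]
    rw [sum_div, mul_sum]
    refine sum_congr rfl fun ω' _ => ?_
    simp [condSum, agreeOn]; grind
  simp_rw [h1]
  rw [sum_comm]
  refine sum_congr rfl fun ω' _ => ?_
  have h2 : ∀ ω, agreeOn F ω ω' ↔ agreeOn F ω' ω := fun ω => ⟨fun h e he => (h e he).symm, fun h e he => (h e he).symm⟩
  have h3 : (∑ ω, if agreeOn F ω ω' then w ω * (w ω' * g ω') / condSum w F ω' 1 else 0) =
      condSum w F ω' 1 * ((w ω' * g ω') / condSum w F ω' 1) := by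
    simp [mul_div_assoc, condSum, sum_mul]; grind
  grind [condSum_one_pos]

section General
variable {α : Type} [Fintype α] {v : α → ℝ}

lemma wSum_pos [Nonempty α] (hv : ∀ ω, 0 < v ω) : 0 < ∑ ω, v ω := sum_pos (fun ω _ => hv ω) univ_nonempty

lemma wEx_mono [Nonempty α] (hv : ∀ ω, 0 < v ω) {g g' : α → ℝ} (h : ∀ ω, g ω ≤ g' ω) : wEx v g ≤ wEx v g' :=
  div_le_div_of_nonneg_right (sum_le_sum fun ω _ => mul_le_mul_of_nonneg_left (h ω) (hv ω).le)
    (wSum_pos hv).le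

lemma wEx_add (g g' : α → ℝ) : wEx v (g + g') = wEx v g + wEx v g' := by simp_all [wEx, add_div, sum_add_distrib, mul_add]

lemma wEx_smul (c : ℝ) (g : α → ℝ) : wEx v (fun ω => c * g ω) = c * wEx v g := by simp [wEx, mul_div_assoc', mul_sum]; grind

lemma wEx_sub (g g' : α → ℝ) : wEx v (g - g') = wEx v g - wEx v g' := by
  have : g - g' = g + fun ω => (-1) * g' ω := by ext; simp; ring
  rw [this, wEx_add, wEx_smul]; ring

lemma wEx_sum {ι : Type} (s : Finset ι) (g : ι → α → ℝ) : wEx v (fun ω => ∑ i ∈ s, g i ω) = ∑ i ∈ s, wEx v (g i) := by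
  unfold wEx
  rw [← sum_div, sum_comm]
  simp [mul_sum]

lemma wEx_const [Nonempty α] (hv : ∀ ω, 0 < v ω) (c : ℝ) : wEx v (fun _ => c) = c := by
  unfold wEx
  rw [← sum_mul, mul_div_assoc, mul_comm, div_mul_cancel₀ _ (wSum_pos hv).ne']

lemma wEx_nonneg (hv : ∀ ω, 0 ≤ v ω) {g : α → ℝ} (h : ∀ ω, 0 ≤ g ω) : 0 ≤ wEx v g :=
  div_nonneg (sum_nonneg fun ω _ => mul_nonneg (hv ω) (h ω)) (sum_nonneg fun ω _ => hv ω)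

/-- Derivative of an expectation under an exponential tilt. -/
lemma hasDerivAt_wEx_tilt [Nonempty α] (hv : ∀ ω, 0 < v ω) (k f : α → ℝ) (s : ℝ) :
    HasDerivAt (fun s => wEx (fun ω => exp (s * k ω) * v ω) f)
      (wCov (fun ω => exp (s * k ω) * v ω) f k) s := by
  have h1 : ∀ g : α → ℝ, HasDerivAt (fun s => ∑ ω, exp (s * k ω) * v ω * g ω) (∑ ω, exp (s * k ω) * v ω * (g ω * k ω)) s := by
    intro g
    apply HasDerivAt.fun_sum
    intro ω _
    have h2 : HasDerivAt (fun s : ℝ => s * k ω) (k ω) s := by simpa using (hasDerivAt_id s).mul_const (k ω)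
    have := ((h2.exp).mul_const (v ω)).mul_const (g ω)
    grind
  have hp : 0 < ∑ ω, exp (s * k ω) * v ω := by grind [wSum_pos, mul_pos, exp_pos]
  have h4 : HasDerivAt (fun s => ∑ ω, exp (s * k ω) * v ω) (∑ ω, exp (s * k ω) * v ω * k ω) s := by simpa using h1 1
  have h3 := (h1 f).div h4 hp.ne'
  unfold wCov wEx
  refine h3.congr_deriv ?_
  grind [Pi.mul_apply]
end General

/-- Positive association of a weight satisfying the lattice condition. -/
lemma wEx_fkg (hw : LatWeight w) {f g : 𝓕 E} (hf : Monotone f) (hg : Monotone g) : wEx w f * wEx w g ≤ wEx w (f * g) := by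
  let f' : 𝓕 E := fun ω => f ω - f ⊥
  let g' : 𝓕 E := fun ω => g ω - g ⊥
  have key := fkg (μ := w) (f := f') (g := g') (fun ω => (hw.pos ω).le)
    (fun ω => by simpa [f'] using hf bot_le) (fun ω => by simpa [g'] using hg bot_le)
    (fun x y h => by simpa [f'] using hf h) (fun x y h => by simpa [g'] using hg h) hw.lattice
  have hS := wSum_pos hw.pos
  have e1 : ∑ ω, w ω * f' ω = (∑ ω, w ω * f ω) - f ⊥ * ∑ ω, w ω := by
    rw [mul_sum, ← sum_sub_distrib]; exact sum_congr rfl fun _ _ => by grind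
  have e2 : ∑ ω, w ω * g' ω = (∑ ω, w ω * g ω) - g ⊥ * ∑ ω, w ω := by
    rw [mul_sum, ← sum_sub_distrib]; exact sum_congr rfl fun _ _ => by grind
  have e3 : ∑ ω, w ω * (f' ω * g' ω) = (∑ ω, w ω * (f * g) ω) - f ⊥ * (∑ ω, w ω * g ω) - g ⊥ * (∑ ω, w ω * f ω)
      + f ⊥ * g ⊥ * ∑ ω, w ω := by
    rw [mul_sum, mul_sum, mul_sum, ← sum_sub_distrib, ← sum_sub_distrib, ← sum_add_distrib]
    exact sum_congr rfl fun _ _ => by grind [Pi.mul_apply]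
  rw [e1, e2, e3] at key
  unfold wEx
  rw [div_mul_div_comm, div_le_div_iff₀ (mul_pos hS hS) hS]
  nlinarith

lemma wEx_step (hw : ∀ ω, 0 < w ω) (F : Finset E) (e : E) {g : 𝓕 E} (hg : dependsOnly (insert e F) g) :
    wEx w g = wEx w (fun ω => condEx w F ω (cInd e) * g (update ω e true) +
      (1 - condEx w F ω (cInd e)) * g (update ω e false)) := by
  rw [← wEx_condEx hw F g]
  congr 1
  funext ω
  rw [condEx_step hw F ω e g]
  congr 2 <;> exact condEx_congr hw fun ω' h => hg _ _ h

lemma wEx_condVar_le (hw : LatWeight w) (F : Finset E) (e : E) {f : 𝓕 E} (hf : Monotone f) :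
    wEx w (fun ω => condEx w F ω (cInd e) * (1 - condEx w F ω (cInd e)) *
      (condEx w (insert e F) (update ω e true) f - condEx w (insert e F) (update ω e false) f)) ≤ wCov w f (cInd e) := by
  set q : 𝓕 E := fun ω => condEx w F ω (cInd e) with hq
  set m : 𝓕 E := fun ω => condEx w F ω f with hm
  have h1 : ∀ ω, condEx w F ω (f * cInd e) = q ω * condEx w (insert e F) (update ω e true) f := by
    intro ω
    rw [condEx_step hw.pos F ω e]
    have a1 : condEx w (insert e F) (update ω e true) (f * cInd e) = condEx w (insert e F) (update ω e true) f := by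
      unfold condEx condSum
      congr 1
      refine sum_congr rfl fun η _ => ?_
      split_ifs with h
      · have : η e = true := by simpa using h e (mem_insert_self _ _)
        simp [cInd, this]
      · rfl
    have a2 : condEx w (insert e F) (update ω e false) (f * cInd e) = 0 := by
      refine condEx_congr hw.pos fun η h => ?_
      have : η e = false := by simpa using h e (mem_insert_self _ _)
      simp [cInd, this]
    grind
  have h2 : (fun ω => q ω * (1 - q ω) * (condEx w (insert e F) (update ω e true) f - condEx w (insert e F) (update ω e false) f)) =
      (fun ω => condEx w F ω (f * cInd e)) - m * q := by
    funext ω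
    simp
    rw [h1, show m ω = _ from condEx_step hw.pos F ω e f]
    grind
  rw [h2, wEx_sub, wEx_condEx hw.pos]
  unfold wCov
  have h3 := wEx_fkg hw (f := m) (g := q) (fun a b h => condEx_mono hw F h hf) (fun a b h => condEx_mono hw F h (cInd_mono e))
  rw [wEx_condEx hw.pos, wEx_condEx hw.pos] at h3
  linarith

/-- Decision trees querying coordinates one at a time. -/
inductive DTree (E : Type) : Type
  | leaf : DTree E
  | node : E → DTree E → DTree E → DTree E

/-- The combination of the two branches along the monotone coupling of the queried bit. -/
def coupleStep (p q a11 a10 a01 a00 : ℝ) : ℝ := min p q * a11 + (p - min p q) * a10 + (q - min p q) * a01 + (1 - max p q) * a00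

def treeC (w : 𝓕 E) (f : 𝓕 E) : DTree E → Finset E → (E → Bool) → 𝓕 E
  | .leaf, F, ξ, ζ => f ξ * condEx w F ζ f
  | .node e t0 t1, F, ξ, ζ =>
    coupleStep (condEx w F ξ (cInd e)) (condEx w F ζ (cInd e))
      (treeC w f t1 (insert e F) (update ξ e true) (update ζ e true))
      (treeC w f t1 (insert e F) (update ξ e true) (update ζ e false))
      (treeC w f t0 (insert e F) (update ξ e false) (update ζ e true))
      (treeC w f t0 (insert e F) (update ξ e false) (update ζ e false))

def treeQ (w : 𝓕 E) : DTree E → Finset E → (E → Bool) → E → ℝ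
  | .leaf, _, _, _ => 0
  | .node e t0 t1, F, ξ, x =>
    (if x = e then 1 else 0) + (condEx w F ξ (cInd e) * treeQ w t1 (insert e F) (update ξ e true) x +
       (1 - condEx w F ξ (cInd e)) * treeQ w t0 (insert e F) (update ξ e false) x)

def treeDet (f : 𝓕 E) : DTree E → Finset E → (E → Bool) → Prop
  | .leaf, F, ξ => ∀ ω, agreeOn F ξ ω → f ω = f ξ
  | .node e t0 t1, F, ξ => treeDet f t0 (insert e F) (update ξ e false) ∧
      treeDet f t1 (insert e F) (update ξ e true)

lemma coupleStep_mono {p q q' a11 a10 a01 a00 a11' a10' a01' a00' : ℝ} (hp0 : 0 ≤ p) (hp1 : p ≤ 1)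
    (hq0 : 0 ≤ q) (hq1' : q' ≤ 1) (hqq : q ≤ q') (h11 : a11 ≤ a11') (h10 : a10 ≤ a10')
    (h01 : a01 ≤ a01') (h00 : a00 ≤ a00') (h1 : a10' ≤ a11') (h0 : a00' ≤ a01') :
    coupleStep p q a11 a10 a01 a00 ≤ coupleStep p q' a11' a10' a01' a00' := by
  unfold coupleStep
  rcases le_total p q with h | h <;> rcases le_total p q' with h' | h' <;>
    simp only [min_eq_left, min_eq_right, max_eq_left, max_eq_right, h, h'] <;> nlinarith

lemma treeC_mono (hw : LatWeight w) {f : 𝓕 E} (hf : Monotone f)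
    (h0 : ∀ ω, 0 ≤ f ω) (h1 : ∀ ω, f ω ≤ 1) (T : DTree E) (F : Finset E) (ξ : E → Bool) :
    Monotone (treeC w f T F ξ) ∧ Monotone (fun ζ => condEx w F ζ f - treeC w f T F ξ ζ) := by
  induction T generalizing F ξ with
  | leaf =>
    refine ⟨fun a b h => mul_le_mul_of_nonneg_left (condEx_mono hw F h hf) (h0 ξ), fun a b h => ?_⟩
    have := condEx_mono hw F h hf
    simp [treeC]
    nlinarith [h1 ξ]
  | node e t0 t1 ih0 ih1 =>
    have key : ∀ g1 g0 : 𝓕 E, Monotone g1 → Monotone g0 → Monotone (fun ζ : E → Bool =>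
        coupleStep (condEx w F ξ (cInd e)) (condEx w F ζ (cInd e))
          (g1 (update ζ e true)) (g1 (update ζ e false))
          (g0 (update ζ e true)) (g0 (update ζ e false))) := by
      intro g1 g0 hg1 hg0 a b h
      exact coupleStep_mono (condEx_coord_nonneg hw.pos F _ e) (condEx_coord_le_one hw.pos F _ e)
        (condEx_coord_nonneg hw.pos F _ e) (condEx_coord_le_one hw.pos F _ e)
        (condEx_mono hw F h (cInd_mono e)) (hg1 (update_mono_cfg e _ h))
        (hg1 (update_mono_cfg e _ h)) (hg0 (update_mono_cfg e _ h)) (hg0 (update_mono_cfg e _ h))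
        (hg1 (update_false_le_true b e)) (hg0 (update_false_le_true b e))
    refine ⟨key _ _ (ih1 _ _).1 (ih0 _ _).1, ?_⟩
    have := key _ _ (ih1 (insert e F) (update ξ e true)).2 (ih0 (insert e F) (update ξ e false)).2
    convert this using 2 with ζ
    simp [treeC]
    rw [condEx_step hw.pos F ζ e f]
    grind [coupleStep, min_add_max]

lemma treeC_depends (f : 𝓕 E) (T : DTree E) (F : Finset E) (ξ : E → Bool) : dependsOnly F (treeC w f T F ξ) := by
  induction T generalizing F ξ with
  | leaf => intro a b h; grind [treeC, condEx_congr_agree]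
  | node e t0 t1 ih0 ih1 =>
    intro a b h
    have hu : ∀ c : Bool, ∀ x ∈ insert e F, update a e c x = update b e c x := by grind
    simp [treeC]
    rw [condEx_congr_agree h, ih1 _ _ _ _ (hu true), ih1 _ _ _ _ (hu false), ih0 _ _ _ _ (hu true), ih0 _ _ _ _ (hu false)]

lemma treeC_diag (hw : ∀ ω, 0 < w ω) (f : 𝓕 E) (T : DTree E) (F : Finset E) (ξ : E → Bool) (h : treeDet f T F ξ) :
    treeC w f T F ξ ξ = condEx w F ξ (fun ω => f ω ^ 2) := by
  induction T generalizing F ξ with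
  | leaf =>
    simp [treeC]
    rw [condEx_congr hw (c := f ξ) h, condEx_congr hw (c := f ξ ^ 2) fun ω hω => by rw [h ω hω]]
    ring
  | node e t0 t1 ih0 ih1 =>
    simp [treeC, coupleStep]
    rw [ih0 _ _ h.1, ih1 _ _ h.2, ← condEx_step hw]

theorem treeC_bound (hw : LatWeight w) {f : 𝓕 E} (hf : Monotone f)
    (h0 : ∀ ω, 0 ≤ f ω) (h1 : ∀ ω, f ω ≤ 1) (T : DTree E) (F : Finset E) (ξ : E → Bool)
    (hdet : treeDet f T F ξ) :
    wEx w (treeC w f T F ξ) ≤ condEx w F ξ f * wEx w f +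
      ∑ x, treeQ w T F ξ x * wCov w f (cInd x) := by
  induction T generalizing F ξ with
  | leaf =>
    simp [treeC, treeQ]
    rw [wEx_smul, wEx_condEx hw.pos, condEx_congr hw.pos (c := f ξ) hdet]
  | node e t0 t1 ih0 ih1 =>
    set p := condEx w F ξ (cInd e) with hp
    have hp0 : 0 ≤ p := condEx_coord_nonneg hw.pos F _ e
    have hp1 : p ≤ 1 := condEx_coord_le_one hw.pos F _ e
    set g1 := treeC w f t1 (insert e F) (update ξ e true) with hg1
    set g0 := treeC w f t0 (insert e F) (update ξ e false) with hg0
    have b1 := ih1 (insert e F) (update ξ e true) hdet.2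
    have b0 := ih0 (insert e F) (update ξ e false) hdet.1
    have hm := treeC_mono hw hf h0 h1
    let q : 𝓕 E := fun ω => condEx w F ω (cInd e)
    have pt : ∀ ω, treeC w f (.node e t0 t1) F ξ ω ≤ p * (q ω * g1 (update ω e true) + (1 - q ω) * g1 (update ω e false)) +
        (1 - p) * (q ω * g0 (update ω e true) + (1 - q ω) * g0 (update ω e false)) +
        q ω * (1 - q ω) * (condEx w (insert e F) (update ω e true) f -
        condEx w (insert e F) (update ω e false) f) := by
      intro ω
      have hq0 : 0 ≤ q ω := condEx_coord_nonneg hw.pos F _ e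
      have hq1 : q ω ≤ 1 := condEx_coord_le_one hw.pos F _ e
      have m0 : g0 (update ω e false) ≤ g0 (update ω e true) := (hm t0 _ _).1 (update_false_le_true ω e)
      have m1 := (hm t1 (insert e F) (update ξ e true)).2 (update_false_le_true ω e)
      have m1' : g1 (update ω e false) ≤ g1 (update ω e true) := (hm t1 _ _).1 (update_false_le_true ω e)
      simp at m1
      rw [← hg1] at m1
      show coupleStep p (q ω) (g1 _) (g1 _) (g0 _) (g0 _) ≤ _
      generalize g1 (update ω e true) = a11 at *
      generalize g1 (update ω e false) = a10 at *
      generalize g0 (update ω e true) = a01 at *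
      generalize g0 (update ω e false) = a00 at *
      generalize q ω = r at *
      have hmn : 0 ≤ min p r - p * r ∧ min p r - p * r ≤ r * (1 - r) := by
        rcases le_total p r with h | h
        · rw [min_eq_left h]; constructor <;> nlinarith
        · rw [min_eq_right h]; constructor <;> nlinarith
      have e : coupleStep p r a11 a10 a01 a00 = p * (r * a11 + (1 - r) * a10) +
          (1 - p) * (r * a01 + (1 - r) * a00) + (min p r - p * r) * ((a11 - a10) - (a01 - a00)) := by
        grind [coupleStep]
      nlinarith
    have s1 := wEx_mono hw.pos pt
    have cv := wEx_condVar_le hw F e hf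
    have t1' := wEx_step hw.pos F e (g := g1) (treeC_depends f t1 _ _)
    have t0' := wEx_step hw.pos F e (g := g0) (treeC_depends f t0 _ _)
    have split : wEx w (fun ω =>
        p * (q ω * g1 (update ω e true) + (1 - q ω) * g1 (update ω e false)) +
        (1 - p) * (q ω * g0 (update ω e true) + (1 - q ω) * g0 (update ω e false)) +
        q ω * (1 - q ω) * (condEx w (insert e F) (update ω e true) f -
        condEx w (insert e F) (update ω e false) f)) =
        p * wEx w g1 + (1 - p) * wEx w g0 + wEx w (fun ω => q ω * (1 - q ω) *
          (condEx w (insert e F) (update ω e true) f -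
        condEx w (insert e F) (update ω e false) f)) := by
      rw [t1', t0', ← wEx_smul, ← wEx_smul, ← wEx_add, ← wEx_add]
      rfl
    have sumeq : ∑ x, treeQ w (.node e t0 t1) F ξ x * wCov w f (cInd x) =
        wCov w f (cInd e) + p * ∑ x, treeQ w t1 (insert e F) (update ξ e true) x * wCov w f (cInd x)
        + (1 - p) * ∑ x, treeQ w t0 (insert e F) (update ξ e false) x * wCov w f (cInd x) := by
      simp [treeQ, add_mul, sum_add_distrib, mul_sum, ← hp, mul_assoc, add_assoc]
    rw [sumeq, condEx_step hw.pos F ξ e f, ← hp]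
    nlinarith

/-- An exploration rule yields a decision tree with controlled query probabilities. -/
lemma exists_tree (hw : ∀ ω, 0 < w ω) (f : 𝓕 E) (A : E → Set (E → Bool)) (Q : Finset E → (E → Bool) → E → Prop)
    (hQ : ∀ F ξ e, e ∉ F → Q F ξ e → ∀ ω, agreeOn F ξ ω → ω ∈ A e)
    (hdet : ∀ F ξ, (∀ e, e ∉ F → ¬ Q F ξ e) → ∀ ω, agreeOn F ξ ω → f ω = f ξ)
    (n : ℕ) (F : Finset E) (hF : (univ \ F).card ≤ n) (ξ : E → Bool) :
    ∃ T : DTree E, treeDet f T F ξ ∧ (∀ x ∈ F, treeQ w T F ξ x = 0) ∧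
      ∀ x, x ∉ F → treeQ w T F ξ x ≤ condEx w F ξ ((A x).indicator 1) := by
  induction n generalizing F ξ with
  | zero =>
    refine ⟨.leaf, hdet F ξ fun e he => ?_, fun _ _ => rfl, fun x hx => ?_⟩
    all_goals
      exfalso
      have : univ \ F = ∅ := Finset.card_eq_zero.1 (Nat.le_zero.1 hF)
      have h2 := Finset.sdiff_eq_empty_iff_subset.1 this
    · grind
    grind
  | succ n ih =>
    by_cases h : ∃ e, e ∉ F ∧ Q F ξ e
    · obtain ⟨e, he, hq⟩ := h
      have hcard : (univ \ insert e F).card ≤ n := by grind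
      obtain ⟨t0, d0, z0, b0⟩ := ih (insert e F) hcard (update ξ e false)
      obtain ⟨t1, d1, z1, b1⟩ := ih (insert e F) hcard (update ξ e true)
      refine ⟨.node e t0 t1, ⟨d0, d1⟩, fun x hx => ?_, fun x hx => ?_⟩
      · grind [treeQ]
      · by_cases hxe : x = e
        · subst hxe
          simp only [treeQ, z0 x (mem_insert_self _ _), z1 x (mem_insert_self _ _)]
          rw [condEx_congr hw (g := (A x).indicator 1) (c := 1) fun ω hω => by simp [hQ F ξ x he hq ω hω]]
          simp
        · simp [treeQ, if_neg hxe]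
          rw [condEx_step hw F ξ e ((A x).indicator 1)]
          grind [add_le_add, mul_le_mul_of_nonneg_left, condEx_coord_nonneg, condEx_coord_le_one]
    · refine ⟨.leaf, hdet F ξ fun e he hq => h ⟨e, he, hq⟩, fun _ _ => rfl, fun x hx => ?_⟩
      simp_all [treeQ, condEx_nonneg, Set.indicator_nonneg]

lemma wCov_coord_nonneg (hw : LatWeight w) {f : 𝓕 E} (hf : Monotone f) (e : E) :
    0 ≤ wCov w f (cInd e) := sub_nonneg.2 (wEx_fkg hw hf (cInd_mono e))

/-- The OSSS inequality for weights satisfying the lattice condition. -/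
theorem osss (hw : LatWeight w) {f : 𝓕 E} (hf : Monotone f) (h0 : ∀ ω, 0 ≤ f ω) (h1 : ∀ ω, f ω ≤ 1) (A : E → Set (E → Bool))
    (Q : Finset E → (E → Bool) → E → Prop)
    (hQ : ∀ F ξ e, e ∉ F → Q F ξ e → ∀ ω, agreeOn F ξ ω → ω ∈ A e)
    (hdet : ∀ F ξ, (∀ e, e ∉ F → ¬ Q F ξ e) → ∀ ω, agreeOn F ξ ω → f ω = f ξ) :
    wEx w (fun ω => f ω ^ 2) - wEx w f ^ 2 ≤
      ∑ x, wEx w ((A x).indicator 1) * wCov w f (cInd x) := by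
  obtain ⟨T, d, -, b⟩ := exists_tree hw.pos f A Q hQ hdet _ ∅ le_rfl ⊥
  have key := treeC_bound hw hf h0 h1 T ∅ ⊥ d
  have hc : treeC w f T ∅ ⊥ = fun _ => wEx w (fun ω => f ω ^ 2) := by
    funext ω
    rw [treeC_depends f T ∅ ⊥ ω ⊥ (by simp), treeC_diag hw.pos f T ∅ ⊥ d, ← wEx_eq_condEx]
  rw [hc, wEx_const hw.pos, ← wEx_eq_condEx] at key
  have : ∑ x, treeQ w T ∅ ⊥ x * wCov w f (cInd x) ≤ ∑ x, wEx w ((A x).indicator 1) * wCov w f (cInd x) :=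
    by grind [sum_le_sum, mul_le_mul_of_nonneg_right, wEx_eq_condEx, wCov_coord_nonneg]
  nlinarith

end Osss

lemma mul_sub_le_of_hasDerivAt {g g' : ℝ → ℝ} {a b m : ℝ} (hab : a ≤ b)
    (hd : ∀ s, HasDerivAt g (g' s) s) (hm : ∀ s ∈ Set.Icc a b, m ≤ g' s) :
    m * (b - a) ≤ g b - g a := by
  refine (convex_Icc a b).mul_sub_le_image_sub_of_le_deriv (fun s _ => (hd s).continuousAt.continuousWithinAt)
    (fun s _ => (hd s).differentiableAt.differentiableWithinAt) (fun s hs => ?_) a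
    (Set.left_mem_Icc.2 hab) b (Set.right_mem_Icc.2 hab) hab
  rw [(hd s).deriv]
  grind [interior_subset]

lemma log_partialSum_le (x : ℕ → ℝ) (hx : ∀ n, 0 ≤ x n) (k n : ℕ) (hkn : k ≤ n) :
    log (1 + ∑ r ∈ range n, x r) - log (1 + ∑ r ∈ range k, x r) ≤
      ∑ i ∈ Ico k n, x i / (1 + ∑ r ∈ range i, x r) := by
  induction n, hkn using Nat.le_induction with
  | base => simp
  | succ n hkn ih =>
    rw [Finset.sum_Ico_succ_top hkn]
    have hS : 0 < 1 + ∑ r ∈ range n, x r := by grind [sum_nonneg]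
    have h1 : log (1 + ∑ r ∈ range (n + 1), x r) - log (1 + ∑ r ∈ range n, x r) ≤ x n / (1 + ∑ r ∈ range n, x r) := by
      rw [sum_range_succ, ← log_div (by grind) hS.ne']
      have h2 : (1 + (∑ r ∈ range n, x r + x n)) / (1 + ∑ r ∈ range n, x r) = x n / (1 + ∑ r ∈ range n, x r) + 1 := by grind
      rw [h2]
      have := Real.log_le_sub_one_of_pos (x := x n / (1 + ∑ r ∈ range n, x r) + 1) (by have := div_nonneg (hx n) hS.le; linarith)
      linarith
    linarith

lemma logAverage_le (x : ℕ → ℝ) (hx1 : ∀ n, x n ≤ 1) (hx : Tendsto x atTop (𝓝 0)) (ε : ℝ) (hε : 0 < ε) (k : ℕ) (hk : 1 ≤ k) :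
    ∃ K : ℝ, ∀ n, k ≤ n → ∑ i ∈ Ico k n, x i / i ≤ K + ε * log n := by
  have hev : ∀ᶠ n in atTop, x n < ε / 2 := hx.eventually (gt_mem_nhds (by positivity))
  obtain ⟨N, hN⟩ := eventually_atTop.1 hev
  refine ⟨N, fun n hn => ?_⟩
  have claim : ∀ n, k ≤ n → ∑ i ∈ Ico k n, x i / i ≤ (min N n : ℕ) + ε * log n := by
    intro n hn
    induction n, hn using Nat.le_induction with
    | base =>
      simp
      positivity
    | succ n hn ih =>
      rw [Finset.sum_Ico_succ_top hn]
      have hn0 : (0 : ℝ) < n := by exact_mod_cast (lt_of_lt_of_le hk hn)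
      have hn1 : (1 : ℝ) ≤ n := by exact_mod_cast (hk.trans hn)
      have hlog : 1 / (2 * (n : ℝ)) ≤ log ((n + 1 : ℕ) : ℝ) - log n := by
        have h1 := Real.log_le_sub_one_of_pos (x := (n : ℝ) / (n + 1)) (by positivity)
        rw [log_div hn0.ne' (by positivity)] at h1
        push_cast
        have h2 : (n : ℝ) / (n + 1) - 1 = - (1 / (n + 1)) := by grind
        have h3 : 1 / (2 * (n : ℝ)) ≤ 1 / (n + 1) := by apply one_div_le_one_div_of_le <;> linarith
        linarith
      rcases lt_or_ge n N with h | h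
      · have e1 : min N (n + 1) = min N n + 1 := by omega
        rw [e1]
        have : x n / n ≤ 1 := (div_le_one hn0).2 ((hx1 n).trans hn1)
        have hmono : log n ≤ log ((n + 1 : ℕ) : ℝ) := by grind [log_le_log]
        push_cast at *
        nlinarith
      · have e1 : min N (n + 1) = min N n := by omega
        rw [e1]
        have : x n / n ≤ ε * (1 / (2 * n)) := by
          rw [mul_one_div, div_le_div_iff₀ hn0 (by positivity)]
          nlinarith [hN n h]
        nlinarith
  refine (claim n hn).trans ?_
  simp_all

/-- A sharp-threshold differential inequality forces stretched-exponential decay. -/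
theorem decay_of_diff_ineq (θ θ' : ℕ → ℝ → ℝ) {a b c C : ℝ} {n₀ : ℕ} (hab : a < b) (hc : 0 < c)
    (hC : 0 ≤ C) (hd : ∀ n s, HasDerivAt (θ n) (θ' n s) s) (h0 : ∀ n s, 0 ≤ θ n s)
    (h1 : ∀ n s, θ n s ≤ 1) (hmono : ∀ n, Monotone (θ n))
    (hineq : ∀ n, n₀ ≤ n → ∀ s ∈ Set.Icc a b, (c * n / (1 + ∑ r ∈ range n, θ r s) - C) * θ n s ≤ θ' n s)
    (hb : Tendsto (fun n => θ n b) atTop (𝓝 0)) :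
    ∃ K δ : ℝ, 0 < δ ∧ ∀ n : ℕ, θ n a ≤ K * exp (-δ * sqrt n) := by
  set m := (a + b) / 2 with hm
  have ham : a < m := by grind
  have hmb : m < b := by grind
  let S : ℕ → ℝ → ℝ := fun n s => 1 + ∑ r ∈ range n, θ r s
  have hS1 : ∀ n s, 1 ≤ S n s := fun n s => by grind [sum_nonneg]
  have hSmono : ∀ n, Monotone (S n) := fun n s t hst => by
    have := sum_le_sum fun r (_ : r ∈ range n) => hmono r hst
    linarith
  let k := n₀ + 1
  have hk : 1 ≤ k := by simp [k]
  -- polynomial control of the partial sums at the midpoint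
  have stepA : ∃ K : ℝ, 0 < K ∧ ∀ n, k ≤ n → S n m ≤ K * sqrt n := by
    set d := b - m with hdd
    have hd0 : 0 < d := by grind
    set ε := d * c / (2 * (1 + C * d)) with hε
    have hε0 : 0 < ε := by positivity
    obtain ⟨K, hK⟩ := logAverage_le (fun n => θ n b) (fun n => h1 n b) hb ε hε0 k hk
    refine ⟨exp ((1 + C * d) * K / (d * c) + log (S k b)), exp_pos _, fun n hn => ?_⟩
    have hn0 : (0 : ℝ) < n := by exact_mod_cast lt_of_lt_of_le hk hn
    let W : ℝ → ℝ := fun s => ∑ i ∈ Ico k n, θ i s / i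
    have hWd : ∀ s, HasDerivAt W (∑ i ∈ Ico k n, θ' i s / i) s := fun s => HasDerivAt.fun_sum fun i _ => (hd i s).div_const _
    have hW0 : ∀ s, 0 ≤ W s := fun s => sum_nonneg fun i _ => div_nonneg (h0 i s) (by positivity)
    have hder : ∀ s ∈ Set.Icc m b, c * (log (S n m) - log (S k b)) - C * W b ≤ ∑ i ∈ Ico k n, θ' i s / i := by
      intro s hs
      have e1 : c * (∑ i ∈ Ico k n, θ i s / S i s) - C * W s ≤ ∑ i ∈ Ico k n, θ' i s / i := by
        rw [mul_sum, mul_sum, ← sum_sub_distrib]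
        refine sum_le_sum fun i hi => ?_
        have hik : k ≤ i := (Finset.mem_Ico.1 hi).1
        have hi0 : (0 : ℝ) < i := by exact_mod_cast lt_of_lt_of_le hk hik
        rw [le_div_iff₀ hi0]
        grind [le_of_eq]
      have e2 := log_partialSum_le (fun n => θ n s) (fun n => h0 n s) k n hn
      have e3 : log (S n m) ≤ log (S n s) := log_le_log (lt_of_lt_of_le one_pos (hS1 n m)) (hSmono n hs.1)
      have e4 : log (S k s) ≤ log (S k b) := log_le_log (lt_of_lt_of_le one_pos (hS1 k s)) (hSmono k hs.2)
      have e5 : W s ≤ W b := sum_le_sum fun i _ => div_le_div_of_nonneg_right (hmono i hs.2) (by positivity)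
      nlinarith
    have hmv := mul_sub_le_of_hasDerivAt hmb.le hWd hder
    have hWm := hW0 m
    have hKn := hK n hn
    have hWb : W b ≤ K + ε * log n := hKn
    have h5 : d * c * (log (S n m) - log (S k b)) ≤ (1 + C * d) * (K + ε * log n) := by
      have : (1 + C * d) * W b ≤ (1 + C * d) * (K + ε * log n) := mul_le_mul_of_nonneg_left hWb (by positivity)
      nlinarith
    have h6 : log (S n m) ≤ ((1 + C * d) * K / (d * c) + log (S k b)) + log n / 2 := by
      have h7 : (1 + C * d) * (K + ε * log n) = d * c * ((1 + C * d) * K / (d * c) + log n / 2) := by rw [hε]; field_simp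
      rw [h7] at h5
      have := le_of_mul_le_mul_left h5 (by positivity)
      linarith
    calc S n m = exp (log (S n m)) := (exp_log (lt_of_lt_of_le one_pos (hS1 n m))).symm
      _ ≤ exp (((1 + C * d) * K / (d * c) + log (S k b)) + log n / 2) :=
        exp_le_exp.2 h6
      _ = _ := by grind [exp_add, Real.sqrt_eq_rpow, Real.rpow_def_of_pos]
  obtain ⟨K, hK0, hK⟩ := stepA
  set d := m - a with hdd
  have hfin : ∀ n, k ≤ n → θ n a ≤ exp (C * d) * exp (-(c * d / K) * sqrt n) := by
    intro n hn
    have hn0 : (0 : ℝ) < n := by exact_mod_cast lt_of_lt_of_le hk hn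
    set L := c * sqrt n / K - C with hL
    let g : ℝ → ℝ := fun s => θ n s * exp (-L * s)
    have hgd : ∀ s, HasDerivAt g (θ' n s * exp (-L * s) + θ n s * (exp (-L * s) * -L)) s := by
      intro s
      have e1 : HasDerivAt (fun s : ℝ => -L * s) (-L) s := by simpa using (hasDerivAt_id s).const_mul (-L)
      exact (hd n s).mul e1.exp
    have hpos : ∀ s ∈ Set.Icc a m, 0 ≤ θ' n s * exp (-L * s) + θ n s * (exp (-L * s) * -L) := by
      intro s hs
      have e1 := hineq n (by omega) s ⟨hs.1, hs.2.trans hmb.le⟩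
      have e2 : L ≤ c * n / (S n s) - C := by
        have e3 : S n s ≤ K * sqrt n := (hSmono n hs.2).trans (hK n hn)
        have : c * sqrt n / K ≤ c * n / S n s := by
          rw [div_le_div_iff₀ hK0 (lt_of_lt_of_le one_pos (hS1 n s))]
          have e4 : c * sqrt n * S n s ≤ c * sqrt n * (K * sqrt n) := mul_le_mul_of_nonneg_left e3 (by positivity)
          grind
        linarith
      have e5 : L * θ n s ≤ θ' n s := (mul_le_mul_of_nonneg_right e2 (h0 n s)).trans e1
      have := mul_nonneg (sub_nonneg.2 e5) (exp_pos (-L * s)).le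
      nlinarith
    have hmv := mul_sub_le_of_hasDerivAt ham.le hgd hpos
    have h6 : θ n a * exp (-L * a) ≤ θ n m * exp (-L * m) := by grind
    have h7 : θ n m * exp (-L * m) ≤ exp (-L * m) := mul_le_of_le_one_left (exp_pos _).le (h1 n m)
    have h8 : θ n a ≤ exp (-L * m) * exp (L * a) := by
      have := mul_le_mul_of_nonneg_right (h6.trans h7) (exp_pos (L * a)).le
      rwa [mul_assoc, ← exp_add, show -L * a + L * a = 0 by ring, Real.exp_zero, mul_one] at this
    refine h8.trans (le_of_eq ?_)
    rw [← exp_add, ← exp_add, hL, hdd]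
    grind
  set δ := c * d / K with hδ
  have hδ0 : 0 < δ := by positivity
  refine ⟨exp (C * d) + exp (δ * sqrt k), δ, hδ0, fun n => ?_⟩
  rcases le_total k n with h | h
  · refine (hfin n h).trans (mul_le_mul_of_nonneg_right ?_ (exp_pos _).le)
    grind [exp_pos]
  · have e1 : 1 ≤ exp (δ * sqrt k) * exp (-δ * sqrt n) := by
      rw [← exp_add]
      simp_all
    refine (h1 n a).trans (e1.trans (mul_le_mul_of_nonneg_right ?_ (exp_pos _).le))
    grind [exp_pos]

section Ginibre

/-- The cone generated by a set of functions. -/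
def posCone {α : Type} (S : Set (α → ℝ)) : AddSubmonoid (α → ℝ) :=
  AddSubmonoid.closure {G | ∃ c : ℝ, 0 ≤ c ∧ ∃ M ∈ S, G = fun ω => c * M ω}

/-- Ginibre's cone argument. -/
theorem ginibre_posCone {α : Type} [Fintype α] (S : Set (α → ℝ)) (hmul : ∀ M ∈ S, ∀ N ∈ S, M * N ∈ S)
    (hsum : ∀ M ∈ S, 0 ≤ ∑ ω, M ω) (G : α → ℝ) (hG : G ∈ posCone S) (N : α → ℝ) (hN : N ∈ S) :
    0 ≤ ∑ ω, exp (G ω) * N ω := by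
  have gen : ∀ g : α → ℝ, (∀ N ∈ S, 0 ≤ ∑ ω, g ω * N ω) → ∀ N ∈ S, 0 ≤ ∑ ω, exp (G ω) * g ω * N ω := by
    induction hG using AddSubmonoid.closure_induction with
    | zero => simp_all
    | add G H _ _ ihG ihH =>
      intro g hg N hN
      have := ihG (fun ω => exp (H ω) * g ω) (ihH g hg) N hN
      simpa [exp_add, mul_assoc] using this
    | mem G h =>
      obtain ⟨c, hc, M, hM, rfl⟩ := h
      intro g hg N hN
      have hpow : ∀ k : ℕ, ∀ N ∈ S, M ^ k * N ∈ S := by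
        intro k
        induction k with
        | zero => grind
        | succ k ihk => grind
      have hs : ∀ ω, HasSum (fun k : ℕ => (k.factorial : ℝ)⁻¹ * (c * M ω) ^ k * (g ω * N ω)) (exp (c * M ω) * (g ω * N ω)) := by
        intro ω
        apply HasSum.mul_right
        have := NormedSpace.exp_series_hasSum_exp' (𝕂 := ℝ) (c * M ω)
        simp_all [Real.exp_eq_exp_ℝ]
      have hs2 := hasSum_sum (fun ω (_ : ω ∈ (univ : Finset α)) => hs ω)
      have h0 := hs2.nonneg (fun k => by
        have := hg _ (hpow k N hN)
        have e : ∑ ω, (k.factorial : ℝ)⁻¹ * (c * M ω) ^ k * (g ω * N ω) = (k.factorial : ℝ)⁻¹ * c ^ k * ∑ ω, g ω * (M ^ k * N) ω := by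
          rw [mul_sum]
          refine sum_congr rfl fun ω _ => ?_
          grind [Pi.mul_apply, Pi.pow_apply, mul_pow]
        rw [e]
        positivity)
      refine h0.trans_eq (sum_congr rfl fun ω _ => by ring)
  simpa using gen 1 (by simp_all) N hN

lemma mem_posCone {α : Type} {S : Set (α → ℝ)} {c : ℝ} (hc : 0 ≤ c) {M : α → ℝ} (hM : M ∈ S) :
    (fun ω => c * M ω) ∈ posCone S := AddSubmonoid.subset_closure ⟨c, hc, M, hM, rfl⟩

theorem ginibre_cone {α ι : Type} [Fintype α] (S : Set (α → ℝ)) (hmul : ∀ M ∈ S, ∀ N ∈ S, M * N ∈ S)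
    (hsum : ∀ M ∈ S, 0 ≤ ∑ ω, M ω) (s : Finset ι) (c : ι → ℝ) (M : ι → α → ℝ)
    (hc : ∀ i ∈ s, 0 ≤ c i) (hM : ∀ i ∈ s, M i ∈ S) (N : α → ℝ) (hN : N ∈ S) :
    0 ≤ ∑ ω, exp (∑ i ∈ s, c i * M i ω) * N ω := by
  refine ginibre_posCone S hmul hsum (fun ω => ∑ i ∈ s, c i * M i ω) ?_ N hN
  have := sum_mem (S := posCone S) (t := s) (f := fun i ω => c i * M i ω) fun i hi => mem_posCone (hc i hi) (hM i hi)
  convert this using 1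
  ext ω; simp

variable {ι : Type} [Fintype ι]

def IsChar (χ : 𝓕 ι) : Prop := ∃ n : ι → ℕ, χ = fun ω => ∏ a, spinVal (ω a) ^ n a

/-- Pointwise product of spin configurations (with `true` as the identity). -/
def spinMul (ω τ : ι → Bool) : ι → Bool := fun a => ω a == τ a

lemma spinVal_beq (a b : Bool) : spinVal (a == b) = spinVal a * spinVal b := by grind [spinVal]

lemma spinVal_sq (a : Bool) : spinVal a * spinVal a = 1 := by grind [spinVal]

lemma IsChar.mul {χ ψ : 𝓕 ι} (h : IsChar χ) (h' : IsChar ψ) : IsChar (χ * ψ) := by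
  obtain ⟨n, rfl⟩ := h
  obtain ⟨m, rfl⟩ := h'
  exact ⟨n + m, by ext ω; simp [pow_add, prod_mul_distrib]⟩

lemma IsChar.one : IsChar (1 : 𝓕 ι) := ⟨0, by ext; simp⟩

lemma IsChar.map_mul {χ : 𝓕 ι} (h : IsChar χ) (ω τ : ι → Bool) : χ (spinMul ω τ) = χ ω * χ τ := by
  obtain ⟨n, rfl⟩ := h
  simp [spinMul, spinVal_beq, mul_pow, prod_mul_distrib]

lemma IsChar.sq_eq_one {χ : 𝓕 ι} (h : IsChar χ) (ω : ι → Bool) : χ ω * χ ω = 1 := by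
  obtain ⟨n, rfl⟩ := h
  simp [← prod_mul_distrib, ← mul_pow, spinVal_sq]

lemma IsChar.le_one {χ : 𝓕 ι} (h : IsChar χ) (ω : ι → Bool) : χ ω ≤ 1 := by nlinarith [h.sq_eq_one ω]

lemma IsChar.neg_one_le {χ : 𝓕 ι} (h : IsChar χ) (ω : ι → Bool) : -1 ≤ χ ω := by nlinarith [h.sq_eq_one ω]

lemma sum_prod_pi {α : Type} [Fintype α] [DecidableEq ι] (g : ι → α → ℝ) : ∑ ω : ι → α, ∏ a, g a (ω a) = ∏ a, ∑ s, g a s := by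
  rw [Finset.prod_univ_sum, Fintype.piFinset_univ]

lemma IsChar.sum_nonneg [DecidableEq ι] {χ : 𝓕 ι} (h : IsChar χ) : 0 ≤ ∑ ω, χ ω := by
  obtain ⟨n, rfl⟩ := h
  rw [sum_prod_pi fun a s => spinVal s ^ n a]
  refine Finset.prod_nonneg fun a _ => ?_
  rcases even_or_odd (n a) with h | h <;> simp [spinVal, h]

/-- Products of factors `χ(ω) ± χ(ω')` on pairs of configurations. -/
inductive DupMonomial : ((ι → Bool) × (ι → Bool) → ℝ) → Prop
  | one : DupMonomial 1
  | add {χ F} : IsChar χ → DupMonomial F → DupMonomial ((fun p => χ p.1 + χ p.2) * F)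
  | sub {χ F} : IsChar χ → DupMonomial F → DupMonomial ((fun p => χ p.1 - χ p.2) * F)

lemma DupMonomial.mul {F G : (ι → Bool) × (ι → Bool) → ℝ} (hF : DupMonomial F) (hG : DupMonomial G) : DupMonomial (F * G) := by
  induction hF with
  | one => grind
  | add h _ ih => rw [mul_assoc]; exact .add h ih
  | sub h _ ih => rw [mul_assoc]; exact .sub h ih

lemma DupMonomial.factor {F : (ι → Bool) × (ι → Bool) → ℝ} (hF : DupMonomial F) : ∃ χ : 𝓕 ι, ∃ g : 𝓕 ι, IsChar χ ∧ (∀ τ, 0 ≤ g τ) ∧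
      ∀ ω τ, F (ω, spinMul ω τ) = χ ω * g τ := by
  induction hF with
  | one => exact ⟨1, 1, .one, fun _ => zero_le_one, fun _ _ => by simp⟩
  | @add χ F h _ ih =>
    obtain ⟨ψ, g, h1, h2, h3⟩ := ih
    refine ⟨χ * ψ, fun τ => (1 + χ τ) * g τ, h.mul h1, fun τ => mul_nonneg (by linarith [h.neg_one_le τ]) (h2 τ), fun ω τ => ?_⟩
    simp [h3, h.map_mul]; ring
  | @sub χ F h _ ih =>
    obtain ⟨ψ, g, h1, h2, h3⟩ := ih
    refine ⟨χ * ψ, fun τ => (1 - χ τ) * g τ, h.mul h1, fun τ => mul_nonneg (by linarith [h.le_one τ]) (h2 τ), fun ω τ => ?_⟩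
    simp [h3, h.map_mul]; ring

lemma spinMul_invol (ω τ : ι → Bool) : spinMul ω (spinMul ω τ) = τ := by grind [spinMul]

lemma DupMonomial.sum_nonneg [DecidableEq ι] {F : (ι → Bool) × (ι → Bool) → ℝ} (hF : DupMonomial F) : 0 ≤ ∑ p, F p := by
  obtain ⟨χ, g, h1, h2, h3⟩ := hF.factor
  rw [sum_prod_type]
  have : ∀ ω : ι → Bool, ∑ τ, F (ω, τ) = ∑ τ, χ ω * g τ := by
    intro ω
    let e : (ι → Bool) ≃ (ι → Bool) := ⟨spinMul ω, spinMul ω, spinMul_invol ω, spinMul_invol ω⟩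
    rw [← e.sum_comp fun τ => F (ω, τ)]
    exact sum_congr rfl fun τ _ => h3 ω τ
  simp_rw [this, ← mul_sum]
  rw [← sum_mul]
  exact mul_nonneg h1.sum_nonneg (Finset.sum_nonneg' h2)

/-- Ginibre's inequality for two copies with dominated couplings. -/
theorem ginibre_dup [DecidableEq ι] {κ : Type} (s : Finset κ) (c d : κ → ℝ) (hcd : ∀ i ∈ s, |d i| ≤ c i)
    (M : κ → 𝓕 ι) (hM : ∀ i ∈ s, IsChar (M i))
    {F : (ι → Bool) × (ι → Bool) → ℝ} (hF : DupMonomial F) :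
    0 ≤ ∑ p : (ι → Bool) × (ι → Bool), exp (∑ i ∈ s, c i * M i p.1) *
      exp (∑ i ∈ s, d i * M i p.2) * F p := by
  have key := ginibre_cone {F : (ι → Bool) × (ι → Bool) → ℝ | DupMonomial F} (fun _ h _ h' => h.mul h')
    (fun _ h => h.sum_nonneg) (s ×ˢ (univ : Finset Bool))
    (fun i => if i.2 then (c i.1 + d i.1) / 2 else (c i.1 - d i.1) / 2)
    (fun i p => if i.2 then M i.1 p.1 + M i.1 p.2 else M i.1 p.1 - M i.1 p.2)
    (fun i hi => by grind)
    (fun i hi => by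
      have h := hM i.1 (mem_product.1 hi).1
      rcases i with ⟨i, b⟩
      cases b
      · simpa using DupMonomial.sub h .one
      · simpa using DupMonomial.add h .one) F hF
  convert key using 3 with p _
  rw [← exp_add, sum_product, ← sum_add_distrib]
  simp; ring

lemma sum_prod_eq_wEx {α : Type} [Fintype α] (w v f g : α → ℝ) :
    ∑ p : α × α, w p.1 * v p.2 * (f p.1 * g p.2) = (∑ ω, w ω * f ω) * ∑ ω, v ω * g ω := by
  rw [sum_prod_type, sum_mul]
  refine sum_congr rfl fun ω _ => ?_
  grind [mul_sum]

/-- Griffiths' second inequality, in comparison form. -/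
theorem griffiths_mono [DecidableEq ι] {κ : Type} (s : Finset κ) (c d : κ → ℝ) (hcd : ∀ i ∈ s, |d i| ≤ c i)
    (M : κ → 𝓕 ι) (hM : ∀ i ∈ s, IsChar (M i)) {χ : 𝓕 ι} (hχ : IsChar χ) :
    wEx (fun ω => exp (∑ i ∈ s, d i * M i ω)) χ ≤
      wEx (fun ω => exp (∑ i ∈ s, c i * M i ω)) χ := by
  have key := ginibre_dup s c d hcd M hM (F := (fun p => χ p.1 - χ p.2) * 1) (.sub hχ .one)
  set w := fun ω : ι → Bool => exp (∑ i ∈ s, c i * M i ω)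
  set v := fun ω : ι → Bool => exp (∑ i ∈ s, d i * M i ω)
  have e : ∑ p : (ι → Bool) × (ι → Bool), w p.1 * v p.2 * (((fun p => χ p.1 - χ p.2) * 1 : (ι → Bool) × (ι → Bool) → ℝ) p) =
      (∑ ω, w ω * χ ω) * (∑ ω, v ω * 1) - (∑ ω, w ω * 1) * ∑ ω, v ω * χ ω := by
    rw [← sum_prod_eq_wEx w v χ (fun _ => 1), ← sum_prod_eq_wEx w v (fun _ => 1) χ, ← sum_sub_distrib]
    grind
  have key' : 0 ≤ ∑ p : (ι → Bool) × (ι → Bool), w p.1 * v p.2 * (((fun p => χ p.1 - χ p.2) * 1 :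
      (ι → Bool) × (ι → Bool) → ℝ) p) := key
  rw [e] at key'
  have h1 : 0 < ∑ ω, w ω := wSum_pos fun _ => exp_pos _
  have h2 : 0 < ∑ ω, v ω := wSum_pos fun _ => exp_pos _
  simp at key'
  unfold wEx
  rw [div_le_div_iff₀ h2 h1]
  linarith

/-- The inequality `⟨s_a s_b⟩ - J⟨s_a s_b⟩_J ≥ |u_a v_b - J v_a u_b|` for `J = ±1`, in signed form. -/
theorem ginibre_pair [DecidableEq ι] {κ : Type} (s : Finset κ) (c d : κ → ℝ) (hcd : ∀ i ∈ s, |d i| ≤ c i)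
    (M : κ → 𝓕 ι) (hM : ∀ i ∈ s, IsChar (M i)) {χ ψ : 𝓕 ι} (hχ : IsChar χ)
    (hψ : IsChar ψ) (J : ℝ) (hJ : J = 1 ∨ J = -1) :
    |wEx (fun ω => exp (∑ i ∈ s, c i * M i ω)) χ * wEx (fun ω => exp (∑ i ∈ s, d i * M i ω)) ψ -
      J * (wEx (fun ω => exp (∑ i ∈ s, d i * M i ω)) χ *
        wEx (fun ω => exp (∑ i ∈ s, c i * M i ω)) ψ)| ≤
    wEx (fun ω => exp (∑ i ∈ s, c i * M i ω)) (χ * ψ) -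
      J * wEx (fun ω => exp (∑ i ∈ s, d i * M i ω)) (χ * ψ) := by
  set w := fun ω : ι → Bool => exp (∑ i ∈ s, c i * M i ω)
  set v := fun ω : ι → Bool => exp (∑ i ∈ s, d i * M i ω)
  have h1 : 0 < ∑ ω, w ω := wSum_pos fun _ => exp_pos _
  have h2 : 0 < ∑ ω, v ω := wSum_pos fun _ => exp_pos _
  have main : ∀ ε δ : ℝ, (ε = 1 ∨ ε = -1) → (δ = 1 ∨ δ = -1) →
      0 ≤ wEx w (χ * ψ) + δ * (wEx w χ * wEx v ψ) + ε * (wEx v χ * wEx w ψ) + ε * δ * wEx v (χ * ψ) := by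
    intro ε δ hε hδ
    have hF : DupMonomial (ι := ι) (fun p => (χ p.1 + ε * χ p.2) * ((ψ p.1 + δ * ψ p.2) * 1)) := by
      rcases hε with rfl | rfl <;> rcases hδ with rfl | rfl
      · simp only [one_mul]; exact DupMonomial.add hχ (.add hψ .one)
      · simp only [one_mul, neg_mul]; exact DupMonomial.add hχ (.sub hψ .one)
      · simp only [one_mul, neg_mul]; exact DupMonomial.sub hχ (.add hψ .one)
      · simp only [one_mul, neg_mul]; exact DupMonomial.sub hχ (.sub hψ .one)
    have key : 0 ≤ ∑ p : (ι → Bool) × (ι → Bool), w p.1 * v p.2 *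
        ((χ p.1 + ε * χ p.2) * ((ψ p.1 + δ * ψ p.2) * 1)) := ginibre_dup s c d hcd M hM hF
    have e : ∑ p : (ι → Bool) × (ι → Bool), w p.1 * v p.2 * ((χ p.1 + ε * χ p.2) * ((ψ p.1 + δ * ψ p.2) * 1)) =
        (∑ ω, w ω * (χ * ψ) ω) * (∑ ω, v ω * 1) + δ * ((∑ ω, w ω * χ ω) * ∑ ω, v ω * ψ ω) +
        ε * ((∑ ω, w ω * ψ ω) * ∑ ω, v ω * χ ω) + ε * δ * ((∑ ω, w ω * 1) * ∑ ω, v ω * (χ * ψ) ω) := by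
      rw [← sum_prod_eq_wEx w v (χ * ψ) (fun _ => 1), ← sum_prod_eq_wEx w v (fun _ => 1) (χ * ψ),
        ← sum_prod_eq_wEx w v χ ψ, ← sum_prod_eq_wEx w v ψ χ, mul_sum, mul_sum, mul_sum,
        ← sum_add_distrib, ← sum_add_distrib, ← sum_add_distrib]
      grind [Pi.mul_apply]
    have := div_nonneg key (mul_pos h1 h2).le
    refine this.trans_eq ?_
    grind [wEx]
  rcases hJ with rfl | rfl
  · have a := main 1 (-1) (Or.inl rfl) (Or.inr rfl)
    have b := main (-1) 1 (Or.inr rfl) (Or.inl rfl)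
    grind
  · have a := main 1 1 (Or.inl rfl) (Or.inl rfl)
    have b := main (-1) (-1) (Or.inr rfl) (Or.inr rfl)
    grind

end Ginibre

section FourCopies
variable {ι : Type} [Fintype ι] [DecidableEq ι]

/-- Hadamard-type combinations of four spins. -/
def quadA (s : (Bool × Bool) × (Bool × Bool)) : ℝ := spinVal s.1.1 + spinVal s.1.2 + spinVal s.2.1 + spinVal s.2.2
def quadB (s : (Bool × Bool) × (Bool × Bool)) : ℝ := spinVal s.1.1 + spinVal s.1.2 - spinVal s.2.1 - spinVal s.2.2
def quadC (s : (Bool × Bool) × (Bool × Bool)) : ℝ := spinVal s.1.1 - spinVal s.1.2 + spinVal s.2.1 - spinVal s.2.2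
def quadD (s : (Bool × Bool) × (Bool × Bool)) : ℝ := -spinVal s.1.1 + spinVal s.1.2 + spinVal s.2.1 - spinVal s.2.2

def quadMono (n : ℕ × ℕ × ℕ × ℕ) (s : (Bool × Bool) × (Bool × Bool)) : ℝ :=
  quadA s ^ n.1 * quadB s ^ n.2.1 * quadC s ^ n.2.2.1 * quadD s ^ n.2.2.2

lemma sum_quadMono_nonneg (n : ℕ × ℕ × ℕ × ℕ) : 0 ≤ ∑ s, quadMono n s := by
  obtain ⟨i, j, k, l⟩ := n
  have h4 : (-1 - 1 - 1 - 1 : ℝ) = -4 := by norm_num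
  simp only [sum_prod_type, sum_bool, quadMono, quadA, quadB, quadC, quadD, spinVal, if_true, Bool.false_eq_true, if_false]
  norm_num
  rcases even_or_odd i with hi | hi <;> rcases even_or_odd j with hj | hj <;>
  rcases even_or_odd k with hk | hk <;> rcases even_or_odd l with hl | hl <;>
  simp only [hi.neg_pow, hj.neg_pow, hk.neg_pow, hl.neg_pow] <;> ring_nf <;> positivity

abbrev QuadConf (ι : Type) : Type := ((ι → Bool) × (ι → Bool)) × ((ι → Bool) × (ι → Bool))

def quadAt (p : QuadConf ι) (a : ι) : (Bool × Bool) × (Bool × Bool) := ((p.1.1 a, p.1.2 a), (p.2.1 a, p.2.2 a))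

def quadSet (ι : Type) [Fintype ι] : Set (QuadConf ι → ℝ) :=
  {F | ∃ n : ι → ℕ × ℕ × ℕ × ℕ, F = fun p => ∏ a, quadMono (n a) (quadAt p a)}

lemma quadSet_mul (F) (hF : F ∈ quadSet ι) (G) (hG : G ∈ quadSet ι) : F * G ∈ quadSet ι := by
  obtain ⟨n, rfl⟩ := hF
  obtain ⟨m, rfl⟩ := hG
  refine ⟨n + m, ?_⟩
  ext p
  simp [← prod_mul_distrib]
  grind [quadMono, Pi.add_apply, Prod.fst_add, Prod.snd_add, pow_add]

lemma quadSet_sum (F) (hF : F ∈ quadSet ι) : 0 ≤ ∑ p, F p := by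
  obtain ⟨n, rfl⟩ := hF
  let e : (ι → (Bool × Bool) × (Bool × Bool)) ≃ QuadConf ι := (Equiv.arrowProdEquivProdArrow ι _ _).trans
      (Equiv.prodCongr (Equiv.arrowProdEquivProdArrow ι _ _) (Equiv.arrowProdEquivProdArrow ι _ _))
  rw [← e.sum_comp]
  have : ∀ ω, ∏ a, quadMono (n a) (quadAt (e ω) a) = ∏ a, quadMono (n a) (ω a) := fun ω => rfl
  simp_rw [this]
  rw [sum_prod_pi fun a s => quadMono (n a) s]
  grind [Finset.prod_nonneg, sum_quadMono_nonneg]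

lemma quadSet_single (a : ι) (m : ℕ × ℕ × ℕ × ℕ) : (fun p : QuadConf ι => quadMono m (quadAt p a)) ∈ quadSet ι := by
  refine ⟨fun b => if b = a then m else (0, 0, 0, 0), ?_⟩
  ext p
  rw [Finset.prod_eq_single a]
  · simp
  · simp_all [quadMono]
  · simp

lemma quadSet_A (a : ι) : (fun p : QuadConf ι => quadA (quadAt p a)) ∈ quadSet ι := by
  simpa [quadMono] using quadSet_single a (1, 0, 0, 0)
lemma quadSet_B (a : ι) : (fun p : QuadConf ι => quadB (quadAt p a)) ∈ quadSet ι := by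
  simpa [quadMono] using quadSet_single a (0, 1, 0, 0)
lemma quadSet_C (a : ι) : (fun p : QuadConf ι => quadC (quadAt p a)) ∈ quadSet ι := by
  simpa [quadMono] using quadSet_single a (0, 0, 1, 0)
lemma quadSet_D (a : ι) : (fun p : QuadConf ι => quadD (quadAt p a)) ∈ quadSet ι := by
  simpa [quadMono] using quadSet_single a (0, 0, 0, 1)

def pairSum {κ : Type} (s : Finset κ) (c : κ → ℝ) (a b : κ → ι) (ω : ι → Bool) : ℝ :=
  ∑ i ∈ s, c i * (spinVal (ω (a i)) * spinVal (ω (b i)))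

def fieldSum (h : ι → ℝ) (ω : ι → Bool) : ℝ := ∑ x, h x * spinVal (ω x)

lemma quad_energy_mem {κ : Type} (s : Finset κ) (c : κ → ℝ) (hc : ∀ i ∈ s, 0 ≤ c i) (a b : κ → ι) (h : ι → ℝ) (hh : ∀ x, 0 ≤ h x) :
    (fun p : QuadConf ι => fieldSum h p.1.1 + fieldSum h p.1.2 + (pairSum s c a b p.1.1 +
      pairSum s c a b p.1.2 + pairSum s c a b p.2.1 + pairSum s c a b p.2.2)) ∈ posCone (quadSet ι) := by
  have h1 : (∑ x, ((fun p : QuadConf ι => h x / 2 * quadA (quadAt p x)) +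
      (fun p => h x / 2 * quadB (quadAt p x)))) ∈ posCone (quadSet ι) :=
    sum_mem fun x _ => add_mem (mem_posCone (by grind) (quadSet_A x))
      (mem_posCone (by grind) (quadSet_B x))
  have h2 : (∑ i ∈ s, ((fun p : QuadConf ι => c i / 4 *
        ((fun p => quadA (quadAt p (a i))) * (fun p => quadA (quadAt p (b i))) : QuadConf ι → ℝ) p) +
      (fun p => c i / 4 * ((fun p => quadB (quadAt p (a i))) * (fun p => quadB (quadAt p (b i))) : QuadConf ι → ℝ) p) +
      (fun p => c i / 4 * ((fun p => quadC (quadAt p (a i))) * (fun p => quadC (quadAt p (b i))) : QuadConf ι → ℝ) p) +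
      (fun p => c i / 4 * ((fun p => quadD (quadAt p (a i))) * (fun p => quadD (quadAt p (b i))) : QuadConf ι → ℝ) p))) ∈
      posCone (quadSet ι) :=
    sum_mem fun i hi => by
      have : 0 ≤ c i / 4 := by grind
      exact add_mem (add_mem (add_mem (mem_posCone this (quadSet_mul _ (quadSet_A _) _ (quadSet_A _)))
        (mem_posCone this (quadSet_mul _ (quadSet_B _) _ (quadSet_B _))))
        (mem_posCone this (quadSet_mul _ (quadSet_C _) _ (quadSet_C _))))
        (mem_posCone this (quadSet_mul _ (quadSet_D _) _ (quadSet_D _)))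
  convert add_mem h1 h2 using 1
  ext p
  simp [fieldSum, pairSum, ← sum_add_distrib]
  grind [quadA, quadB, quadAt, quadC, quadD]

/-- In a nonnegative field the truncated two-point function is at most the zero-field two-point
function. -/
theorem truncated_le_zero_field {κ : Type} (s : Finset κ) (c : κ → ℝ) (hc : ∀ i ∈ s, 0 ≤ c i)
    (a b : κ → ι) (h : ι → ℝ) (hh : ∀ x, 0 ≤ h x) (x y : ι) :
    wCov (fun ω => exp (fieldSum h ω) * exp (pairSum s c a b ω)) (fun ω => spinVal (ω x))
      (fun ω => spinVal (ω y)) ≤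
    wEx (fun ω => exp (pairSum s c a b ω)) (fun ω => spinVal (ω x) * spinVal (ω y)) := by
  set w : 𝓕 ι := fun ω => exp (fieldSum h ω) * exp (pairSum s c a b ω)
  set v : 𝓕 ι := fun ω => exp (pairSum s c a b ω)
  have hw : 0 < ∑ ω, w ω := wSum_pos fun _ => mul_pos (exp_pos _) (exp_pos _)
  have hv : 0 < ∑ ω, v ω := wSum_pos fun _ => exp_pos _
  have key := ginibre_posCone (quadSet ι) quadSet_mul quadSet_sum _ (quad_energy_mem s c hc a b h hh)
    _ (quadSet_mul _ (quadSet_C x) _ (quadSet_D y))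
  let W : (ι → Bool) × (ι → Bool) → ℝ := fun p => w p.1 * w p.2
  let U : (ι → Bool) × (ι → Bool) → ℝ := fun p => v p.1 * v p.2
  let d : ι → (ι → Bool) × (ι → Bool) → ℝ := fun z p => spinVal (p.1 z) - spinVal (p.2 z)
  have key2 : 0 ≤ ∑ p : QuadConf ι, W p.1 * U p.2 * ((d x p.1 + d x p.2) * (d y p.2 - d y p.1)) := by
    grind [Pi.mul_apply, quadC, quadD, quadAt, exp_add]
  have anti : ∀ (u : 𝓕 ι) z, ∑ p : (ι → Bool) × (ι → Bool), u p.1 * u p.2 * d z p = 0 := by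
    intro u z
    have e : ∑ p : (ι → Bool) × (ι → Bool), u p.1 * u p.2 * d z p = ∑ p : (ι → Bool) × (ι → Bool), -(u p.1 * u p.2 * d z p) := by
      rw [← (Equiv.prodComm (ι → Bool) (ι → Bool)).sum_comp]
      refine sum_congr rfl fun p _ => ?_
      simp [d]; ring
    grind [sum_neg_distrib]
  have quad : ∀ u : 𝓕 ι, ∑ p : (ι → Bool) × (ι → Bool), u p.1 * u p.2 * (d x p * d y p) =
      2 * ((∑ ω, u ω * (spinVal (ω x) * spinVal (ω y))) * (∑ ω, u ω * 1) -
        (∑ ω, u ω * spinVal (ω x)) * (∑ ω, u ω * spinVal (ω y))) := by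
    intro u
    have a1 := sum_prod_eq_wEx u u (fun ω => spinVal (ω x) * spinVal (ω y)) (fun _ => 1)
    have a2 := sum_prod_eq_wEx u u (fun _ => 1) (fun ω => spinVal (ω x) * spinVal (ω y))
    have a3 := sum_prod_eq_wEx u u (fun ω => spinVal (ω x)) (fun ω => spinVal (ω y))
    have a4 := sum_prod_eq_wEx u u (fun ω => spinVal (ω y)) (fun ω => spinVal (ω x))
    have : ∑ p : (ι → Bool) × (ι → Bool), u p.1 * u p.2 * (d x p * d y p) =
      (((∑ ω, u ω * (spinVal (ω x) * spinVal (ω y))) * (∑ ω, u ω * 1) +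
       (∑ ω, u ω * 1) * (∑ ω, u ω * (spinVal (ω x) * spinVal (ω y)))) - (∑ ω, u ω * spinVal (ω x)) * (∑ ω, u ω * spinVal (ω y))) -
        (∑ ω, u ω * spinVal (ω y)) * (∑ ω, u ω * spinVal (ω x)) := by
      rw [← a1, ← a2, ← a3, ← a4, ← sum_add_distrib, ← sum_sub_distrib, ← sum_sub_distrib]
      exact sum_congr rfl fun p _ => by grind
    grind
  have fac : ∑ p : QuadConf ι, W p.1 * U p.2 * ((d x p.1 + d x p.2) * (d y p.2 - d y p.1)) =
      (∑ p, W p * 1) * (∑ p, U p * (d x p * d y p)) - (∑ p, W p * (d x p * d y p)) * (∑ p, U p * 1) := by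
    have a1 := sum_prod_eq_wEx W U (fun _ => 1) (fun p => d x p * d y p)
    have a2 := sum_prod_eq_wEx W U (fun p => d x p * d y p) (fun _ => 1)
    have a3 := sum_prod_eq_wEx W U (d x) (d y)
    have a4 := sum_prod_eq_wEx W U (d y) (d x)
    have z1 : ∑ p, W p * d x p = 0 := anti w x
    have z2 : ∑ p, W p * d y p = 0 := anti w y
    rw [z1, zero_mul] at a3
    rw [z2, zero_mul] at a4
    rw [← a1, ← a2, ← sub_zero (_ - _), ← a4, ← add_zero (_ - _), ← a3, ← sum_sub_distrib, ← sum_sub_distrib, ← sum_add_distrib]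
    exact sum_congr rfl fun p _ => by ring
  have z3 : ∑ ω, v ω * spinVal (ω x) = 0 := by
    let e : (ι → Bool) ≃ (ι → Bool) := ⟨fun ω z => !ω z, fun ω z => !ω z, fun ω => by simp, fun ω => by simp⟩
    have h1 : ∀ b : Bool, spinVal (!b) = -spinVal b := by simp_all [spinVal]
    have h2 : ∑ ω, v ω * spinVal (ω x) = ∑ ω, -(v ω * spinVal (ω x)) := by
      rw [← e.sum_comp]
      refine sum_congr rfl fun ω _ => ?_
      have : v (e ω) = v ω := by simp [v, pairSum, e, h1]
      rw [this]
      simp only [e, Equiv.coe_fn_mk, h1]; ring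
    grind [sum_neg_distrib]
  have sW : ∑ p, W p * 1 = (∑ ω, w ω) * ∑ ω, w ω := by
    have := sum_prod_eq_wEx w w (fun _ => 1) (fun _ => 1)
    grind
  have sU : ∑ p, U p * 1 = (∑ ω, v ω) * ∑ ω, v ω := by
    have := sum_prod_eq_wEx v v (fun _ => 1) (fun _ => 1)
    grind
  have qW : ∑ p, W p * (d x p * d y p) = _ := quad w
  have qU : ∑ p, U p * (d x p * d y p) = _ := quad v
  rw [fac, sW, sU, qW, qU, z3] at key2
  simp at key2
  unfold wCov wEx
  simp only [Pi.mul_apply]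
  rw [div_mul_div_comm, div_sub_div _ _ hw.ne' (mul_pos hw hw).ne', div_le_div_iff₀ (mul_pos hw (mul_pos hw hw)) hv]
  nlinarith

/-- The magnetisation in a nonnegative field is bounded by zero-field two-point functions. -/
theorem magnetisation_le_sum {κ : Type} (s : Finset κ) (c : κ → ℝ) (hc : ∀ i ∈ s, 0 ≤ c i)
    (a b : κ → ι) (h : ι → ℝ) (hh : ∀ x, 0 ≤ h x) (x : ι) :
    wEx (fun ω => exp (fieldSum h ω) * exp (pairSum s c a b ω)) (fun ω => spinVal (ω x)) ≤
      ∑ y, h y * wEx (fun ω => exp (pairSum s c a b ω)) (fun ω => spinVal (ω x) * spinVal (ω y)) := by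
  set v : 𝓕 ι := fun ω => exp (pairSum s c a b ω) with hv
  have hv0 : ∀ ω, 0 < v ω := fun ω => exp_pos _
  let g : ℝ → ℝ := fun t => wEx (fun ω => exp (t * fieldSum h ω) * v ω) (fun ω => spinVal (ω x))
  have hd : ∀ t, HasDerivAt g (wCov (fun ω => exp (t * fieldSum h ω) * v ω) (fun ω => spinVal (ω x))
      (fieldSum h)) t := fun t => hasDerivAt_wEx_tilt hv0 _ _ t
  have hb : ∀ t ∈ Set.Icc (0 : ℝ) 1, wCov (fun ω => exp (t * fieldSum h ω) * v ω)
      (fun ω => spinVal (ω x)) (fieldSum h) ≤ ∑ y, h y * wEx v (fun ω => spinVal (ω x) * spinVal (ω y)) := by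
    intro t ht
    set W : 𝓕 ι := fun ω => exp (t * fieldSum h ω) * v ω with hW
    have hWe : W = fun ω => exp (fieldSum (fun y => t * h y) ω) * v ω := by grind [fieldSum, mul_sum]
    have e : wCov W (fun ω => spinVal (ω x)) (fieldSum h) = ∑ y, h y * wCov W (fun ω => spinVal (ω x)) (fun ω => spinVal (ω y)) := by
      unfold wCov
      have e1 : ((fun ω => spinVal (ω x)) * fieldSum h) = fun ω : ι → Bool => ∑ y, h y * (spinVal (ω x) * spinVal (ω y)) := by
        grind [Pi.mul_apply, fieldSum, mul_sum]
      have e2 : fieldSum h = fun ω : ι → Bool => ∑ y, h y * spinVal (ω y) := rfl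
      rw [e1, e2, wEx_sum, wEx_sum, mul_sum, ← sum_sub_distrib]
      refine sum_congr rfl fun y _ => ?_
      rw [wEx_smul, wEx_smul]
      simp [mul_sub]
      congr 1
      ring
    rw [e]
    refine sum_le_sum fun y _ => mul_le_mul_of_nonneg_left ?_ (hh y)
    rw [hWe]
    exact truncated_le_zero_field s c hc a b _ (fun z => mul_nonneg ht.1 (hh z)) x y
  have hmv := mul_sub_le_of_hasDerivAt (g := fun t => -g t) zero_le_one (fun t => (hd t).neg)
    (m := -∑ y, h y * wEx v (fun ω => spinVal (ω x) * spinVal (ω y))) (fun t ht => neg_le_neg (hb t ht))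
  have g0 : g 0 = 0 := by
    simp [g]
    let e : (ι → Bool) ≃ (ι → Bool) := ⟨fun ω z => !ω z, fun ω z => !ω z, fun ω => by simp, fun ω => by simp⟩
    have h1 : ∀ b : Bool, spinVal (!b) = -spinVal b := by grind [spinVal]
    have h2 : ∑ ω, v ω * spinVal (ω x) = ∑ ω, -(v ω * spinVal (ω x)) := by
      rw [← e.sum_comp]
      grind [pairSum]
    grind [sum_neg_distrib, wEx]
  grind

end FourCopies

def boxAt (x : V) (n : ℕ) : Finset V := Icc (x.1 - n) (x.1 + n) ×ˢ Icc (x.2 - n) (x.2 + n)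

lemma mem_boxAt {x y : V} {n : ℕ} : y ∈ boxAt x n ↔ |y.1 - x.1| ≤ n ∧ |y.2 - x.2| ≤ n := by grind [boxAt]

/-- The Boltzmann weight of `η` in `Λ` with boundary condition `σ`. -/
def gw (β : ℝ) (Λ : Finset V) (σ : Ω) (η : ↥Λ → Bool) : ℝ := exp (-β * hamiltonian Λ (spatch Λ η σ))

lemma gw_pos (β : ℝ) (Λ : Finset V) (σ : Ω) (η : ↥Λ → Bool) : 0 < gw β Λ σ η := exp_pos _

lemma PiOp_eq_wEx (β : ℝ) (Λ : Finset V) (f : Ω → ℝ) (σ : Ω) : PiOp β Λ f σ = wEx (gw β Λ σ) (fun η => f (spatch Λ η σ)) := rfl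

lemma spatch_of_mem {Λ : Finset V} {η : ↥Λ → Bool} {σ : Ω} {x : V} (h : x ∈ Λ) : spatch Λ η σ x = η ⟨x, h⟩ := by simp [spatch, h]

lemma spatch_notMem {Λ : Finset V} {η : ↥Λ → Bool} {σ : Ω} {x : V} (h : x ∉ Λ) : spatch Λ η σ x = σ x := by simp [spatch, h]

lemma spatch_congr {Λ : Finset V} {η : ↥Λ → Bool} {σ σ' : Ω} (h : ∀ x ∉ Λ, σ x = σ' x) : spatch Λ η σ = spatch Λ η σ' := by
  ext x
  by_cases hx : x ∈ Λ
  · grind [spatch_of_mem]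
  grind [spatch_notMem]

lemma spatch_restrict {Λ : Finset V} {σ τ : Ω} (h : ∀ x ∉ Λ, σ x = τ x) : spatch Λ (fun x => τ x) σ = τ := by
  grind [spatch_of_mem, spatch_notMem]

lemma spatch_mono {Λ : Finset V} {η η' : ↥Λ → Bool} {σ σ' : Ω} (h : η ≤ η') (h' : σ ≤ σ') : spatch Λ η σ ≤ spatch Λ η' σ' := by
  intro x
  by_cases hx : x ∈ Λ
  · rw [spatch_of_mem hx, spatch_of_mem hx]; exact h _
  · rw [spatch_notMem hx, spatch_notMem hx]; exact h' _

lemma spatch_inf {Λ : Finset V} (η η' : ↥Λ → Bool) (σ σ' : Ω) : spatch Λ (η ⊓ η') (σ ⊓ σ') = spatch Λ η σ ⊓ spatch Λ η' σ' := by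
  ext x
  by_cases hx : x ∈ Λ <;> simp [spatch, hx]

lemma spatch_sup {Λ : Finset V} (η η' : ↥Λ → Bool) (σ σ' : Ω) : spatch Λ (η ⊔ η') (σ ⊔ σ') = spatch Λ η σ ⊔ spatch Λ η' σ' := by
  ext x
  by_cases hx : x ∈ Λ <;> simp [spatch, hx]

lemma pairEnergy_mk (σ : Ω) (x y : V) : pairEnergy σ s(x, y) = spinVal (σ x) * spinVal (σ y) := rfl

lemma mem_dualEdges {Λ : Finset V} {e : Sym2 V} : e ∈ dualEdges Λ ↔ ∃ x ∈ Λ, ∃ i : Fin 4, s(x, x + dir i) = e := by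
  simp_all [dualEdges]

lemma dualEdges_mono {Λ Λ' : Finset V} (h : Λ ⊆ Λ') : dualEdges Λ ⊆ dualEdges Λ' := by grind [mem_dualEdges]

lemma dir_neg (i : Fin 4) : ∃ j : Fin 4, dir j = -dir i := by
  fin_cases i
  · exact ⟨1, by decide⟩
  · exact ⟨0, by decide⟩
  · exact ⟨3, by decide⟩
  · exact ⟨2, by decide⟩

lemma dir_ne_zero (i : Fin 4) : dir i ≠ 0 := by fin_cases i <;> decide

/-- An edge of `dualEdges Λ'` one of whose endpoints is in `Λ` belongs to `dualEdges Λ`. -/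
lemma mem_dualEdges_of_mem {Λ Λ' : Finset V} {e : Sym2 V} (he : e ∈ dualEdges Λ') {x : V}
    (hx : x ∈ Λ) (hxe : x ∈ e) : e ∈ dualEdges Λ := by
  rw [mem_dualEdges] at he ⊢
  obtain ⟨y, hy, i, rfl⟩ := he
  rcases Sym2.mem_iff.1 hxe with rfl | rfl
  · grind
  · obtain ⟨j, hj⟩ := dir_neg i
    grind [add_neg_cancel_right, Sym2.eq_swap]

lemma hamiltonian_exchange {Λ Λ' : Finset V} (h : Λ ⊆ Λ') {σ τ : Ω} (hst : ∀ x ∉ Λ, σ x = τ x) :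
    hamiltonian Λ' σ + hamiltonian Λ τ = hamiltonian Λ' τ + hamiltonian Λ σ := by
  have key : ∑ e ∈ dualEdges Λ' \ dualEdges Λ, pairEnergy σ e = ∑ e ∈ dualEdges Λ' \ dualEdges Λ, pairEnergy τ e := by
    refine sum_congr rfl fun e he => ?_
    rw [Finset.mem_sdiff] at he
    have hh : ∀ x ∈ e, σ x = τ x := fun x hx => hst x fun hxΛ => he.2 (mem_dualEdges_of_mem he.1 hxΛ hx)
    induction e using Sym2.ind with
    | _ x y => grind [pairEnergy_mk]
  grind [hamiltonian, Finset.sum_sdiff, dualEdges_mono]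

/-- The finite-volume kernels are consistent. -/
theorem PiOp_PiOp (β : ℝ) {Λ Λ' : Finset V} (h : Λ ⊆ Λ') (f : Ω → ℝ) (σ : Ω) : PiOp β Λ' (PiOp β Λ f) σ = PiOp β Λ' f σ := by
  have hZ : ∀ τ, Zpart β Λ τ = ∑ ζ, gw β Λ τ ζ := fun _ => rfl
  have hZpos : ∀ τ, 0 < Zpart β Λ τ := fun τ => by grind [sum_pos, gw_pos, univ_nonempty]
  rw [PiOp_eq_wEx, PiOp_eq_wEx]
  unfold wEx
  congr 1
  let rep : (↥Λ' → Bool) → (↥Λ → Bool) → (↥Λ' → Bool) := fun η ζ x => if hx : (x : V) ∈ Λ then ζ ⟨x, hx⟩ else η x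
  let res : (↥Λ' → Bool) → (↥Λ → Bool) := fun η x => η ⟨x, h x.2⟩
  have e1 : ∀ η ζ, spatch Λ' (rep η ζ) σ = spatch Λ ζ (spatch Λ' η σ) := by
    intro η ζ
    ext x
    by_cases hx : x ∈ Λ
    · grind [spatch_of_mem]
    · rw [spatch_notMem hx]
      by_cases hx' : x ∈ Λ'
      · grind [spatch_of_mem]
      grind [spatch_notMem]
  have e2 : ∀ η, rep η (res η) = η := by grind
  have e3 : ∀ η ζ ζ', rep (rep η ζ) ζ' = rep η ζ' := by grind
  have e4 : ∀ η ζ, res (rep η ζ) = ζ := by grind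
  have e5 : ∀ η, spatch Λ (res η) (spatch Λ' η σ) = spatch Λ' η σ := by intro η; rw [← e1, e2]
  have off : ∀ η ζ, ∀ x ∉ Λ, spatch Λ' (rep η ζ) σ x = spatch Λ' η σ x := by simp_all [spatch_notMem]
  have gwc : ∀ η ζ ζ', gw β Λ (spatch Λ' (rep η ζ) σ) ζ' = gw β Λ (spatch Λ' η σ) ζ' := by
    intro η ζ ζ'; unfold gw; rw [spatch_congr (off η ζ)]
  have Zc : ∀ η ζ, Zpart β Λ (spatch Λ' (rep η ζ) σ) = Zpart β Λ (spatch Λ' η σ) := by simp_all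
  have hex : ∀ η ζ, gw β Λ' σ η * gw β Λ (spatch Λ' η σ) ζ = gw β Λ' σ (rep η ζ) * gw β Λ (spatch Λ' η σ) (res η) := by
    intro η ζ
    unfold gw
    rw [← exp_add, ← exp_add, e5, e1]
    have := hamiltonian_exchange h (σ := spatch Λ' η σ) (τ := spatch Λ ζ (spatch Λ' η σ)) (fun x hx => (spatch_notMem hx).symm)
    grind
  have lhs : ∑ η, gw β Λ' σ η * PiOp β Λ f (spatch Λ' η σ) =
      ∑ p : (↥Λ' → Bool) × (↥Λ → Bool), gw β Λ' σ p.1 * gw β Λ (spatch Λ' p.1 σ) p.2 *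
        f (spatch Λ' (rep p.1 p.2) σ) / Zpart β Λ (spatch Λ' p.1 σ) := by
    rw [sum_prod_type]
    refine sum_congr rfl fun η _ => ?_
    unfold PiOp
    rw [mul_div_assoc', mul_sum, sum_div]
    refine sum_congr rfl fun ζ _ => ?_
    rw [e1, ← mul_assoc]; rfl
  let sw : (↥Λ' → Bool) × (↥Λ → Bool) ≃ (↥Λ' → Bool) × (↥Λ → Bool) :=
    ⟨fun p => (rep p.1 p.2, res p.1), fun p => (rep p.1 p.2, res p.1),
      fun p => by simp_all, fun p => by simp_all⟩
  rw [lhs, ← sw.sum_comp]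
  have : ∀ p, gw β Λ' σ (sw p).1 * gw β Λ (spatch Λ' (sw p).1 σ) (sw p).2 *
        f (spatch Λ' (rep (sw p).1 (sw p).2) σ) / Zpart β Λ (spatch Λ' (sw p).1 σ) =
      gw β Λ' σ p.1 * f (spatch Λ' p.1 σ) * (gw β Λ (spatch Λ' p.1 σ) p.2 / Zpart β Λ (spatch Λ' p.1 σ)) := by
    simp [sw, e3, e2, gwc, Zc]
    grind
  rw [sum_congr rfl fun p _ => this p, sum_prod_type]
  refine sum_congr rfl fun η _ => ?_
  simp
  rw [← mul_sum, ← sum_div, ← hZ, div_self (hZpos _).ne', mul_one]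

lemma spinVal_mono {a b : Bool} (h : a ≤ b) : spinVal a ≤ spinVal b := by revert h; cases a <;> cases b <;> norm_num [spinVal]

lemma hamiltonian_submodular (Λ : Finset V) (σ τ : Ω) :
    hamiltonian Λ (σ ⊓ τ) + hamiltonian Λ (σ ⊔ τ) ≤ hamiltonian Λ σ + hamiltonian Λ τ := by
  unfold hamiltonian
  rw [← neg_add, ← neg_add, neg_le_neg_iff, ← sum_add_distrib, ← sum_add_distrib]
  refine sum_le_sum fun e _ => ?_
  induction e using Sym2.ind with
  | _ x y => grind [pairEnergy_mk, Pi.inf_apply, Pi.sup_apply, spinVal]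

lemma gw_holley {β : ℝ} (hβ : 0 ≤ β) (Λ : Finset V) {σ σ' : Ω} (h : σ ≤ σ') (a b : ↥Λ → Bool) :
    gw β Λ σ a * gw β Λ σ' b ≤ gw β Λ σ (a ⊓ b) * gw β Λ σ' (a ⊔ b) := by
  unfold gw
  rw [← exp_add, ← exp_add, exp_le_exp]
  have h1 := hamiltonian_submodular Λ (spatch Λ a σ) (spatch Λ b σ')
  rw [← spatch_inf, ← spatch_sup, inf_eq_left.2 h, sup_eq_right.2 h] at h1
  nlinarith

lemma gw_latticeWeight {β : ℝ} (hβ : 0 ≤ β) (Λ : Finset V) (σ : Ω) : LatWeight (gw β Λ σ) where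
  pos := gw_pos β Λ σ
  lattice := fun a b => gw_holley hβ Λ le_rfl a b

lemma wEx_fkg' {E : Type} [Fintype E] [DecidableEq E] {w : 𝓕 E} (hw : LatWeight w) {f g : 𝓕 E} (hf : Monotone f) (hg : Monotone g) :
    wEx w f * wEx w g ≤ wEx w (f * g) := by
  convert wEx_fkg hw hf hg

/-- Holley's inequality for two weights. -/
theorem wEx_le_of_holley {E : Type} [Fintype E] [DecidableEq E] {u v : 𝓕 E} (hu : ∀ ω, 0 < u ω)
    (hv : ∀ ω, 0 < v ω) (h : ∀ a b, u a * v b ≤ u (a ⊓ b) * v (a ⊔ b)) {f : 𝓕 E}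
    (hf : Monotone f) : wEx u f ≤ wEx v f := by
  have hU : 0 < ∑ ω, u ω := wSum_pos hu
  have hV : 0 < ∑ ω, v ω := wSum_pos hv
  have := holley (μ := fun ω => f ω - f ⊥) (f := fun ω => u ω / ∑ ω, u ω) (g := fun ω => v ω / ∑ ω, v ω)
    (fun ω => sub_nonneg.2 (hf bot_le)) (fun ω => (div_pos (hu ω) hU).le) (fun ω => (div_pos (hv ω) hV).le)
    (fun a b hab => sub_le_sub_right (hf hab) _)
    (by rw [← sum_div, ← sum_div, div_self hU.ne', div_self hV.ne'])
    (fun a b => by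
      rw [div_mul_div_comm, div_mul_div_comm]
      exact div_le_div_of_nonneg_right (h a b) (mul_pos hU hV).le)
  have e : ∀ w : 𝓕 E, 0 < ∑ ω, w ω → ∑ ω, (f ω - f ⊥) * (w ω / ∑ ω, w ω) = wEx w f - f ⊥ := by
    intro w hw
    simp only [sub_mul, sum_sub_distrib, ← mul_sum, ← sum_div, div_self hw.ne', mul_one]
    unfold wEx
    rw [sum_div]
    congr 1
    exact sum_congr rfl fun _ _ => by ring
  grind

theorem PiOp_mono_bc {β : ℝ} (hβ : 0 ≤ β) (Λ : Finset V) {f : Ω → ℝ} (hf : Monotone f) : Monotone (PiOp β Λ f) := by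
  intro σ σ' h
  refine (wEx_le_of_holley (gw_pos _ _ _) (gw_pos _ _ _) (fun a b => gw_holley hβ Λ h a b)
    (f := fun η => f (spatch Λ η σ)) fun a b hab => hf (spatch_mono hab le_rfl)).trans ?_
  exact wEx_mono (gw_pos _ _ _) fun η => hf (spatch_mono le_rfl h)

lemma PiOp_mono_fun {β : ℝ} (Λ : Finset V) {f g : Ω → ℝ} (h : ∀ σ, f σ ≤ g σ) (σ : Ω) : PiOp β Λ f σ ≤ PiOp β Λ g σ := by
  grind [PiOp_eq_wEx, wEx_mono, gw_pos]

theorem PiOp_fkg {β : ℝ} (hβ : 0 ≤ β) (Λ : Finset V) {f g : Ω → ℝ} (hf : Monotone f) (hg : Monotone g) (σ : Ω) :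
    PiOp β Λ f σ * PiOp β Λ g σ ≤ PiOp β Λ (fun τ => f τ * g τ) σ :=
  wEx_fkg' (gw_latticeWeight hβ Λ σ) (fun a b hab => hf (spatch_mono hab le_rfl))
    (fun a b hab => hg (spatch_mono hab le_rfl))

lemma PiOp_const {β : ℝ} (Λ : Finset V) (c : ℝ) (σ : Ω) : PiOp β Λ (fun _ => c) σ = c := by simp_all [PiOp_eq_wEx, wEx_const, gw_pos]

lemma PiOp_add {β : ℝ} (Λ : Finset V) (f g : Ω → ℝ) (σ : Ω) : PiOp β Λ (fun τ => f τ + g τ) σ = PiOp β Λ f σ + PiOp β Λ g σ := by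
  exact wEx_add _ _

lemma PiOp_smul {β : ℝ} (Λ : Finset V) (c : ℝ) (f : Ω → ℝ) (σ : Ω) : PiOp β Λ (fun τ => c * f τ) σ = c * PiOp β Λ f σ := by
  grind [PiOp_eq_wEx, wEx_smul]

lemma PiOp_sum {β : ℝ} {κ : Type*} (s : Finset κ) (Λ : Finset V) (f : κ → Ω → ℝ) (σ : Ω) :
    PiOp β Λ (fun τ => ∑ k ∈ s, f k τ) σ = ∑ k ∈ s, PiOp β Λ (f k) σ := by
  classical
  induction s using induction_on with
  | empty => simp_all [PiOp_const]
  | insert a s ha ih => simp_all [PiOp_add]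

lemma abs_PiOp_le {β : ℝ} (Λ : Finset V) {f : Ω → ℝ} {C : ℝ} (h : ∀ σ, |f σ| ≤ C) (σ : Ω) :
    |PiOp β Λ f σ| ≤ C := by
  rw [abs_le]
  constructor
  · rw [← PiOp_const (β := β) Λ (-C) σ]; grind [PiOp_mono_fun]
  · rw [← PiOp_const (β := β) Λ C σ]; grind [PiOp_mono_fun]

section GibbsMeasures

lemma continuous_spatch (Λ : Finset V) (η : ↥Λ → Bool) : Continuous (spatch Λ η) := by
  refine continuous_pi fun x => ?_
  by_cases hx : x ∈ Λ
  · simp_all [spatch, continuous_const]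
  simp_all [spatch, continuous_apply]

lemma measurable_spatch (Λ : Finset V) (η : ↥Λ → Bool) : Measurable (spatch Λ η) := (continuous_spatch Λ η).measurable

lemma continuous_spinVal : Continuous spinVal := continuous_of_discreteTopology

lemma continuous_hamiltonian (Λ : Finset V) : Continuous (hamiltonian Λ) := by
  refine (continuous_finsetSum _ fun e _ => ?_).neg
  induction e using Sym2.ind with
  | _ x y => exact (continuous_spinVal.comp (continuous_apply x)).mul (continuous_spinVal.comp (continuous_apply y))

lemma continuous_gw (β : ℝ) (Λ : Finset V) (η : ↥Λ → Bool) : Continuous fun σ => gw β Λ σ η :=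
  Real.continuous_exp.comp (continuous_const.mul ((continuous_hamiltonian Λ).comp (continuous_spatch Λ η)))

lemma Zpart_eq (β : ℝ) (Λ : Finset V) (σ : Ω) : Zpart β Λ σ = ∑ η, gw β Λ σ η := rfl

lemma Zpart_pos (β : ℝ) (Λ : Finset V) (σ : Ω) : 0 < Zpart β Λ σ := wSum_pos (gw_pos β Λ σ)

/-- The Gibbs probability of `η` in `Λ` with boundary condition `σ`. -/
def gp (β : ℝ) (Λ : Finset V) (η : ↥Λ → Bool) (σ : Ω) : ℝ := gw β Λ σ η / Zpart β Λ σ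

lemma continuous_gp (β : ℝ) (Λ : Finset V) (η : ↥Λ → Bool) : Continuous (gp β Λ η) := (continuous_gw β Λ η).div (by
    exact continuous_finsetSum _ fun η _ => continuous_gw β Λ η)
    fun σ => (Zpart_pos β Λ σ).ne'

lemma gp_nonneg (β : ℝ) (Λ : Finset V) (η : ↥Λ → Bool) (σ : Ω) : 0 ≤ gp β Λ η σ := (div_pos (gw_pos _ _ _ _) (Zpart_pos _ _ _)).le

lemma gp_le_one (β : ℝ) (Λ : Finset V) (η : ↥Λ → Bool) (σ : Ω) : gp β Λ η σ ≤ 1 := by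
  unfold gp
  rw [div_le_one (Zpart_pos _ _ _), Zpart_eq]
  exact single_le_sum (f := gw β Λ σ) (fun η _ => (gw_pos β Λ σ η).le) (mem_univ η)

lemma PiOp_eq_sum_gp (β : ℝ) (Λ : Finset V) (f : Ω → ℝ) (σ : Ω) : PiOp β Λ f σ = ∑ η, gp β Λ η σ * f (spatch Λ η σ) := by
  unfold PiOp gp
  rw [sum_div]
  grind [gw]

lemma measurable_PiOp {β : ℝ} {Λ : Finset V} {f : Ω → ℝ} (hf : Measurable f) : Measurable (PiOp β Λ f) := by
  have : PiOp β Λ f = fun σ => ∑ η, gp β Λ η σ * f (spatch Λ η σ) := funext (PiOp_eq_sum_gp β Λ f)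
  rw [this]
  exact Finset.measurable_sum _ fun η _ => (continuous_gp β Λ η).measurable.mul (hf.comp (measurable_spatch Λ η))

lemma integrable_of_bounded {γ : Measure Ω} [IsFiniteMeasure γ] {f : Ω → ℝ}
    (hf : Measurable f) {C : ℝ} (hC : ∀ σ, |f σ| ≤ C) : Integrable f γ :=
  Integrable.of_bound hf.aestronglyMeasurable C (Eventually.of_forall fun σ => by simp_all)

variable {β : ℝ} {γ : Measure Ω}

/-- The law obtained from `γ` by resampling the spins in `Λ`. -/
def resample (β : ℝ) (Λ : Finset V) (γ : Measure Ω) : Measure Ω :=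
  ∑ η, (γ.withDensity fun σ => ENNReal.ofReal (gp β Λ η σ)).map (spatch Λ η)

instance resample_finite [IsFiniteMeasure γ] (Λ : Finset V) : IsFiniteMeasure (resample β Λ γ) := by
  have : ∀ η, IsFiniteMeasure (γ.withDensity fun σ => ENNReal.ofReal (gp β Λ η σ)) := fun η =>
    isFiniteMeasure_withDensity_ofReal
      (integrable_of_bounded (continuous_gp β Λ η).measurable (C := 1) fun σ => by grind [gp_nonneg, gp_le_one]).2
  unfold resample
  infer_instance

lemma integral_resample [IsFiniteMeasure γ] (Λ : Finset V) {f : Ω → ℝ} (hf : Measurable f)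
    {C : ℝ} (hC : ∀ σ, |f σ| ≤ C) : ∫ σ, f σ ∂(resample β Λ γ) = ∫ σ, PiOp β Λ f σ ∂γ := by
  have hfin : ∀ η, IsFiniteMeasure (γ.withDensity fun σ => ENNReal.ofReal (gp β Λ η σ)) := fun η =>
    isFiniteMeasure_withDensity_ofReal
      (integrable_of_bounded (continuous_gp β Λ η).measurable (C := 1) fun σ => by grind [gp_nonneg, gp_le_one]).2
  unfold resample
  rw [integral_finsetSum_measure fun η _ => integrable_of_bounded hf hC]
  have : PiOp β Λ f = fun σ => ∑ η, gp β Λ η σ * f (spatch Λ η σ) := funext (PiOp_eq_sum_gp β Λ f)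
  rw [this, integral_finsetSum]
  · refine sum_congr rfl fun η _ => ?_
    rw [integral_map (measurable_spatch Λ η).aemeasurable hf.aestronglyMeasurable, integral_withDensity_eq_integral_toReal_smul
        (continuous_gp β Λ η).measurable.ennreal_ofReal (by simp)]
    grind [ENNReal.toReal_ofReal, gp_nonneg, smul_eq_mul]
  · intro η _
    refine integrable_of_bounded ((continuous_gp β Λ η).measurable.mul (hf.comp (measurable_spatch Λ η))) (C := C) fun σ => ?_
    rw [abs_mul, abs_of_nonneg (gp_nonneg _ _ _ _)]
    exact (mul_le_of_le_one_left (abs_nonneg _) (gp_le_one _ _ _ _)).trans (hC _)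

/-- A Gibbs measure is invariant under resampling a finite region. -/
theorem IsGibbsIsing.resample_eq (hγ : IsGibbsIsing β γ) (Λ : Finset V) : resample β Λ γ = γ := by
  have := hγ.1
  refine ext_of_forall_integral_eq_of_IsFiniteMeasure fun f => ?_
  rw [integral_resample Λ f.continuous.measurable (C := ‖f‖) fun σ => f.norm_coe_le_norm σ]
  exact (hγ.2 f f.continuous Λ).symm

theorem IsGibbsIsing.integral_eq (hγ : IsGibbsIsing β γ) (Λ : Finset V) {f : Ω → ℝ}
    (hf : Measurable f) {C : ℝ} (hC : ∀ σ, |f σ| ≤ C) : ∫ σ, f σ ∂γ = ∫ σ, PiOp β Λ f σ ∂γ := by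
  have := hγ.1
  conv_lhs => rw [← hγ.resample_eq Λ]
  exact integral_resample Λ hf hC

/-- A tail event: membership is not affected by changing finitely many spins. -/
def IsTail (T : Set Ω) : Prop := ∀ (Λ : Finset V) (σ τ : Ω), (∀ x ∉ Λ, σ x = τ x) → σ ∈ T → τ ∈ T

lemma IsTail.spatch_mem {T : Set Ω} (hT : IsTail T) (Λ : Finset V) (η : ↥Λ → Bool) (σ : Ω) : spatch Λ η σ ∈ T ↔ σ ∈ T :=
  ⟨hT Λ _ _ fun _ hx => spatch_notMem hx, hT Λ _ _ fun _ hx => (spatch_notMem hx).symm⟩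

lemma continuous_bounded (f : Ω → ℝ) (hf : Continuous f) : ∃ C, ∀ σ, |f σ| ≤ C := by
  obtain ⟨C, hC⟩ := isCompact_univ.exists_bound_of_continuousOn hf.continuousOn
  exact ⟨C, fun σ => by simp_all⟩

/-- Conditioning a Gibbs measure on a tail event. -/
theorem IsGibbsIsing.cond (hγ : IsGibbsIsing β γ) {T : Set Ω} (hTm : MeasurableSet T)
    (hT : IsTail T) (h0 : γ T ≠ 0) : IsGibbsIsing β (ProbabilityTheory.cond γ T) := by
  have := hγ.1
  refine ⟨ProbabilityTheory.cond_isProbabilityMeasure h0, fun f hf Λ => ?_⟩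
  obtain ⟨C, hC⟩ := continuous_bounded f hf
  have key : ∫ σ in T, f σ ∂γ = ∫ σ in T, PiOp β Λ f σ ∂γ := by
    rw [← integral_indicator hTm, ← integral_indicator hTm]
    rw [hγ.integral_eq Λ (hf.measurable.indicator hTm) (C := C) fun σ => by grind [Real.norm_eq_abs, norm_indicator_le_norm_self]]
    refine integral_congr_ae (Eventually.of_forall fun σ => ?_)
    simp [PiOp_eq_sum_gp]
    by_cases hσ : σ ∈ T
    · rw [indicator_of_mem hσ, PiOp_eq_sum_gp]
      exact sum_congr rfl fun η _ => by rw [indicator_of_mem ((hT.spatch_mem Λ η σ).2 hσ)]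
    · rw [Set.indicator_of_notMem hσ]
      exact Finset.sum_eq_zero fun η _ => by rw [Set.indicator_of_notMem (mt (hT.spatch_mem Λ η σ).1 hσ), mul_zero]
  unfold ProbabilityTheory.cond
  simp_all

/-- Pushing a Gibbs measure forward along a map intertwining the kernels. -/
theorem IsGibbsIsing.map (hγ : IsGibbsIsing β γ) {β' : ℝ} {Φ : Ω → Ω} (hΦ : Continuous Φ) (T : Finset V → Finset V)
    (h : ∀ Λ f σ, PiOp β' Λ f (Φ σ) = PiOp β (T Λ) (fun τ => f (Φ τ)) σ) :
    IsGibbsIsing β' (γ.map Φ) := by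
  have := hγ.1
  refine ⟨Measure.isProbabilityMeasure_map hΦ.aemeasurable, fun f hf Λ => ?_⟩
  rw [integral_map hΦ.aemeasurable hf.aestronglyMeasurable,
    integral_map hΦ.aemeasurable (measurable_PiOp hf.measurable).aestronglyMeasurable]
  simp [h]
  exact hγ.2 (fun τ => f (Φ τ)) (hf.comp hΦ) (T Λ)

/-- Multiplication of a spin configuration by the sign field `κ` (`true` meaning a flip). -/
def flipBy (κ : V → Bool) (σ : Ω) : Ω := fun x => xor (κ x) (σ x)

lemma continuous_flipBy (κ : V → Bool) : Continuous (flipBy κ) :=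
  continuous_pi fun x => (continuous_of_discreteTopology (f := fun b => xor (κ x) b)).comp (continuous_apply x)

lemma PiOp_flipBy (κ : V → Bool) {β' : ℝ} (Λ : Finset V)
    (hκ : ∀ τ, β' * hamiltonian Λ (flipBy κ τ) = β * hamiltonian Λ τ) (f : Ω → ℝ) (σ : Ω) :
    PiOp β' Λ f (flipBy κ σ) = PiOp β Λ (fun τ => f (flipBy κ τ)) σ := by
  let e : (↥Λ → Bool) ≃ (↥Λ → Bool) := ⟨fun η x => xor (κ x) (η x), fun η x => xor (κ x) (η x), fun η => by simp, fun η => by simp⟩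
  have he : ∀ η, spatch Λ (e η) (flipBy κ σ) = flipBy κ (spatch Λ η σ) := by grind [spatch, flipBy]
  unfold PiOp Zpart
  rw [← e.sum_comp, ← e.sum_comp (fun η => exp _)]
  simp_all

theorem IsGibbsIsing.flipBy (hγ : IsGibbsIsing β γ) {β' : ℝ} (κ : V → Bool)
    (hκ : ∀ Λ τ, β' * hamiltonian Λ (flipBy κ τ) = β * hamiltonian Λ τ) :
    IsGibbsIsing β' (γ.map (_root_.flipBy κ)) :=
  hγ.map (continuous_flipBy κ) id fun Λ f σ => PiOp_flipBy κ Λ (hκ Λ) f σ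

lemma hamiltonian_flip_const (b : Bool) (Λ : Finset V) (τ : Ω) : hamiltonian Λ (flipBy (fun _ => b) τ) = hamiltonian Λ τ := by
  unfold hamiltonian
  rw [neg_inj]
  refine sum_congr rfl fun e _ => ?_
  induction e using Sym2.ind with
  | _ x y => grind [pairEnergy_mk, flipBy, spinVal]

def parity (x : V) : Bool := decide ((x.1 + x.2) % 2 = 1)

lemma parity_add_dir (x : V) (i : Fin 4) : parity (x + dir i) = !parity x := by
  unfold parity
  rw [Bool.eq_not_iff]
  fin_cases i <;> simp [dir] <;> omega

lemma hamiltonian_flip_parity (p : Bool) (Λ : Finset V) (τ : Ω) :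
    hamiltonian Λ (flipBy (fun x => xor p (parity x)) τ) = -hamiltonian Λ τ := by
  unfold hamiltonian
  rw [neg_inj, ← sum_neg_distrib]
  refine sum_congr rfl fun e he => ?_
  grind [mem_dualEdges, pairEnergy_mk, flipBy, parity_add_dir, spinVal]

theorem IsGibbsIsing.flip (hγ : IsGibbsIsing β γ) (b : Bool) : IsGibbsIsing β (γ.map (_root_.flipBy fun _ => b)) :=
  hγ.flipBy _ fun Λ τ => by rw [hamiltonian_flip_const]

theorem IsGibbsIsing.flip_parity (hγ : IsGibbsIsing β γ) (p : Bool) :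
    IsGibbsIsing (-β) (γ.map (_root_.flipBy fun x => xor p (parity x))) :=
  hγ.flipBy _ fun Λ τ => by rw [hamiltonian_flip_parity]; ring

def shiftBy (v : V) (σ : Ω) : Ω := fun x => σ (x + v)

lemma continuous_shiftBy (v : V) : Continuous (shiftBy v) := continuous_pi fun x => continuous_apply (x + v)

def shiftSet (v : V) (Λ : Finset V) : Finset V := Λ.map (addRightEmbedding v)

lemma mem_shiftSet {v x : V} {Λ : Finset V} : x ∈ shiftSet v Λ ↔ x - v ∈ Λ := by grind [shiftSet]

lemma hamiltonian_shiftBy (v : V) (Λ : Finset V) (τ : Ω) : hamiltonian Λ (shiftBy v τ) = hamiltonian (shiftSet v Λ) τ := by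
  unfold hamiltonian
  have e : dualEdges (shiftSet v Λ) = (dualEdges Λ).map (addRightEmbedding v : V ↪ V).sym2Map := by
    ext s
    simp only [mem_dualEdges, Finset.mem_map, mem_shiftSet]
    constructor
    · rintro ⟨x, hx, i, rfl⟩
      refine ⟨s(x - v, x - v + dir i), ⟨_, hx, i, rfl⟩, ?_⟩
      simp_all [sub_add_eq_add_sub]
    · rintro ⟨s, ⟨y, hy, i, rfl⟩, rfl⟩
      refine ⟨y + v, by simpa using hy, i, ?_⟩
      simp_all [add_right_comm]
  rw [e, Finset.sum_map]
  congr 1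
  refine sum_congr rfl fun e _ => ?_
  induction e using Sym2.ind with
  | _ x y => rfl

lemma PiOp_shiftBy (v : V) (Λ : Finset V) (f : Ω → ℝ) (σ : Ω) :
    PiOp β Λ f (shiftBy v σ) = PiOp β (shiftSet v Λ) (fun τ => f (shiftBy v τ)) σ := by
  let e : (↥(shiftSet v Λ) → Bool) ≃ (↥Λ → Bool) :=
    ⟨fun η x => η ⟨x + v, mem_shiftSet.2 (by simp)⟩, fun η x => η ⟨x - v, mem_shiftSet.1 x.2⟩, fun η => by simp, fun η => by simp⟩
  have he : ∀ η, spatch Λ (e η) (shiftBy v σ) = shiftBy v (spatch _ η σ) := by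
    intro η; ext x
    by_cases hx : x ∈ Λ
    · have : x + v ∈ shiftSet v Λ := by simpa [mem_shiftSet] using hx
      simp only [shiftBy, spatch, hx, this]
      rfl
    simp_all [mem_shiftSet, shiftBy, spatch]
  unfold PiOp Zpart
  rw [← e.sum_comp, ← e.sum_comp (fun η => exp _)]
  grind [hamiltonian_shiftBy]

theorem IsGibbsIsing.shift (hγ : IsGibbsIsing β γ) (v : V) : IsGibbsIsing β (γ.map (shiftBy v)) :=
  hγ.map (continuous_shiftBy v) _ fun Λ f σ => PiOp_shiftBy v Λ f σ

end GibbsMeasures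

section Magnetisation

lemma PiOp_neg {β : ℝ} (Λ : Finset V) (f : Ω → ℝ) (σ : Ω) : PiOp β Λ (fun τ => -f τ) σ = -PiOp β Λ f σ := by
  have := PiOp_smul (β := β) Λ (-1) f σ
  grind

lemma spin_monotone (x : V) : Monotone fun τ : Ω => spinVal (τ x) := fun _ _ h => spinVal_mono (h x)

lemma spinVal_abs (b : Bool) : |spinVal b| = 1 := by grind [spinVal]

lemma spinVal_not (b : Bool) : spinVal (!b) = -spinVal b := by grind [spinVal]

lemma flipBy_true_top : flipBy (fun _ => true) ⊤ = (⊥ : Ω) := by ext x; simp [flipBy]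

lemma PiOp_spin_bot (β : ℝ) (Λ : Finset V) (x : V) : PiOp β Λ (fun τ => spinVal (τ x)) ⊥ = -PiOp β Λ (fun τ => spinVal (τ x)) ⊤ := by
  rw [← flipBy_true_top, PiOp_flipBy (β := β) _ Λ (fun τ => by rw [hamiltonian_flip_const])]
  rw [← PiOp_neg]
  simp [flipBy, spinVal_not]

lemma PiOp_spin_top_nonneg {β : ℝ} (hβ : 0 ≤ β) (Λ : Finset V) (x : V) : 0 ≤ PiOp β Λ (fun τ => spinVal (τ x)) ⊤ := by
  have := PiOp_mono_bc hβ Λ (spin_monotone x) (bot_le : (⊥ : Ω) ≤ ⊤)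
  simp_all [PiOp_spin_bot]

lemma PiOp_le_of_eq_top {β : ℝ} (hβ : 0 ≤ β) {Λ Λ' : Finset V} (h : Λ ⊆ Λ') {f : Ω → ℝ}
    (hf : Monotone f) : PiOp β Λ' f ⊤ ≤ PiOp β Λ f ⊤ := by
  rw [← PiOp_PiOp β h, ← PiOp_const (β := β) Λ' (PiOp β Λ f ⊤) ⊤]
  exact PiOp_mono_fun _ (fun σ => PiOp_mono_bc hβ Λ hf le_top) _

/-- The magnetisation at the centre of the box of radius `n` with plus boundary condition. -/
def mag (β : ℝ) (n : ℕ) : ℝ := PiOp β (boxAt 0 n) (fun τ => spinVal (τ 0)) ⊤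

/-- The magnetisation vanishes. -/
notation:max "NoMag" β:max => Tendsto (mag β) atTop (𝓝 0)

lemma mag_nonneg {β : ℝ} (hβ : 0 ≤ β) (n : ℕ) : 0 ≤ mag β n := PiOp_spin_top_nonneg hβ _ _

lemma boxAt_mono (x : V) {m n : ℕ} (h : m ≤ n) : boxAt x m ⊆ boxAt x n := by grind [mem_boxAt]

lemma mag_antitone {β : ℝ} (hβ : 0 ≤ β) : Antitone (mag β) := fun _ _ h => PiOp_le_of_eq_top hβ (boxAt_mono 0 h) (spin_monotone 0)

lemma mag_le_one (β : ℝ) (n : ℕ) : mag β n ≤ 1 := (abs_le.1 (abs_PiOp_le _ (C := 1) (fun _ => (spinVal_abs _).le) _)).2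

lemma shiftSet_boxAt (x v : V) (n : ℕ) : shiftSet v (boxAt x n) = boxAt (x + v) n := by
  ext y
  rw [mem_shiftSet, mem_boxAt, mem_boxAt]
  grind [fst_sub, snd_sub, Prod.fst_add, Prod.snd_add]

lemma PiOp_boxAt_spin (β : ℝ) (x : V) (n : ℕ) : PiOp β (boxAt x n) (fun τ => spinVal (τ x)) ⊤ = mag β n := by
  have := PiOp_shiftBy (β := β) x (boxAt 0 n) (fun τ => spinVal (τ 0)) ⊤
  rw [shiftSet_boxAt, zero_add] at this
  simp [shiftBy] at this
  rw [← this]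
  rfl

lemma PiOp_spin_top_le_mag {β : ℝ} (hβ : 0 ≤ β) {Λ : Finset V} {x : V} {n : ℕ} (h : boxAt x n ⊆ Λ) :
    PiOp β Λ (fun τ => spinVal (τ x)) ⊤ ≤ mag β n := by
  rw [← PiOp_boxAt_spin β x n]
  exact PiOp_le_of_eq_top hβ h (spin_monotone x)

/-- A function of the spins in `A`. -/
def SpinDep (A : Finset V) (f : Ω → ℝ) : Prop := ∀ σ τ : Ω, (∀ x ∈ A, σ x = τ x) → f σ = f τ

lemma SpinDep.mono {A B : Finset V} {f : Ω → ℝ} (h : SpinDep A f) (hAB : A ⊆ B) :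
    SpinDep B f := fun σ τ hs => h σ τ fun x hx => hs x (hAB hx)

lemma SpinDep.continuous {A : Finset V} {f : Ω → ℝ} (h : SpinDep A f) : Continuous f := by
  have : f = fun σ => f (spatch A (fun x => σ x) ⊤) := by
    funext σ
    refine h _ _ fun x hx => ?_
    rw [spatch_of_mem hx]
  have e : f = (fun η : ↥A → Bool => f (spatch A η ⊤)) ∘ fun σ (x : ↥A) => σ x := this
  rw [e]
  exact continuous_of_discreteTopology.comp (continuous_pi fun x => continuous_apply _)

lemma monotone_of_dominated {A : Finset V} {f : Ω → ℝ} (h : SpinDep A f) {C : ℝ}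
    (hC : ∀ σ, |f σ| ≤ C) : Monotone fun σ => C * ∑ x ∈ A, spinVal (σ x) + f σ := by
  intro σ τ hst
  have hC0 : 0 ≤ C := (abs_nonneg _).trans (hC ⊤)
  by_cases he : ∀ x ∈ A, σ x = τ x
  · simp
    rw [h σ τ he, sum_congr rfl fun x hx => by rw [he x hx]]
  · push Not at he
    obtain ⟨y, hy, hne⟩ := he
    have h1 : ∑ x ∈ A, spinVal (σ x) + 2 ≤ ∑ x ∈ A, spinVal (τ x) := by
      rw [← add_sum_erase _ _ hy, ← add_sum_erase _ _ hy]
      have h2 : spinVal (σ y) + 2 ≤ spinVal (τ y) := by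
        have := hst y
        revert this hne
        cases σ y <;> cases τ y <;> norm_num [spinVal]
      have h3 : ∑ x ∈ A.erase y, spinVal (σ x) ≤ ∑ x ∈ A.erase y, spinVal (τ x) := sum_le_sum fun x _ => spinVal_mono (hst x)
      linarith
    have h4 := abs_le.1 (hC σ)
    have h5 := abs_le.1 (hC τ)
    have h6 := mul_le_mul_of_nonneg_left h1 hC0
    linarith

variable {β : ℝ} {γ : Measure Ω}

theorem IsGibbsIsing.le_top (hβ : 0 ≤ β) (hγ : IsGibbsIsing β γ) (Λ : Finset V) {f : Ω → ℝ}
    (hm : Measurable f) {C : ℝ} (hC : ∀ σ, |f σ| ≤ C) (hf : Monotone f) : ∫ σ, f σ ∂γ ≤ PiOp β Λ f ⊤ := by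
  have := hγ.1
  rw [hγ.integral_eq Λ hm hC]
  calc _ ≤ ∫ σ, PiOp β Λ f ⊤ ∂γ := integral_mono
        (integrable_of_bounded (measurable_PiOp hm) fun σ => abs_PiOp_le Λ hC σ) (integrable_const _)
        fun σ => PiOp_mono_bc hβ Λ hf _root_.le_top
    _ = _ := by simp

theorem IsGibbsIsing.bot_le (hβ : 0 ≤ β) (hγ : IsGibbsIsing β γ) (Λ : Finset V) {f : Ω → ℝ}
    (hm : Measurable f) {C : ℝ} (hC : ∀ σ, |f σ| ≤ C) (hf : Monotone f) : PiOp β Λ f ⊥ ≤ ∫ σ, f σ ∂γ := by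
  have := hγ.1
  rw [hγ.integral_eq Λ hm hC]
  calc PiOp β Λ f ⊥ = ∫ σ, PiOp β Λ f ⊥ ∂γ := by simp
    _ ≤ _ := integral_mono (integrable_const _)
        (integrable_of_bounded (measurable_PiOp hm) fun σ => abs_PiOp_le Λ hC σ)
        fun σ => PiOp_mono_bc hβ Λ hf _root_.bot_le

lemma measurable_spin (x : V) : Measurable fun τ : Ω => spinVal (τ x) := (continuous_spinVal.comp (continuous_apply x)).measurable

/-- Quantitative comparison of a Gibbs measure with the plus finite-volume measure. -/
theorem IsGibbsIsing.local_approx (hβ : 0 ≤ β) (hγ : IsGibbsIsing β γ) (Λ : Finset V)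
    {A : Finset V} {f : Ω → ℝ} (hf : SpinDep A f) {C : ℝ} (hC : ∀ σ, |f σ| ≤ C) :
    |PiOp β Λ f ⊤ - ∫ σ, f σ ∂γ| ≤ 2 * C * ∑ x ∈ A, PiOp β Λ (fun τ => spinVal (τ x)) ⊤ := by
  have := hγ.1
  have hC0 : 0 ≤ C := (abs_nonneg _).trans (hC ⊤)
  set S : Ω → ℝ := fun σ => ∑ x ∈ A, spinVal (σ x) with hS
  have hSm : Measurable S := Finset.measurable_sum _ fun x _ => measurable_spin x
  have hSb : ∀ σ, |S σ| ≤ A.card := fun σ => by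
    refine (Finset.abs_sum_le_sum_abs _ _).trans ?_
    simp [spinVal_abs]
  have intS : Integrable S γ := integrable_of_bounded hSm hSb
  have gen : ∀ g : Ω → ℝ, SpinDep A g → (∀ σ, |g σ| ≤ C) → C * ∫ σ, S σ ∂γ + ∫ σ, g σ ∂γ ≤ C * PiOp β Λ S ⊤ + PiOp β Λ g ⊤ := by
    intro g hg hgC
    have intg : Integrable g γ := integrable_of_bounded hg.continuous.measurable hgC
    have := hγ.le_top hβ Λ (f := fun σ => C * S σ + g σ) ((hSm.const_mul C).add hg.continuous.measurable)
      (C := C * A.card + C) (fun σ => (abs_add_le _ _).trans (add_le_add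
        (by simp_all [abs_of_nonneg, mul_le_mul_of_nonneg_left]) (hgC σ)))
      (monotone_of_dominated hg hgC)
    rwa [PiOp_add, PiOp_smul, integral_add (intS.const_mul C) intg, integral_const_mul] at this
  have h2 := gen (fun σ => -f σ) (fun σ τ h => congrArg Neg.neg (hf σ τ h)) (fun σ => by grind)
  rw [integral_neg, PiOp_neg] at h2
  have h3 : -PiOp β Λ S ⊤ ≤ ∫ σ, S σ ∂γ := by
    have := hγ.bot_le hβ Λ hSm hSb fun σ τ h => sum_le_sum fun x _ => spinVal_mono (h x)
    simp_all [PiOp_sum, PiOp_spin_bot]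
  have h4 : PiOp β Λ S ⊤ = ∑ x ∈ A, PiOp β Λ (fun τ => spinVal (τ x)) ⊤ := by simp [hS, PiOp_sum]
  have h5 := mul_le_mul_of_nonneg_left h3 hC0
  grind

lemma exists_boxAt_subset (A : Finset V) (n : ℕ) : ∃ N, ∀ x ∈ A, boxAt x n ⊆ boxAt 0 N := by
  refine ⟨n + ∑ x ∈ A, (x.1.natAbs + x.2.natAbs), fun x hx y hy => ?_⟩
  rw [mem_boxAt, abs_le, abs_le] at hy
  rw [mem_boxAt, abs_le, abs_le]
  have h1 : x.1.natAbs + x.2.natAbs ≤ ∑ x ∈ A, (x.1.natAbs + x.2.natAbs) :=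
    single_le_sum (f := fun x : V => x.1.natAbs + x.2.natAbs) (fun _ _ => Nat.zero_le _) hx
  grind [fst_zero, snd_zero]

/-- If the magnetisation vanishes, local expectations converge to those of any Gibbs measure. -/
theorem IsGibbsIsing.local_limit (hβ : 0 ≤ β) (hγ : IsGibbsIsing β γ) (hm : Tendsto (mag β) atTop (nhds 0)) {A : Finset V} {f : Ω → ℝ}
    (hf : SpinDep A f) :
    Tendsto (fun N : ℕ => PiOp β (boxAt 0 N) f ⊤) atTop (nhds (∫ σ, f σ ∂γ)) := by
  obtain ⟨C, hC⟩ := continuous_bounded f hf.continuous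
  have hC0 : 0 ≤ C := (abs_nonneg _).trans (hC ⊤)
  rw [Metric.tendsto_atTop]
  intro ε hε
  have hk : 0 < 2 * C * A.card + 1 := by positivity
  obtain ⟨n, hn⟩ := (hm.eventually (gt_mem_nhds (div_pos hε hk))).exists
  obtain ⟨N, hN⟩ := exists_boxAt_subset A n
  refine ⟨N, fun M hM => ?_⟩
  rw [Real.dist_eq]
  refine (hγ.local_approx hβ (boxAt 0 M) hf hC).trans_lt ?_
  have : ∑ x ∈ A, PiOp β (boxAt 0 M) (fun τ => spinVal (τ x)) ⊤ ≤ A.card * mag β n := by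
    rw [← nsmul_eq_mul]
    exact sum_le_card_nsmul _ _ _ fun x hx => PiOp_spin_top_le_mag hβ ((hN x hx).trans (boxAt_mono 0 hM))
  have h0 := mag_nonneg hβ n
  calc _ ≤ 2 * C * (A.card * mag β n) := mul_le_mul_of_nonneg_left this (by positivity)
    _ ≤ (2 * C * A.card + 1) * mag β n := by nlinarith
    _ < _ := by simp_all [lt_div_iff₀']

/-- Vanishing magnetisation implies uniqueness of the Gibbs measure. -/
theorem IsGibbsIsing.unique (hβ : 0 ≤ β) (hm : Tendsto (mag β) atTop (nhds 0))
    {γ' : Measure Ω} (hγ : IsGibbsIsing β γ) (hγ' : IsGibbsIsing β γ') : γ = γ' := by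
  have := hγ.1
  have := hγ'.1
  refine ext_of_generate_finite _ generateFrom_measurableCylinders.symm isPiSystem_measurableCylinders (fun s hs => ?_) (by simp)
  have hms := MeasurableSet.of_mem_measurableCylinders hs
  obtain ⟨A, S, hS, rfl⟩ := (mem_measurableCylinders _).1 hs
  have hdep : SpinDep A ((cylinder A S).indicator fun _ => (1 : ℝ)) := by
    intro σ τ h
    have : (σ ∈ cylinder A S) ↔ τ ∈ cylinder A S := by
      simp
      rw [show A.restrict σ = A.restrict τ from funext fun x => h x x.2]
    by_cases hσ : σ ∈ cylinder A S
    · simp_all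
    simp_all
  have key := tendsto_nhds_unique (hγ.local_limit hβ hm hdep) (hγ'.local_limit hβ hm hdep)
  simp_all [measureReal_def, ENNReal.toReal_eq_toReal_iff']

end Magnetisation

section RandomCluster

/-- Whether the two endpoints of an edge carry the same spin. -/
def agreeAt (τ : Ω) : Sym2 V → Bool := Sym2.lift ⟨fun x y => τ x == τ y, fun x y => by grind⟩

lemma agreeAt_mk (τ : Ω) (x y : V) : agreeAt τ s(x, y) = (τ x == τ y) := rfl

variable {E : Finset (Sym2 V)}

/-- `τ` is constant along the open edges of `ω`. -/
def Compat (ω : ↥E → Bool) (τ : Ω) : Prop := ∀ e : ↥E, ω e = true → agreeAt τ e = true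

lemma Compat.anti {ω ω' : ↥E → Bool} {τ : Ω} (h : Compat ω' τ) (hω : ω ≤ ω') : Compat ω τ :=
  fun e he => h e (by have := hω e; rw [he] at this; exact top_le_iff.1 this)

def spinProd (σ τ : Ω) : Ω := fun x => σ x == τ x

lemma agreeAt_spinProd {σ τ : Ω} {e : Sym2 V} (h : agreeAt σ e = true) : agreeAt (spinProd σ τ) e = agreeAt τ e := by
  induction e using Sym2.ind with
  | _ x y =>
    simp [agreeAt_mk, spinProd] at h ⊢
    revert h
    cases σ x <;> cases σ y <;> cases τ x <;> cases τ y <;> simp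

lemma Compat.mul {ω : ↥E → Bool} {σ τ : Ω} (h : Compat ω σ) (h' : Compat ω τ) :
    Compat ω (spinProd σ τ) := fun e he => by rw [agreeAt_spinProd (h e he)]; exact h' e he

lemma spinProd_spinProd (σ τ : Ω) : spinProd σ (spinProd σ τ) = τ := by grind [spinProd]

open scoped Classical in
/-- The cols of `Λ` compatible with `ω` and the plus boundary condition. -/
def cols (Λ : Finset V) (ω : ↥E → Bool) : Finset (↥Λ → Bool) := univ.filter fun η => Compat ω (spatch Λ η ⊤)

lemma mem_cols {Λ : Finset V} {ω : ↥E → Bool} {η : ↥Λ → Bool} : η ∈ cols Λ ω ↔ Compat ω (spatch Λ η ⊤) := by simp [cols]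

lemma compat_top (ω : ↥E → Bool) : Compat ω ⊤ := by
  rintro ⟨e, -⟩ -
  induction e using Sym2.ind with
  | _ x y => simp [agreeAt_mk]

lemma spatch_top_top (Λ : Finset V) : spatch Λ (fun _ => true) ⊤ = ⊤ := by ext x; simp_all [spatch]

lemma cols_nonempty (Λ : Finset V) (ω : ↥E → Bool) : (cols Λ ω).Nonempty :=
  ⟨fun _ => true, mem_cols.2 (by rw [spatch_top_top]; exact compat_top ω)⟩

lemma exists_patch {Λ : Finset V} {τ : Ω} (h : ∀ y ∉ Λ, τ y = true) :
    spatch Λ (fun x => τ x) ⊤ = τ := spatch_restrict fun x hx => by simp [h x hx]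

lemma spinProd_off {Λ : Finset V} {σ τ : Ω} (h : ∀ y ∉ Λ, σ y = true) (h' : ∀ y ∉ Λ, τ y = true) :
    ∀ y ∉ Λ, spinProd σ τ y = true := fun y hy => by grind [spinProd]

lemma patch_off {Λ : Finset V} (η : ↥Λ → Bool) : ∀ y ∉ Λ, spatch Λ η ⊤ y = true := fun y hy => by rw [spatch_notMem hy]; rfl

/-- The submodularity inequality behind the lattice condition for random-cluster weights. -/
lemma card_cols_mul_le {B Λ : Finset V} (hB : B ⊆ Λ) (a b : ↥E → Bool) : (cols Λ a).card * (cols B b).card ≤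
      (cols Λ (a ⊓ b)).card * (cols B (a ⊔ b)).card := by
  classical
  rw [← card_product, mul_comm]
  let F : (↥Λ → Bool) × (↥B → Bool) → (↥Λ → Bool) := fun p x => spinProd (spatch Λ p.1 ⊤) (spatch B p.2 ⊤) x
  have offB : ∀ (η : ↥B → Bool), ∀ y ∉ Λ, spatch B η ⊤ y = true := fun η y hy => patch_off η y fun h => hy (hB h)
  have hF : ∀ p, spatch Λ (F p) ⊤ = spinProd (spatch Λ p.1 ⊤) (spatch B p.2 ⊤) := fun p =>
    exists_patch (spinProd_off (patch_off p.1) (offB p.2))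
  have h1 : (cols Λ a ×ˢ cols B b).image F ⊆ cols Λ (a ⊓ b) := by
    intro η hη
    obtain ⟨p, hp, rfl⟩ := mem_image.1 hη
    rw [mem_product, mem_cols, mem_cols] at hp
    rw [mem_cols, hF]
    exact (hp.1.anti inf_le_left).mul (hp.2.anti inf_le_right)
  refine (Finset.card_le_mul_card_image (f := F) _ (cols B (a ⊔ b)).card ?_).trans (Nat.mul_le_mul_left _ (card_le_card h1))
  intro η hη
  obtain ⟨p0, hp0, rfl⟩ := mem_image.1 hη
  refine Finset.card_le_card_of_injOn (fun p x => spinProd (spatch B p0.2 ⊤) (spatch B p.2 ⊤) x) ?_ ?_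
  · intro p hp
    rw [mem_coe, mem_filter, mem_product, mem_cols, mem_cols] at hp
    rw [mem_product, mem_cols, mem_cols] at hp0
    obtain ⟨⟨hp1, hp2⟩, hpe⟩ := hp
    rw [mem_coe, mem_cols, exists_patch (spinProd_off (patch_off _) (patch_off _))]
    have e1 : spinProd (spatch Λ p.1 ⊤) (spatch B p.2 ⊤) = spinProd (spatch Λ p0.1 ⊤) (spatch B p0.2 ⊤) := by grind
    have e2 : spinProd (spatch B p0.2 ⊤) (spatch B p.2 ⊤) = spinProd (spatch Λ p0.1 ⊤) (spatch Λ p.1 ⊤) := by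
      ext x
      have := congrFun e1 x
      simp [spinProd] at this ⊢
      revert this
      cases spatch Λ p.1 ⊤ x <;> cases spatch B p.2 ⊤ x <;> cases spatch Λ p0.1 ⊤ x <;>
        cases spatch B p0.2 ⊤ x <;> simp
    intro e he
    have he' : a e = true ∨ b e = true := by simp_all
    rcases he' with he | he
    · rw [e2]; exact hp0.1.mul hp1 e he
    · exact hp0.2.mul hp2 e he
  · intro p hp q hq hpq
    have e1 : spinProd (spatch Λ p.1 ⊤) (spatch B p.2 ⊤) = spinProd (spatch Λ q.1 ⊤) (spatch B q.2 ⊤) := by grind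
    have e2 : p.2 = q.2 := by
      ext x
      have := congrFun hpq x
      simp [spinProd, spatch_of_mem x.2] at this
      revert this
      cases p0.2 x <;> cases p.2 x <;> cases q.2 x <;> simp
    have e3 : p.1 = q.1 := by
      ext x
      have := congrFun e1 x
      rw [e2] at this
      simp [spinProd, spatch_of_mem x.2] at this
      revert this
      cases p.1 x <;> cases q.1 x <;> cases spatch B q.2 ⊤ (x : V) <;> simp
    grind

def nOpen (ω : ↥E → Bool) : ℝ := ∑ e, cInd e ω

def fkW (Λ : Finset V) (s : ℝ) (ω : ↥E → Bool) : ℝ := exp (s * nOpen ω) * (cols Λ ω).card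

lemma fkW_pos (Λ : Finset V) (s : ℝ) (ω : ↥E → Bool) : 0 < fkW Λ s ω := mul_pos (exp_pos _) (by simp_all [cols_nonempty])

lemma nOpen_modular (a b : ↥E → Bool) : nOpen a + nOpen b = nOpen (a ⊓ b) + nOpen (a ⊔ b) := by
  unfold nOpen
  rw [← sum_add_distrib, ← sum_add_distrib]
  simp [cInd]
  grind

lemma fkW_holley {B Λ : Finset V} (hB : B ⊆ Λ) (s : ℝ) (a b : ↥E → Bool) :
    fkW Λ s a * fkW B s b ≤ fkW Λ s (a ⊓ b) * fkW B s (a ⊔ b) := by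
  have h1 : ((cols Λ a).card : ℝ) * (cols B b).card ≤ (cols Λ (a ⊓ b)).card * (cols B (a ⊔ b)).card := by
    exact_mod_cast card_cols_mul_le hB a b
  have h2 : exp (s * nOpen a) * exp (s * nOpen b) = exp (s * nOpen (a ⊓ b)) * exp (s * nOpen (a ⊔ b)) := by
    rw [← exp_add, ← exp_add, ← mul_add, ← mul_add, nOpen_modular]
  unfold fkW
  calc _ = (exp (s * nOpen a) * exp (s * nOpen b)) *
        (((cols Λ a).card : ℝ) * (cols B b).card) := by ring
    _ ≤ (exp (s * nOpen a) * exp (s * nOpen b)) *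
        ((cols Λ (a ⊓ b)).card * (cols B (a ⊔ b)).card) :=
        mul_le_mul_of_nonneg_left h1 (mul_pos (exp_pos _) (exp_pos _)).le
    _ = _ := by grind

lemma fkW_latticeWeight (Λ : Finset V) (s : ℝ) : LatWeight (fkW (E := E) Λ s) where
  pos := fkW_pos Λ s
  lattice := fkW_holley subset_rfl s

/-- The event that `x` is forced to be plus by the boundary of `B`. -/
def forced (E : Finset (Sym2 V)) (B : Finset V) (x : V) : Set (↥E → Bool) :=
  {ω | ∀ τ : Ω, (∀ y ∉ B, τ y = true) → Compat ω τ → τ x = true}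

lemma forced_upper {B : Finset V} {x : V} {ω ω' : ↥E → Bool} (h : ω ≤ ω') (hω : ω ∈ forced E B x) :
    ω' ∈ forced E B x := fun τ h1 h2 => hω τ h1 (h2.anti h)

lemma forced_mono {B B' : Finset V} (hB : B ⊆ B') {x : V} : forced E B' x ⊆ forced E B x :=
  fun _ hω τ h1 h2 => hω τ (fun y hy => h1 y fun h => hy (hB h)) h2

open scoped Classical in
lemma indicator_forced_monotone (B : Finset V) (x : V) : Monotone ((forced E B x).indicator (1 : 𝓕 ↥E)) := by
  intro ω ω' h
  by_cases hω : ω ∈ forced E B x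
  · rw [indicator_of_mem hω, indicator_of_mem (forced_upper h hω)]; rfl
  simp_all [Set.indicator_nonneg]

lemma sum_cols_spin (B : Finset V) {x : V} (hx : x ∈ B) (ω : ↥E → Bool) : ∑ η ∈ cols B ω, spinVal (η ⟨x, hx⟩) =
      (cols B ω).card * (forced E B x).indicator (1 : 𝓕 ↥E) ω := by
  classical
  by_cases hω : ω ∈ forced E B x
  · rw [indicator_of_mem hω, Pi.one_apply, mul_one, ← nsmul_one, ← sum_const]
    refine sum_congr rfl fun η hη => ?_
    have := hω _ (patch_off η) (mem_cols.1 hη)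
    rw [spatch_of_mem hx] at this
    rw [this]; rfl
  · rw [Set.indicator_of_notMem hω, mul_zero]
    simp only [forced, Set.mem_ofPred_eq, not_forall] at hω
    obtain ⟨τ, h1, h2, h3⟩ := hω
    refine Finset.sum_involution (fun η _ y => spinProd τ (spatch B η ⊤) y) ?_ ?_ ?_ ?_
    · grind [spinProd, spatch_of_mem, spinVal]
    · intro η _ _ h
      have := congrFun h ⟨x, hx⟩
      grind [spinProd, spatch_of_mem]
    · intro η hη
      rw [mem_cols, exists_patch (spinProd_off h1 (patch_off η))]
      exact h2.mul (mem_cols.1 hη)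
    · intro η _
      ext y
      rw [exists_patch (spinProd_off h1 (patch_off η)), spinProd_spinProd, spatch_of_mem y.2]

end RandomCluster

section EdwardsSokal

variable {E : Finset (Sym2 V)}

lemma exp_nOpen_compat (s : ℝ) (τ : Ω) (ω : ↥E → Bool) [Decidable (Compat ω τ)] : exp (s * nOpen ω) * (if Compat ω τ then 1 else 0) =
      ∏ e : ↥E, (fun (e : ↥E) (b : Bool) => if b = true then (if agreeAt τ e = true then exp s else 0) else 1) e (ω e) := by
  split_ifs with h
  · rw [mul_one, nOpen, mul_sum, exp_sum]
    refine prod_congr rfl fun e _ => ?_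
    by_cases he : ω e = true
    · simp [cInd, he, h e he]
    · simp [cInd, he]
  · rw [mul_zero]
    unfold Compat at h
    push Not at h
    obtain ⟨e, he, h⟩ := h
    symm
    refine Finset.prod_eq_zero (mem_univ e) ?_
    grind

lemma sum_fk (B : Finset V) (s : ℝ) (g : (↥B → Bool) → ℝ) : ∑ ω : ↥E → Bool, exp (s * nOpen ω) * ∑ η ∈ cols B ω, g η =
      ∑ η, (∏ e : ↥E, (1 + if agreeAt (spatch B η ⊤) e = true then exp s else 0)) * g η := by
  classical
  have h1 : ∀ ω : ↥E → Bool, exp (s * nOpen ω) * ∑ η ∈ cols B ω, g η =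
      ∑ η, (exp (s * nOpen ω) * (if Compat ω (spatch B η ⊤) then 1 else 0)) * g η := by
    simp_all [cols, sum_filter, mul_sum]
  simp_rw [h1]
  rw [sum_comm]
  refine sum_congr rfl fun η _ => ?_
  rw [← sum_mul]
  congr 1
  simp_rw [exp_nOpen_compat]
  refine (sum_prod_pi fun (e : ↥E) (b : Bool) => if b = true then
    (if agreeAt (spatch B η ⊤) e = true then exp s else 0) else 1).trans ?_
  refine prod_congr rfl fun e _ => ?_
  rw [sum_bool]
  grind

lemma pairEnergy_agreeAt (β s : ℝ) (hs : exp s = exp (2 * β) - 1) (τ : Ω) (e : Sym2 V) :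
    (1 + if agreeAt τ e = true then exp s else 0) = exp β * exp (β * pairEnergy τ e) := by
  induction e using Sym2.ind with
  | _ x y =>
    rw [agreeAt_mk, pairEnergy_mk, ← exp_add, hs]
    have h1 : β + β = 2 * β := by ring
    rcases Bool.eq_false_or_eq_true (τ x) with h | h <;> rcases Bool.eq_false_or_eq_true (τ y) with h' | h' <;>
      simp [h, h', spinVal, h1]

lemma prod_agree_eq_gw {B : Finset V} {β s : ℝ} (hs : exp s = exp (2 * β) - 1)
    (hBE : dualEdges B ⊆ E) (hE : ∀ e ∈ E, e ∉ dualEdges B → ∀ x ∈ e, x ∉ B) (η : ↥B → Bool) :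
    ∏ e : ↥E, (1 + if agreeAt (spatch B η ⊤) e = true then exp s else 0) =
      (exp β ^ E.card * exp (β * (E \ dualEdges B).card)) * gw β B ⊤ η := by
  simp_rw [pairEnergy_agreeAt β s hs]
  rw [prod_mul_distrib, prod_const, card_univ, card_coe, mul_assoc]
  rw [← exp_sum, ← mul_sum, gw, ← exp_add, sum_coe_sort E (pairEnergy (spatch B η ⊤)), ← Finset.sum_sdiff hBE, hamiltonian]
  have : ∑ e ∈ E \ dualEdges B, pairEnergy (spatch B η ⊤) e = (E \ dualEdges B).card := by
    rw [Finset.card_eq_sum_ones, Nat.cast_sum]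
    refine sum_congr rfl fun e he => ?_
    rw [Finset.mem_sdiff] at he
    have h := hE e he.1 he.2
    induction e using Sym2.ind with
    | _ x y => simp_all [pairEnergy_mk, spatch_notMem, spinVal]
  grind

/-- The Edwards–Sokal identity for the one-point function. -/
lemma wEx_forced_eq {B : Finset V} {β s : ℝ} (hs : exp s = exp (2 * β) - 1)
    (hBE : dualEdges B ⊆ E) (hE : ∀ e ∈ E, e ∉ dualEdges B → ∀ x ∈ e, x ∉ B) {x : V} (hx : x ∈ B) :
    wEx (fkW (E := E) B s) ((forced E B x).indicator 1) = PiOp β B (fun τ => spinVal (τ x)) ⊤ := by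
  have h1 : ∀ ω : ↥E → Bool, fkW B s ω * (forced E B x).indicator 1 ω =
      exp (s * nOpen ω) * ∑ η ∈ cols B ω, spinVal (η ⟨x, hx⟩) := fun ω => by
    rw [sum_cols_spin, fkW, mul_assoc]
  have h2 : ∀ ω : ↥E → Bool, fkW B s ω = exp (s * nOpen ω) * ∑ η ∈ cols B ω, (1 : ℝ) := fun ω => by rw [fkW]; simp
  rw [PiOp_eq_wEx, wEx, wEx]
  rw [sum_congr rfl fun ω _ => h1 ω, sum_congr rfl fun ω _ => h2 ω, sum_fk, sum_fk]
  simp_rw [prod_agree_eq_gw hs hBE hE, mul_assoc, ← mul_sum]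
  simp_all [mul_div_mul_left, spatch_of_mem]

lemma dualEdges_off {B Λ : Finset V} : ∀ e ∈ dualEdges Λ, e ∉ dualEdges B → ∀ x ∈ e, x ∉ B :=
  fun _ he he' _ hx hxB => he' (mem_dualEdges_of_mem he hxB hx)

lemma wEx_forced_dualEdges {B Λ : Finset V} (hB : B ⊆ Λ) {β s : ℝ} (hs : exp s = exp (2 * β) - 1) {x : V} (hx : x ∈ B) :
    wEx (fkW (E := dualEdges Λ) B s) ((forced (dualEdges Λ) B x).indicator 1) =
      PiOp β B (fun τ => spinVal (τ x)) ⊤ :=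
  wEx_forced_eq hs (dualEdges_mono hB) dualEdges_off hx

/-- Comparison of boundary conditions. -/
lemma wEx_forced_le {B Λ : Finset V} (hB : B ⊆ Λ) {β s : ℝ} (hs : exp s = exp (2 * β) - 1) {x : V} (hx : x ∈ B) :
    wEx (fkW (E := dualEdges Λ) Λ s) ((forced (dualEdges Λ) B x).indicator 1) ≤
      PiOp β B (fun τ => spinVal (τ x)) ⊤ := by
  rw [← wEx_forced_dualEdges hB hs hx]
  grind [wEx_le_of_holley, fkW_pos, fkW_holley, indicator_forced_monotone]

lemma le_wEx_forced {B Λ : Finset V} (hB : B ⊆ Λ) {β s : ℝ} (hs : exp s = exp (2 * β) - 1) {x : V} (hx : x ∈ B) :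
    PiOp β Λ (fun τ => spinVal (τ x)) ⊤ ≤
      wEx (fkW (E := dualEdges Λ) Λ s) ((forced (dualEdges Λ) B x).indicator 1) := by
  rw [← wEx_forced_dualEdges subset_rfl hs (hB hx)]
  refine wEx_mono (fkW_pos _ _) fun ω => ?_
  refine Set.indicator_le_indicator_of_subset (forced_mono hB) (fun _ => zero_le_one) ω

end EdwardsSokal

section Exploration

def nrm (x : V) : ℕ := max x.1.natAbs x.2.natAbs

lemma mem_boxAt_iff {x y : V} {n : ℕ} : y ∈ boxAt x n ↔ nrm (y - x) ≤ n := by grind [mem_boxAt, nrm, fst_sub, snd_sub]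

lemma mem_boxAt_zero {y : V} {n : ℕ} : y ∈ boxAt 0 n ↔ nrm y ≤ n := by rw [mem_boxAt_iff, sub_zero]

lemma nrm_add_dir (x : V) (i : Fin 4) : nrm (x + dir i) ≤ nrm x + 1 ∧ nrm x ≤ nrm (x + dir i) + 1 := by
  obtain ⟨a, b⟩ := x
  fin_cases i <;> simp only [dir, nrm, Prod.mk_add_mk, Fin.zero_eta, Fin.mk_one, Fin.reduceFinMk,
    Matrix.cons_val] <;> omega

/-- The two endpoints of a lattice edge have sup norms differing by at most one. -/
lemma nrm_edge {Λ : Finset V} {x y : V} (h : s(x, y) ∈ dualEdges Λ) : nrm x ≤ nrm y + 1 ∧ nrm y ≤ nrm x + 1 := by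
  obtain ⟨z, -, i, h⟩ := mem_dualEdges.1 h
  grind [nrm_add_dir]

variable {E : Finset (Sym2 V)}

def revStep (D : Finset (Sym2 V)) (F : Finset ↥E) (ω : ↥E → Bool) (x y : V) : Prop :=
  ∃ e ∈ F, (e : Sym2 V) = s(x, y) ∧ s(x, y) ∈ D ∧ ω e = true

/-- The set revealed by exploration from the ring of radius `k`. -/
def ringReach (k : ℕ) (D : Finset (Sym2 V)) (F : Finset ↥E) (ω : ↥E → Bool) : Set V :=
  {y | ∃ x, nrm x = k ∧ ReflTransGen (revStep D F ω) x y}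

lemma ringReach_step {k : ℕ} {D : Finset (Sym2 V)} {F : Finset ↥E} {ω : ↥E → Bool} {e : ↥E} {x y : V}
    (hx : x ∈ ringReach k D F ω) (he : e ∈ F) (hxy : (e : Sym2 V) = s(x, y)) (hD : s(x, y) ∈ D)
    (ho : ω e = true) : y ∈ ringReach k D F ω := by
  obtain ⟨z, hz, h⟩ := hx
  exact ⟨z, hz, h.tail ⟨e, he, hxy, hD, ho⟩⟩

lemma ringReach_ring {k : ℕ} {D : Finset (Sym2 V)} {F : Finset ↥E} {ω : ↥E → Bool} {x : V}
    (hx : nrm x = k) : x ∈ ringReach k D F ω := ⟨x, hx, .refl⟩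

lemma ringReach_mono {k : ℕ} {D : Finset (Sym2 V)} {F F' : Finset ↥E} (hF : F ⊆ F') {ξ ω : ↥E → Bool}
    (h : agreeOn F ξ ω) : ringReach k D F ξ ⊆ ringReach k D F' ω := by
  rintro y ⟨x, hx, hxy⟩
  exact ⟨x, hx, hxy.lift id fun a b ⟨e, he, h1, h2, h3⟩ => ⟨e, hF he, h1, h2, by rw [h e he, h3]⟩⟩

def ringQuery (k : ℕ) (D : Finset (Sym2 V)) (F : Finset ↥E) (ω : ↥E → Bool) (e : ↥E) : Prop :=
  (e : Sym2 V) ∈ D ∧ ∃ y ∈ (e : Sym2 V), y ∈ ringReach k D F ω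

lemma forced_of_done {Λ : Finset V} {k n : ℕ} (hk : 1 ≤ k) (hkn : k ≤ n) (F : Finset ↥(dualEdges Λ)) (ξ ω : ↥(dualEdges Λ) → Bool)
    (hd : ∀ e, e ∉ F → ¬ ringQuery k (dualEdges (boxAt 0 n)) F ξ e) (h : agreeOn F ξ ω)
    (hf : ξ ∈ forced (dualEdges Λ) (boxAt 0 n) 0) : ω ∈ forced (dualEdges Λ) (boxAt 0 n) 0 := by
  classical
  set D := dualEdges (boxAt 0 n)
  set C := ringReach k D F ξ with hC
  have hcl : ∀ (e : ↥(dualEdges Λ)) (x y : V), (e : Sym2 V) = s(x, y) → s(x, y) ∈ D → x ∈ C → e ∈ F := by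
    intro e x y hxy hD hx
    by_contra hF
    exact hd e hF ⟨hxy ▸ hD, x, by grind, hx⟩
  have h0 : (0 : V) ∈ C := by
    by_contra h0
    have := hf (fun x => if nrm x < k ∧ x ∉ C then false else true) ?_ ?_
    · simp_all [nrm]
    · grind [mem_boxAt_zero]
    · have main : ∀ (e : ↥(dualEdges Λ)) (x y : V), (e : Sym2 V) = s(x, y) → ξ e = true → nrm x < k ∧ x ∉ C → nrm y < k ∧ y ∉ C := by
        rintro e x y hxy ho ⟨h1, h2⟩
        have hD : s(x, y) ∈ D := by
          refine mem_dualEdges_of_mem (hxy ▸ e.2) (x := x) ?_ (by simp)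
          rw [mem_boxAt_zero]; omega
        have hy : y ∉ C := fun hy => h2 (ringReach_step hy (hcl e y x (by grind) (by grind) hy) (by grind) (by grind) ho)
        have := nrm_edge hD
        grind [ringReach_ring]
      rintro ⟨e, he⟩ ho
      induction e using Sym2.ind with
      | _ x y =>
        rw [agreeAt_mk]
        grind
  intro τ hτ hc
  have := hf (fun x => if x ∈ C then τ x else true) ?_ ?_
  · grind
  · grind
  · have main : ∀ (e : ↥(dualEdges Λ)) (x y : V), (e : Sym2 V) = s(x, y) → ξ e = true → x ∈ C → y ∉ C → τ x = true := by
      intro e x y hxy ho hx hy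
      grind [ringReach_step, dualEdges_off]
    rintro ⟨e, he⟩ ho
    induction e using Sym2.ind with
    | _ x y =>
      rw [agreeAt_mk]
      by_cases hx : x ∈ C <;> by_cases hy : y ∈ C
      · rw [if_pos hx, if_pos hy]
        by_cases hD : s(x, y) ∈ D
        · have hF := hcl ⟨_, he⟩ x y rfl hD hx
          exact hc ⟨_, he⟩ (by rw [h _ hF]; exact ho)
        grind [dualEdges_off]
      · grind
      · grind
      grind

lemma ringReach_agree {k : ℕ} {D : Finset (Sym2 V)} {F : Finset ↥E} {ξ ω : ↥E → Bool}
    (h : agreeOn F ξ ω) : ringReach k D F ξ = ringReach k D F ω :=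
  (ringReach_mono subset_rfl h).antisymm (ringReach_mono subset_rfl fun e he => (h e he).symm)

lemma forced_iff_of_done {Λ : Finset V} {k n : ℕ} (hk : 1 ≤ k) (hkn : k ≤ n) (F : Finset ↥(dualEdges Λ)) (ξ ω : ↥(dualEdges Λ) → Bool)
    (hd : ∀ e, e ∉ F → ¬ ringQuery k (dualEdges (boxAt 0 n)) F ξ e) (h : agreeOn F ξ ω) :
    ω ∈ forced (dualEdges Λ) (boxAt 0 n) 0 ↔ ξ ∈ forced (dualEdges Λ) (boxAt 0 n) 0 := by
  refine ⟨forced_of_done hk hkn F ω ξ ?_ fun e he => (h e he).symm, forced_of_done hk hkn F ξ ω hd h⟩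
  grind [ringQuery, ringReach_agree]

/-- Reaching a site at distance `d + 1` from the ring forces it from the box of radius `d`. -/
lemma ringReach_subset_forced {k d : ℕ} {D : Finset (Sym2 V)} {F : Finset ↥E} {ω : ↥E → Bool} {y : V}
    (hd : nrm y + d + 1 ≤ k ∨ k + d + 1 ≤ nrm y) (h : y ∈ ringReach k D F ω) :
    ω ∈ forced E (boxAt y d) y := by
  intro τ h1 h2
  obtain ⟨x, hx, hxy⟩ := h
  have hτx : τ x = true := by
    apply h1
    rw [mem_boxAt_iff]
    simp [nrm] at *
    omega
  clear hd h1 hx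
  induction hxy with
  | refl => exact hτx
  | tail _ hbc ih =>
    obtain ⟨e, -, he, -, ho⟩ := hbc
    have := h2 e ho
    grind [agreeAt_mk]

end Exploration

theorem osss' {E : Type} [Fintype E] [DecidableEq E] {w : 𝓕 E} (hw : LatWeight w) {f : 𝓕 E} (hf : Monotone f)
    (h0 : ∀ ω, 0 ≤ f ω) (h1 : ∀ ω, f ω ≤ 1) (A : E → Set (E → Bool))
    (Q : Finset E → (E → Bool) → E → Prop)
    (hQ : ∀ F ξ e, e ∉ F → Q F ξ e → ∀ ω, agreeOn F ξ ω → ω ∈ A e)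
    (hdet : ∀ F ξ, (∀ e, e ∉ F → ¬ Q F ξ e) → ∀ ω, agreeOn F ξ ω → f ω = f ξ) :
    wEx w (fun ω => f ω ^ 2) - wEx w f ^ 2 ≤
      ∑ x, wEx w ((A x).indicator 1) * wCov w f (cInd x) := by
  convert osss hw hf h0 h1 A Q hQ hdet

lemma wCov_coord_nonneg' {E : Type} [Fintype E] [DecidableEq E] {w : 𝓕 E} (hw : LatWeight w)
    {f : 𝓕 E} (hf : Monotone f) (e : E) : 0 ≤ wCov w f (cInd e) :=
  sub_nonneg.2 (wEx_fkg' hw hf (cInd_mono e))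

/-- The inverse temperature with `exp s = exp (2 β) - 1`. -/
def betaOf (s : ℝ) : ℝ := log (1 + exp s) / 2

lemma exp_betaOf (s : ℝ) : exp s = exp (2 * betaOf s) - 1 := by
  rw [betaOf, mul_div_cancel₀ _ two_ne_zero, exp_log (by positivity)]; ring

lemma betaOf_nonneg (s : ℝ) : 0 ≤ betaOf s := div_nonneg (Real.log_nonneg (by linarith [exp_pos s])) zero_le_two

lemma betaOf_log {β : ℝ} (hβ : 0 < β) : betaOf (log (exp (2 * β) - 1)) = β := by
  grind [Real.one_lt_exp_iff, betaOf, exp_log, Real.log_exp]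

/-- Finite-volume connection probability in the random-cluster representation. -/
def fkTheta (n : ℕ) (s : ℝ) : ℝ := wEx (fkW (E := dualEdges (boxAt 0 (2 * n))) (boxAt 0 (2 * n)) s)
    ((forced (dualEdges (boxAt 0 (2 * n))) (boxAt 0 n) 0).indicator 1)

lemma zero_mem_boxAt (n : ℕ) : (0 : V) ∈ boxAt 0 n := by simp [mem_boxAt_zero, nrm]

lemma fkTheta_le_mag (n : ℕ) (s : ℝ) : fkTheta n s ≤ mag (betaOf s) n :=
  wEx_forced_le (boxAt_mono 0 (by omega)) (exp_betaOf s) (zero_mem_boxAt n)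

lemma mag_le_fkTheta (n : ℕ) (s : ℝ) : mag (betaOf s) (2 * n) ≤ fkTheta n s :=
  le_wEx_forced (boxAt_mono 0 (by omega)) (exp_betaOf s) (zero_mem_boxAt n)

lemma fkTheta_nonneg (n : ℕ) (s : ℝ) : 0 ≤ fkTheta n s := (mag_nonneg (betaOf_nonneg s) _).trans (mag_le_fkTheta n s)

lemma fkTheta_le_one (n : ℕ) (s : ℝ) : fkTheta n s ≤ 1 := (fkTheta_le_mag n s).trans (mag_le_one _ _)

def fkTheta' (n : ℕ) (s : ℝ) : ℝ := wCov (fkW (E := dualEdges (boxAt 0 (2 * n))) (boxAt 0 (2 * n)) s)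
    ((forced (dualEdges (boxAt 0 (2 * n))) (boxAt 0 n) 0).indicator 1) nOpen

lemma hasDerivAt_fkTheta (n : ℕ) (s : ℝ) : HasDerivAt (fkTheta n) (fkTheta' n s) s :=
  hasDerivAt_wEx_tilt (v := fun ω => ((cols (boxAt 0 (2 * n)) ω).card : ℝ))
    (fun ω => by exact_mod_cast (cols_nonempty _ ω).card_pos) nOpen _ s

lemma wCov_nOpen {E : Finset (Sym2 V)} {w : 𝓕 ↥E} (f : 𝓕 ↥E) : wCov w f nOpen = ∑ e, wCov w f (cInd e) := by
  have h1 : f * nOpen = fun ω => ∑ e, (f * (cInd e : 𝓕 ↥E)) ω := by ext ω; simp [nOpen, mul_sum]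
  have h2 : (nOpen : 𝓕 ↥E) = fun ω => ∑ e, cInd e ω := rfl
  unfold wCov
  rw [h1, wEx_sum, h2, wEx_sum, mul_sum, sum_sub_distrib]

lemma fkTheta'_nonneg (n : ℕ) (s : ℝ) : 0 ≤ fkTheta' n s := by
  grind [fkTheta', wCov_nOpen, sum_nonneg, wCov_coord_nonneg', fkW_latticeWeight, indicator_forced_monotone]

lemma fkTheta_mono (n : ℕ) : Monotone (fkTheta n) :=
  monotone_of_deriv_nonneg (fun s => (hasDerivAt_fkTheta n s).differentiableAt) fun s => by
    rw [(hasDerivAt_fkTheta n s).deriv]; exact fkTheta'_nonneg n s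

lemma sum_range_mag_le (n : ℕ) (s : ℝ) : ∑ r ∈ range n, mag (betaOf s) r ≤ 2 * ∑ r ∈ range n, fkTheta r s := by
  have hm := mag_antitone (betaOf_nonneg s)
  have h1 : ∑ r ∈ range n, mag (betaOf s) r ≤ ∑ r ∈ range (2 * n), mag (betaOf s) r :=
    Finset.sum_le_sum_of_subset_of_nonneg (Finset.range_subset_range.2 (by omega))
      fun r _ _ => mag_nonneg (betaOf_nonneg s) r
  have h2 : ∀ m, ∑ r ∈ range (2 * m), mag (betaOf s) r ≤ 2 * ∑ r ∈ range m, mag (betaOf s) (2 * r) := by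
    intro m
    induction m with
    | zero => simp
    | succ m ih =>
      rw [mul_add, mul_one, sum_range_succ, sum_range_succ, sum_range_succ]
      have := hm (show 2 * m ≤ 2 * m + 1 by omega)
      linarith
  have h3 : ∑ r ∈ range n, mag (betaOf s) (2 * r) ≤ ∑ r ∈ range n, fkTheta r s := sum_le_sum fun r _ => mag_le_fkTheta r s
  grind

/-- Sum over the rings of the one-arm probabilities. -/
lemma sum_ring_le {q : ℕ → ℝ} (hq : ∀ d, 0 ≤ q d) (n j : ℕ) (hj : j ≤ n + 1) :
    ∑ k ∈ Icc 1 n, q (max (j - k) (k - j)) ≤ 2 * ∑ d ∈ range (n + 1), q d := by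
  have h1 : ∑ k ∈ (Icc 1 n).filter (· ≤ j), q (max (j - k) (k - j)) ≤ ∑ d ∈ range (n + 1), q d := by
    rw [← sum_image (f := q) (g := fun k => max (j - k) (k - j))]
    · grind [Finset.sum_le_sum_of_subset_of_nonneg]
    · intro a ha b hb hab
      grind
  have h2 : ∑ k ∈ (Icc 1 n).filter (¬ · ≤ j), q (max (j - k) (k - j)) ≤ ∑ d ∈ range (n + 1), q d := by
    rw [← sum_image (f := q) (g := fun k => max (j - k) (k - j))]
    · grind [Finset.sum_le_sum_of_subset_of_nonneg]
    · intro a ha b hb hab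
      grind
  grind [Finset.sum_filter_add_sum_filter_not]

lemma nrm_le_add (z y : V) : nrm z ≤ nrm (z - y) + nrm y := by grind [nrm, fst_sub, snd_sub]

lemma wEx_ringReach_le {n k : ℕ} (hk : 1 ≤ k) (hkn : k ≤ n) (hn : 1 ≤ n) (s : ℝ) {y : V} (hy : nrm y ≤ n + 1) :
    wEx (fkW (E := dualEdges (boxAt 0 (2 * n))) (boxAt 0 (2 * n)) s)
      ({ω | y ∈ ringReach k (dualEdges (boxAt 0 n)) univ ω}.indicator 1) ≤
      (fun d => if d = 0 then 1 else mag (betaOf s) (d - 1)) (max (nrm y - k) (k - nrm y)) := by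
  beta_reduce
  split_ifs with h
  · rw [← wEx_const (fkW_pos (E := dualEdges (boxAt 0 (2 * n))) (boxAt 0 (2 * n)) s) (1 : ℝ)]
    exact wEx_mono (fkW_pos _ _) fun ω => Set.indicator_le_self' (fun _ _ => zero_le_one) ω
  · set d := max (nrm y - k) (k - nrm y) - 1 with hd
    have hsub : boxAt y d ⊆ boxAt 0 (2 * n) := by
      intro z hz
      rw [mem_boxAt_iff] at hz
      rw [mem_boxAt_zero]
      have := nrm_le_add z y
      omega
    have h1 := wEx_forced_le hsub (exp_betaOf s) (x := y) (by simp [mem_boxAt_iff, nrm])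
    rw [PiOp_boxAt_spin] at h1
    refine (wEx_mono (fkW_pos _ _) fun ω => ?_).trans h1
    refine Set.indicator_le_indicator_of_subset (fun ω hω => ?_) (fun _ => zero_le_one) ω
    exact ringReach_subset_forced (by omega) hω

lemma fkTheta_ineq {n : ℕ} (hn : 1 ≤ n) (s : ℝ) :
    n * (fkTheta n s * (1 - fkTheta n s)) ≤ 8 * (1 + ∑ r ∈ range n, fkTheta r s) * fkTheta' n s := by
  classical
  set E := dualEdges (boxAt 0 (2 * n)) with hE
  set w := fkW (E := E) (boxAt 0 (2 * n)) s with hw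
  set f : 𝓕 ↥E := (forced E (boxAt 0 n) 0).indicator 1 with hf
  set D := dualEdges (boxAt 0 n) with hD
  have hlw : LatWeight w := fkW_latticeWeight _ _
  have hfm : Monotone f := indicator_forced_monotone _ _
  have hf01 : ∀ ω, f ω = 0 ∨ f ω = 1 := fun ω => by
    by_cases h : ω ∈ forced E (boxAt 0 n) 0
    · simp_all
    simp_all
  have hsq : (fun ω => f ω ^ 2) = f := by grind
  let A : ℕ → ↥E → Set (↥E → Bool) := fun k e => {ω | ringQuery k D univ ω e}
  have key : ∀ k ∈ Icc 1 n, wEx w f * (1 - wEx w f) ≤ ∑ e, wEx w ((A k e).indicator 1) * wCov w f (cInd e) := by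
    intro k hk
    rw [mem_Icc] at hk
    have := osss' hlw hfm (fun ω => by grind) (fun ω => by grind) (A k) (fun F ξ e => ringQuery k D F ξ e)
      (fun F ξ e _ hq ω hω => ⟨hq.1, hq.2.imp fun y hy => ⟨hy.1, ringReach_mono (Finset.subset_univ _) hω hy.2⟩⟩)
      (fun F ξ hd ω hω => by
        have := forced_iff_of_done hk.1 hk.2 F ξ ω hd hω
        by_cases h : ξ ∈ forced E (boxAt 0 n) 0
        · rw [hf, indicator_of_mem h, indicator_of_mem (this.2 h)]; rfl
        · rw [hf, Set.indicator_of_notMem h, Set.indicator_of_notMem (fun h' => h (this.1 h'))])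
    grind
  let q : ℕ → ℝ := fun d => if d = 0 then 1 else mag (betaOf s) (d - 1)
  have hq : ∀ d, 0 ≤ q d := fun d => by grind [mag_nonneg, betaOf_nonneg]
  have hqs : ∑ d ∈ range (n + 1), q d ≤ 2 * (1 + ∑ r ∈ range n, fkTheta r s) := by
    rw [Finset.sum_range_succ']
    grind [sum_range_mag_le]
  have hA : ∀ e : ↥E, ∑ k ∈ Icc 1 n, wEx w ((A k e).indicator 1) ≤ 8 * (1 + ∑ r ∈ range n, fkTheta r s) := by
    have hS : 0 ≤ ∑ r ∈ range n, fkTheta r s := sum_nonneg fun r _ => fkTheta_nonneg r s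
    rintro ⟨e, he⟩
    by_cases heD : e ∈ D
    · induction e using Sym2.ind with
      | _ x y =>
        obtain ⟨z, hz, i, hzi⟩ := mem_dualEdges.1 heD
        have hnorm : nrm x ≤ n + 1 ∧ nrm y ≤ n + 1 := by
          rw [mem_boxAt_zero] at hz
          grind [nrm_add_dir]
        have hb : ∀ k ∈ Icc 1 n, wEx w ((A k ⟨s(x, y), he⟩).indicator 1) ≤
            q (max (nrm x - k) (k - nrm x)) + q (max (nrm y - k) (k - nrm y)) := by
          intro k hk
          rw [mem_Icc] at hk
          refine le_trans ?_ (add_le_add (wEx_ringReach_le hk.1 hk.2 hn s hnorm.1) (wEx_ringReach_le hk.1 hk.2 hn s hnorm.2))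
          rw [← wEx_add]
          refine wEx_mono (fkW_pos _ _) fun ω => ?_
          by_cases h : ω ∈ A k ⟨s(x, y), he⟩
          · rw [indicator_of_mem h]
            obtain ⟨-, u, hu, hr⟩ := h
            have hv : {ω : ↥E → Bool | u ∈ ringReach k D univ ω}.indicator (1 : 𝓕 ↥E) ω = 1 := indicator_of_mem (by exact hr) 1
            rcases Sym2.mem_iff.1 hu with rfl | rfl
            · rw [Pi.add_apply, hv]
              simp_all [Set.indicator_nonneg]
            · rw [Pi.add_apply, add_comm, hv]
              simp_all [Set.indicator_nonneg]
          simp_all [add_nonneg, Set.indicator_nonneg]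
        refine (sum_le_sum hb).trans ?_
        rw [sum_add_distrib]
        linarith [sum_ring_le hq n _ hnorm.1, sum_ring_le hq n _ hnorm.2]
    · have : ∀ k, A k ⟨e, he⟩ = ∅ := fun k => by ext ω; simp [A, ringQuery, heD]
      simp_rw [this]
      have h0 : wEx w ((∅ : Set (↥E → Bool)).indicator 1) = 0 := by simp_all [wEx_const, fkW_pos]
      grind [Finset.sum_const_zero]
  have hsum := sum_le_sum key
  rw [sum_const, Nat.card_Icc, Nat.add_sub_cancel, nsmul_eq_mul, sum_comm] at hsum
  refine hsum.trans ?_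
  rw [fkTheta', wCov_nOpen, mul_sum]
  refine sum_le_sum fun e _ => ?_
  rw [← sum_mul]
  exact mul_le_mul_of_nonneg_right (hA e) (wCov_coord_nonneg' hlw hfm e)

/-- Sharpness: decay of the magnetisation below a point of vanishing magnetisation. -/
theorem mag_decay {β₀ β₁ : ℝ} (h0 : 0 < β₀) (h1 : β₀ < β₁) (hm : Tendsto (mag β₁) atTop (𝓝 0)) :
    ∃ K δ : ℝ, 0 < δ ∧ ∀ n : ℕ, mag β₀ (2 * n) ≤ K * exp (-δ * sqrt n) := by
  set a := log (exp (2 * β₀) - 1) with ha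
  set b := log (exp (2 * β₁) - 1) with hb
  have hab : a < b := by simp_all [Real.log_lt_log]
  have hba : betaOf a = β₀ := betaOf_log h0
  have hbb : betaOf b = β₁ := betaOf_log (h0.trans h1)
  have hb0 : Tendsto (fun n => fkTheta n b) atTop (𝓝 0) :=
    squeeze_zero (fun n => fkTheta_nonneg n b) (fun n => by grind [fkTheta_le_mag]) hm
  obtain ⟨n₀, hn₀⟩ := eventually_atTop.1 (hb0.eventually (gt_mem_nhds (show (0 : ℝ) < 1 / 2 by norm_num)))
  have hineq : ∀ n, max n₀ 1 ≤ n → ∀ s ∈ Set.Icc a b,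
      (1 / 16 * (n : ℝ) / (1 + ∑ r ∈ range n, fkTheta r s) - 0) * fkTheta n s ≤ fkTheta' n s := by
    intro n hn s hs
    have hn1 : 1 ≤ n := (le_max_right _ _).trans hn
    have hhalf : fkTheta n s ≤ 1 / 2 := (fkTheta_mono n hs.2).trans (hn₀ n ((le_max_left _ _).trans hn)).le
    have key := fkTheta_ineq hn1 s
    have hS : 0 ≤ ∑ r ∈ range n, fkTheta r s := sum_nonneg fun r _ => fkTheta_nonneg r s
    have hp := fkTheta_nonneg n s
    have h3 : (n : ℝ) * (fkTheta n s * (1 / 2)) ≤ n * (fkTheta n s * (1 - fkTheta n s)) :=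
      mul_le_mul_of_nonneg_left (mul_le_mul_of_nonneg_left (by linarith) hp) (cast_nonneg n)
    rw [sub_zero, div_mul_eq_mul_div, div_le_iff₀ (by linarith)]
    linarith
  obtain ⟨K, δ, hδ, h⟩ := decay_of_diff_ineq fkTheta fkTheta' (c := 1 / 16) (C := 0) (n₀ := max n₀ 1) hab
    (by norm_num) le_rfl hasDerivAt_fkTheta fkTheta_nonneg fkTheta_le_one fkTheta_mono hineq hb0
  refine ⟨K, δ, hδ, fun n => (h n).trans' ?_⟩
  grind [mag_le_fkTheta]

/-- Monotonicity of the plus magnetisation in the inverse temperature. -/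
lemma PiOp_spin_mono_beta {β β' : ℝ} (h0 : 0 < β) (h : β ≤ β') (B : Finset V) {x : V} (hx : x ∈ B) :
    PiOp β B (fun τ => spinVal (τ x)) ⊤ ≤ PiOp β' B (fun τ => spinVal (τ x)) ⊤ := by
  have hd : ∀ s, HasDerivAt (fun s => wEx (fkW (E := dualEdges B) B s) ((forced (dualEdges B) B x).indicator 1))
      (wCov (fkW (E := dualEdges B) B s) ((forced (dualEdges B) B x).indicator 1) nOpen) s := fun s =>
    hasDerivAt_wEx_tilt (v := fun ω => ((cols B ω).card : ℝ))
      (fun ω => by simp_all [cols_nonempty]) nOpen _ s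
  have hm : Monotone (fun s => wEx (fkW (E := dualEdges B) B s) ((forced (dualEdges B) B x).indicator 1)) :=
    monotone_of_deriv_nonneg (fun s => (hd s).differentiableAt) fun s => by
      rw [(hd s).deriv, wCov_nOpen]
      grind [sum_nonneg, wCov_coord_nonneg', fkW_latticeWeight, indicator_forced_monotone]
  have e1 : 1 < exp (2 * β) := Real.one_lt_exp_iff.2 (by linarith)
  have e2 : exp (2 * β) ≤ exp (2 * β') := exp_le_exp.2 (by linarith)
  have hs : log (exp (2 * β) - 1) ≤ log (exp (2 * β') - 1) := log_le_log (by linarith) (by linarith)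
  have := hm hs
  grind [wEx_forced_dualEdges, exp_log]

lemma mag_mono_beta {β β' : ℝ} (h0 : 0 < β) (h : β ≤ β') (n : ℕ) : mag β n ≤ mag β' n := PiOp_spin_mono_beta h0 h _ (zero_mem_boxAt n)

lemma tendsto_mul_mag {β₀ β₁ : ℝ} (h0 : 0 < β₀) (h1 : β₀ < β₁) (hm : Tendsto (mag β₁) atTop (𝓝 0)) :
    Tendsto (fun n : ℕ => (n : ℝ) * mag β₀ n) atTop (𝓝 0) := by
  obtain ⟨K, δ, hδ, h⟩ := mag_decay h0 h1 hm
  have hK : 0 ≤ K := by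
    have := (mag_nonneg h0.le _).trans (h 0)
    simp_all
  have hb : ∀ n : ℕ, (n : ℝ) * mag β₀ n ≤ (3 * K) * (((n / 2 : ℕ) : ℝ) * exp (-δ * sqrt ((n / 2 : ℕ) : ℝ))) +
      K * exp (-δ * sqrt ((n / 2 : ℕ) : ℝ)) := by
    intro n
    have h2 : mag β₀ n ≤ K * exp (-δ * sqrt ((n / 2 : ℕ) : ℝ)) := (mag_antitone h0.le (by omega : 2 * (n / 2) ≤ n)).trans (h (n / 2))
    have h3 : (n : ℝ) ≤ 2 * ((n / 2 : ℕ) : ℝ) + 1 := by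
      have : n ≤ 2 * (n / 2) + 1 := by omega
      exact_mod_cast this
    have h5 : 0 ≤ K * exp (-δ * sqrt ((n / 2 : ℕ) : ℝ)) := by positivity
    calc (n : ℝ) * mag β₀ n ≤ (2 * ((n / 2 : ℕ) : ℝ) + 1) * (K * exp (-δ * sqrt ((n / 2 : ℕ) : ℝ))) :=
          mul_le_mul h3 h2 (mag_nonneg h0.le _) (by positivity)
      _ ≤ _ := by nlinarith
  have hsq : Tendsto (fun m : ℕ => sqrt (m : ℝ)) atTop atTop := Real.tendsto_sqrt_atTop.comp tendsto_natCast_atTop_atTop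
  have t1 : Tendsto (fun m : ℕ => (m : ℝ) * exp (-δ * sqrt (m : ℝ))) atTop (𝓝 0) := by
    have := ((Real.tendsto_pow_mul_exp_neg_atTop_nhds_zero 2).comp (hsq.const_mul_atTop hδ)).const_mul (1 / δ ^ 2)
    grind
  have t2 : Tendsto (fun m : ℕ => exp (-δ * sqrt (m : ℝ))) atTop (𝓝 0) := by
    have := Real.tendsto_exp_neg_atTop_nhds_zero.comp (hsq.const_mul_atTop hδ)
    refine this.congr fun m => ?_
    grind
  have hdiv : Tendsto (fun n : ℕ => n / 2) atTop atTop := Nat.tendsto_div_const_atTop two_ne_zero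
  have := ((t1.comp hdiv).const_mul (3 * K)).add ((t2.comp hdiv).const_mul K)
  grind [squeeze_zero, mul_nonneg, mag_nonneg]

def bstep (b : Bool) : V := if b then (1, 0) else (0, 1)

def btgt (p : V × Bool) : V := p.1 + bstep p.2

def bonds (Λ : Finset V) : Finset (V × Bool) := (Λ ×ˢ univ) ∪ (Λ ×ˢ univ).image fun q => (q.1 - bstep q.2, q.2)

lemma mem_bonds {Λ : Finset V} {p : V × Bool} : p ∈ bonds Λ ↔ p.1 ∈ Λ ∨ btgt p ∈ Λ := by
  unfold bonds btgt
  simp only [Finset.mem_union, mem_product, mem_univ, and_true, mem_image]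
  refine or_congr Iff.rfl ⟨?_, fun h => ⟨(p.1 + bstep p.2, p.2), h, ?_⟩⟩
  · rintro ⟨⟨x, b⟩, hx, rfl⟩
    simpa using hx
  · simp

def bondSum (B : Finset (V × Bool)) (σ : Ω) : ℝ := ∑ p ∈ B, spinVal (σ p.1) * spinVal (σ (btgt p))

lemma bstep_add_ne_zero (b c : Bool) : bstep b + bstep c ≠ 0 := by
  cases b <;> cases c <;> simp [bstep]

lemma bstep_injective {b c : Bool} (h : bstep b = bstep c) : b = c := by grind [bstep]

lemma bond_edge_injective : Function.Injective fun p : V × Bool => s(p.1, btgt p) := by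
  rintro ⟨x, b⟩ ⟨y, c⟩ h
  simp [btgt] at h
  rcases h with ⟨rfl, h⟩ | ⟨h1, h2⟩
  · rw [bstep_injective (add_left_cancel h)]
  grind [bstep_add_ne_zero]

lemma dualEdges_eq_image (Λ : Finset V) : dualEdges Λ = (bonds Λ).image fun p => s(p.1, btgt p) := by
  ext e
  rw [mem_dualEdges, mem_image]
  constructor
  · rintro ⟨x, hx, i, rfl⟩
    fin_cases i
    · exact ⟨(x, true), mem_bonds.2 (.inl hx), rfl⟩
    · refine ⟨(x + (-1, 0), true), mem_bonds.2 (.inr ?_), ?_⟩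
      · have e : x + ((-1, 0) : V) + (1, 0) = x := by rw [add_assoc]; simp
        simp_all [btgt, bstep]
      simp [btgt, bstep, add_assoc, dir]
    · exact ⟨(x, false), mem_bonds.2 (.inl hx), rfl⟩
    · refine ⟨(x + (0, -1), false), mem_bonds.2 (.inr ?_), ?_⟩
      · have e : x + ((0, -1) : V) + (0, 1) = x := by rw [add_assoc]; simp
        simp_all [btgt, bstep]
      simp [btgt, bstep, add_assoc, dir]
  · rintro ⟨⟨x, b⟩, hp, rfl⟩
    rcases mem_bonds.1 hp with h | h
    · cases b
      · exact ⟨x, h, 2, rfl⟩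
      · exact ⟨x, h, 0, rfl⟩
    · refine ⟨_, h, if b then 1 else 3, ?_⟩
      cases b <;> simp [btgt, bstep, add_assoc, dir]

lemma hamiltonian_eq_bondSum (Λ : Finset V) (σ : Ω) : hamiltonian Λ σ = -bondSum (bonds Λ) σ := by
  unfold hamiltonian bondSum
  rw [dualEdges_eq_image, sum_image fun _ _ _ _ h => bond_edge_injective h]
  rfl

lemma exp_mul_of_sq {M : ℝ} (hM : M = 1 ∨ M = -1) (β : ℝ) : exp (β * M) = cosh β * (1 + tanh β * M) := by
  grind [Real.cosh_pos, Real.tanh_eq_sinh_div_cosh, Real.cosh_add_sinh, Real.cosh_sub_sinh]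

lemma spinVal_eq (b : Bool) : spinVal b = 1 ∨ spinVal b = -1 := by grind [spinVal]

lemma prod_sign {ι : Type} (s : Finset ι) (f : ι → ℝ) (h : ∀ i ∈ s, f i = 1 ∨ f i = -1) : ∏ i ∈ s, f i = 1 ∨ ∏ i ∈ s, f i = -1 := by
  classical
  induction s using induction_on with
  | empty => simp
  | insert a s ha ih => grind

theorem high_temp {ι κ : Type} [Fintype ι] [DecidableEq ι] [DecidableEq κ] (B : Finset κ) (k : κ → ι → ℕ) (k0 : ι → ℕ) (β : ℝ) :
    ∑ ω : ι → Bool, (∏ z, spinVal (ω z) ^ k0 z) * exp (∑ p ∈ B, β * ∏ z, spinVal (ω z) ^ k p z) =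
      cosh β ^ B.card * 2 ^ card ι *
        ∑ F ∈ B.powerset.filter (fun F => ∀ z, Even (k0 z + ∑ p ∈ F, k p z)), tanh β ^ F.card := by
  have h1 : ∀ ω : ι → Bool, (∏ z, spinVal (ω z) ^ k0 z) * exp (∑ p ∈ B, β * ∏ z, spinVal (ω z) ^ k p z) =
      ∑ F ∈ B.powerset, cosh β ^ B.card * tanh β ^ F.card *
        ∏ z, spinVal (ω z) ^ (k0 z + ∑ p ∈ F, k p z) := by
    intro ω
    rw [exp_sum]
    have : ∀ p ∈ B, exp (β * ∏ z, spinVal (ω z) ^ k p z) = cosh β * (1 + tanh β * ∏ z, spinVal (ω z) ^ k p z) := fun p _ =>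
      exp_mul_of_sq (prod_sign _ _ fun z _ => by
        rcases spinVal_eq (ω z) with h | h <;> rw [h]
        · simp
        grind [neg_one_pow_eq_or]) β
    rw [prod_congr rfl this, prod_mul_distrib, prod_const, Finset.prod_one_add, mul_sum, mul_sum]
    refine sum_congr rfl fun F _ => ?_
    rw [prod_mul_distrib, prod_const, Finset.prod_comm]
    simp [pow_add, prod_mul_distrib, Finset.prod_pow_eq_pow_sum]
    ring
  rw [sum_congr rfl fun ω _ => h1 ω, sum_comm, sum_filter, mul_sum]
  refine sum_congr rfl fun F _ => ?_
  rw [← mul_sum, sum_prod_pi fun z s => spinVal s ^ (k0 z + ∑ p ∈ F, k p z)]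
  split_ifs with h
  · have : ∀ z ∈ (univ : Finset ι), ∑ s : Bool, spinVal s ^ (k0 z + ∑ p ∈ F, k p z) = 2 := fun z _ => by simp_all [spinVal]
    grind [prod_congr, prod_const, card_univ]
  · push Not at h
    obtain ⟨z, hz⟩ := h
    rw [Finset.prod_eq_zero (mem_univ z)]
    · simp
    simp_all [spinVal]

lemma sum_option_gauge {ι : Type} [Fintype ι] [DecidableEq ι] (G : (Option ι → Bool) → ℝ) (hG : ∀ ω, G (fun z => !ω z) = G ω) :
    ∑ ω, G ω = 2 * ∑ u : ι → Bool, G (fun z => z.elim true u) := by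
  have e : ∑ ω, G ω = ∑ q : Bool × (ι → Bool), G (fun z => z.elim q.1 q.2) := by
    refine sum_equiv (Equiv.piOptionEquivProd (β := fun _ => Bool)) _ _ fun ω => ?_
    congr 1
    ext z
    cases z <;> rfl
  have e2 : ∑ u : ι → Bool, G (fun z => z.elim false u) = ∑ u : ι → Bool, G (fun z => z.elim true u) := by
    refine sum_equiv (Equiv.piCongrRight fun _ : ι => boolNot) _ _ fun u => ?_
    rw [← hG]
    congr 1
    ext z
    cases z <;> rfl
  grind [sum_prod_type, sum_bool]

/-- The spin at a located site; sites without location carry the spin `+1`. -/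
def lSpin {ι : Type} (loc : V → Option ι) (ω : ι → Bool) (x : V) : ℝ := (loc x).elim 1 fun z => spinVal (ω z)

def locExp {ι : Type} [DecidableEq ι] (loc : V → Option ι) (x : V) (z : ι) : ℕ := if loc x = some z then 1 else 0

lemma lSpin_eq_prod {ι : Type} [Fintype ι] [DecidableEq ι] (loc : V → Option ι) (ω : ι → Bool) (x : V) :
    lSpin loc ω x = ∏ z, spinVal (ω z) ^ locExp loc x z := by
  unfold lSpin locExp
  cases h : loc x with
  | none => simp
  | some y => simp_all

lemma isChar_lSpin {ι : Type} [Fintype ι] [DecidableEq ι] (loc : V → Option ι) (x : V) :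
    IsChar fun ω : ι → Bool => lSpin loc ω x := ⟨locExp loc x, by grind [lSpin_eq_prod]⟩

/-- The two-point function of the free-end Ising system with bonds `B` and located sites. -/
def locCorr {ι : Type} [Fintype ι] [DecidableEq ι] (loc : V → Option ι) (β : ℝ) (B : Finset (V × Bool)) (s t : V) : ℝ :=
  wEx (fun ω : ι → Bool => exp (∑ p ∈ B, β * (lSpin loc ω p.1 * lSpin loc ω (btgt p))))
    fun ω => lSpin loc ω s * lSpin loc ω t

/-- The degree of a located site in a set of bonds, sources included. -/
def locDeg {ι : Type} [DecidableEq ι] (loc : V → Option ι) (s t : V) (F : Finset (V × Bool)) (z : ι) : ℕ :=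
  locExp loc s z + locExp loc t z + ∑ p ∈ F, (locExp loc p.1 z + locExp loc (btgt p) z)

theorem locCorr_eq {ι : Type} [Fintype ι] [DecidableEq ι] (loc : V → Option ι) (β : ℝ) (B : Finset (V × Bool)) (s t : V) :
    locCorr loc β B s t =
      (∑ F ∈ B.powerset.filter (fun F => ∀ z, Even (locDeg loc s t F z)), tanh β ^ F.card) /
        ∑ F ∈ B.powerset.filter (fun F => ∀ z, Even (∑ p ∈ F, (locExp loc p.1 z + locExp loc (btgt p) z))),
          tanh β ^ F.card := by
  have h1 := high_temp B (fun p z => locExp loc p.1 z + locExp loc (btgt p) z) (fun z => locExp loc s z + locExp loc t z) β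
  have h0 := high_temp B (fun p z => locExp loc p.1 z + locExp loc (btgt p) z) (fun _ => 0) β
  simp only [pow_add, prod_mul_distrib, ← lSpin_eq_prod] at h1 h0
  simp at h0
  have hC : cosh β ^ B.card * 2 ^ card ι ≠ 0 := by positivity
  unfold locCorr wEx locDeg
  grind

/-- Bonds of the strip with rows `0..n`, interior columns `1..n`; horizontal bonds start in columns `lo..hi`. -/
def sBonds (n : ℕ) (lo hi : ℤ) : Finset (V × Bool) := ((Icc lo hi ×ˢ Icc 0 (n : ℤ)) ×ˢ {true}) ∪
    ((Icc 1 (n : ℤ) ×ˢ Icc 0 ((n : ℤ) - 1)) ×ˢ {false})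

lemma mem_sBonds_true {n : ℕ} {lo hi i j : ℤ} : ((i, j), true) ∈ sBonds n lo hi ↔ (lo ≤ i ∧ i ≤ hi) ∧ 0 ≤ j ∧ j ≤ n := by simp [sBonds]

lemma mem_sBonds_false {n : ℕ} {lo hi i j : ℤ} : ((i, j), false) ∈ sBonds n lo hi ↔ (1 ≤ i ∧ i ≤ n) ∧ 0 ≤ j ∧ j ≤ (n : ℤ) - 1 := by
  simp [sBonds]

def bit (F : Finset (V × Bool)) (p : V × Bool) : ZMod 2 := if p ∈ F then 1 else 0

lemma two_eq_zero_zmod : (2 : ZMod 2) = 0 := rfl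

def zs (b : Bool) : ZMod 2 := if b then 0 else 1

lemma bit_eq_zero {F : Finset (V × Bool)} {p : V × Bool} (h : p ∉ F) : bit F p = 0 := if_neg h

lemma zs_add_zs (a b : Bool) : zs a + zs b = if a ≠ b then 1 else 0 := by cases a <;> cases b <;> decide

lemma zs_not_and_decide (e : Bool) (P : Prop) [Decidable P] : zs (!(e && decide P)) = if P then zs (!e) else 0 := by grind [zs]

/-- The bonds whose dual bond is unsatisfied. -/
def dualDiff (B : Finset (V × Bool)) (σ : Ω) : Finset (V × Bool) := B.filter fun p => σ p.1 ≠ σ (p.1 - bstep (!p.2))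

lemma dualDiff_subset (B : Finset (V × Bool)) (σ : Ω) : dualDiff B σ ⊆ B := Finset.filter_subset _ _

lemma bit_dualDiff {B : Finset (V × Bool)} {p : V × Bool} (h : p ∈ B) (σ : Ω) :
    bit (dualDiff B σ) p = zs (σ p.1) + zs (σ (p.1 - bstep (!p.2))) := by
  grind [zs_add_zs, bit, dualDiff]

def faces (n : ℕ) (δ : ℤ) : Finset V := Icc δ (n - δ) ×ˢ Icc 0 ((n : ℤ) - 1)

lemma mem_faces {n : ℕ} {δ i j : ℤ} : ((i, j) : V) ∈ faces n δ ↔ (δ ≤ i ∧ i ≤ n - δ) ∧ 0 ≤ j ∧ j ≤ (n : ℤ) - 1 := by simp [faces]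

def upperArc (n : ℕ) (δ a b : ℤ) (x : V) : Prop := if x.1 < δ then a ≤ x.2 else if n - δ < x.1 then b ≤ x.2 else n ≤ x.2

instance (n : ℕ) (δ a b : ℤ) (x : V) : Decidable (upperArc n δ a b x) := by unfold upperArc; infer_instance

/-- The boundary condition, `-` above the cut when `e = true`. -/
def cutBC (n : ℕ) (δ a b : ℤ) (e : Bool) : Ω := fun x => !(e && decide (upperArc n δ a b x))

/-- The faces coloured by `τ`, with the boundary condition `cutBC`. -/
notation:max "cut" n:max δ:max a:max b:max e:max τ:max => spatch (faces n δ) τ (cutBC n δ a b e)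

/-- The horizontal bond indicator including the two external half-bonds. -/
def hbit (n : ℕ) (δ a b : ℤ) (e : Bool) (F : Finset (V × Bool)) (x : V) : ZMod 2 :=
  bit F (x, true) + ((if x.1 < δ ∧ x.2 = a then zs (!e) else 0) + if n - δ < x.1 ∧ x.2 = b then zs (!e) else 0)

def srcCond (n : ℕ) (δ a b : ℤ) (e : Bool) (F : Finset (V × Bool)) : Prop := (∀ i j : ℤ, 1 ≤ i → i ≤ n → 0 ≤ j → j ≤ n →
    hbit n δ a b e F (i, j) + hbit n δ a b e F (i - 1, j) + bit F ((i, j), false) + bit F ((i, j - 1), false) = 0) ∧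
  ∑ k ∈ Icc 0 (n : ℤ), hbit n δ a b e F (0, k) = zs (!e)

/-- The height function of a bond set. -/
def height (n : ℕ) (δ a b : ℤ) (e : Bool) (F : Finset (V × Bool)) (x : V) : ZMod 2 := ∑ k ∈ Icc 0 x.2, hbit n δ a b e F (x.1, k)

lemma Icc_insert_right {j : ℤ} (h : 0 ≤ j) : Icc 0 j = insert j (Icc 0 (j - 1)) := by grind

section
variable {n : ℕ} {δ a b : ℤ} {e : Bool} {F : Finset (V × Bool)}

lemma height_step {i j : ℤ} (h : 0 ≤ j) : height n δ a b e F (i, j) = hbit n δ a b e F (i, j) + height n δ a b e F (i, j - 1) := by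
  grind [height, Icc_insert_right]

lemma height_neg {i j : ℤ} (h : j < 0) : height n δ a b e F (i, j) = 0 := by grind [height, Finset.Icc_eq_empty]

lemma height_of_telescope (g : ℤ → ZMod 2) (i : ℤ) (h0 : g (-1) = 0)
    (hg : ∀ j : ℤ, 0 ≤ j → j ≤ n → hbit n δ a b e F (i, j) = g j + g (j - 1)) :
    ∀ j : ℤ, -1 ≤ j → j ≤ n → height n δ a b e F (i, j) = g j := by
  intro j hj
  induction j, hj using leInduction with
  | base => intro _; rw [h0, height_neg (by norm_num)]
  | succ j hj ih =>
    intro hjn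
    rw [height_step (by omega), hg _ (by omega) hjn, add_sub_cancel_right, ih (by omega)]
    linear_combination (g j) * two_eq_zero_zmod

lemma height_hor (hC : srcCond n δ a b e F) (hF : F ⊆ sBonds n δ (n - δ)) {i : ℤ} (hi : 1 ≤ i) (hin : i ≤ n) :
    ∀ j : ℤ, -1 ≤ j → j ≤ n → height n δ a b e F (i, j) + height n δ a b e F (i - 1, j) = bit F ((i, j), false) := by
  intro j hj
  induction j, hj using leInduction with
  | base => grind [height_neg, bit_eq_zero, mem_sBonds_false]
  | succ j hj ih =>
    intro hjn
    have h1 := hC.1 i (j + 1) hi hin (by omega) hjn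
    rw [height_step (i := i) (j := j + 1) (by omega), height_step (i := i - 1) (j := j + 1) (by omega)]
    have h2 := ih (by omega)
    rw [add_sub_cancel_right] at h1 ⊢
    linear_combination h1 + h2 - (bit F ((i, j+1), false)) * two_eq_zero_zmod

lemma bit_top (hF : F ⊆ sBonds n δ (n - δ)) (i : ℤ) : bit F ((i, (n : ℤ)), false) = 0 := by grind [bit_eq_zero, mem_sBonds_false]

lemma height_top (hC : srcCond n δ a b e F) (hF : F ⊆ sBonds n δ (n - δ)) :
    ∀ i : ℤ, 0 ≤ i → i ≤ n → height n δ a b e F (i, n) = zs (!e) := by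
  intro i hi
  induction i, hi using leInduction with
  | base => intro _; exact hC.2
  | succ i hi ih =>
    intro hin
    have h1 := height_hor hC hF (i := i + 1) (by omega) hin n (by omega) le_rfl
    rw [bit_top hF, add_sub_cancel_right, ih (by omega)] at h1
    linear_combination h1 - (zs !e) * two_eq_zero_zmod

lemma hbit_inner {i j : ℤ} (h1 : δ ≤ i) (h2 : i ≤ n - δ) : hbit n δ a b e F (i, j) = bit F ((i, j), true) := by grind [hbit]

variable (hn : 2 ≤ n) (hδ : δ = 0 ∨ δ = 1) (ha : 0 ≤ a) (han : a ≤ n) (hb : 0 ≤ b) (hbn : b ≤ n)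

include hn hδ ha han hb hbn

lemma hbit_outer (hF : F ⊆ sBonds n δ (n - δ)) {i j : ℤ} (h : ¬(δ ≤ i ∧ i ≤ n - δ)) :
    hbit n δ a b e F (i, j) = zs (cutBC n δ a b e (i, j)) + zs (cutBC n δ a b e (i, j - 1)) := by
  have h0 : bit F ((i, j), true) = 0 := bit_eq_zero fun hm => h (mem_sBonds_true.1 (hF hm)).1
  unfold hbit cutBC
  rw [h0, zs_not_and_decide, zs_not_and_decide]
  simp [upperArc]
  grind

lemma cutBC_bot {i : ℤ} {j : ℤ} (hj : j < 0) : zs (cutBC n δ a b e (i, j)) = 0 := by grind [cutBC, zs_not_and_decide, upperArc]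

lemma cutBC_top (i : ℤ) : zs (cutBC n δ a b e (i, n)) = zs (!e) := by grind [cutBC, upperArc]

lemma dual_hbit (τ : ↥(faces n δ) → Bool) {i j : ℤ} (hj : 0 ≤ j) (hjn : j ≤ n) :
    hbit n δ a b e (dualDiff (sBonds n δ (n - δ)) (cut n δ a b e τ)) (i, j) =
      zs (cut n δ a b e τ (i, j)) +
        zs (cut n δ a b e τ (i, j - 1)) := by
  by_cases h : δ ≤ i ∧ i ≤ n - δ
  · simp_all [hbit_inner, bit_dualDiff, mem_sBonds_true, bstep]
  grind [hbit_outer, dualDiff_subset, spatch_notMem, mem_faces]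

lemma spatch_bot (τ : ↥(faces n δ) → Bool) {i j : ℤ} (hj : j < 0) : zs (cut n δ a b e τ (i, j)) = 0 := by
  grind [spatch_notMem, cutBC_bot, mem_faces]

lemma spatch_top (τ : ↥(faces n δ) → Bool) (i : ℤ) : zs (cut n δ a b e τ (i, n)) = zs (!e) := by
  grind [spatch_notMem, cutBC_top, mem_faces]

lemma dual_vbit (τ : ↥(faces n δ) → Bool) {i j : ℤ} (hi : 1 ≤ i) (hin : i ≤ n) (hj : -1 ≤ j) (hjn : j ≤ n) :
    bit (dualDiff (sBonds n δ (n - δ)) (cut n δ a b e τ)) ((i, j), false) =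
      zs (cut n δ a b e τ (i, j)) +
        zs (cut n δ a b e τ (i - 1, j)) := by
  by_cases h : 0 ≤ j ∧ j ≤ (n : ℤ) - 1
  · simp_all [bit_dualDiff, mem_sBonds_false, bstep]
  · grind [bit_eq_zero, mem_sBonds_false, dualDiff_subset, spatch_bot, spatch_top]

lemma height_dual (τ : ↥(faces n δ) → Bool) {i j : ℤ} (hj : -1 ≤ j) (hjn : j ≤ n) :
    height n δ a b e (dualDiff (sBonds n δ (n - δ)) (cut n δ a b e τ)) (i, j) =
      zs (cut n δ a b e τ (i, j)) :=
  height_of_telescope (fun j => zs (cut n δ a b e τ (i, j))) i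
    (spatch_bot hn hδ ha han hb hbn τ (by norm_num)) (fun _ h1 h2 => dual_hbit hn hδ ha han hb hbn τ h1 h2)
    j hj hjn

lemma srcCond_dualDiff (τ : ↥(faces n δ) → Bool) : srcCond n δ a b e (dualDiff (sBonds n δ (n - δ)) (cut n δ a b e τ)) := by
  constructor
  · intro i j h1 h2 h3 h4
    rw [dual_hbit hn hδ ha han hb hbn τ h3 h4, dual_hbit hn hδ ha han hb hbn τ h3 h4,
      dual_vbit hn hδ ha han hb hbn τ h1 h2 (by omega) h4,
      dual_vbit hn hδ ha han hb hbn τ h1 h2 (by omega) (by omega)]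
    generalize zs (cut n δ a b e τ (i, j)) = A
    generalize zs (cut n δ a b e τ (i - 1, j)) = B
    generalize zs (cut n δ a b e τ (i, j - 1)) = C
    generalize zs (cut n δ a b e τ (i - 1, j - 1)) = D
    linear_combination (A + B + C + D) * two_eq_zero_zmod
  · have := height_dual hn hδ ha han hb hbn (e := e) τ (i := 0) (j := n) (by omega) le_rfl
    rw [spatch_top hn hδ ha han hb hbn] at this
    exact this

lemma height_eq_zs (hF : F ⊆ sBonds n δ (n - δ)) (hC : srcCond n δ a b e F) {i j : ℤ} (hi : 0 ≤ i) (hin : i ≤ n)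
    (hj : -1 ≤ j) (hjn : j ≤ n) :
    zs (spatch (faces n δ) (fun x => decide (height n δ a b e F x = 0)) (cutBC n δ a b e) (i, j)) =
      height n δ a b e F (i, j) := by
  by_cases h : ((i, j) : V) ∈ faces n δ
  · rw [spatch_of_mem h]
    generalize height n δ a b e F (i, j) = A
    revert A; decide
  · rw [spatch_notMem h]
    rw [mem_faces] at h
    by_cases h' : δ ≤ i ∧ i ≤ n - δ
    · grind [height_neg, cutBC_bot, cutBC_top, height_top]
    · exact (height_of_telescope (fun j => zs (cutBC n δ a b e (i, j))) i (cutBC_bot hn hδ ha han hb hbn (by norm_num))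
        (fun _ _ _ => hbit_outer hn hδ ha han hb hbn hF h') j hj hjn).symm

lemma dualDiff_height (hF : F ⊆ sBonds n δ (n - δ)) (hC : srcCond n δ a b e F) : dualDiff (sBonds n δ (n - δ))
      (spatch (faces n δ) (fun x => decide (height n δ a b e F x = 0)) (cutBC n δ a b e)) = F := by
  have key : ∀ p ∈ sBonds n δ (n - δ), bit (dualDiff (sBonds n δ (n - δ))
      (spatch (faces n δ) (fun x => decide (height n δ a b e F x = 0)) (cutBC n δ a b e))) p = bit F p := by
    rintro ⟨⟨i, j⟩, c⟩ hp
    rw [bit_dualDiff hp]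
    cases c
    · have h := mem_sBonds_false.1 hp
      have e1 : ((i, j) : V) - bstep (!false) = (i - 1, j) := by simp [bstep]
      simp only [e1]
      rw [height_eq_zs hn hδ ha han hb hbn hF hC (by omega) (by omega) (by omega) (by omega),
        height_eq_zs hn hδ ha han hb hbn hF hC (by omega) (by omega) (by omega) (by omega),
        height_hor hC hF (by omega) (by omega) j (by omega) (by omega)]
    · have h := mem_sBonds_true.1 hp
      have e1 : ((i, j) : V) - bstep (!true) = (i, j - 1) := by simp [bstep]
      simp only [e1]
      rw [height_eq_zs hn hδ ha han hb hbn hF hC (by omega) (by omega) (by omega) (by omega),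
        height_eq_zs hn hδ ha han hb hbn hF hC (by omega) (by omega) (by omega) (by omega),
        height_step (by omega), hbit_inner h.1.1 h.1.2]
      linear_combination (height n δ a b e F (i, j - 1)) * two_eq_zero_zmod
  grind [bit, dualDiff_subset]

/-- Planar duality: bond sets with given sources are the contours of spin configurations on the faces. -/
theorem sum_srcCond_eq [DecidablePred (srcCond n δ a b e)] (x : ℝ) :
    ∑ F ∈ (sBonds n δ (n - δ)).powerset.filter (srcCond n δ a b e), x ^ F.card =
      ∑ τ : ↥(faces n δ) → Bool,
        x ^ (dualDiff (sBonds n δ (n - δ)) (cut n δ a b e τ)).card := by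
  symm
  refine Finset.sum_bij' (fun τ _ => dualDiff (sBonds n δ (n - δ)) (cut n δ a b e τ))
    (fun F _ => fun x => decide (height n δ a b e F x = 0)) ?_ ?_ ?_ ?_ ?_
  · grind [dualDiff_subset, srcCond_dualDiff]
  · grind
  · grind [mem_faces, height_dual, spatch_of_mem, zs]
  · grind [dualDiff_height]
  grind

end

def sSites (n : ℕ) : Finset V := Icc 1 (n : ℤ) ×ˢ Icc 0 (n : ℤ)

lemma mem_sSites {n : ℕ} {i j : ℤ} : ((i, j) : V) ∈ sSites n ↔ (1 ≤ i ∧ i ≤ n) ∧ 0 ≤ j ∧ j ≤ n := by simp [sSites]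

/-- The strip with a ghost spin on the left and the value `+` on the right. -/
def locS (n : ℕ) (W : Finset V) (x : V) : Option (Option ↥W) :=
  if x.1 ≤ 0 then some none else if h : x.1 ≤ n ∧ x ∈ W then some (some ⟨x, h.2⟩) else none

def locF (W : Finset V) (x : V) : Option ↥W := if h : x ∈ W then some ⟨x, h⟩ else none

lemma locS_eq_none {n : ℕ} {W : Finset V} {x : V} : locS n W x = some none ↔ x.1 ≤ 0 := by grind [locS]

lemma locS_eq_some {n : ℕ} {W : Finset V} {x : V} (z : ↥W) : locS n W x = some (some z) ↔ x = z ∧ 1 ≤ x.1 ∧ x.1 ≤ n := by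
  unfold locS
  grind

lemma locF_eq_some {W : Finset V} {x : V} (z : ↥W) : locF W x = some z ↔ x = z := by simp_all [locF]

lemma sum_incident (F : Finset (V × Bool)) (x : V) : ∑ p ∈ F, ((if p.1 = x then (1 : ZMod 2) else 0) + if btgt p = x then 1 else 0) =
      bit F (x, true) + bit F (x - (1, 0), true) + bit F (x, false) + bit F (x - (0, 1), false) := by
  have h1 : ∀ p : V × Bool, ((if p.1 = x then (1 : ZMod 2) else 0) + if btgt p = x then 1 else 0) =
      (if p = (x, true) then 1 else 0) + (if p = (x - (1, 0), true) then 1 else 0) +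
        (if p = (x, false) then 1 else 0) + if p = (x - (0, 1), false) then 1 else 0 := by
    simp_all [btgt, bstep, eq_sub_iff_add_eq]
  rw [sum_congr rfl fun p _ => h1 p]
  simp [sum_add_distrib, bit]

lemma cast_locExp {ι : Type} [DecidableEq ι] (loc : V → Option ι) (x : V) (z : ι) :
    ((locExp loc x z : ℕ) : ZMod 2) = if loc x = some z then 1 else 0 := by
  simp_all [locExp]

/-- The parity condition for the numerator (`e = true`) and denominator (`e = false`) of a two-point function. -/
def parityCond {ι : Type} [DecidableEq ι] (loc : V → Option ι) (s t : V) (e : Bool) (F : Finset (V × Bool)) : Prop :=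
  ∀ z, (if e then (if loc s = some z then (1 : ZMod 2) else 0) + (if loc t = some z then 1 else 0) else 0) +
    ∑ p ∈ F, ((if loc p.1 = some z then (1 : ZMod 2) else 0) + if loc (btgt p) = some z then 1 else 0) = 0

open Classical in
lemma locCorr_eq_parity {ι : Type} [Fintype ι] [DecidableEq ι] (loc : V → Option ι) (β : ℝ) (B : Finset (V × Bool)) (s t : V) :
    locCorr loc β B s t =
      (∑ F ∈ B.powerset.filter (parityCond loc s t true), tanh β ^ F.card) /
        ∑ F ∈ B.powerset.filter (parityCond loc s t false), tanh β ^ F.card := by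
  rw [locCorr_eq]
  congr 1
  · refine sum_congr (filter_congr fun F _ => forall_congr' fun z => ?_) fun _ _ => rfl
    rw [← ZMod.natCast_eq_zero_iff_even, locDeg]
    simp_all [cast_locExp]
  · refine sum_congr (filter_congr fun F _ => forall_congr' fun z => ?_) fun _ _ => rfl
    rw [← ZMod.natCast_eq_zero_iff_even]
    simp_all [cast_locExp]

lemma bits_eq_zero {n : ℕ} {lo hi : ℤ} {F : Finset (V × Bool)} (hF : F ⊆ sBonds n lo hi) (hlo : 0 ≤ lo)
    (hhi : hi ≤ n) {i j : ℤ} (h : ¬ ((0 ≤ i ∧ i ≤ n + 1) ∧ 0 ≤ j ∧ j ≤ n)) :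
    bit F ((i, j), true) + bit F ((i - 1, j), true) + bit F ((i, j), false) + bit F ((i, j - 1), false) = 0 := by
  grind [bit_eq_zero, mem_sBonds_true, mem_sBonds_false]

lemma parityCond_locS {n : ℕ} {W : Finset V} (hW : sSites n ⊆ W) {F : Finset (V × Bool)} (hF : F ⊆ sBonds n 0 n) (a b : ℤ) (e : Bool) :
    parityCond (locS n W) (0, 0) ((n : ℤ) + 1, 0) e F ↔ srcCond n 0 a b e F := by
  have hh : ∀ i j : ℤ, 0 ≤ i → i ≤ n → hbit n 0 a b e F (i, j) = bit F ((i, j), true) := fun i j h1 h2 => hbit_inner h1 (by omega)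
  have hnone : ∑ p ∈ F, ((if locS n W p.1 = some none then (1 : ZMod 2) else 0) +
      if locS n W (btgt p) = some none then 1 else 0) = ∑ k ∈ Icc 0 (n : ℤ), bit F ((0, k), true) := by
    have : ∀ p ∈ F, ((if locS n W p.1 = some none then (1 : ZMod 2) else 0) + if locS n W (btgt p) = some none then 1 else 0) =
        ∑ k ∈ Icc 0 (n : ℤ), if p = ((0, k), true) then 1 else 0 := by
      rintro ⟨⟨i, j⟩, c⟩ hp
      simp only [locS_eq_none]
      cases c
      · have := mem_sBonds_false.1 (hF hp)
        have hi : ¬ i ≤ 0 := by omega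
        simp [btgt, bstep, hi]
      · have := mem_sBonds_true.1 (hF hp)
        by_cases h : i = 0
        · simp_all [btgt, bstep]
        · simp [btgt, bstep, h]
          grind
    rw [sum_congr rfl this, sum_comm]
    simp [bit]
  have hsome : ∀ z : ↥W, ∑ p ∈ F, ((if locS n W p.1 = some (some z) then (1 : ZMod 2) else 0) +
      if locS n W (btgt p) = some (some z) then 1 else 0) =
      if 1 ≤ z.1.1 ∧ z.1.1 ≤ n then bit F (z.1, true) + bit F (z.1 - (1, 0), true) + bit F (z.1, false) +
        bit F (z.1 - (0, 1), false) else 0 := by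
    intro z
    simp [locS_eq_some]
    split_ifs with h
    · rw [← sum_incident]
      grind
    simp_all [if_neg]
  have e0 : ∀ z : ↥W, ¬ (locS n W (0, 0) = some (some z)) := fun z hz => by grind [locS_eq_some]
  have e1 : ∀ z : ↥W, ¬ (locS n W ((n : ℤ) + 1, 0) = some (some z)) := fun z hz => by grind [locS_eq_some]
  have e2 : locS n W (0, 0) = some none := locS_eq_none.2 le_rfl
  have e3 : ¬ locS n W ((n : ℤ) + 1, 0) = some none := fun h => by grind [locS_eq_none]
  unfold parityCond srcCond
  rw [Option.forall, and_comm]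
  refine and_congr ?_ ?_
  · constructor
    · intro h i j h1 h2 h3 h4
      have := h ⟨(i, j), hW (mem_sSites.2 ⟨⟨h1, h2⟩, h3, h4⟩)⟩
      rw [hsome, if_neg (e0 _), if_neg (e1 _), if_pos (show 1 ≤ i ∧ i ≤ n from ⟨h1, h2⟩)] at this
      rw [hh i j (by omega) h2, hh (i - 1) j (by omega) (by omega)]
      simpa using this
    · rintro h ⟨⟨i, j⟩, hz⟩
      rw [hsome, if_neg (e0 _), if_neg (e1 _)]
      simp only [ite_self, zero_add]
      split_ifs with hc
      · by_cases hj : 0 ≤ j ∧ j ≤ n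
        · have := h i j hc.1 hc.2 hj.1 hj.2
          rw [hh i j (by omega) hc.2, hh (i - 1) j (by omega) (by omega)] at this
          simpa using this
        · simpa using bits_eq_zero hF le_rfl le_rfl (i := i) (j := j) (by tauto)
      · rfl
  · rw [hnone, if_pos e2, if_neg e3, sum_congr rfl fun k _ => hh 0 k le_rfl (by omega), add_zero]
    generalize ∑ k ∈ Icc 0 (n : ℤ), bit F ((0, k), true) = A
    revert A
    cases e <;> decide

lemma parityCond_locF {n : ℕ} (hn : 2 ≤ n) {W : Finset V} (hW : sSites n ⊆ W) {F : Finset (V × Bool)}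
    (hF : F ⊆ sBonds n 1 (n - 1)) {a b : ℤ} (ha : 0 ≤ a) (han : a ≤ n) (hb : 0 ≤ b) (hbn : b ≤ n) (e : Bool) :
    parityCond (locF W) (1, a) ((n : ℤ), b) e F ↔ srcCond n 1 a b e F := by
  have hsum : ∑ k ∈ Icc 0 (n : ℤ), hbit n 1 a b e F (0, k) = zs (!e) := by
    rw [Finset.sum_eq_single a]
    · grind [hbit, bit_eq_zero, mem_sBonds_true]
    · grind [hbit, bit_eq_zero, mem_sBonds_true]
    grind
  have hsite : ∀ i j : ℤ, 1 ≤ i → i ≤ n →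
      hbit n 1 a b e F (i, j) + hbit n 1 a b e F (i - 1, j) + bit F ((i, j), false) + bit F ((i, j - 1), false) =
      (if e then (if ((1, a) : V) = (i, j) then (1 : ZMod 2) else 0) + (if (((n : ℤ), b) : V) = (i, j) then 1 else 0)
        else 0) + (bit F ((i, j), true) + bit F ((i - 1, j), true) + bit F ((i, j), false) + bit F ((i, j - 1), false)) := by
    unfold hbit
    grind [zs]
  unfold parityCond srcCond
  rw [and_iff_left hsum]
  simp only [locF_eq_some, sum_incident]
  constructor
  · intro h i j h1 h2 h3 h4
    rw [hsite i j h1 h2]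
    simpa using h ⟨(i, j), hW (mem_sSites.2 ⟨⟨h1, h2⟩, h3, h4⟩)⟩
  · rintro h ⟨⟨i, j⟩, hz⟩
    by_cases hc : (1 ≤ i ∧ i ≤ n) ∧ 0 ≤ j ∧ j ≤ n
    · simp_all
    · have u1 : ¬ ((1, a) : V) = (i, j) := by rw [Prod.mk.injEq]; omega
      have u2 : ¬ (((n : ℤ), b) : V) = (i, j) := by grind
      simp [u1, u2]
      have : bit F ((i, j), true) + bit F ((i - 1, j), true) + bit F ((i, j), false) + bit F ((i, j - 1), false) = 0 := by
        rw [bit_eq_zero, bit_eq_zero, bit_eq_zero, bit_eq_zero]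
        · simp
        all_goals
          intro hm
          first
            | (have := mem_sBonds_true.1 (hF hm); omega)
            | (have := mem_sBonds_false.1 (hF hm); omega)
      simpa using this

def dualSum (B : Finset (V × Bool)) (σ : Ω) : ℝ := ∑ p ∈ B, spinVal (σ p.1) * spinVal (σ (p.1 - bstep (!p.2)))

lemma dualSum_eq (B : Finset (V × Bool)) (σ : Ω) : dualSum B σ = B.card - 2 * (dualDiff B σ).card := by
  have h : ∀ p : V × Bool, spinVal (σ p.1) * spinVal (σ (p.1 - bstep (!p.2))) =
      1 - 2 * if σ p.1 ≠ σ (p.1 - bstep (!p.2)) then 1 else 0 := by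
    grind [spinVal]
  unfold dualSum dualDiff
  rw [sum_congr rfl fun p _ => h p, sum_sub_distrib, ← mul_sum, Finset.sum_boole]
  simp

def Zdual (n : ℕ) (δ a b : ℤ) (e : Bool) (β : ℝ) : ℝ := ∑ τ : ↥(faces n δ) → Bool,
    exp (β * dualSum (sBonds n δ (n - δ)) (cut n δ a b e τ))

lemma Zdual_pos (n : ℕ) (δ a b : ℤ) (e : Bool) (β : ℝ) : 0 < Zdual n δ a b e β := sum_pos (fun _ _ => exp_pos _) univ_nonempty

lemma sum_pow_dualDiff (n : ℕ) (δ a b : ℤ) (e : Bool) {β x : ℝ} (hx : x = exp (-2 * β)) : ∑ τ : ↥(faces n δ) → Bool,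
        x ^ (dualDiff (sBonds n δ (n - δ)) (cut n δ a b e τ)).card =
      exp (-β * (sBonds n δ (n - δ)).card) * Zdual n δ a b e β := by
  rw [Zdual, mul_sum]
  refine sum_congr rfl fun τ _ => ?_
  rw [dualSum_eq, ← exp_add, hx, ← Real.exp_nat_mul]
  grind

open Classical in
lemma locCorr_eq_Zdual {ι : Type} [Fintype ι] [DecidableEq ι] (loc : V → Option ι) {n : ℕ} (hn : 2 ≤ n) {δ a b : ℤ}
    (hδ : δ = 0 ∨ δ = 1) (ha : 0 ≤ a) (han : a ≤ n) (hb : 0 ≤ b) (hbn : b ≤ n) (s t : V)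
    (h : ∀ F ⊆ sBonds n δ (n - δ), ∀ e, parityCond loc s t e F ↔ srcCond n δ a b e F)
    {β β' : ℝ} (hd : tanh β = exp (-2 * β')) :
    locCorr loc β (sBonds n δ (n - δ)) s t = Zdual n δ a b true β' / Zdual n δ a b false β' := by
  rw [locCorr_eq_parity, filter_congr fun F hF => h F (mem_powerset.1 hF) true, filter_congr fun F hF => h F (mem_powerset.1 hF) false,
    sum_srcCond_eq hn hδ ha han hb hbn, sum_srcCond_eq hn hδ ha han hb hbn, sum_pow_dualDiff n δ a b true hd,
    sum_pow_dualDiff n δ a b false hd, mul_div_mul_left _ _ (exp_pos _).ne']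

/-- Duality for the correlation between the two sides of the strip. -/
theorem locCorr_locS {n : ℕ} (hn : 2 ≤ n) {W : Finset V} (hW : sSites n ⊆ W) {β β' : ℝ} (hd : tanh β = exp (-2 * β')) :
    locCorr (locS n W) β (sBonds n 0 n) (0, 0) ((n : ℤ) + 1, 0) = Zdual n 0 0 0 true β' / Zdual n 0 0 0 false β' := by
  have := locCorr_eq_Zdual (locS n W) hn (δ := 0) (a := 0) (b := 0) (Or.inl rfl) le_rfl (by omega) le_rfl (by omega)
    (0, 0) ((n : ℤ) + 1, 0) (fun F hF e => parityCond_locS hW (by grind) 0 0 e) hd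
  grind

/-- Duality for the correlation between two sites on opposite sides of a free strip. -/
theorem locCorr_locF {n : ℕ} (hn : 2 ≤ n) {W : Finset V} (hW : sSites n ⊆ W) {β β' : ℝ} {a b : ℤ}
    (ha : 0 ≤ a) (han : a ≤ n) (hb : 0 ≤ b) (hbn : b ≤ n) (hd : tanh β = exp (-2 * β')) :
    locCorr (locF W) β (sBonds n 1 (n - 1)) (1, a) ((n : ℤ), b) =
      Zdual n 1 a b true β' / Zdual n 1 a b false β' :=
  locCorr_eq_Zdual (locF W) hn (Or.inr rfl) ha han hb hbn _ _
    (fun _ hF e => parityCond_locF hn hW hF ha han hb hbn e) hd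

section
variable {ι : Type} [Fintype ι] [DecidableEq ι]

lemma locCorr_comm (loc : V → Option ι) (β : ℝ) (B : Finset (V × Bool)) (s t : V) : locCorr loc β B s t = locCorr loc β B t s := by
  grind [locCorr]

lemma locCorr_congr {loc loc' : V → Option ι} (β : ℝ) {B : Finset (V × Bool)} {s t : V}
    (hB : ∀ p ∈ B, loc p.1 = loc' p.1 ∧ loc (btgt p) = loc' (btgt p)) (hs : loc s = loc' s) (ht : loc t = loc' t) :
    locCorr loc β B s t = locCorr loc' β B s t := by
  grind [lSpin, sum_congr, locCorr]

lemma locCorr_mono (loc : V → Option ι) {β β' : ℝ} (h0 : 0 ≤ β) (h : β ≤ β') {B B' : Finset (V × Bool)} (hB : B ⊆ B')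
    (s t : V) : locCorr loc β B s t ≤ locCorr loc β' B' s t := by
  have := griffiths_mono B' (fun _ => β') (fun p => if p ∈ B then β else 0) (fun p _ => by grind)
    (fun p ω => lSpin loc ω p.1 * lSpin loc ω (btgt p))
    (fun p _ => (isChar_lSpin loc p.1).mul (isChar_lSpin loc (btgt p)))
    ((isChar_lSpin loc s).mul (isChar_lSpin loc t))
  simp [Finset.inter_eq_right.2 hB] at this
  exact this

lemma locCorr_gauge (loc : V → Option (Option ι)) (β : ℝ) {B : Finset (V × Bool)} {s t : V}
    (hB : ∀ p ∈ B, (loc p.1).isSome ∧ (loc (btgt p)).isSome) (hs : (loc s).isSome) (ht : (loc t).isSome) :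
    locCorr loc β B s t = locCorr (fun x => (loc x).join) β B s t := by
  have hneg : ∀ (ω : Option ι → Bool) x, (loc x).isSome → lSpin loc (fun z => !ω z) x = -lSpin loc ω x := by
    grind [Option.isSome_iff_exists, lSpin, spinVal_not]
  have hel : ∀ (u : ι → Bool) x, lSpin loc (fun z => z.elim true u) x = lSpin (fun x => (loc x).join) u x := by
    intro u x
    simp [lSpin]
    rcases loc x with _ | _ | z
    · rfl
    · simp [spinVal]
    · rfl
  have hw : ∀ ω : Option ι → Bool, ∑ p ∈ B, β * (lSpin loc (fun z => !ω z) p.1 * lSpin loc (fun z => !ω z) (btgt p)) =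
      ∑ p ∈ B, β * (lSpin loc ω p.1 * lSpin loc ω (btgt p)) := fun ω =>
    sum_congr rfl fun p hp => by grind
  simp_all [locCorr, wEx, sum_option_gauge, mul_div_mul_left]

/-- Bonds to fixed spins contribute at most linearly to a magnetisation. -/
lemma locCorr_le_sum (loc : V → Option ι) {β : ℝ} (hβ : 0 ≤ β) {B₁ B₂ : Finset (V × Bool)} (hd : Disjoint B₁ B₂)
    {s t : V} {z₀ : ι} (hs : loc s = some z₀) (ht : loc t = none) (u : V × Bool → V)
    (h₁ : ∀ p ∈ B₁, (loc p.1).isSome ∧ (loc (btgt p)).isSome)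
    (h₂ : ∀ p ∈ B₂, (loc (u p)).isSome ∧ ((loc p.1 = none ∧ u p = btgt p) ∨ (loc (btgt p) = none ∧ u p = p.1))) :
    locCorr loc β (B₁ ∪ B₂) s t ≤ β * ∑ p ∈ B₂, locCorr loc β B₁ s (u p) := by
  have hv : ∀ (ω : ι → Bool) x, (loc x).isSome → lSpin loc ω x = spinVal (ω ((loc x).getD z₀)) := by
    grind [Option.isSome_iff_exists, lSpin]
  have hpair : ∀ ω : ι → Bool, ∑ p ∈ B₁, β * (lSpin loc ω p.1 * lSpin loc ω (btgt p)) =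
      pairSum B₁ (fun _ => β) (fun p => (loc p.1).getD z₀) (fun p => (loc (btgt p)).getD z₀) ω := fun ω =>
    sum_congr rfl fun p hp => by grind
  have hfield : ∀ ω : ι → Bool, ∑ p ∈ B₂, β * (lSpin loc ω p.1 * lSpin loc ω (btgt p)) =
      fieldSum (fun x => ∑ p ∈ B₂, if (loc (u p)).getD z₀ = x then β else 0) ω := by
    intro ω
    unfold fieldSum
    simp [sum_mul]
    rw [sum_comm]
    refine sum_congr rfl fun p hp => ?_
    simp
    grind [lSpin]
  have hst : ∀ ω : ι → Bool, lSpin loc ω s * lSpin loc ω t = spinVal (ω z₀) := fun ω => by grind [lSpin]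
  have key := magnetisation_le_sum B₁ (fun _ => β) (fun _ _ => hβ) (fun p => (loc p.1).getD z₀)
    (fun p => (loc (btgt p)).getD z₀) (fun x => ∑ p ∈ B₂, if (loc (u p)).getD z₀ = x then β else 0)
    (fun x => sum_nonneg fun p _ => by grind) z₀
  have e1 : locCorr loc β (B₁ ∪ B₂) s t = wEx (fun ω => exp (fieldSum (fun x => ∑ p ∈ B₂,
      if (loc (u p)).getD z₀ = x then β else 0) ω) * exp (pairSum B₁ (fun _ => β) (fun p => (loc p.1).getD z₀)
        (fun p => (loc (btgt p)).getD z₀) ω)) (fun ω => spinVal (ω z₀)) := by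
    grind [locCorr, Finset.sum_union, exp_add]
  rw [e1]
  refine key.trans_eq ?_
  simp [sum_mul]
  rw [sum_comm, mul_sum]
  refine sum_congr rfl fun p hp => ?_
  simp
  unfold locCorr
  grind

end

lemma lSpin_locF (W : Finset V) (η : ↥W → Bool) (x : V) : lSpin (locF W) η x = spinVal (spatch W η ⊤ x) := by
  unfold lSpin locF spatch
  split_ifs <;> simp [spinVal]

lemma PiOp_spin_eq_locCorr (β : ℝ) {W : Finset V} {s : V} (hs : s ∉ W) (t : V) :
    PiOp β W (fun τ => spinVal (τ t)) ⊤ = locCorr (locF W) β (bonds W) s t := by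
  rw [PiOp_eq_wEx]
  have hs' : ∀ η : ↥W → Bool, spatch W η ⊤ s = true := fun η => by rw [spatch_notMem hs]; rfl
  congr 1
  · grind [gw, hamiltonian_eq_bondSum, bondSum, lSpin_locF, mul_sum, neg_mul_neg]
  grind [lSpin_locF, spinVal]

/-- The correlation between the two sides of the strip. -/
def crossCorr (n : ℕ) (β : ℝ) : ℝ := locCorr (locS n (sSites n)) β (sBonds n 0 n) (0, 0) ((n : ℤ) + 1, 0)

lemma sBonds_right (n : ℕ) (lo : ℤ) (h : lo ≤ n) : sBonds n lo n =
    sBonds n lo (n - 1) ∪ (Icc 0 (n : ℤ)).image fun j => (((n : ℤ), j), true) := by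
  ext ⟨⟨i, j⟩, c⟩
  cases c
  · simp [mem_sBonds_false]
  grind [mem_sBonds_true]

lemma sBonds_left (n : ℕ) (hi : ℤ) (h : 0 ≤ hi) : sBonds n 0 hi = sBonds n 1 hi ∪ (Icc 0 (n : ℤ)).image fun j => ((0, j), true) := by
  ext ⟨⟨i, j⟩, c⟩
  cases c
  · simp [mem_sBonds_false]
  grind [mem_sBonds_true]

lemma locS_of_le {n : ℕ} {W : Finset V} {x : V} (h : x.1 ≤ 0) : locS n W x = some none := locS_eq_none.2 h

lemma locS_of_mem {n : ℕ} {W : Finset V} {x : V} (h0 : ¬ x.1 ≤ 0) (h : x.1 ≤ n) (hx : x ∈ W) :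
    locS n W x = some (some ⟨x, hx⟩) := by grind [locS]

lemma locS_of_lt {n : ℕ} {W : Finset V} {x : V} (h : n < x.1) : locS n W x = none := by grind [locS]

section
variable {n : ℕ} {W : Finset V} (hW : sSites n ⊆ W)
include hW

lemma locS_isSome {i j : ℤ} (hin : i ≤ n) (hj : 0 ≤ j) (hjn : j ≤ n) : (locS n W (i, j)).isSome := by
  grind [locS_of_le, locS_of_mem, mem_sSites]

lemma locS_isSome_bond {p : V × Bool} (hp : p ∈ sBonds n 0 (n - 1)) : (locS n W p.1).isSome ∧ (locS n W (btgt p)).isSome := by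
  obtain ⟨⟨i, j⟩, c⟩ := p
  cases c
  · have h := mem_sBonds_false.1 hp
    simp [btgt, bstep]
    grind [locS_isSome]
  · have h := mem_sBonds_true.1 hp
    simp [btgt, bstep]
    grind [locS_isSome]

lemma locCorr_cross_le {β : ℝ} (hβ : 0 ≤ β) : locCorr (locS n W) β (sBonds n 0 n) (0, 0) ((n : ℤ) + 1, 0) ≤
      β * ∑ j ∈ Icc 0 (n : ℤ), locCorr (fun x => (locS n W x).join) β (sBonds n 0 (n - 1)) (0, 0) ((n : ℤ), j) := by
  rw [sBonds_right n 0 (by omega)]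
  refine (locCorr_le_sum (locS n W) hβ ?_ (z₀ := none) (locS_of_le le_rfl) (locS_of_lt (by simp)) Prod.fst
    (fun p hp => locS_isSome_bond hW hp) ?_).trans_eq ?_
  · grind [Finset.disjoint_left, mem_sBonds_true]
  · intro p hp
    obtain ⟨j, hj, rfl⟩ := mem_image.1 hp
    simp_all [locS_isSome, locS_of_lt, btgt, bstep]
  · rw [sum_image (by simp_all)]
    congr 1
    refine sum_congr rfl fun j hj => ?_
    simp_all [locCorr_gauge, locS_isSome_bond, locS_isSome]

end

lemma crossCorr_eq {n : ℕ} (hn : 2 ≤ n) {W : Finset V} (hW : sSites n ⊆ W) {β β' : ℝ} (hd : tanh β = exp (-2 * β')) :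
    crossCorr n β = locCorr (locS n W) β (sBonds n 0 n) (0, 0) ((n : ℤ) + 1, 0) := by
  simp_all [locCorr_locS, crossCorr]

lemma crossCorr_mono (n : ℕ) {β β' : ℝ} (h0 : 0 ≤ β) (h : β ≤ β') : crossCorr n β ≤ crossCorr n β' :=
  locCorr_mono _ h0 h subset_rfl _ _

lemma join_locS {n : ℕ} {W : Finset V} (h1 : ∀ x ∈ W, 1 ≤ x.1) {x : V} (hx : x.1 ≤ n) : (locS n W x).join = locF W x := by
  by_cases h0 : x.1 ≤ 0
  · rw [locS_of_le h0, locF, dif_neg fun h => by grind]; rfl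
  · by_cases hW : x ∈ W
    · simp_all [locS_of_mem, locF]
    grind [locS, locF]

/-- The crossing correlation is controlled by the magnetisation. -/
theorem crossCorr_le_mag {n : ℕ} (hn : 2 ≤ n) {β β' : ℝ} (hβ : 0 ≤ β) (hd : tanh β = exp (-2 * β')) :
    crossCorr n β ≤ β * ((n + 1) * mag β (n - 1)) := by
  set W : Finset V := Icc 1 (2 * n : ℤ) ×ˢ Icc (-n : ℤ) (2 * n) with hWdef
  have hW : sSites n ⊆ W := by grind [mem_sSites]
  have h1 : ∀ x ∈ W, (1 : ℤ) ≤ x.1 := by grind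
  rw [crossCorr_eq hn hW hd]
  refine (locCorr_cross_le hW hβ).trans (mul_le_mul_of_nonneg_left ?_ hβ)
  have hterm : ∀ j ∈ Icc 0 (n : ℤ), locCorr (fun x => (locS n W x).join) β (sBonds n 0 (n - 1)) (0, 0)
      ((n : ℤ), j) ≤ mag β (n - 1) := by
    intro j hj
    have h00 : ((0, 0) : V) ∉ W := fun h => by grind
    calc locCorr (fun x => (locS n W x).join) β (sBonds n 0 (n - 1)) (0, 0) ((n : ℤ), j)
        = locCorr (locF W) β (sBonds n 0 (n - 1)) (0, 0) ((n : ℤ), j) := by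
          refine locCorr_congr β ?_ (join_locS h1 (by simp)) (join_locS h1 le_rfl)
          rintro ⟨⟨i, k⟩, c⟩ hp
          cases c
          · simp_all [mem_sBonds_false, join_locS, btgt, bstep]
          · have h := mem_sBonds_true.1 hp
            exact ⟨join_locS h1 (by simp; omega), join_locS h1 (by simp [btgt, bstep]; omega)⟩
      _ ≤ locCorr (locF W) β (bonds W) (0, 0) ((n : ℤ), j) := by
          refine locCorr_mono _ hβ le_rfl ?_ _ _
          rintro ⟨⟨i, k⟩, c⟩ hp
          rw [mem_bonds]
          cases c
          · grind [mem_sBonds_false]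
          · have h := mem_sBonds_true.1 hp
            simp [btgt, bstep]; grind
      _ = PiOp β W (fun τ => spinVal (τ ((n : ℤ), j))) ⊤ := (PiOp_spin_eq_locCorr β h00 _).symm
      _ ≤ mag β (n - 1) := by
          refine PiOp_spin_top_le_mag hβ ?_
          grind [mem_boxAt]
  refine (sum_le_card_nsmul _ _ _ hterm).trans_eq ?_
  simp

def siteFace (n : ℕ) : ↥(sSites n) ≃ ↥(faces n 0) where
  toFun x := ⟨(x.1.2, n - x.1.1), by grind [mem_sSites, mem_faces]⟩
  invFun y := ⟨(n - y.1.2, y.1.1), by grind [mem_faces, mem_sSites]⟩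
  left_inv x := by grind
  right_inv y := by grind

lemma lSpin_rotate (n : ℕ) (b : Bool) (u : ↥(faces n 0) → Bool) {i j : ℤ} (hi : 0 ≤ i) (hin : i ≤ n + 1) (hj : 0 ≤ j) (hjn : j ≤ n) :
    lSpin (locS n (sSites n)) (fun z => z.elim b fun x => u (siteFace n x)) (i, j) =
      spinVal (spatch (faces n 0) u (cutBC n 0 0 0 (!b)) (j, n - i)) := by
  by_cases h0 : i ≤ 0
  · grind [spatch_notMem, mem_faces, lSpin, locS_of_le, cutBC, upperArc]
  · by_cases h1 : i ≤ n
    · have hx : ((i, j) : V) ∈ sSites n := mem_sSites.2 ⟨⟨by omega, h1⟩, hj, hjn⟩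
      grind [spatch_of_mem, lSpin, locS_of_mem, siteFace]
    grind [spatch_notMem, mem_faces, lSpin, locS_of_lt, cutBC, upperArc, spinVal]

lemma sum_rotate (n : ℕ) (b : Bool) (u : ↥(faces n 0) → Bool) :
    ∑ p ∈ sBonds n 0 n, lSpin (locS n (sSites n)) (fun z => z.elim b fun x => u (siteFace n x)) p.1 *
        lSpin (locS n (sSites n)) (fun z => z.elim b fun x => u (siteFace n x)) (btgt p) =
      dualSum (sBonds n 0 n) (spatch (faces n 0) u (cutBC n 0 0 0 (!b))) := by
  refine Finset.sum_nbij' (fun p => ((if p.2 then p.1.2 else p.1.2 + 1, n - p.1.1), p.2))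
    (fun q => ((n - q.1.2, if q.2 then q.1.1 else q.1.1 - 1), q.2)) ?_ ?_ ?_ ?_ ?_
  · rintro ⟨⟨i, j⟩, c⟩ hp
    cases c
    · grind [mem_sBonds_false]
    simp_all [mem_sBonds_true]
  · rintro ⟨⟨i, j⟩, c⟩ hp
    cases c
    · grind [mem_sBonds_false]
    simp_all [mem_sBonds_true]
  · grind
  · grind
  · rintro ⟨⟨i, j⟩, c⟩ hp
    cases c
    · have h := mem_sBonds_false.1 hp
      simp [btgt, bstep]
      grind [lSpin_rotate]
    · have h := mem_sBonds_true.1 hp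
      simp [btgt, bstep]
      rw [lSpin_rotate n b u (by omega) (by omega) (by omega) (by omega),
        lSpin_rotate n b u (by omega) (by omega) (by omega) (by omega), sub_sub]

lemma sum_option {ι : Type} [Fintype ι] [DecidableEq ι] (G : (Option ι → Bool) → ℝ) :
    ∑ ω, G ω = ∑ u : ι → Bool, G (fun z => z.elim true u) + ∑ u : ι → Bool, G (fun z => z.elim false u) := by
  have e : ∑ ω, G ω = ∑ q : Bool × (ι → Bool), G (fun z => z.elim q.1 q.2) := by
    refine sum_equiv (Equiv.piOptionEquivProd (β := fun _ => Bool)) _ _ fun ω => ?_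
    congr 1
    ext z
    cases z <;> rfl
  rw [e, sum_prod_type, sum_bool]

lemma crossCorr_eq_sub_div (n : ℕ) (β : ℝ) :
    crossCorr n β = (Zdual n 0 0 0 false β - Zdual n 0 0 0 true β) / (Zdual n 0 0 0 false β + Zdual n 0 0 0 true β) := by
  have hZ : ∀ b : Bool, ∑ u : ↥(sSites n) → Bool, exp (∑ p ∈ sBonds n 0 n, β * (lSpin (locS n (sSites n)) (fun z => z.elim b u) p.1 *
        lSpin (locS n (sSites n)) (fun z => z.elim b u) (btgt p))) = Zdual n 0 0 0 (!b) β := by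
    intro b
    symm
    refine sum_equiv (arrowCongr (siteFace n).symm (Equiv.refl Bool)) _ _ fun u => ?_
    rw [← mul_sum]
    have := sum_rotate n b u
    rw [sub_zero, ← this]
    rfl
  have hs : ∀ (b : Bool) (u : ↥(sSites n) → Bool), lSpin (locS n (sSites n)) (fun z => z.elim b u) (0, 0) *
        lSpin (locS n (sSites n)) (fun z => z.elim b u) ((n : ℤ) + 1, 0) = spinVal b := by
    grind [lSpin, locS_of_le, locS_of_lt]
  unfold crossCorr locCorr wEx
  rw [sum_option, sum_option]
  simp [hs, ← sum_mul, hZ]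
  simp [spinVal]
  grind

/-- The critical inverse temperature. -/
def betaC : ℝ := 1 / 2 * log (1 + √2)

lemma betaC_pos : 0 < betaC := by grind [betaC, Real.log_pos, Real.sqrt_pos]

lemma tanh_eq_exp (x : ℝ) : tanh x = (exp (2 * x) - 1) / (exp (2 * x) + 1) := by
  grind [Real.tanh_eq_sinh_div_cosh, Real.sinh_eq, Real.cosh_eq, Real.exp_neg, two_mul, exp_add, exp_pos]

lemma tanh_betaC : tanh betaC = exp (-2 * betaC) := by
  have h0 : 0 < √2 := Real.sqrt_pos.2 zero_lt_two
  have he : exp (2 * betaC) = 1 + √2 := by grind [betaC, exp_log]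
  rw [tanh_eq_exp, neg_mul, Real.exp_neg, he]
  grind

lemma crossCorr_betaC_pos {n : ℕ} (hn : 2 ≤ n) : 2 / 5 ≤ crossCorr n betaC := by
  have h := locCorr_locS hn (W := sSites n) subset_rfl tanh_betaC
  have h' := crossCorr_eq_sub_div n betaC
  have h1 := Zdual_pos n 0 0 0 true betaC
  have h0 := Zdual_pos n 0 0 0 false betaC
  change crossCorr n betaC = _ at h
  generalize Zdual n 0 0 0 true betaC = A at *
  rw [eq_div_iff h0.ne'] at h
  rw [eq_div_iff (by positivity), ← h] at h'
  nlinarith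

lemma dualSum_eq_bondSum {n : ℕ} (hn : 2 ≤ n) (σ : Ω) : dualSum (sBonds n 1 (n - 1)) σ = bondSum (bonds (faces n 1)) σ := by
  refine Finset.sum_nbij' (fun q => (q.1 - bstep (!q.2), !q.2)) (fun p => (btgt p, !p.2)) ?_ ?_ ?_ ?_ ?_
  · simp [mem_bonds, mem_sBonds_false, btgt, bstep, mem_faces, mem_sBonds_true]; grind
  · simp [mem_bonds, btgt, bstep, mem_faces, mem_sBonds_true, mem_sBonds_false]; grind
  · simp_all [btgt]
  · grind [btgt]
  simp_all [btgt, mul_comm]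

/-- The sign carried by the boundary condition outside `F`. -/
def outSign (F : Finset V) (η : Ω) (x : V) : ℝ := if x ∈ F then 1 else spinVal (η x)

lemma outSign_eq (F : Finset V) (η : Ω) (x : V) : outSign F η x = 1 ∨ outSign F η x = -1 := by grind [outSign, spinVal_eq]

lemma spinVal_spatch (F : Finset V) (τ : ↥F → Bool) (η : Ω) (x : V) :
    spinVal (spatch F τ η x) = outSign F η x * lSpin (locF F) τ x := by
  grind [outSign, lSpin, locF, spatch]

def dualEx (B : Finset (V × Bool)) (F : Finset V) (η : Ω) (β : ℝ) (f : Ω → ℝ) : ℝ :=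
  wEx (fun τ : ↥F → Bool => exp (β * dualSum B (spatch F τ η))) fun τ => f (spatch F τ η)

lemma interface_le (B : Finset (V × Bool)) (F : Finset V) (η : Ω) {β : ℝ} (hβ : 0 ≤ β) (x y : V) :
    |dualEx B F ⊤ β (fun σ => spinVal (σ x)) * dualEx B F η β (fun σ => spinVal (σ y)) -
      dualEx B F ⊤ β (fun σ => spinVal (σ y)) * dualEx B F η β (fun σ => spinVal (σ x))| ≤
    dualEx B F ⊤ β (fun σ => spinVal (σ x) * spinVal (σ y)) -
      dualEx B F η β (fun σ => spinVal (σ x) * spinVal (σ y)) := by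
  have hsq : ∀ x, outSign F η x * outSign F η x = 1 := by grind [outSign_eq]
  have habs : ∀ x, |outSign F η x| = 1 := by grind
  have htop : ∀ x, outSign F ⊤ x = 1 := by simp_all [outSign, spinVal]
  have key := ginibre_pair B (fun _ => β) (fun p => β * (outSign F η p.1 * outSign F η (p.1 - bstep (!p.2)))) (fun p _ => by grind)
    (fun p τ => lSpin (locF F) τ p.1 * lSpin (locF F) τ (p.1 - bstep (!p.2)))
    (fun p _ => (isChar_lSpin _ _).mul (isChar_lSpin _ _)) (isChar_lSpin (locF F) x)
    (isChar_lSpin (locF F) y) (outSign F η x * outSign F η y)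
    (by grind)
  have w1 : (fun τ : ↥F → Bool => exp (β * dualSum B (spatch F τ ⊤))) = fun τ => exp (∑ p ∈ B,
      β * (lSpin (locF F) τ p.1 * lSpin (locF F) τ (p.1 - bstep (!p.2)))) := by
    simp_all [dualSum, spinVal_spatch, mul_sum]
  have w2 : (fun τ : ↥F → Bool => exp (β * dualSum B (spatch F τ η))) = fun τ => exp (∑ p ∈ B,
      β * (outSign F η p.1 * outSign F η (p.1 - bstep (!p.2))) *
        (lSpin (locF F) τ p.1 * lSpin (locF F) τ (p.1 - bstep (!p.2)))) := by
    simp [dualSum, spinVal_spatch, mul_sum]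
    grind
  simp [dualEx, spinVal_spatch, htop]
  rw [w1, w2]
  set wd := fun τ : ↥F → Bool => exp (∑ p ∈ B, β * (outSign F η p.1 * outSign F η (p.1 - bstep (!p.2))) *
        (lSpin (locF F) τ p.1 * lSpin (locF F) τ (p.1 - bstep (!p.2))))
  have s1 : ∀ z, wEx wd (fun τ => outSign F η z * lSpin (locF F) τ z) =
      outSign F η z * wEx wd fun τ => lSpin (locF F) τ z := fun z => wEx_smul _ _
  have s2 : wEx wd (fun τ => outSign F η x * lSpin (locF F) τ x * (outSign F η y * lSpin (locF F) τ y)) =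
      outSign F η x * outSign F η y * wEx wd fun τ => lSpin (locF F) τ x * lSpin (locF F) τ y := by
    rw [← wEx_smul]
    grind
  rw [s1, s1, s2]
  refine le_trans (le_of_eq ?_) key
  generalize wEx wd (fun τ => lSpin (locF F) τ y) = D
  generalize wEx wd (fun τ => lSpin (locF F) τ x) = E
  grind

lemma ratio_telescope (u v : ℤ → ℝ) {m : ℝ} (hm : 0 < m) (hu : ∀ j, m ≤ u j) :
    ∀ k : ℤ, -1 ≤ k → m ^ 2 * |v k / u k - v (-1) / u (-1)| ≤
      ∑ j ∈ Icc 0 k, |u j * v (j - 1) - u (j - 1) * v j| := by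
  intro k hk
  induction k, hk using leInduction with
  | base => simp
  | succ k hk ih =>
    rw [Icc_insert_right (by omega), Finset.sum_insert (by simp), add_sub_cancel_right]
    have hstep : m ^ 2 * |v (k + 1) / u (k + 1) - v k / u k| ≤ |u (k + 1) * v k - u k * v (k + 1)| := by
      have e : |u (k + 1) * v k - u k * v (k + 1)| = (u (k + 1) * u k) * |v (k + 1) / u (k + 1) - v k / u k| := by
        have e' : u (k + 1) * v k - u k * v (k + 1) = -((u (k + 1) * u k) * (v (k + 1) / u (k + 1) - v k / u k)) := by grind
        grind [abs_neg]
      grind [pow_two, mul_le_mul_of_nonneg_right, mul_le_mul]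
    have htri := abs_sub_le (v (k + 1) / u (k + 1)) (v k / u k) (v (-1) / u (-1))
    nlinarith

lemma hasDerivAt_log_Zdual (n : ℕ) (δ a b : ℤ) (e : Bool) (β : ℝ) :
    HasDerivAt (fun β => log (Zdual n δ a b e β)) (dualEx (sBonds n δ (n - δ)) (faces n δ)
      (cutBC n δ a b e) β (dualSum (sBonds n δ (n - δ)))) β := by
  have h : HasDerivAt (Zdual n δ a b e) (∑ τ : ↥(faces n δ) → Bool, exp (β * dualSum (sBonds n δ (n - δ)) (cut n δ a b e τ)) *
        dualSum (sBonds n δ (n - δ)) (cut n δ a b e τ)) β := by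
    refine HasDerivAt.fun_sum fun τ _ => ?_
    have := (hasDerivAt_id β).mul_const (dualSum (sBonds n δ (n - δ)) (cut n δ a b e τ))
    rw [one_mul] at this
    exact this.exp
  exact h.log (Zdual_pos n δ a b e β).ne'

lemma dualEx_dualSum (B : Finset (V × Bool)) (F : Finset V) (η : Ω) (β : ℝ) : dualEx B F η β (dualSum B) =
      ∑ p ∈ B, dualEx B F η β fun σ => spinVal (σ p.1) * spinVal (σ (p.1 - bstep (!p.2))) := wEx_sum _ _

lemma cutBC_false (n : ℕ) (δ a b : ℤ) : cutBC n δ a b false = ⊤ := by ext x; simp [cutBC]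

lemma dualEx_of_notMem (B : Finset (V × Bool)) {F : Finset V} (η : Ω) (β : ℝ) {x : V} (hx : x ∉ F) :
    dualEx B F η β (fun σ => spinVal (σ x)) = spinVal (η x) := by
  simp_all [dualEx, spatch_notMem, wEx_const, exp_pos]

lemma le_dualEx_top {n : ℕ} (hn : 2 ≤ n) {β m : ℝ} (hβ : 0 ≤ β) (hm : ∀ k, m ≤ mag β k) (x : V) :
    m ≤ dualEx (sBonds n 1 (n - 1)) (faces n 1) ⊤ β (fun σ => spinVal (σ x)) := by
  by_cases hx : x ∈ faces n 1
  · have e : dualEx (sBonds n 1 (n - 1)) (faces n 1) ⊤ β (fun σ => spinVal (σ x)) = PiOp β (faces n 1) (fun σ => spinVal (σ x)) ⊤ := by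
      unfold dualEx
      congr 1
      grind [gw, hamiltonian_eq_bondSum, dualSum_eq_bondSum]
    obtain ⟨i, j⟩ := x
    have hsub : faces n 1 ⊆ boxAt (i, j) n := by grind [mem_faces, mem_boxAt]
    refine (hm n).trans ?_
    rw [← PiOp_boxAt_spin β (i, j) n]
    simp_all [PiOp_le_of_eq_top, spin_monotone]
  · rw [dualEx_of_notMem _ _ _ hx]
    exact (hm 0).trans ((mag_le_one β 0).trans (by simp [spinVal]))

lemma interface_cost {n : ℕ} (hn : 2 ≤ n) (a b : ℤ) {β m : ℝ} (hβ : 0 ≤ β) (hm0 : 0 < m) (hm : ∀ k, m ≤ mag β k) :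
    (n - 1 : ℝ) * (2 * m ^ 2) ≤ dualEx (sBonds n 1 (n - 1)) (faces n 1) ⊤ β (dualSum (sBonds n 1 (n - 1))) -
      dualEx (sBonds n 1 (n - 1)) (faces n 1) (cutBC n 1 a b true) β (dualSum (sBonds n 1 (n - 1))) := by
  rw [dualEx_dualSum, dualEx_dualSum, ← sum_sub_distrib]
  set B := sBonds n 1 (n - 1) with hB
  set F := faces n 1
  set η := cutBC n 1 a b true
  set u : V → ℝ := fun x => dualEx B F ⊤ β fun σ => spinVal (σ x)
  set v : V → ℝ := fun x => dualEx B F η β fun σ => spinVal (σ x)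
  have hcol : ∀ i ∈ Icc 1 ((n : ℤ) - 1), 2 * m ^ 2 ≤ ∑ j ∈ Icc 0 (n : ℤ), |u (i, j) * v (i, j - 1) - u (i, j - 1) * v (i, j)| := by
    intro i hi
    have ht := ratio_telescope (fun j => u (i, j)) (fun j => v (i, j)) hm0 (fun j => le_dualEx_top hn hβ hm _) n (by omega)
    have nb : ((i, -1) : V) ∉ F := by grind [mem_faces]
    have nt : ((i, (n : ℤ)) : V) ∉ F := by grind [mem_faces]
    have e1 : u (i, -1) = 1 := (dualEx_of_notMem _ _ _ nb).trans (by simp [spinVal])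
    have e2 : u (i, (n : ℤ)) = 1 := (dualEx_of_notMem _ _ _ nt).trans (by simp [spinVal])
    have e3 : v (i, -1) = 1 := by grind [dualEx_of_notMem, cutBC, upperArc, spinVal]
    have e4 : v (i, (n : ℤ)) = -1 := by grind [dualEx_of_notMem, cutBC, upperArc, spinVal]
    simp only [e1, e2, e3, e4] at ht
    linarith
  calc (n - 1 : ℝ) * (2 * m ^ 2) = ∑ i ∈ Icc 1 ((n : ℤ) - 1), 2 * m ^ 2 := by
        rw [sum_const, Int.card_Icc, nsmul_eq_mul]
        have : ((n : ℤ) - 1 + 1 - 1).toNat = n - 1 := by omega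
        grind [Nat.cast_sub]
    _ ≤ ∑ i ∈ Icc 1 ((n : ℤ) - 1), ∑ j ∈ Icc 0 (n : ℤ),
        |u (i, j) * v (i, j - 1) - u (i, j - 1) * v (i, j)| := sum_le_sum hcol
    _ = ∑ p ∈ (Icc 1 ((n : ℤ) - 1) ×ˢ Icc 0 (n : ℤ)) ×ˢ {true},
        |u p.1 * v (p.1 - bstep (!p.2)) - u (p.1 - bstep (!p.2)) * v p.1| := by
        simp_all [sum_product, bstep]
    _ ≤ ∑ p ∈ B, |u p.1 * v (p.1 - bstep (!p.2)) - u (p.1 - bstep (!p.2)) * v p.1| :=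
        Finset.sum_le_sum_of_subset_of_nonneg subset_union_left fun _ _ _ => abs_nonneg _
    _ ≤ _ := sum_le_sum fun p _ => interface_le B F η hβ _ _

lemma exists_tanh_eq {x : ℝ} (h0 : 0 < x) (h1 : x < 1) : ∃ β, 0 < β ∧ tanh β = x := by
  refine ⟨1 / 2 * log ((1 + x) / (1 - x)), ?_, ?_⟩
  · have : 1 < (1 + x) / (1 - x) := by simp_all [one_lt_div]; grind
    grind [Real.log_pos]
  · rw [tanh_eq_exp, ← mul_assoc, mul_one_div_cancel two_ne_zero, one_mul, exp_log (div_pos (by linarith) (by linarith))]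
    grind

lemma tanh_strictMono : StrictMono tanh := by
  intro x y h
  rw [tanh_eq_exp, tanh_eq_exp, div_lt_div_iff₀ (by positivity) (by positivity)]
  have : exp (2 * x) < exp (2 * y) := by simp_all
  linarith

lemma locCorr_le_one {ι : Type} [Fintype ι] [DecidableEq ι] (loc : V → Option ι) (β : ℝ) (B : Finset (V × Bool))
    (s t : V) : locCorr loc β B s t ≤ 1 := by
  rw [← wEx_const (v := fun ω : ι → Bool => exp (∑ p ∈ B, β * (lSpin loc ω p.1 * lSpin loc ω (btgt p)))) (fun _ => exp_pos _) 1]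
  exact wEx_mono (fun _ => exp_pos _) fun ω => ((isChar_lSpin loc s).mul (isChar_lSpin loc t)).le_one ω

lemma Zdual_ratio_le {n : ℕ} (hn : 2 ≤ n) {a b : ℤ} (ha : 0 ≤ a) (han : a ≤ n) (hb : 0 ≤ b) (hbn : b ≤ n)
    {β₀ β₁ m : ℝ} (h0 : 0 < β₀) (h01 : β₀ ≤ β₁) (hm0 : 0 < m) (hm : ∀ k, m ≤ mag β₀ k) :
    Zdual n 1 a b true β₁ / Zdual n 1 a b false β₁ ≤ exp (-((n - 1 : ℝ) * (2 * m ^ 2) * (β₁ - β₀))) := by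
  have key := mul_sub_le_of_hasDerivAt h01 (fun s => (hasDerivAt_log_Zdual n 1 a b false s).sub (hasDerivAt_log_Zdual n 1 a b true s))
    (m := (n - 1 : ℝ) * (2 * m ^ 2)) (fun s hs => by
      exact interface_cost hn a b (h0.le.trans hs.1) hm0 fun k => (hm k).trans (mag_mono_beta h0 hs.1 k))
  obtain ⟨β', _, hd⟩ := exists_tanh_eq (exp_pos (-2 * β₀)) (Real.exp_lt_one_iff.2 (by linarith))
  have hle := locCorr_le_one (locF (sSites n)) β' (sBonds n 1 (n - 1)) (1, a) ((n : ℤ), b)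
  rw [locCorr_locF hn subset_rfl ha han hb hbn hd, div_le_one (Zdual_pos _ _ _ _ _ _)] at hle
  have hlog := log_le_log (Zdual_pos n 1 a b true β₀) hle
  simp at key
  rw [← Real.log_le_iff_le_exp (div_pos (Zdual_pos _ _ _ _ _ _) (Zdual_pos _ _ _ _ _ _)),
    log_div (Zdual_pos _ _ _ _ _ _).ne' (Zdual_pos _ _ _ _ _ _).ne']
  linarith

lemma crossCorr_le_sq {n : ℕ} (hn : 2 ≤ n) {β C : ℝ} (hβ : 0 ≤ β) (hC : ∀ a b : ℤ, 0 ≤ a → a ≤ n → 0 ≤ b → b ≤ n →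
      locCorr (locF (sSites n)) β (sBonds n 1 (n - 1)) (1, a) ((n : ℤ), b) ≤ C) :
    crossCorr n β ≤ β ^ 2 * ((n + 1) ^ 2 * C) := by
  have h1 : ∀ x ∈ sSites n, (1 : ℤ) ≤ x.1 := by grind [mem_sSites]
  have hin : ∀ {i j : ℤ}, 1 ≤ i → i ≤ n → 0 ≤ j → j ≤ n → (locF (sSites n) (i, j)).isSome := by simp_all [locF, mem_sSites]
  have hout : ∀ {i j : ℤ}, i ≤ 0 → locF (sSites n) (i, j) = none := by grind [locF]
  have hin1 : ∀ j ∈ Icc 0 (n : ℤ), locCorr (fun x => (locS n (sSites n) x).join) β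
      (sBonds n 0 (n - 1)) (0, 0) ((n : ℤ), j) ≤ β * ((n + 1) * C) := by
    intro j hj
    rw [mem_Icc] at hj
    rw [locCorr_congr (loc' := locF (sSites n)) β _ (join_locS h1 (by simp)) (join_locS h1 le_rfl), locCorr_comm,
      sBonds_left n _ (by omega)]
    · obtain ⟨z₀, hz₀⟩ := Option.isSome_iff_exists.1 (hin (i := n) (j := j) (by omega) le_rfl hj.1 hj.2)
      refine (locCorr_le_sum (locF (sSites n)) hβ ?_ hz₀ (hout le_rfl) btgt ?_ ?_).trans ?_
      · grind [Finset.disjoint_left, mem_sBonds_true]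
      · simp [mem_sBonds_false, btgt, bstep, mem_sBonds_true]; grind
      · simp [mem_image, btgt, bstep]; grind
      · rw [sum_image (by simp_all)]
        refine mul_le_mul_of_nonneg_left ((sum_le_card_nsmul _ _ C fun k hk => ?_).trans_eq (by simp)) hβ
        simp_all [locCorr_comm, btgt, bstep]
    · rintro ⟨⟨i, k⟩, c⟩ hp
      cases c
      · have h := mem_sBonds_false.1 hp
        exact ⟨join_locS h1 (by simp; omega), join_locS h1 (by simp [btgt, bstep]; omega)⟩
      · have h := mem_sBonds_true.1 hp
        exact ⟨join_locS h1 (by simp; omega), join_locS h1 (by simp [btgt, bstep]; omega)⟩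
  refine (locCorr_cross_le subset_rfl hβ).trans ?_
  refine (mul_le_mul_of_nonneg_left (sum_le_card_nsmul _ _ _ hin1) hβ).trans_eq ?_
  simp
  ring

lemma tendsto_sq_mul_exp {c : ℝ} (hc : 0 < c) (K : ℝ) :
    Tendsto (fun n : ℕ => K * (((n : ℝ) + 1) ^ 2 * exp (-((n - 1 : ℝ) * c)))) atTop (𝓝 0) := by
  have h1 : Tendsto (fun n : ℕ => c * ((n : ℝ) + 1)) atTop atTop :=
    (tendsto_natCast_atTop_atTop.atTop_add tendsto_const_nhds).const_mul_atTop hc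
  have h2 := ((Real.tendsto_pow_mul_exp_neg_atTop_nhds_zero 2).comp h1).const_mul (K * exp (2 * c) / c ^ 2)
  rw [mul_zero] at h2
  refine h2.congr fun n => ?_
  have e : exp (-((n - 1 : ℝ) * c)) = exp (2 * c) * exp (-(c * (n + 1))) := by rw [← exp_add]; ring
  simp
  rw [e]
  field_simp

lemma tendsto_mag_or {β : ℝ} (hβ : 0 ≤ β) : NoMag β ∨ ∃ m, 0 < m ∧ ∀ n, m ≤ mag β n := by
  have ht := tendsto_atTop_ciInf (mag_antitone hβ) ⟨0, by rintro _ ⟨n, rfl⟩; exact mag_nonneg hβ n⟩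
  rcases (le_ciInf fun n => mag_nonneg hβ n : 0 ≤ ⨅ n, mag β n).eq_or_lt with h | h
  · grind
  · exact Or.inr ⟨_, h, fun n => ciInf_le ⟨0, by rintro _ ⟨n, rfl⟩; exact mag_nonneg hβ n⟩ n⟩

/-- Below the self-dual point there is no spontaneous magnetisation. -/
theorem tendsto_mag_of_lt {β : ℝ} (h0 : 0 < β) (h1 : β < betaC) : NoMag β := by
  refine (tendsto_mag_or h0.le).resolve_right ?_
  rintro ⟨m, hm0, hm⟩
  obtain ⟨β₁, hβ, hβ₁⟩ := exists_between h1
  obtain ⟨β', h0', hd⟩ := exists_tanh_eq (exp_pos (-2 * β₁)) (Real.exp_lt_one_iff.2 (by linarith))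
  have hc : betaC ≤ β' := by
    refine tanh_strictMono.le_iff_le.1 ?_
    grind [tanh_betaC, exp_le_exp]
  have hlim := tendsto_sq_mul_exp (c := 2 * m ^ 2 * (β₁ - β)) (by simp_all) (β' ^ 2)
  obtain ⟨n, hlt, hn⟩ := ((hlim.eventually (gt_mem_nhds (by norm_num : (0 : ℝ) < 2 / 5))).and (eventually_ge_atTop 2)).exists
  have hle := crossCorr_le_sq hn (C := exp (-((n - 1 : ℝ) * (2 * m ^ 2 * (β₁ - β))))) h0'.le (fun a b ha han hb hbn => by
      rw [locCorr_locF hn subset_rfl ha han hb hbn hd]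
      have := Zdual_ratio_le hn ha han hb hbn h0 hβ.le hm0 hm
      grind)
  have := (crossCorr_betaC_pos hn).trans (crossCorr_mono n betaC_pos.le hc)
  linarith

/-- Below the critical point the magnetisation decays faster than the inverse of the size. -/
theorem tendsto_mul_mag_of_lt {β : ℝ} (h0 : 0 < β) (h1 : β < betaC) : Tendsto (fun n : ℕ => (n : ℝ) * mag β n) atTop (𝓝 0) := by
  obtain ⟨β₁, hβ, hβ₁⟩ := exists_between h1
  grind [tendsto_mul_mag, tendsto_mag_of_lt]

/-- Above the critical point there is spontaneous magnetisation. -/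
theorem exists_le_mag_of_gt {β : ℝ} (h1 : betaC < β) : ∃ m, 0 < m ∧ ∀ n, m ≤ mag β n := by
  refine (tendsto_mag_or (betaC_pos.trans h1).le).resolve_left fun h => ?_
  have h2 := tendsto_mul_mag betaC_pos h1 h
  obtain ⟨n, hlt, hn⟩ := ((h2.eventually (gt_mem_nhds (show (0 : ℝ) < 2 / 15 / betaC by
    simp_all [betaC_pos]))).and (eventually_ge_atTop 1)).exists
  have := crossCorr_le_mag (n := n + 1) (by omega) betaC_pos.le tanh_betaC
  have h3 := crossCorr_betaC_pos (n := n + 1) (by omega)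
  push_cast at this
  have h4 := mag_nonneg betaC_pos.le n
  rw [lt_div_iff₀ betaC_pos] at hlt
  have hn' : (1 : ℝ) ≤ n := by simp_all
  nlinarith

lemma exists_antidiff (h : ℤ → Bool) (m : ℤ) :
    ∃ I : ℤ → Bool, (∀ j, j < m → I j = false) ∧ ∀ j, m ≤ j → I j = ((I (j - 1)) ^^ (h j)) := by
  let r : ℕ → Bool := fun n => Nat.rec false (fun k b => b ^^ h (m + k)) n
  refine ⟨fun j => r (j - m + 1).toNat, fun j hj => ?_, fun j hj => ?_⟩
  · simp [Int.toNat_of_nonpos (show j - m + 1 ≤ 0 by omega)]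
    rfl
  · obtain ⟨k, rfl⟩ : ∃ k : ℕ, j = m + k := ⟨(j - m).toNat, by omega⟩
    simp [show (m + k - 1 - m + 1 : ℤ).toNat = k by omega]
    rfl

/-- A curl-free edge set with bounded support is the boundary of a bounded set of dual sites. -/
lemma exists_potential (h v : ℤ → ℤ → Bool) (m : ℤ) (hm : 0 ≤ m) (hh : ∀ i j, h i j = true → |i| ≤ m ∧ |j| ≤ m)
    (hv : ∀ i j, v i j = true → |i| ≤ m ∧ |j| ≤ m)
    (hc : ∀ i j, (h i j ^^ h (i - 1) j) = (v i j ^^ v i (j - 1))) :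
    ∃ I : ℤ → ℤ → Bool, (∀ i j, I i j = true → |i| ≤ m ∧ |j| ≤ m) ∧
      (∀ i j, I i j = (I i (j - 1) ^^ h i j)) ∧ ∀ i j, I i j = (I (i - 1) j ^^ v i j) := by
  choose I hI0 hI1 using fun i => exists_antidiff (h i) (-m)
  have low : ∀ j, j < -m → ¬ (|j| ≤ m) := fun j hj hn => by grind
  have h1 : ∀ i j, I i j = (I i (j - 1) ^^ h i j) := by grind
  have h2 : ∀ i j, I i j = (I (i - 1) j ^^ v i j) := by
    intro i j
    rcases lt_or_ge j (-m) with hj | hj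
    · grind
    · have : ∀ j, -m - 1 ≤ j → I i j = (I (i - 1) j ^^ v i j) := by
        intro j hj
        induction j, hj using leInduction with
        | base => grind
        | succ k hk ih =>
          have := hc i (k + 1)
          rw [h1 i, h1 (i - 1), add_sub_cancel_right, ih]
          rw [add_sub_cancel_right] at this
          revert this
          cases h i (k + 1) <;> cases h (i - 1) (k + 1) <;> cases v i (k + 1) <;> cases v i k <;>
            cases I (i - 1) k <;> simp
      grind
  have hi : ∀ i j, m < |i| → I i j = false := by
    intro i j hi
    rcases lt_or_ge j (-m) with hj | hj
    · grind
    · have : ∀ j, -m - 1 ≤ j → I i j = false := by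
        intro j hj
        induction j, hj using leInduction with
        | base => grind
        | succ k hk ih => grind
      grind
  refine ⟨I, fun i j e => ?_, h1, h2⟩
  by_contra hn
  rw [not_and_or, not_le, not_le] at hn
  rcases hn with hn | hn
  · grind
  · have : ∀ i, -m - 1 ≤ i → I i j = false := by
      intro i hj
      induction i, hj using leInduction with
      | base => grind
      | succ k hk ih => grind
    grind

def starAdj (u v : V) : Prop := |v.1 - u.1| ≤ 1 ∧ |v.2 - u.2| ≤ 1

/-- `y` can be reached from `x` by a `*`-path whose sites, except possibly `x`, have spin `b`. -/
def starReach (b : Bool) (σ : Ω) : V → V → Prop := ReflTransGen fun u v => starAdj u v ∧ σ v = b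

def finStar (b : Bool) : Set Ω := {σ | ∀ x, {y | starReach b σ x y}.Finite}

lemma openAdj_symm {ω : Config} {x y : V} (h : openAdj ω x y) : openAdj ω y x := by grind [openAdj]

lemma openAdj_of_ne_h {σ : Ω} {i j : ℤ} (h : σ (i, j) ≠ σ (i, j - 1)) : openAdj (contour σ) (i, j) (i + 1, j) :=
  ⟨⟨_, _, by simp [latAdj], rfl⟩, by simpa [contour, contourPair, dualSites] using h⟩

lemma openAdj_of_ne_v {σ : Ω} {i j : ℤ} (h : σ (i, j) ≠ σ (i - 1, j)) : openAdj (contour σ) (i, j) (i, j + 1) :=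
  ⟨⟨_, _, by simp [latAdj], rfl⟩, by simpa [contour, contourPair, dualSites] using h⟩

lemma bool_xor_mask {a b c d : Bool} {P Q R : Prop} [Decidable P] [Decidable Q] [Decidable R]
    (h1 : a ≠ b → (Q ↔ P)) (h2 : c ≠ b → (R ↔ P)) :
    ((decide (d ≠ a ∧ P) : Bool) ^^ decide (c ≠ b ∧ R)) = (decide (d ≠ c ∧ P) ^^ decide (a ≠ b ∧ Q)) := by
  by_cases hP : P <;> by_cases hQ : Q <;> by_cases hR : R <;>
    simp only [hP, hQ, hR, iff_true, iff_false, imp_false, ne_eq, not_not, not_true_eq_false] at h1 h2 <;>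
    revert h1 h2 <;> simp only [hP, hQ, hR] <;> revert a b c d <;> decide

lemma eq_of_corner {α : Type*} {g : V → α} {u v : V} (huv : starAdj u v) (h : g (u.1 ⊔ v.1, u.2 ⊔ v.2) = g (u.1 ⊔ v.1, u.2 ⊔ v.2 - 1) ∧
      g (u.1 ⊔ v.1, u.2 ⊔ v.2) = g (u.1 ⊔ v.1 - 1, u.2 ⊔ v.2) ∧
      g (u.1 ⊔ v.1, u.2 ⊔ v.2) = g (u.1 ⊔ v.1 - 1, u.2 ⊔ v.2 - 1)) : g u = g v := by
  obtain ⟨h1, h2⟩ := huv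
  grind

/-- If the contours do not percolate then one of the two spins has no infinite `*`-cluster. -/
theorem finStar_of_not_percolate {σ : Ω} (hσ : ¬ HasInfiniteCluster (contour σ)) : σ ∈ finStar true ∨ σ ∈ finStar false := by
  classical
  by_contra hn
  rw [not_or] at hn
  obtain ⟨hn1, hn2⟩ := hn
  simp only [finStar, Set.mem_ofPred_eq, not_forall] at hn1 hn2
  obtain ⟨x, hx⟩ := hn1
  obtain ⟨x', hx'⟩ := hn2
  unfold HasInfiniteCluster at hσ
  push Not at hσ
  let M : ℕ := nrm x + nrm x' + 2
  let C : Set V := ⋃ p ∈ boxAt 0 M, cluster (contour σ) p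
  have hCfin : C.Finite := (boxAt 0 M).finite_toSet.biUnion fun p _ => hσ p
  have hbox : ∀ p, p ∈ boxAt 0 M → p ∈ C := fun p hp => Set.mem_biUnion hp ReflTransGen.refl
  have hcl : ∀ p q, openAdj (contour σ) p q → (p ∈ C ↔ q ∈ C) := by
    have : ∀ p q, openAdj (contour σ) p q → p ∈ C → q ∈ C := by
      intro p q hpq hp
      simp only [C, Set.mem_iUnion] at hp ⊢
      obtain ⟨r, hr, hp⟩ := hp
      exact ⟨r, hr, ReflTransGen.tail hp hpq⟩
    grind [openAdj_symm]
  obtain ⟨m, hm⟩ := exists_boxAt_subset hCfin.toFinset 0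
  have hCm : ∀ i j : ℤ, (i, j) ∈ C → |i| ≤ m ∧ |j| ≤ m := fun i j h => by
    simpa [mem_boxAt] using hm (i, j) (hCfin.mem_toFinset.2 h) (show (i, j) ∈ boxAt (i, j) 0 by simp [mem_boxAt])
  have ch : ∀ i j : ℤ, σ (i, j) ≠ σ (i, j - 1) → ((i, j) ∈ C ↔ (i + 1, j) ∈ C) := fun i j h => hcl _ _ (openAdj_of_ne_h h)
  have cv : ∀ i j : ℤ, σ (i, j) ≠ σ (i - 1, j) → ((i, j) ∈ C ↔ (i, j + 1) ∈ C) := fun i j h => hcl _ _ (openAdj_of_ne_v h)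
  obtain ⟨I, hI, hIh, hIv⟩ := exists_potential (fun i j => decide (σ (i, j) ≠ σ (i, j - 1) ∧ (i, j) ∈ C))
    (fun i j => decide (σ (i, j) ≠ σ (i - 1, j) ∧ (i, j) ∈ C)) m (by positivity)
    (fun i j h => hCm i j (of_decide_eq_true h).2) (fun i j h => hCm i j (of_decide_eq_true h).2) (by
      intro i j
      refine bool_xor_mask (fun h => ?_) fun h => ?_
      · grind
      grind)
  -- around a vertex of `C`, the flipped configuration is constant; elsewhere `I` is constant
  have key : ∀ i j : ℤ, ((i, j) ∈ C →
      (σ (i, j) ^^ I i j) = (σ (i, j - 1) ^^ I i (j - 1)) ∧ (σ (i, j) ^^ I i j) = (σ (i - 1, j) ^^ I (i - 1) j) ∧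
      (σ (i, j) ^^ I i j) = (σ (i - 1, j - 1) ^^ I (i - 1) (j - 1))) ∧
      ((i, j) ∉ C → I i j = I i (j - 1) ∧ I i j = I (i - 1) j ∧ I i j = I (i - 1) (j - 1)) := by
    intro i j
    have e1 := hIh i j
    have e2 := hIv i j
    have e3 := hIv i (j - 1)
    have c1 := cv i (j - 1)
    rw [sub_add_cancel] at c1
    constructor
    · intro hC
      have e4 : I i (j - 1) = (I (i - 1) (j - 1) ^^ decide (σ (i, j - 1) ≠ σ (i - 1, j - 1))) := by
        rw [e3]; congr 2
        exact propext ⟨fun h => h.1, fun h => ⟨h, (c1 h).2 hC⟩⟩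
      simp [hC] at e1 e2
      clear e3 c1
      generalize I i (j - 1) = b at *
      generalize I (i - 1) j = c at *
      generalize I (i - 1) (j - 1) = d at *
      generalize σ (i, j) = a' at *
      generalize σ (i, j - 1) = b' at *
      generalize σ (i - 1, j) = c' at *
      generalize σ (i - 1, j - 1) = d' at *
      subst e4
      rw [e2] at e1 ⊢
      clear e2
      revert a' b' c' d' c d
      decide
    · intro hC
      have e4 : I i (j - 1) = I (i - 1) (j - 1) := by rw [e3, decide_eq_false (fun h => hC ((c1 h.1).1 h.2)), Bool.xor_false]
      simp [hC] at e1 e2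
      grind
  have adjC : ∀ u v : V, starAdj u v → (u.1 ⊔ v.1, u.2 ⊔ v.2) ∈ C → (σ u ^^ I u.1 u.2) = (σ v ^^ I v.1 v.2) := fun u v huv hC =>
    eq_of_corner (g := fun u => (σ u ^^ I u.1 u.2)) huv ((key _ _).1 hC)
  have adjI : ∀ u v : V, starAdj u v → σ u = σ v → I u.1 u.2 = I v.1 v.2 := by
    intro u v huv he
    by_cases hC : (u.1 ⊔ v.1, u.2 ⊔ v.2) ∈ C
    · have := adjC u v huv hC
      rw [he] at this
      exact Bool.xor_right_inj.1 this
    · exact eq_of_corner (g := fun u => I u.1 u.2) huv ((key _ _).2 hC)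
  have const : ∀ k : ℕ, k ≤ M → ∀ u : V, nrm u ≤ k → (σ u ^^ I u.1 u.2) = (σ 0 ^^ I 0 0) := by
    intro k
    induction k with
    | zero =>
      rintro - ⟨a, b⟩ hu
      simp [nrm] at hu
      obtain ⟨rfl, rfl⟩ : a = 0 ∧ b = 0 := by omega
      rfl
    | succ k ih =>
      rintro hk ⟨a, b⟩ hu
      have hs : ∀ z : ℤ, z.natAbs ≤ k + 1 → |z - z.sign - z| ≤ 1 ∧ (z - z.sign).natAbs ≤ k ∧ (z ⊔ (z - z.sign)).natAbs ≤ k + 1 := by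
        intro z hz
        rcases lt_trichotomy z 0 with h | rfl | h
        · rw [Int.sign_eq_neg_one_of_neg h, abs_le]; omega
        · simp
        · rw [Int.sign_eq_one_of_pos h, abs_le]; omega
      simp [nrm] at hu
      obtain ⟨a1, a2, a3⟩ := hs a hu.1
      obtain ⟨b1, b2, b3⟩ := hs b hu.2
      rw [← ih (by omega) (a - a.sign, b - b.sign) (max_le a2 b2)]
      exact adjC _ _ ⟨a1, b1⟩ (hbox _ (mem_boxAt_zero.2 ((max_le a3 b3).trans hk)))
  have fin : ∀ (b : Bool) (z : V), nrm z + 1 ≤ M → (σ 0 ^^ I 0 0) = !b → {y | starReach b σ z y}.Finite := by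
    intro b z hz hb
    refine ((boxAt 0 m).finite_toSet.insert z).subset fun y hy => ?_
    have : y = z ∨ σ y = b ∧ I y.1 y.2 = true := by
      induction hy with
      | refl => exact Or.inl rfl
      | @tail y w _ hw ih =>
        refine Or.inr ⟨hw.2, ?_⟩
        rcases ih with rfl | ⟨h1, h2⟩
        · have h3 := const M le_rfl w ?_
          · rw [hb, hw.2] at h3
            revert h3
            cases b <;> cases I w.1 w.2 <;> simp
          · have h1 := hw.1.1
            have h2 := hw.1.2
            rw [abs_le] at h1 h2
            simp [nrm] at hz ⊢
            omega
        · exact (adjI _ _ hw.1 (h1.trans hw.2.symm)).symm.trans h2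
    rcases this with rfl | h
    · simp
    · refine Set.mem_insert_of_mem _ ?_
      simpa [mem_boxAt] using hI _ _ h.2
  rcases hc : (σ 0 ^^ I 0 0) with _ | _
  · exact hx (fin true x (by omega) hc)
  · exact hx' (fin false x' (by omega) hc)

/-- Whether the edge between two sites separates a site of `D` from a site of `U \ D`. -/
def cornerEdge (d u d' u' : Bool) : Bool := (d && !d' && u') || (d' && !d && u)

lemma cornerEdge_even {a a' b b' c c' d d' : Bool}
    (h : (((a || b) || c) || d) = true → (a = false → b = false → a' = b') ∧ (a = false → c = false → a' = c') ∧
      (b = false → d = false → b' = d') ∧ (c = false → d = false → c' = d')) :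
    (cornerEdge a a' b b' ^^ cornerEdge c c' d d') = (cornerEdge a a' c c' ^^ cornerEdge b b' d d') := by
  revert a a' b b' c c' d d'
  decide

/-- If there is no infinite `*`-cluster of minus spins, some path of plus spins joins the two
half-axes outside a given box. -/
theorem exists_plus_path {σ : Ω} (hσ : σ ∈ finStar false) (n : ℕ) : ∃ j k : ℤ, n ≤ j ∧ 0 ≤ k ∧ ReflTransGen
      (fun u v => (∃ i, v = u + dir i) ∧ σ v = true) ((j, 0) : V) (-k, 0) := by
  classical
  by_contra hn
  push Not at hn
  let D : Set V := {y | ∃ x ∈ boxAt 0 n, starReach false σ x y}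
  have hDfin : D.Finite := by
    refine ((boxAt 0 n).finite_toSet.biUnion fun p _ => hσ p).subset ?_
    rintro y ⟨x, hx, h⟩
    exact Set.mem_biUnion hx h
  have hD0 : ∀ u : V, nrm u ≤ n → u ∈ D := fun u hu => ⟨u, mem_boxAt_zero.2 hu, ReflTransGen.refl⟩
  have hDp : ∀ u v : V, u ∈ D → starAdj u v → v ∉ D → σ v = true := by
    rintro u v ⟨x, hx, h⟩ huv hv
    by_contra hs
    exact hv ⟨x, hx, h.tail ⟨huv, Bool.eq_false_iff.2 hs⟩⟩
  obtain ⟨m, hm⟩ := exists_boxAt_subset hDfin.toFinset 1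
  let U : Set V := {v | ∃ j : ℤ, 0 ≤ j ∧ ((j, 0) : V) ∉ D ∧ ReflTransGen (fun u v => (∃ i, v = u + dir i) ∧ σ v = true) ((j, 0) : V) v}
  let E : V → V → Bool := fun u v => cornerEdge (decide (u ∈ D)) (decide (u ∈ U)) (decide (v ∈ D)) (decide (v ∈ U))
  have hU : ∀ u v, (∃ i, v = u + dir i) → σ u = true → σ v = true → (u ∈ U ↔ v ∈ U) := by
    rintro u v ⟨i, rfl⟩ h1 h2
    constructor
    · grind
    · obtain ⟨i', hi'⟩ := dir_neg i
      grind
  have hEm : ∀ u v : V, starAdj u v → E u v = true → |u.1| ≤ m ∧ |u.2| ≤ m := by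
    intro u v huv hE
    have hE' : u ∈ D ∨ v ∈ D := by grind [cornerEdge]
    have : u ∈ boxAt 0 m := by
      rcases hE' with h | h
      · exact hm u (hDfin.mem_toFinset.2 h) (by simp [mem_boxAt])
      · refine hm v (hDfin.mem_toFinset.2 h) ?_
        rw [mem_boxAt, abs_sub_comm, abs_sub_comm u.2]
        exact_mod_cast huv
    simp_all [mem_boxAt]
  obtain ⟨I, hI, -, hIv⟩ := exists_potential (fun i j => E (i, j) (i, j - 1)) (fun i j => E (i, j) (i - 1, j)) m
    (by positivity) (fun i j h => hEm (i, j) (i, j - 1) (by simp [starAdj]) h)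
    (fun i j h => hEm (i, j) (i - 1, j) (by simp [starAdj]) h) (by
      intro i j
      have adj : ∀ p q : V, p ∈ ({(i, j), (i, j - 1), (i - 1, j), (i - 1, j - 1)} : Set V) →
          q ∈ ({(i, j), (i, j - 1), (i - 1, j), (i - 1, j - 1)} : Set V) → starAdj p q := by
        rintro p q (rfl | rfl | rfl | rfl) (rfl | rfl | rfl | rfl) <;> simp [starAdj]
      have hUU : ∀ p ∈ ({(i, j), (i, j - 1), (i - 1, j), (i - 1, j - 1)} : Set V), p ∈ D →
          ∀ u ∈ ({(i, j), (i, j - 1), (i - 1, j), (i - 1, j - 1)} : Set V),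
          ∀ v ∈ ({(i, j), (i, j - 1), (i - 1, j), (i - 1, j - 1)} : Set V), (∃ i, v = u + dir i) →
          u ∉ D → v ∉ D → (u ∈ U ↔ v ∈ U) := fun p hp hpD u hu v hv huv hu' hv' =>
        hU u v huv (hDp p u hpD (adj p u hp hu) hu') (hDp p v hpD (adj p v hp hv) hv')
      refine cornerEdge_even ?_
      simp only [Bool.or_eq_true, decide_eq_true_eq, decide_eq_false_iff_not, decide_eq_decide]
      intro hD
      obtain ⟨p, hp, hpD⟩ : ∃ p ∈ ({(i, j), (i, j - 1), (i - 1, j), (i - 1, j - 1)} : Set V), p ∈ D := by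
        rcases hD with ((h | h) | h) | h <;> grind
      have d1 : dir 1 = (-1, 0) := rfl
      have d3 : dir 3 = (0, -1) := rfl
      refine ⟨hUU p hp hpD _ (by simp) _ (by simp) ⟨3, ?_⟩, hUU p hp hpD _ (by simp) _ (by simp) ⟨1, ?_⟩,
        hUU p hp hpD _ (by simp) _ (by simp) ⟨1, ?_⟩, hUU p hp hpD _ (by simp) _ (by simp) ⟨3, ?_⟩⟩ <;>
      simp [d1, d3, sub_eq_add_neg])
  have hneg : ∀ j : ℤ, 0 ≤ j → ((-j, 0) : V) ∉ D → ((-j, 0) : V) ∉ U := by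
    rintro j hj hjD ⟨k, hk, hkD, h⟩
    refine hn k j ?_ hj h
    by_contra hlt
    exact hkD (hD0 _ (by simp only [nrm]; omega))
  have hm1 : ∀ j : ℤ, (m : ℤ) < |j| → I j 0 = false ∧ ((j, 0) : V) ∉ D := by
    refine fun j hj => ⟨Bool.eq_false_iff.2 fun h => not_le.2 hj (hI j 0 h).1, fun h => ?_⟩
    have := hm _ (hDfin.mem_toFinset.2 h) (show ((j, 0) : V) ∈ boxAt (j, 0) 1 by simp [mem_boxAt])
    rw [mem_boxAt] at this
    simp at this
    omega
  -- along the negative half-axis nothing is crossed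
  have left : ∀ j : ℤ, -m - 1 ≤ j → j ≤ 0 → I j 0 = false := by
    intro j hj
    induction j, hj using leInduction with
    | base => exact fun _ => (hm1 _ (by grind [abs_of_nonpos])).1
    | succ k hk ih =>
      intro h0
      rw [hIv, add_sub_cancel_right, ih (by omega)]
      have h1 := hneg (-k) (by omega)
      have h2 := hneg (-(k + 1)) (by omega)
      rw [neg_neg] at h1 h2
      simp only [E, cornerEdge]
      by_cases a : ((k, 0) : V) ∈ D <;> by_cases b : ((k + 1, 0) : V) ∈ D <;> simp [a, b]
      · exact h2 b
      grind
  -- along the positive half-axis every boundary edge of `D` is crossed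
  have right : ∀ j : ℤ, j ≤ m + 1 → 0 ≤ j → I j 0 = decide (((j, 0) : V) ∈ D) := by
    intro j hj
    induction j, hj using Int.leInductionDown with
    | base =>
      intro _
      obtain ⟨h1, h2⟩ := hm1 (m + 1) (by grind [abs_of_nonneg])
      grind
    | pred k hk ih =>
      intro h0
      have h1 := hIv k 0
      have hp : ∀ l : ℤ, 0 ≤ l → ((l, 0) : V) ∉ D → ((l, 0) : V) ∈ U := fun l hl hD => ⟨l, hl, hD, .refl⟩
      have h2 := hp k (by omega)
      have h3 := hp (k - 1) h0
      simp only [E, cornerEdge] at h1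
      by_cases a : ((k, 0) : V) ∈ D <;> by_cases b : ((k - 1, 0) : V) ∈ D <;>
        simp only [a, b, not_true_eq_false, not_false_eq_true, false_implies, true_implies] at h1 h2 h3 ⊢ <;>
        revert h1 <;> grind
  have h1 := left 0 (by omega) le_rfl
  rw [right 0 (by omega) le_rfl] at h1
  exact of_decide_eq_false h1 (hD0 _ (by simp [nrm]))

lemma isOpen_starReach (b : Bool) (x y : V) : IsOpen {σ | starReach b σ x y} := by
  rw [isOpen_iff_eventually]
  intro σ h
  induction h with
  | refl => exact Eventually.of_forall fun _ => .refl
  | @tail y w _ hw ih =>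
    have : ∀ᶠ τ : Ω in nhds σ, τ w = b := by
      have := (continuous_apply w).continuousAt (x := σ).eventually (p := fun c => c = b) (mem_nhds_discrete.2 hw.2)
      exact this
    filter_upwards [ih, this] with τ h1 h2 using h1.tail ⟨hw.1, h2⟩

lemma measurableSet_finStar (b : Bool) : MeasurableSet (finStar b) := by
  have : finStar b = ⋂ x : V, ⋃ N : ℕ, ⋂ y : V, ⋂ _ : y ∉ boxAt 0 N, {σ | starReach b σ x y}ᶜ := by
    ext σ
    simp only [Set.mem_iInter, Set.mem_iUnion]
    refine forall_congr' fun x => ⟨fun h => ?_, fun ⟨N, h⟩ => ?_⟩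
    · obtain ⟨N, hN⟩ := exists_boxAt_subset h.toFinset 0
      refine ⟨N, fun y hy hr => hy (hN y (h.mem_toFinset.2 hr) ?_)⟩
      simp [mem_boxAt]
    · exact (boxAt 0 N).finite_toSet.subset fun y hy => by_contra fun h' => h y h' hy
  rw [this]
  exact MeasurableSet.iInter fun x => MeasurableSet.iUnion fun N => MeasurableSet.iInter fun y =>
    MeasurableSet.iInter fun _ => (isOpen_starReach b x y).measurableSet.compl

lemma isTail_finStar (b : Bool) : IsTail (finStar b) := by
  intro Λ σ τ h hσ x
  refine ((Λ.finite_toSet.insert x).biUnion fun z _ => hσ z).subset fun y hy => ?_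
  simp only [Set.mem_iUnion]
  induction hy with
  | refl => exact ⟨x, Set.mem_insert _ _, .refl⟩
  | @tail y w _ hw ih =>
    by_cases hwΛ : w ∈ Λ
    · exact ⟨w, Set.mem_insert_of_mem _ hwΛ, .refl⟩
    · obtain ⟨z, hz, hr⟩ := ih
      exact ⟨z, hz, ReflTransGen.tail hr ⟨hw.1, (h w hwΛ).trans hw.2⟩⟩

lemma finStar_flip (b : Bool) (σ : Ω) : flipBy (fun _ => true) σ ∈ finStar b ↔ σ ∈ finStar (!b) := by
  simp_all [starReach, flipBy, finStar]

lemma starAdj_dir (x : V) (i : Fin 4) : starAdj x (x + dir i) ∧ starAdj (x + dir i) x := by fin_cases i <;> simp [starAdj, dir]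

lemma PiOp_local {β : ℝ} {Λ : Finset V} {f : Ω → ℝ} {σ σ' : Ω} (h : ∀ x ∈ Λ, ∀ i, x + dir i ∉ Λ → σ (x + dir i) = σ' (x + dir i))
    (hf : ∀ η, f (spatch Λ η σ) = f (spatch Λ η σ')) : PiOp β Λ f σ = PiOp β Λ f σ' := by
  have hH : ∀ η, hamiltonian Λ (spatch Λ η σ) = hamiltonian Λ (spatch Λ η σ') := by
    intro η
    unfold hamiltonian
    rw [neg_inj]
    refine sum_congr rfl fun e he => ?_
    obtain ⟨x, hx, i, rfl⟩ := mem_dualEdges.1 he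
    rw [pairEnergy_mk, pairEnergy_mk, spatch_of_mem hx, spatch_of_mem hx]
    by_cases hi : x + dir i ∈ Λ
    · grind [spatch_of_mem]
    grind [spatch_notMem]
  grind [PiOp, Zpart]

/-- The sites reachable from outside `boxAt 0 N` by exploring neighbours of minus spins. -/
inductive Explored (N : ℕ) (σ : Ω) : V → Prop
  | out {x : V} (h : x ∉ boxAt 0 N) : Explored N σ x
  | step {x : V} (h : Explored N σ x) (hx : x ∉ boxAt 0 N ∨ σ x = false) (i : Fin 4) :
      Explored N σ (x + dir i)

lemma Explored.mono {N : ℕ} {σ τ : Ω} (h : ∀ x, Explored N σ x → σ x = τ x) {x : V} (hx : Explored N σ x) : Explored N τ x := by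
  induction hx with
  | out h => exact .out h
  | step h0 h1 i ih => exact .step ih (h1.imp_right fun e => (h _ h0) ▸ e) i

lemma Explored.mono' {N : ℕ} {σ τ : Ω} (h : ∀ x, Explored N σ x → σ x = τ x) {x : V} (hx : Explored N τ x) : Explored N σ x := by
  induction hx with
  | out h => exact .out h
  | step h0 h1 i ih => exact .step ih (h1.imp_right fun e => (h _ ih).trans e) i

lemma Explored.exists_reach {N : ℕ} {σ : Ω} {x : V} (hx : Explored N σ x) : ∃ z, starReach false σ x z ∧ N ≤ nrm z := by
  induction hx with
  | @out x h => exact ⟨x, .refl, by grind [mem_boxAt_zero]⟩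
  | @step x h hx i ih =>
    rcases hx with hx | hx
    · rw [mem_boxAt_zero] at hx
      have := nrm_add_dir x i
      exact ⟨_, .refl, by omega⟩
    · obtain ⟨z, hz, hN⟩ := ih
      exact ⟨z, .head ⟨(starAdj_dir x i).2, hx⟩ hz, hN⟩

/-- The sites of `boxAt 0 N` which are not explored. -/
def unexplored (N : ℕ) (σ : Ω) : Finset V := by classical exact {x ∈ boxAt 0 N | ¬ Explored N σ x}

lemma mem_unexplored {N : ℕ} {σ : Ω} {x : V} : x ∈ unexplored N σ ↔ ¬ Explored N σ x := by
  classical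
  unfold unexplored
  rw [mem_filter, and_iff_right_iff_imp]
  exact fun h => by_contra fun h' => h (.out h')

lemma unexplored_congr {N : ℕ} {σ τ : Ω} (h : ∀ x, x ∉ unexplored N σ → σ x = τ x) : unexplored N σ = unexplored N τ := by
  have h' : ∀ x, Explored N σ x → σ x = τ x := fun x hx => h x (by simp_all [mem_unexplored])
  ext x
  rw [mem_unexplored, mem_unexplored, not_iff_not]
  exact ⟨fun hx => hx.mono h', fun hx => hx.mono' h'⟩

lemma unexplored_dep (N : ℕ) {σ τ : Ω} (h : ∀ x ∈ boxAt 0 N, σ x = τ x) : unexplored N σ = unexplored N τ := by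
  have : ∀ {σ τ : Ω}, (∀ x ∈ boxAt 0 N, σ x = τ x) → ∀ {x}, Explored N σ x → Explored N τ x := by
    intro σ τ h x hx
    induction hx with
    | out h => exact .out h
    | @step x h0 h1 i ih =>
      refine .step ih ?_ i
      grind
  grind [mem_unexplored]

/-- Without infinite minus `*`-clusters, a ferromagnetic Gibbs measure has at least the plus
magnetisation. -/
theorem IsGibbsIsing.le_integral_spin {β : ℝ} {γ : Measure Ω} (hβ : 0 ≤ β) (hγ : IsGibbsIsing β γ)
    (hF : ∀ᵐ σ ∂γ, σ ∈ finStar false) {m : ℝ} (hm : ∀ n, m ≤ mag β n) :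
    m ≤ ∫ σ, spinVal (σ 0) ∂γ := by
  classical
  have := hγ.1
  have ms : Measurable fun σ : Ω => spinVal (σ 0) := measurable_spin 0
  let g : ℕ → Ω → ℝ := fun N σ => if (0 : V) ∈ unexplored N σ then m else -1
  let ind : ℕ → Finset V → Ω → ℝ := fun N D σ => if unexplored N σ = D then 1 else 0
  have indc : ∀ N D, Continuous (ind N D) := fun N D => SpinDep.continuous (A := boxAt 0 N) fun σ τ h => by grind [unexplored_dep]
  have gc : ∀ N, Continuous (g N) := fun N => SpinDep.continuous (A := boxAt 0 N) fun σ τ h => by grind [unexplored_dep]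
  have sumind : ∀ N σ (h : Ω → ℝ), h σ = ∑ D ∈ (boxAt 0 N).powerset, ind N D σ * h σ := by
    intro N σ h
    rw [← sum_mul, Finset.sum_ite_eq (boxAt 0 N).powerset (unexplored N σ) fun _ => (1:ℝ), if_pos, one_mul]
    exact mem_powerset.2 (Finset.filter_subset _ _)
  have step : ∀ N, ∫ σ, g N σ ∂γ ≤ ∫ σ, spinVal (σ 0) ∂γ := by
    intro N
    obtain ⟨C, hC⟩ := continuous_bounded _ (gc N)
    have i1 : ∀ D, Integrable (fun σ => ind N D σ * g N σ) γ := fun D =>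
      integrable_of_bounded ((indc N D).measurable.mul (gc N).measurable) (C := 1 * C) fun σ => by grind
    have b2 : ∀ D σ, |ind N D σ * spinVal (σ 0)| ≤ 1 := fun D σ => by grind [spinVal_abs]
    have m2 : ∀ D, Measurable fun σ => ind N D σ * spinVal (σ 0) := fun D => (indc N D).measurable.mul ms
    rw [integral_congr_ae (Eventually.of_forall fun σ => sumind N σ (g N)),
      integral_congr_ae (Eventually.of_forall fun σ => sumind N σ fun σ => spinVal (σ 0)),
      integral_finsetSum _ fun D _ => i1 D, integral_finsetSum _ fun D _ => integrable_of_bounded (m2 D) (b2 D)]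
    refine sum_le_sum fun D hD => ?_
    rw [hγ.integral_eq D (m2 D) (b2 D)]
    refine integral_mono (i1 D) (integrable_of_bounded (measurable_PiOp (m2 D)) fun σ => abs_PiOp_le D (b2 D) σ) fun σ => ?_
    have e : ∀ η, ind N D (spatch D η σ) = ind N D σ := by
      intro η
      simp [ind]
      congr 1
      refine propext ⟨fun h => ?_, fun h => ?_⟩
      · rw [← h]
        simp_all [unexplored_congr, spatch_notMem]
      · exact (unexplored_congr fun x hx => (spatch_notMem (h ▸ hx)).symm).symm.trans h
    have e' : PiOp β D (fun σ => ind N D σ * spinVal (σ 0)) σ = ind N D σ * PiOp β D (fun σ => spinVal (σ 0)) σ := by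
      rw [← PiOp_smul, PiOp_eq_sum_gp, PiOp_eq_sum_gp]
      grind
    simp only [e', ind, g]
    split_ifs with h1 h2
    · rw [one_mul, one_mul]
      have : PiOp β D (fun σ => spinVal (σ 0)) σ = PiOp β D (fun σ => spinVal (σ 0)) ⊤ := by
        refine PiOp_local (fun x hx i hi => ?_) fun η => by grind [spatch_of_mem]
        by_contra hne
        rw [← h1, mem_unexplored, not_not] at hi
        rw [← h1, mem_unexplored] at hx
        obtain ⟨j, hj⟩ := dir_neg i
        refine hx ?_
        rw [← add_neg_cancel_right x (dir i), ← hj]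
        exact .step hi (Or.inr (by simp_all)) j
      rw [this]
      exact (hm N).trans (PiOp_le_of_eq_top hβ (mem_powerset.1 hD) (spin_monotone 0))
    · rw [one_mul, one_mul]
      exact (abs_le.1 (abs_PiOp_le D (C := 1) (fun _ => (spinVal_abs _).le) σ)).1
    · grind
    grind
  refine le_of_tendsto' (x := atTop) (f := fun N => ∫ σ, g N σ ∂γ) ?_ step
  have := tendsto_integral_of_dominated_convergence (μ := γ) (F := g) (f := fun _ => m) (fun _ => |m| + 1)
    (fun N => (gc N).measurable.aestronglyMeasurable) (integrable_const _)
    (fun N => Eventually.of_forall fun σ => by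
      grind [Real.norm_eq_abs]) (by
      filter_upwards [hF] with σ hσ
      refine tendsto_const_nhds.congr' ?_
      obtain ⟨N, hN⟩ := exists_boxAt_subset (hσ 0).toFinset 0
      filter_upwards [eventually_gt_atTop N] with M hM
      refine (if_pos (mem_unexplored.2 fun h => ?_)).symm
      obtain ⟨z, hz, hz'⟩ := h.exists_reach
      have := hN z ((hσ 0).mem_toFinset.2 hz) (show z ∈ boxAt z 0 by simp [mem_boxAt])
      grind [mem_boxAt_zero])
  simp_all

def fewPlus (σ : Ω) (y : V) : Prop := ∀ i j : Fin 4, i ≠ j → σ (y + dir i) = false ∨ σ (y + dir j) = false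

lemma dir_injective : ∀ {i j : Fin 4}, dir i = dir j → i = j := by decide

lemma starAdj_symm {u v : V} (h : starAdj u v) : starAdj v u := by grind [starAdj]

lemma starAdj_cases {u v : V} (h : starAdj u v) : v = u ∨ (∃ i, v = u + dir i) ∨ ∃ i j, i ≠ j ∧ v = u + dir i + dir j := by
  obtain ⟨a, b⟩ := u
  obtain ⟨c, d⟩ := v
  obtain ⟨h1, h2⟩ := h
  simp [abs_le] at h1 h2
  have d0 : dir 0 = (1, 0) := rfl
  have d1 : dir 1 = (-1, 0) := rfl
  have d2 : dir 2 = (0, 1) := rfl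
  have d3 : dir 3 = (0, -1) := rfl
  obtain h1 | h1 | h1 : c = a + 1 ∨ c = a ∨ c = a - 1 := by omega
  all_goals obtain h2 | h2 | h2 : d = b + 1 ∨ d = b ∨ d = b - 1 := by omega
  · exact Or.inr (Or.inr ⟨0, 2, by decide, by simp_all⟩)
  · exact Or.inr (Or.inl ⟨0, by simp_all⟩)
  · exact Or.inr (Or.inr ⟨0, 3, by decide, by simp_all [sub_eq_add_neg]⟩)
  · exact Or.inr (Or.inl ⟨2, by simp_all⟩)
  · grind
  · exact Or.inr (Or.inl ⟨3, by simp_all [sub_eq_add_neg]⟩)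
  · exact Or.inr (Or.inr ⟨1, 2, by decide, by simp_all [sub_eq_add_neg]⟩)
  · exact Or.inr (Or.inl ⟨1, by simp_all [sub_eq_add_neg]⟩)
  · exact Or.inr (Or.inr ⟨1, 3, by decide, by simp_all [sub_eq_add_neg]⟩)

lemma dir_bridge (i j : Fin 4) : ∃ k l, k ≠ l ∧ (starAdj (dir i) (dir k) ∧ starAdj (dir k) (dir j)) ∧
    starAdj (dir i) (dir l) ∧ starAdj (dir l) (dir j) := by
  unfold starAdj
  revert i j
  decide

lemma starAdj_add (z u v : V) : starAdj (z + u) (z + v) ↔ starAdj u v := by simp [starAdj]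

section Neutral

variable {κ : V → Bool} (hκ : ∀ x i, κ (x + dir i) = !κ x) {σ : Ω}

/-- A minus site representing a site `z` which is minus or surrounded by minus sites. -/
def minusRep (κ : V → Bool) (σ : Ω) (z w : V) : Prop := σ w = false ∧ (w = z ∨ κ z = true ∧ fewPlus σ z ∧ ∃ i, w = z + dir i)

lemma minusRep_reach {z w w' : V} (h : minusRep κ σ z w) (h' : minusRep κ σ z w') : starReach false σ w w' := by
  obtain ⟨h0, rfl | ⟨-, hf, i, rfl⟩⟩ := h <;> obtain ⟨h0', rfl | ⟨-, hf', j, rfl⟩⟩ := h'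
  · exact .refl
  · exact .single ⟨(starAdj_dir _ _).1, h0'⟩
  · exact .single ⟨(starAdj_dir _ _).2, h0'⟩
  · obtain ⟨k, l, hkl, ⟨h1, h2⟩, h3, h4⟩ := dir_bridge i j
    rcases hf k l hkl with h | h
    · exact .tail (.single ⟨(starAdj_add z _ _).2 h1, h⟩) ⟨(starAdj_add z _ _).2 h2, h0'⟩
    · exact .tail (.single ⟨(starAdj_add z _ _).2 h3, h⟩) ⟨(starAdj_add z _ _).2 h4, h0'⟩

/-- Minus sites, together with the sites of one parity with at most one plus neighbour. -/
def minusOrFew (κ : V → Bool) (σ : Ω) (z : V) : Prop := σ z = false ∨ κ z = true ∧ fewPlus σ z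

include hκ in
lemma exists_minusRep {z z' : V} (hz : minusOrFew κ σ z) (hz' : minusOrFew κ σ z') (h : starAdj z z') :
    ∃ w w', minusRep κ σ z w ∧ minusRep κ σ z' w' ∧ starAdj w w' := by
  have main : ∀ z z' : V, minusOrFew κ σ z → κ z' = true ∧ fewPlus σ z' → starAdj z z' →
      ∃ w w', minusRep κ σ z w ∧ minusRep κ σ z' w' ∧ starAdj w w' := by
    intro z z' hz hz' h
    have hrefl : ∀ w, starAdj w w := fun w => by simp [starAdj]
    rcases starAdj_cases h with rfl | ⟨i, rfl⟩ | ⟨i, j, hij, rfl⟩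
    · rcases hz'.2 0 1 (by decide) with h | h <;>
        exact ⟨_, _, ⟨h, Or.inr ⟨hz'.1, hz'.2, _, rfl⟩⟩, ⟨h, Or.inr ⟨hz'.1, hz'.2, _, rfl⟩⟩, hrefl _⟩
    · obtain ⟨i', hi'⟩ := dir_neg i
      rcases hz with hz | hz
      · exact ⟨z, z, ⟨hz, Or.inl rfl⟩, ⟨hz, Or.inr ⟨hz'.1, hz'.2, i', by grind⟩⟩, hrefl _⟩
      grind
    · obtain ⟨i', hi'⟩ := dir_neg i
      obtain ⟨j', hj'⟩ := dir_neg j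
      have hij' : i' ≠ j' := by
        rintro rfl
        rw [hi', neg_inj] at hj'
        exact hij (dir_injective hj')
      have hm : ∃ k l, z + dir i + dir j + dir k = z + dir l ∧ σ (z + dir l) = false := by
        rcases hz'.2 i' j' hij' with h | h
        · grind
        grind
      obtain ⟨k, l, hkl, hl⟩ := hm
      have r' : minusRep κ σ (z + dir i + dir j) (z + dir l) := ⟨hl, Or.inr ⟨hz'.1, hz'.2, k, hkl.symm⟩⟩
      rcases hz with hz | hz
      · exact ⟨z, _, ⟨hz, Or.inl rfl⟩, r', (starAdj_dir _ _).1⟩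
      · exact ⟨_, _, ⟨hl, Or.inr ⟨hz.1, hz.2, l, rfl⟩⟩, r', hrefl _⟩
  rcases hz' with h' | h'
  · rcases hz with hz | hz
    · exact ⟨z, z', ⟨hz, Or.inl rfl⟩, ⟨h', Or.inl rfl⟩, h⟩
    · obtain ⟨w', w, h1, h2, h3⟩ := main z' z (Or.inl h') hz (starAdj_symm h)
      grind [starAdj_symm]
  grind

include hκ in
lemma finite_minusOrFew (hσ : σ ∈ finStar false) (x : V) :
    {y | ReflTransGen (fun u v => starAdj u v ∧ minusOrFew κ σ v) x y}.Finite := by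
  have hfin : (⋃ v ∈ boxAt x 2, ⋃ w ∈ {w | starReach false σ v w}, (boxAt w 1 : Set V)).Finite :=
    (boxAt x 2).finite_toSet.biUnion fun v _ => (hσ v).biUnion fun w _ => (boxAt w 1).finite_toSet
  refine (hfin.insert x).subset fun y hy => ?_
  have near : ∀ {z w}, minusRep κ σ z w → starAdj w z := by
    rintro z w ⟨-, rfl | ⟨-, -, i, rfl⟩⟩
    · simp [starAdj]
    · exact (starAdj_dir _ _).2
  have : y = x ∨ minusOrFew κ σ y ∧ ∃ v w, v ∈ boxAt x 2 ∧ starReach false σ v w ∧ minusRep κ σ y w := by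
    induction hy with
    | refl => grind
    | @tail y z _ hz ih =>
      refine Or.inr ⟨hz.2, ?_⟩
      rcases ih with rfl | ⟨hy, v, w, hv, hr, hw⟩
      · obtain ⟨w, -, hw, -⟩ := exists_minusRep hκ hz.2 hz.2 (by simp [starAdj])
        refine ⟨w, w, ?_, .refl, hw⟩
        have h1 := near hw
        have h2 := hz.1
        simp [starAdj, abs_le] at h1 h2
        rw [mem_boxAt, abs_le, abs_le]
        omega
      · obtain ⟨a, b, ha, hb, hab⟩ := exists_minusRep hκ hy hz.2 hz.1
        exact ⟨v, b, hv, (hr.trans (minusRep_reach hw ha)).tail ⟨hab, hb.1⟩, hb⟩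
  rcases this with rfl | ⟨-, v, w, hv, hr, hw⟩
  · grind
  · refine Set.mem_insert_of_mem _ (Set.mem_biUnion hv (Set.mem_biUnion hr ?_))
    have := near hw
    simp [mem_boxAt]
    exact_mod_cast this

end Neutral

lemma spatch_singleton (y : V) (b : Bool) (σ : Ω) : spatch {y} (fun _ => b) σ = update σ y b := by grind [spatch]

lemma gw_singleton (β : ℝ) (y : V) (b : Bool) (σ : Ω) :
    gw β {y} σ (fun _ => b) = exp (β * (spinVal b * ∑ i, spinVal (σ (y + dir i)))) := by
  unfold gw hamiltonian
  rw [spatch_singleton]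
  have : dualEdges {y} = univ.image fun i : Fin 4 => s(y, y + dir i) := by
    ext e
    rw [mem_dualEdges]
    simp
  rw [this, sum_image fun i _ j _ h => by grind [dir_injective], mul_sum]
  grind [pairEnergy_mk, dir_ne_zero]

lemma PiOp_singleton (β : ℝ) (y : V) (f : Ω → ℝ) (σ : Ω) : PiOp β {y} f σ = (gw β {y} σ (fun _ => true) * f (update σ y true) +
      gw β {y} σ (fun _ => false) * f (update σ y false)) /
      (gw β {y} σ (fun _ => true) + gw β {y} σ (fun _ => false)) := by
  have h : ∀ F : (↥({y} : Finset V) → Bool) → ℝ, ∑ η, F η = F (fun _ => true) + F fun _ => false := by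
    intro F
    rw [← sum_bool fun b => F fun _ => b]
    refine sum_equiv (Equiv.funUnique _ Bool) _ _ fun η => congrArg F (funext fun a => ?_)
    grind
  grind [PiOp_eq_wEx, wEx, spatch_singleton]

lemma sum_spin_nonneg {σ : Ω} {y : V} (h : ¬ fewPlus σ y) : 0 ≤ ∑ i, spinVal (σ (y + dir i)) := by
  have : ∀ b : Fin 4 → Bool, (∃ i j, i ≠ j ∧ b i = true ∧ b j = true) → (0 : ℤ) ≤ ∑ i, if b i then 1 else -1 := by decide
  have h' := this (fun i => σ (y + dir i)) (by grind [fewPlus])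
  have e : ∑ i, spinVal (σ (y + dir i)) = ((∑ i, if σ (y + dir i) then 1 else -1 : ℤ) : ℝ) := by
    push_cast
    rfl
  rw [e]
  positivity

section Parity

variable (κ : V → Bool)

/-- Neutral sites, minus sites, and sites of one parity whose spin is prescribed by `ε`. -/
def fewOr (ε : V → Bool) (σ : Ω) (z : V) : Prop := (κ z = true ∧ (fewPlus σ z ∨ σ z = ε z)) ∨ (κ z = false ∧ σ z = false)

/-- A path of such sites in the box of radius `N` reaches its boundary. -/
def fewReach (N : ℕ) (x : V) (ε : V → Bool) (σ : Ω) : Prop :=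
  ∃ y, N ≤ nrm y ∧ ReflTransGen (fun u v => starAdj u v ∧ v ∈ boxAt 0 N ∧ fewOr κ ε σ v) x y

variable {κ}

lemma fewReach.mono {N : ℕ} {x : V} {ε ε' : V → Bool} {σ σ' : Ω}
    (h : ∀ v ∈ boxAt 0 N, fewOr κ ε σ v → fewOr κ ε' σ' v) (hr : fewReach κ N x ε σ) :
    fewReach κ N x ε' σ' := by
  obtain ⟨y, hy, hr⟩ := hr
  exact ⟨y, hy, hr.lift id fun _ _ h' => ⟨h'.1, h'.2.1, h _ h'.2.1 h'.2.2⟩⟩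

lemma fewReach_of_infinite {x : V} {ε : V → Bool} {σ : Ω}
    (h : ¬ {y | ReflTransGen (fun u v => starAdj u v ∧ fewOr κ ε σ v) x y}.Finite) (N : ℕ) :
    fewReach κ N x ε σ := by
  by_contra hG
  refine h ((boxAt 0 N).finite_toSet.subset fun z hz => ?_)
  have : ReflTransGen (fun u v => starAdj u v ∧ v ∈ boxAt 0 N ∧ fewOr κ ε σ v) x z := by
    induction hz with
    | refl => exact .refl
    | @tail y w _ hw ih =>
      have h1 : nrm y < N := not_le.1 fun h' => hG ⟨y, h', ih⟩
      have h2 : w ∈ boxAt y 1 := by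
        rw [mem_boxAt]
        exact_mod_cast hw.1
      rw [mem_boxAt_iff] at h2
      have := nrm_le_add w y
      grind [mem_boxAt_zero]
  rw [mem_coe, mem_boxAt_zero]
  exact (not_le.1 fun h' => hG ⟨z, h', this⟩).le

variable (hκ : ∀ x i, κ (x + dir i) = !κ x)

include hκ in
lemma fewPlus_update {y z : V} (hy : κ y = true) (hz : κ z = true) (σ : Ω) (b : Bool) : fewPlus (update σ y b) z ↔ fewPlus σ z := by
  have : ∀ i, z + dir i ≠ y := by grind
  simp_all [fewPlus]

open Classical in
include hκ in
lemma PiOp_fewReach_le {β : ℝ} (hβ : β ≤ 0) (N : ℕ) (x : V) {y : V} (hy : κ y = true) {ε : V → Bool} (hε : ε y = false) (σ : Ω) :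
    PiOp β {y} (fun σ => if fewReach κ N x (update ε y true) σ then (1 : ℝ) else 0) σ ≤
      PiOp β {y} (fun σ => if fewReach κ N x ε σ then (1 : ℝ) else 0) σ := by
  have hne : ∀ {z} (b : Bool), z ≠ y → (fewOr κ (update ε y true) (update σ y b) z ↔ fewOr κ ε σ z) := by
    intro z b hz
    unfold fewOr
    rw [update_of_ne hz, update_of_ne hz]
    by_cases h : κ z = true
    · simp [fewPlus_update hκ hy h]
    · simp [h]
  have hne' : ∀ {z} (b : Bool), z ≠ y → (fewOr κ ε (update σ y b) z ↔ fewOr κ ε σ z) := by simp_all [fewOr]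
  have h1 : ∀ b, fewOr κ (update ε y true) (update σ y b) y ↔ fewPlus σ y ∨ b = true := by simp [fewOr, hy, fewPlus_update hκ hy hy]
  have h2 : ∀ b, fewOr κ ε (update σ y b) y ↔ fewPlus σ y ∨ b = false := by simp [fewOr, hy, fewPlus_update hκ hy hy, hε]
  have key : ∀ b b', (fewPlus σ y ∨ b = !b') → (fewReach κ N x (update ε y true) (update σ y b) ↔
      fewReach κ N x ε (update σ y b')) := by
    intro b b' hb
    have : ∀ v, fewOr κ (update ε y true) (update σ y b) v ↔ fewOr κ ε (update σ y b') v := by grind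
    exact ⟨fun h => h.mono fun v _ => (this v).1, fun h => h.mono fun v _ => (this v).2⟩
  rw [PiOp_singleton, PiOp_singleton]
  have p := gw_pos β {y} σ (fun _ => true)
  have q := gw_pos β {y} σ (fun _ => false)
  refine div_le_div_of_nonneg_right ?_ (by positivity)
  by_cases hf : fewPlus σ y
  · grind
  · simp only [key _ _ (Or.inr rfl : fewPlus σ y ∨ true = !false), key _ _ (Or.inr rfl : fewPlus σ y ∨ false = !true)]
    have hle : gw β {y} σ (fun _ => true) ≤ gw β {y} σ (fun _ => false) := by
      rw [gw_singleton, gw_singleton, exp_le_exp]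
      have := sum_spin_nonneg hf
      rw [show spinVal true = 1 from rfl, show spinVal false = -1 by simp [spinVal]]
      nlinarith
    have hm : (if fewReach κ N x ε (update σ y true) then (1 : ℝ) else 0) ≤ if fewReach κ N x ε (update σ y false) then 1 else 0 := by
      have : fewReach κ N x ε (update σ y true) → fewReach κ N x ε (update σ y false) := by
        refine fun h => h.mono fun v _ hv => ?_
        grind
      grind
    nlinarith

open Classical in
lemma fewReach_continuous (N : ℕ) (x : V) (ε : V → Bool) : Continuous fun σ => if fewReach κ N x ε σ then (1 : ℝ) else 0 := by
  refine SpinDep.continuous (A := boxAt 0 (N + 1)) fun σ τ h => ?_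
  have : ∀ {σ τ : Ω}, (∀ v ∈ boxAt 0 (N + 1), σ v = τ v) → fewReach κ N x ε σ → fewReach κ N x ε τ := by
    intro σ τ h hr
    refine hr.mono fun v hv h' => ?_
    grind [nrm_add_dir, mem_boxAt_zero, fewOr, fewPlus]
  grind

include hκ in
/-- For an antiferromagnet, the absence of infinite minus `*`-clusters survives the flip of one
sublattice. -/
theorem IsGibbsIsing.flip_mem_finStar {β : ℝ} (hβ : β ≤ 0) {γ : Measure Ω} (hγ : IsGibbsIsing β γ)
    (hF : ∀ᵐ σ ∂γ, σ ∈ finStar false) : ∀ᵐ σ ∂γ, _root_.flipBy κ σ ∈ finStar false := by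
  classical
  have := hγ.1
  let g : ℕ → V → (V → Bool) → Ω → ℝ := fun N x ε σ => if fewReach κ N x ε σ then 1 else 0
  have gc : ∀ N x ε, Continuous (g N x ε) := fun N x ε => fewReach_continuous N x ε
  have gb : ∀ N x ε σ, |g N x ε σ| ≤ 1 := fun N x ε σ => by grind
  have flip : ∀ N x, ∫ σ, g N x (fun _ => true) σ ∂γ ≤ ∫ σ, g N x (fun _ => false) σ ∂γ := by
    intro N x
    have : ∀ S : Finset V, ∫ σ, g N x (fun v => decide (v ∈ S)) σ ∂γ ≤ ∫ σ, g N x (fun _ => false) σ ∂γ := by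
      intro S
      induction S using induction_on with
      | empty => simp
      | insert y S hy ih =>
        refine le_trans ?_ ih
        have e : (fun v => decide (v ∈ insert y S)) = update (fun v => decide (v ∈ S)) y true := by grind
        rw [e]
        by_cases hκy : κ y = true
        · rw [hγ.integral_eq {y} (gc _ _ _).measurable (gb _ _ _), hγ.integral_eq {y} (gc N x fun v => decide (v ∈ S)).measurable (gb _ _ _)]
          refine integral_mono (integrable_of_bounded (measurable_PiOp (gc _ _ _).measurable) fun σ => abs_PiOp_le _ (gb _ _ _) σ)
            (integrable_of_bounded (measurable_PiOp (gc _ _ _).measurable) fun σ => abs_PiOp_le _ (gb _ _ _) σ) fun σ => ?_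
          exact PiOp_fewReach_le hκ hβ N x hκy (by grind) σ
        · refine le_of_eq (integral_congr_ae (Eventually.of_forall fun σ => ?_))
          have : ∀ v, fewOr κ (update (fun v => decide (v ∈ S)) y true) σ v ↔ fewOr κ (fun v => decide (v ∈ S)) σ v := by grind [fewOr]
          simp only [g, show fewReach κ N x (update (fun v => decide (v ∈ S)) y true) σ ↔
            fewReach κ N x (fun v => decide (v ∈ S)) σ by simp_all [fewReach]]
    refine le_trans (le_of_eq (integral_congr_ae (Eventually.of_forall fun σ => ?_))) (this (boxAt 0 N))
    have h : ∀ v ∈ boxAt 0 N, fewOr κ (fun _ => true) σ v ↔ fewOr κ (fun v => decide (v ∈ boxAt 0 N)) σ v := by grind [fewOr]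
    simp only [g, show fewReach κ N x (fun _ => true) σ ↔ fewReach κ N x (fun v => decide (v ∈ boxAt 0 N)) σ from
      ⟨fun h' => h'.mono fun v hv => (h v hv).1, fun h' => h'.mono fun v hv => (h v hv).2⟩]
  have lim : ∀ x, Tendsto (fun N => ∫ σ, g N x (fun _ => false) σ ∂γ) atTop (nhds 0) := by
    intro x
    have := tendsto_integral_of_dominated_convergence (μ := γ) (F := fun N => g N x fun _ => false) (f := fun _ => 0)
      (fun _ => 1) (fun N => (gc N x _).measurable.aestronglyMeasurable) (integrable_const _)
      (fun N => Eventually.of_forall fun σ => gb _ _ _ σ) (by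
        filter_upwards [hF] with σ hσ
        refine tendsto_const_nhds.congr' ?_
        have hfin := finite_minusOrFew hκ hσ x
        obtain ⟨N, hN⟩ := exists_boxAt_subset hfin.toFinset 0
        filter_upwards [eventually_gt_atTop N] with M hM
        refine (if_neg ?_).symm
        rintro ⟨y, hy, hr⟩
        have hr' : ReflTransGen (fun u v => starAdj u v ∧ minusOrFew κ σ v) x y := by
          refine hr.lift id fun u v h => ⟨h.1, ?_⟩
          rcases h.2.2 with ⟨h1, h2 | h2⟩ | h2
          · exact Or.inr ⟨h1, h2⟩
          · exact Or.inl h2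
          · exact Or.inl h2.2
        have := hN y (hfin.mem_toFinset.2 hr') (show y ∈ boxAt y 0 by simp [mem_boxAt])
        rw [mem_boxAt_zero] at this
        omega)
    simp_all
  have null : ∀ x, ∀ᵐ σ ∂γ, ∃ N, ¬ fewReach κ N x (fun _ => true) σ := by
    intro x
    have hm : ∀ N, MeasurableSet {σ | fewReach κ N x (fun _ => true) σ} := by
      intro N
      have : {σ | fewReach κ N x (fun _ => true) σ} = g N x (fun _ => true) ⁻¹' {1} := by grind
      rw [this]
      exact (gc N x _).measurable (measurableSet_singleton 1)
    have hle : ∀ N, γ.real (⋂ N, {σ | fewReach κ N x (fun _ => true) σ}) ≤ ∫ σ, g N x (fun _ => false) σ ∂γ := by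
      intro N
      refine (measureReal_mono (Set.iInter_subset _ N)).trans (le_trans (le_of_eq ?_) (flip N x))
      rw [← integral_indicator_one (hm N)]
      exact integral_congr_ae (Eventually.of_forall fun σ => by simp [g, Set.indicator_apply])
    have h0 := ge_of_tendsto' (lim x) hle
    have : γ (⋂ N, {σ | fewReach κ N x (fun _ => true) σ}) = 0 := by
      rw [← measureReal_eq_zero_iff]
      grind [measureReal_nonneg]
    rw [ae_iff]
    convert this using 2
    ext σ
    simp
  rw [← ae_all_iff] at null
  filter_upwards [null] with σ hσ x
  by_contra hinf
  obtain ⟨N, hN⟩ := hσ x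
  refine hN (fewReach_of_infinite (fun hf => hinf (hf.subset fun y hy => ?_)) N)
  refine hy.lift id fun u v h => ⟨h.1, ?_⟩
  have := h.2
  unfold _root_.flipBy at this
  rcases hv : κ v with _ | _
  · exact Or.inr ⟨hv, by grind⟩
  · exact Or.inl ⟨hv, Or.inr (by grind)⟩

end Parity

/-- Nearest neighbours, together with the diagonals of the faces opened by `c`. -/
def link (c : V → Bool) (u v : V) : Prop := (∃ i, v = u + dir i) ∨ starAdj u v ∧ c (u ⊓ v) = true

def hop (c : V → Bool) (P : V → Prop) (u v : V) : Prop := link c u v ∧ P u ∧ P v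

/-- There is an enhanced path of plus spins from `x` to distance `r` inside the box of radius `r`. -/
def arm (x : V) (r : ℕ) (c : V → Bool) (σ : Ω) : Prop :=
  ∃ y, nrm (y - x) = r ∧ ReflTransGen (hop c fun u => u ∈ boxAt x r ∧ σ u = true) x y

lemma link_symm {c : V → Bool} {u v : V} (h : link c u v) : link c v u := by
  rcases h with ⟨i, rfl⟩ | ⟨h, hc⟩
  · obtain ⟨j, hj⟩ := dir_neg i
    exact Or.inl ⟨j, by grind⟩
  · exact Or.inr ⟨starAdj_symm h, by grind⟩

lemma link_starAdj {c : V → Bool} {u v : V} (h : link c u v) : starAdj u v := by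
  rcases h with ⟨i, rfl⟩ | h
  exacts [(starAdj_dir u i).1, h.1]

lemma link_mono {c c' : V → Bool} {u v : V} (hc : c (u ⊓ v) = true → c' (u ⊓ v) = true) (h : link c u v) :
    link c' u v := h.imp id fun h => ⟨h.1, hc h.2⟩

lemma hop_path_symm {c : V → Bool} {P : V → Prop} {u v : V} (h : ReflTransGen (hop c P) u v) : ReflTransGen (hop c P) v u := by
  induction h with
  | refl => exact .refl
  | tail _ h ih => exact .head ⟨link_symm h.1, h.2.2, h.2.1⟩ ih

lemma starAdj_iff {u v : V} : starAdj u v ↔ nrm (v - u) ≤ 1 := by grind [starAdj, nrm, fst_sub, snd_sub]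

lemma inf_mem_boxAt {x u v : V} {r : ℕ} (hu : u ∈ boxAt x r) (hv : v ∈ boxAt x r) : u ⊓ v ∈ boxAt x r := by
  grind [mem_boxAt, Prod.fst_inf, Prod.snd_inf]

lemma arm_mono {x : V} {r : ℕ} {c c' : V → Bool} {σ σ' : Ω}
    (hc : ∀ p ∈ boxAt x r, c p = true → c' p = true) (hσ : ∀ u ∈ boxAt x r, σ u = true → σ' u = true)
    (h : arm x r c σ) : arm x r c' σ' := by
  obtain ⟨y, hy, hp⟩ := h
  exact ⟨y, hy, hp.lift id fun u v h => ⟨link_mono (hc _ (inf_mem_boxAt h.2.1.1 h.2.2.1)) h.1,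
    ⟨h.2.1.1, hσ _ h.2.1.1 h.2.1.2⟩, h.2.2.1, hσ _ h.2.2.1 h.2.2.2⟩⟩

lemma arm_congr {x : V} {r : ℕ} {c c' : V → Bool} {σ σ' : Ω}
    (hc : ∀ p ∈ boxAt x r, c p = c' p) (hσ : ∀ u ∈ boxAt x r, σ u = σ' u) : arm x r c σ ↔ arm x r c' σ' :=
  ⟨arm_mono (fun p hp h => hc p hp ▸ h) fun p hp h => hσ p hp ▸ h,
   arm_mono (fun p hp h => (hc p hp).symm ▸ h) fun p hp h => (hσ p hp).symm ▸ h⟩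

lemma arm_shift {x : V} {r : ℕ} {c : V → Bool} {σ : Ω} (h : arm x r c σ) : arm 0 r (shiftBy x c) (shiftBy x σ) := by
  obtain ⟨y, hy, hp⟩ := h
  refine ⟨y - x, by rwa [sub_zero], ?_⟩
  have := hp.lift (p := hop (shiftBy x c) fun u => u ∈ boxAt 0 r ∧ shiftBy x σ u = true) (fun u => u - x) ?_
  · simpa [Function.onFun] using this
  · rintro u v ⟨h1, h2, h3⟩
    simp [hop, shiftBy]
    rw [mem_boxAt_zero, mem_boxAt_zero, ← mem_boxAt_iff, ← mem_boxAt_iff]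
    refine ⟨?_, h2, h3⟩
    rcases h1 with ⟨i, rfl⟩ | ⟨h, hc⟩
    · exact Or.inl ⟨i, by abel⟩
    · refine Or.inr ⟨by grind [starAdj_iff, sub_sub_sub_cancel_right], ?_⟩
      rw [← hc]
      refine congrArg c (Prod.ext ?_ ?_) <;> simp [min_sub_sub_right]

/-- A path reaching distance `r` from its origin contains an arm. -/
lemma exists_arm_of_path {c : V → Bool} {P : V → Prop} {x y : V} {r : ℕ} (hr : r ≤ nrm (y - x)) (h : ReflTransGen (hop c P) x y) :
    ∃ z, nrm (z - x) = r ∧ ReflTransGen (hop c fun u => u ∈ boxAt x r ∧ P u) x z := by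
  have key : (∃ z, nrm (z - x) = r ∧ ReflTransGen (hop c fun u => u ∈ boxAt x r ∧ P u) x z) ∨
      nrm (y - x) < r ∧ ReflTransGen (hop c fun u => u ∈ boxAt x r ∧ P u) x y := by
    clear hr
    induction h with
    | refl =>
      rcases Nat.eq_zero_or_pos r with h | h
      · exact Or.inl ⟨x, by simp [nrm, h], .refl⟩
      simp_all [nrm, refl]
    | @tail u v _ h ih =>
      rcases ih with h' | ⟨h1, h2⟩
      · grind
      · have h3 := starAdj_iff.1 (link_starAdj h.1)
        have h4 := nrm_le_add (v - x) (u - x)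
        rw [sub_sub_sub_cancel_right] at h4
        have h5 := h2.tail (show hop c (fun u => u ∈ boxAt x r ∧ P u) u v from
          ⟨h.1, ⟨mem_boxAt_iff.2 (by omega), h.2.1⟩, mem_boxAt_iff.2 (by omega), h.2.2⟩)
        grind
  grind

/-- Removing a plus spin whose plus neighbours remain connected. -/
lemma arm_of_update {n : ℕ} {c c' : V → Bool} {σ : Ω} {w : V} (hw0 : w ≠ 0) (hcc : ∀ p, c p = true → c' p = true)
    (hoff : ∀ v ∈ boxAt 0 n, starAdj w v → c (w ⊓ v) = false)
    (H1 : ∀ i j, w + dir i ∈ boxAt 0 n ∧ σ (w + dir i) = true → w + dir j ∈ boxAt 0 n ∧ σ (w + dir j) = true →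
      ReflTransGen (hop c' fun u => u ∈ boxAt 0 n ∧ update σ w false u = true) (w + dir i) (w + dir j))
    (H2 : nrm w = n → ∀ i, w + dir i ∈ boxAt 0 n ∧ σ (w + dir i) = true → ∃ y, nrm y = n ∧
      ReflTransGen (hop c' fun u => u ∈ boxAt 0 n ∧ update σ w false u = true) (w + dir i) y)
    (h : arm 0 n c (update σ w true)) : arm 0 n c' (update σ w false) := by
  obtain ⟨y, hy, hp⟩ := h
  rw [sub_zero] at hy
  set R := hop c' fun u => u ∈ boxAt 0 n ∧ update σ w false u = true with hR
  have key : (y ≠ w ∧ ReflTransGen R 0 y) ∨ (y = w ∧ ∃ i, (w + dir i ∈ boxAt 0 n ∧ σ (w + dir i) = true) ∧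
      ReflTransGen R 0 (w + dir i)) := by
    clear hy
    induction hp with
    | refl => grind
    | @tail u v _ h ih =>
      obtain ⟨hl, ⟨huD, hu⟩, hvD, hv⟩ := h
      have hnn : ∀ v, v ∈ boxAt 0 n → link c w v → ∃ i, v = w + dir i := fun v hv h => h.resolve_right fun h' => by grind
      rcases ih with ⟨huw, hu'⟩ | ⟨rfl, i, hi, hi'⟩
      · by_cases hvw : v = w
        · grind [link_symm]
        · exact Or.inl ⟨hvw, hu'.tail ⟨link_mono (hcc _) hl, ⟨huD, by grind⟩, hvD, by grind⟩⟩
      · obtain ⟨j, rfl⟩ := hnn v hvD hl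
        have hne : u + dir j ≠ u := fun h => dir_ne_zero j (by grind)
        rw [update_of_ne hne] at hv
        exact Or.inl ⟨hne, hi'.trans (H1 i j hi ⟨hvD, hv⟩)⟩
  rcases key with ⟨-, h⟩ | ⟨rfl, i, hi, h⟩
  · exact ⟨y, by grind, h⟩
  · obtain ⟨z, hz, hz'⟩ := H2 hy i hi
    exact ⟨z, by grind, h.trans hz'⟩

/-- Interpolation between two configurations differing on a finite set. -/
lemma exists_pivotal_step {g : (V → Bool) → Prop} (P : Finset V) : ∀ {a b : V → Bool}, (∀ x ∉ P, a x = b x) →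
    (∀ x ∈ P, a x = false ∧ b x = true) → ¬ g a → g b →
    ∃ p ∈ P, ∃ d : V → Bool, (∀ x ∉ P, d x = a x) ∧ ¬ g (update d p false) ∧ g (update d p true) := by
  induction P using induction_on with
  | empty =>
    intro a b h _ ha hb
    exact absurd (show a = b from funext fun x => h x (by simp)) fun h => ha (h ▸ hb)
  | insert q P hq ih =>
    intro a b h h' ha hb
    by_cases hg : g (update a q true)
    · grind [Function.update_eq_self_iff]
    · obtain ⟨p, hp, d, hd, h1, h2⟩ := ih (a := update a q true) (b := b) (fun x hx => by grind) (fun x hx => by grind) hg hb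
      grind

set_option maxHeartbeats 1000000 in
/-- If a box is pivotal for the arm event, a local modification makes a face pivotal. -/
lemma exists_pivotal_face {n L : ℕ} (hL : 1 ≤ L) (hLn : L ≤ n) {x : V} {c : V → Bool} {σ : Ω}
    (hx : x ∈ boxAt 0 (n + L)) (h0 : (0 : V) ∉ boxAt x (3 * L + 2))
    (hm : ¬ arm 0 n c (spatch (boxAt x L) (fun _ => false) σ))
    (hp : arm 0 n c (spatch (boxAt x L) (fun _ => true) σ)) :
    ∃ c' σ', (∀ p ∉ boxAt x (3 * L + 2) ∩ boxAt 0 n, c' p = c p) ∧ (∀ u ∉ boxAt x (3 * L + 2), σ' u = σ u) ∧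
      ∃ p ∈ boxAt x (3 * L + 2) ∩ boxAt 0 n,
        ¬ arm 0 n (update c' p false) σ' ∧ arm 0 n (update c' p true) σ' := by
  classical
  obtain ⟨x1, x2⟩ := x
  simp only [mem_boxAt, fst_zero, snd_zero, sub_zero] at hx
  push_cast at hx
  rw [abs_le, abs_le] at hx
  set U := boxAt (x1, x2) (3 * L + 2) with hU
  obtain ⟨a, ha⟩ : ∃ a : ℤ, a = max (-(n : ℤ)) (min (x1 - L) (n - 2 * L)) := ⟨_, rfl⟩
  obtain ⟨b, hb⟩ : ∃ b : ℤ, b = max (-(n : ℤ)) (min (x2 - L) (n - 2 * L)) := ⟨_, rfl⟩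
  set W := U.filter fun u => (a ≤ u.1 ∧ u.1 ≤ a + 2 * L) ∧ b ≤ u.2 ∧ u.2 ≤ b + 2 * L with hW
  have memW : ∀ u : V, u ∈ W ↔ (a ≤ u.1 ∧ u.1 ≤ a + 2 * L) ∧ b ≤ u.2 ∧ u.2 ≤ b + 2 * L := by
    intro u
    rw [hW, mem_filter, hU, mem_boxAt, abs_le, abs_le, and_iff_right_iff_imp]
    omega
  have memL : ∀ u : V, u ∈ boxAt 0 n ↔ (-(n : ℤ) ≤ u.1 ∧ u.1 ≤ n) ∧ -(n : ℤ) ≤ u.2 ∧ u.2 ≤ n := fun u => by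
    rw [mem_boxAt, abs_le, abs_le, fst_zero, snd_zero, sub_zero, sub_zero]
  have hWU : ∀ w ∈ W, ∀ v, starAdj w v → w ∈ U ∧ v ∈ U := by
    intro w hw v hv
    rw [memW] at hw
    simp [starAdj, abs_le] at hv
    rw [hU, mem_boxAt, mem_boxAt, abs_le, abs_le, abs_le, abs_le]
    omega
  have hWL : ∀ w ∈ W, w ∈ boxAt 0 n := fun w hw => by rw [memW] at hw; rw [memL]; omega
  have hBW : ∀ u ∈ boxAt (x1, x2) L, u ∈ boxAt 0 n → u ∈ W := by
    intro u hu hu'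
    rw [mem_boxAt, abs_le, abs_le] at hu
    rw [memL] at hu'
    rw [memW]
    omega
  have hw0 : ∀ w ∈ W, w ≠ 0 := fun w hw h => h0 (h ▸ (mem_filter.1 hw).1)
  set c0 : V → Bool := fun p => if p ∈ U ∩ boxAt 0 n then false else c p with hc0
  set c1 : V → Bool := fun p => if p ∈ U ∩ boxAt 0 n then true else c p with hc1
  have h01 : ∀ p, c0 p = true → c1 p = true := fun p => by simp only [hc0, hc1]; split_ifs <;> simp
  have hoff : ∀ w ∈ W, ∀ v ∈ boxAt 0 n, starAdj w v → c0 (w ⊓ v) = false := by grind [inf_mem_boxAt]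
  set odd : V → Prop := fun w => (w.1 + w.2 - a - b) % 2 = 1 with hodd
  have hpar : ∀ (w : V) (i : Fin 4), odd (w + dir i) ↔ ¬ odd w := by
    rintro ⟨w1, w2⟩ i
    fin_cases i <;> simp [hodd, dir] <;> omega
  set S0 : Ω := fun u => if u ∈ W then false else σ u with hS0
  set S1 : Ω := fun u => if u ∈ W then decide (odd u) else σ u with hS1
  set S2 : Ω := fun u => if u ∈ W then true else σ u with hS2
  -- interpolation between the closed and open faces
  have fin : ∀ S : Ω, (∀ u ∉ U, S u = σ u) → ¬ arm 0 n c0 S → arm 0 n c1 S →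
      ∃ c' σ', (∀ p ∉ U ∩ boxAt 0 n, c' p = c p) ∧ (∀ u ∉ U, σ' u = σ u) ∧ ∃ p ∈ U ∩ boxAt 0 n,
        ¬ arm 0 n (update c' p false) σ' ∧ arm 0 n (update c' p true) σ' := by
    intro S hS h1 h2
    obtain ⟨p, hp, d, hd, h3, h4⟩ := exists_pivotal_step (g := fun c => arm 0 n c S) (U ∩ boxAt 0 n)
      (a := c0) (b := c1) (fun p hp => by simp only [hc0, hc1, if_neg hp])
      (fun p hp => by simp only [hc0, hc1, if_pos hp, and_self]) h1 h2
    exact ⟨d, S, fun p hp => by rw [hd p hp]; simp only [hc0, if_neg hp], hS, p, hp, h3, h4⟩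
  have step0 : ¬ arm 0 n c0 S0 := fun h => hm <| arm_mono (fun p _ h => by
      simp only [hc0] at h; split_ifs at h; exact h) (fun u hu h => by
      simp only [hS0] at h
      split_ifs at h with h1
      grind [spatch]) h
  have step1 : ¬ arm 0 n c0 S1 := by
    intro h
    obtain ⟨w, hw, d, hd, h3, h4⟩ := exists_pivotal_step (g := fun S => arm 0 n c0 S) (W.filter odd)
      (a := S0) (b := S1) (fun u hu => by
        rw [mem_filter, not_and] at hu
        simp only [hS0, hS1]
        split_ifs with h1
        · simp [hu h1]
        · rfl)
      (fun u hu => by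
        rw [mem_filter] at hu
        simp [hS0, hS1, hu.1, hu.2]) step0 h
    rw [mem_filter] at hw
    have hout : ∀ i, d (w + dir i) = true → w + dir i ∉ W := by grind
    have hwW := (memW w).1 hw.1
    have hwo : (w.1 + w.2 - a - b) % 2 = 1 := hw.2
    refine h3 (arm_of_update (hw0 w hw.1) (fun _ h => h) (hoff w hw.1) (fun i j hi hj => ?_) (fun hn i hi => ?_) h4)
    · have h1 := hout i hi.2
      have h2 := hout j hj.2
      rw [memW] at h1 h2
      have : i = j := by fin_cases i <;> fin_cases j <;> simp [dir] at h1 h2 ⊢ <;> omega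
      subst this
      exact .refl
    · have h1 := hout i hi.2
      have h2 := hi.1
      rw [memW] at h1
      rw [memL] at h2
      simp [nrm] at hn
      fin_cases i <;> simp [dir] at h1 h2 <;> omega
  by_cases h2 : arm 0 n c0 S2
  · obtain ⟨w, hw, d, hd, h3, h4⟩ := exists_pivotal_step (g := fun S => arm 0 n c0 S) (W.filter fun u => ¬ odd u)
      (a := S1) (b := S2) (fun u hu => by
        rw [mem_filter, not_and, not_not] at hu
        simp only [hS1, hS2]
        split_ifs with h1
        · simp [hu h1]
        · rfl)
      (fun u hu => by
        rw [mem_filter] at hu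
        simp [hS1, hS2, hu.1, hu.2]) step1 h2
    rw [mem_filter] at hw
    have hwW := (memW w).1 hw.1
    have hdU : ∀ u ∉ U, update d w false u = σ u := by
      intro u hu
      have huW : u ∉ W := fun h => hu (mem_filter.1 h).1
      rw [update_of_ne (ne_of_mem_of_not_mem hw.1 huW).symm, hd u (fun h => huW (mem_filter.1 h).1)]
      simp [hS1, if_neg huW]
    set R := hop c1 fun u => u ∈ boxAt 0 n ∧ update d w false u = true with hR
    have hnew : ∀ i, d (w + dir i) = true → update d w false (w + dir i) = true := fun i hi => by
      rwa [update_of_ne (fun h => dir_ne_zero i (by simpa using h))]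
    have hdiag : ∀ i j : Fin 4, starAdj (w + dir i) (w + dir j) → (w + dir i ∈ boxAt 0 n ∧ d (w + dir i) = true) →
        (w + dir j ∈ boxAt 0 n ∧ d (w + dir j) = true) → R (w + dir i) (w + dir j) := by
      intro i j hij hi hj
      refine ⟨Or.inr ⟨hij, ?_⟩, ⟨hi.1, hnew i hi.2⟩, hj.1, hnew j hj.2⟩
      simp only [hc1]
      rw [if_pos (mem_inter.2 ⟨inf_mem_boxAt (hWU w hw.1 _ (starAdj_dir w i).1).2
        (hWU w hw.1 _ (starAdj_dir w j).1).2, inf_mem_boxAt hi.1 hj.1⟩)]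
    have hin : ∀ i, w + dir i ∈ W → w + dir i ∈ boxAt 0 n ∧ d (w + dir i) = true := by
      intro i hi
      refine ⟨hWL _ hi, ?_⟩
      rw [hd _ (fun h => (mem_filter.1 h).2 ((hpar w i).2 hw.2))]
      simp [hS1, if_pos hi, (hpar w i).2 hw.2]
    obtain ⟨i1, hi1, hi1W⟩ : ∃ i1 : Fin 4, (i1 = 0 ∨ i1 = 1) ∧ w + dir i1 ∈ W := by
      rcases le_or_gt (w.1 + 1) (a + 2 * L) with h | h
      · exact ⟨0, Or.inl rfl, (memW _).2 (by simp [dir]; omega)⟩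
      · exact ⟨1, Or.inr rfl, (memW _).2 (by simp [dir]; omega)⟩
    obtain ⟨i2, hi2, hi2W⟩ : ∃ i2 : Fin 4, (i2 = 2 ∨ i2 = 3) ∧ w + dir i2 ∈ W := by
      rcases le_or_gt (w.2 + 1) (b + 2 * L) with h | h
      · exact ⟨2, Or.inl rfl, (memW _).2 (by simp [dir]; omega)⟩
      · exact ⟨3, Or.inr rfl, (memW _).2 (by simp [dir]; omega)⟩
    have hadj : ∀ i j : Fin 4, (i = 0 ∨ i = 1) → (j = 2 ∨ j = 3) →
        starAdj (w + dir i) (w + dir j) ∧ starAdj (w + dir j) (w + dir i) := by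
      rintro i j (rfl | rfl) (rfl | rfl) <;> simp [starAdj_add] <;> simp [starAdj, dir]
    have h12 := hdiag i1 i2 (hadj i1 i2 hi1 hi2).1 (hin i1 hi1W) (hin i2 hi2W)
    have hall : ∀ i, w + dir i ∈ boxAt 0 n ∧ d (w + dir i) = true → ReflTransGen R (w + dir i1) (w + dir i) := by
      intro i hi
      by_cases h : i = 0 ∨ i = 1
      · exact (ReflTransGen.single h12).tail (hdiag i2 i (hadj i i2 h hi2).2 (hin i2 hi2W) hi)
      · exact .single (hdiag i1 i (hadj i1 i hi1 (by revert h; fin_cases i <;> simp)).1 (hin i1 hi1W) hi)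
    refine fin _ hdU h3 (arm_of_update (hw0 w hw.1) h01 (hoff w hw.1)
      (fun i j hi hj => (hop_path_symm (hall i hi)).trans (hall j hj)) (fun hn i hi => ?_) h4)
    have e1 := hop_path_symm (hall i hi)
    have l1 := (memL _).1 (hWL _ hi1W)
    have l2 := (memL _).1 (hWL _ hi2W)
    by_cases hw2 : w.2.natAbs = n
    · refine ⟨_, ?_, e1⟩
      simp [nrm] at hn ⊢
      rcases hi1 with rfl | rfl <;> simp [dir] at l1 ⊢ <;> omega
    · refine ⟨_, ?_, e1.tail h12⟩
      simp [nrm] at hn ⊢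
      rcases hi2 with rfl | rfl <;> simp [dir] at l2 ⊢ <;> omega
  · refine fin S2 (fun u hu => by grind) h2 (arm_mono (fun p _ h => by simp only [hc1]; split_ifs <;> simp [h]) (fun u hu h => ?_) hp)
    simp only [hS2]
    split_ifs with h1
    · rfl
    grind [spatch]

section Coins

variable {E : Type} [Fintype E] [DecidableEq E]

/-- Product weight with odds `exp s` for each coordinate. -/
def coinW (s : ℝ) (η : E → Bool) : ℝ := exp (s * ∑ e, cInd e η) * 1

lemma coinW_pos (s : ℝ) (η : E → Bool) : 0 < coinW s η := mul_pos (exp_pos _) one_pos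

lemma cInd_modular (e : E) (a b : E → Bool) : cInd e a + cInd e b = cInd e (a ⊓ b) + cInd e (a ⊔ b) := by
  simp [cInd]
  grind

lemma coinW_modular (s : ℝ) (a b : E → Bool) : coinW s a * coinW s b = coinW s (a ⊓ b) * coinW s (a ⊔ b) := by
  simp [coinW, ← exp_add, ← mul_add, ← sum_add_distrib]
  grind [cInd_modular]

lemma coinW_latticeWeight (s : ℝ) : LatWeight (coinW s : 𝓕 E) := ⟨coinW_pos s, fun a b => (coinW_modular s a b).le⟩

def flipAt (e : E) (η : E → Bool) : E → Bool := update η e (!η e)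

lemma flipAt_flipAt (e : E) (η : E → Bool) : flipAt e (flipAt e η) = η := by simp [flipAt]

lemma sum_flipAt (e : E) (G : 𝓕 E) : ∑ η, G (flipAt e η) = ∑ η, G η :=
  Equiv.sum_comp (Function.Involutive.toPerm (flipAt e) (flipAt_flipAt e)) G

lemma coinW_flipAt (s : ℝ) (e : E) (η : E → Bool) : coinW s (flipAt e η) = coinW s η * exp (if η e then -s else s) := by
  simp [coinW, ← exp_add]
  rw [← add_sum_erase _ _ (mem_univ e), ← add_sum_erase _ _ (mem_univ e), sum_congr rfl (g := fun x => cInd x η) fun x hx => by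
      simp [cInd, flipAt, update_of_ne (Finset.ne_of_mem_erase hx)]]
  simp [cInd, flipAt]
  grind

lemma wEx_coin_update (s : ℝ) (e : E) (G : 𝓕 E) :
    wEx (coinW s) (fun η => G (update η e true)) = (1 + exp (-s)) * wEx (coinW s) (G * cInd e) ∧
    wEx (coinW s) (fun η => G (update η e false)) = (1 + exp s) * wEx (coinW s) (G * (1 - cInd e)) := by
  simp [wEx, ← mul_div_assoc]
  have h1 := sum_flipAt e fun η => coinW s η * ((if η e then 0 else 1) * G (update η e true))
  have h2 := sum_flipAt e fun η => coinW s η * ((if η e then 1 else 0) * G (update η e false))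
  constructor
  · congr 1
    calc _ = ∑ η, coinW s η * ((if η e then 0 else 1) * G (update η e true)) +
          ∑ η, coinW s η * (G * cInd e) η := by
          rw [← sum_add_distrib]
          refine sum_congr rfl fun η _ => ?_
          by_cases h : η e
          · simp [cInd, h, show update η e true = η by grind]
          · simp [cInd, h]
      _ = _ := by
          rw [← h1, add_mul, one_mul, add_comm, mul_sum]
          congr 1
          refine sum_congr rfl fun η _ => ?_
          rw [coinW_flipAt]
          by_cases h : η e
          · simp [cInd, flipAt, h, show update η e true = η by grind]; ring
          · simp [cInd, flipAt, h]
  · congr 1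
    calc _ = ∑ η, coinW s η * ((if η e then 1 else 0) * G (update η e false)) +
          ∑ η, coinW s η * (G * (1 - cInd e)) η := by
          rw [← sum_add_distrib]
          refine sum_congr rfl fun η _ => ?_
          by_cases h : η e
          · simp [cInd, h]
          · simp [cInd, h, show update η e false = η by grind]
      _ = _ := by
          rw [← h2, add_mul, one_mul, add_comm, mul_sum]
          congr 1
          refine sum_congr rfl fun η _ => ?_
          rw [coinW_flipAt]
          by_cases h : η e
          · simp [cInd, flipAt, h]
          · simp [cInd, flipAt, h, show update η e false = η by grind]; ring

/-- Probability that a coordinate is pivotal, as a covariance. -/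
lemma wEx_pivotal_eq (s : ℝ) (e : E) (G : 𝓕 E) : wEx (coinW s) (fun η => G (update η e true) - G (update η e false)) =
      (1 + exp s) * (1 + exp (-s)) * wCov (coinW s) G (cInd e) := by
  refine (wEx_sub _ _).trans ?_
  rw [(wEx_coin_update s e G).1, (wEx_coin_update s e G).2, wCov]
  have h1 := (wEx_coin_update s e fun _ => 1).1
  rw [wEx_const (coinW_pos s), show (fun _ : E → Bool => (1 : ℝ)) * cInd e = cInd e from one_mul _] at h1
  have h2 : wEx (coinW s) (G * (1 - cInd e)) = wEx (coinW s) G - wEx (coinW s) (G * cInd e) := by grind [mul_sub, wEx_sub]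
  have h3 : exp s * exp (-s) = 1 := by rw [← exp_add]; simp
  grind

lemma wEx_coin_flip_le (s : ℝ) (e : E) (b : Bool) {G : 𝓕 E} (hG : ∀ η, 0 ≤ G η) :
    wEx (coinW s) (fun η => G (update η e b)) ≤ (1 + exp |s|) * wEx (coinW s) G := by
  have hle : ∀ t, |t| ≤ |s| → exp t ≤ exp |s| := fun t ht => exp_le_exp.2 ((le_abs_self t).trans ht)
  cases b
  · rw [(wEx_coin_update s e G).2]
    refine mul_le_mul (by grind) (wEx_mono (coinW_pos s) fun η => ?_) ?_ (by positivity)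
    · simp only [Pi.mul_apply, Pi.sub_apply, Pi.one_apply, cInd]; split_ifs <;> simp [hG]
    · refine wEx_nonneg (fun η => (coinW_pos s η).le) fun η => mul_nonneg (hG η) ?_
      simp [cInd]; grind
  · rw [(wEx_coin_update s e G).1]
    refine mul_le_mul (by grind) (wEx_mono (coinW_pos s) fun η => ?_) ?_ (by positivity)
    · grind [Pi.mul_apply, cInd]
    · refine wEx_nonneg (fun η => (coinW_pos s η).le) fun η => mul_nonneg (hG η) ?_
      grind [cInd]

def coinLaw (s : ℝ) : Measure Bool := ENNReal.ofReal (exp s / (1 + exp s)) • Measure.dirac true +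
    ENNReal.ofReal (1 / (1 + exp s)) • Measure.dirac false

lemma coinLaw_singleton (s : ℝ) (b : Bool) : (coinLaw s).real {b} = exp (if b then s else 0) / (1 + exp s) := by
  have := exp_pos s
  cases b <;> simp [coinLaw, measureReal_def, this.le, add_nonneg, div_nonneg]

instance (s : ℝ) : IsProbabilityMeasure (coinLaw s) := by
  refine ⟨?_⟩
  simp only [coinLaw, Measure.add_apply, Measure.smul_apply, measure_univ, smul_eq_mul, mul_one]
  rw [← ENNReal.ofReal_add (by positivity) (by positivity), ← add_div, add_comm, div_self (by positivity), ENNReal.ofReal_one]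

def coinM (s : ℝ) : Measure (V → Bool) := Measure.infinitePi fun _ => coinLaw s

instance (s : ℝ) : IsProbabilityMeasure (coinM s) := by unfold coinM; infer_instance

/-- Expectation over the coins in `A`, the others being off. -/
def coinE (s : ℝ) (A : Finset V) (g : 𝓕 V) : ℝ := wEx (coinW s) fun η : ↥A → Bool => g (spatch A η ⊥)

lemma coinE_eq_integral (s : ℝ) (A : Finset V) (g : 𝓕 V) : coinE s A g = ∫ c, g (spatch A (fun a => c a) ⊥) ∂coinM s := by
  have h := integral_restrict_infinitePi (μ := fun _ : V => coinLaw s) (s := A)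
    (f := fun η => g (spatch A η ⊥)) (Measurable.of_discrete.aestronglyMeasurable)
  refine Eq.trans ?_ h.symm
  have h1 : ∀ η : ↥A → Bool, (Measure.pi fun _ : ↥A => coinLaw s).real {η} = coinW s η / (1 + exp s) ^ A.card := by
    intro η
    rw [measureReal_def, Measure.pi_singleton, ENNReal.toReal_prod]
    simp only [← measureReal_def, coinLaw_singleton, coinW, mul_one, Finset.prod_div_distrib, prod_const,
      card_univ, card_coe, ← exp_sum, mul_sum, cInd, mul_ite, mul_zero]
  have h2 : ∑ η : ↥A → Bool, coinW s η = (1 + exp s) ^ A.card := by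
    have h3 : ∑ η : ↥A → Bool, (Measure.pi fun _ : ↥A => coinLaw s).real {η} = 1 := by simp
    simp [h1, ← sum_div] at h3
    grind
  rw [integral_fintype Integrable.of_finite, coinE, wEx, h2, sum_div]
  grind [smul_eq_mul]

lemma coinM_shift (s : ℝ) (v : V) : (coinM s).map (shiftBy v) = coinM s := by
  have := Measure.infinitePi_map_piCongrLeft (μ := fun _ : V => coinLaw s) (subRight v)
  rw [← coinM] at this
  convert this using 2
  ext c x
  have h := Equiv.piCongrLeft_apply_apply (fun _ : V => Bool) (subRight v) c (x + v)
  exact (by simp_all : c (x + v) = Equiv.piCongrLeft (fun _ => Bool) (subRight v) c x)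

end Coins

section

def ind (P : Prop) : ℝ := open Classical in if P then 1 else 0

lemma ind_of {P : Prop} (h : P) : ind P = 1 := if_pos h

lemma ind_not {P : Prop} (h : ¬P) : ind P = 0 := if_neg h

lemma ind_nonneg (P : Prop) : 0 ≤ ind P := by grind [ind]

lemma ind_le_one (P : Prop) : ind P ≤ 1 := by grind [ind]

lemma abs_ind_le (P : Prop) : |ind P| ≤ 1 := by grind [ind_nonneg, ind_le_one]

lemma ind_mono {P Q : Prop} (h : P → Q) : ind P ≤ ind Q := by
  by_cases hP : P
  · grind
  grind [ind_not, ind_nonneg]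

lemma ind_congr {P Q : Prop} (h : P ↔ Q) : ind P = ind Q := congrArg ind (propext h)

lemma ind_sq (P : Prop) : ind P ^ 2 = ind P := by grind [ind]

lemma SpinDep.integrable {γ : Measure Ω} [IsFiniteMeasure γ] {A : Finset V} {f : Ω → ℝ} (h : SpinDep A f) : Integrable f γ := by
  obtain ⟨C, hC⟩ := continuous_bounded f h.continuous
  exact integrable_of_bounded h.continuous.measurable hC

lemma dep_arm_spins (x : V) (r : ℕ) (c : V → Bool) : SpinDep (boxAt x r) fun σ => ind (arm x r c σ) :=
  fun _ _ h => ind_congr (arm_congr (fun _ _ => rfl) h)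

lemma coinE_mono (s : ℝ) (A : Finset V) {g g' : 𝓕 V} (h : ∀ c, g c ≤ g' c) : coinE s A g ≤ coinE s A g' :=
  wEx_mono (coinW_pos s) fun _ => h _

lemma coinE_const (s : ℝ) (A : Finset V) (a : ℝ) : coinE s A (fun _ => a) = a := wEx_const (coinW_pos s) a

lemma coinE_sum {ι : Type} (s : ℝ) (A : Finset V) (I : Finset ι) (g : ι → 𝓕 V) :
    coinE s A (fun c => ∑ i ∈ I, g i c) = ∑ i ∈ I, coinE s A (g i) :=
  wEx_sum I fun i (η : ↥A → Bool) => g i (spatch A η ⊥)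

lemma coinE_add (s : ℝ) (A : Finset V) (g g' : 𝓕 V) : coinE s A (fun c => g c + g' c) = coinE s A g + coinE s A g' := wEx_add _ _

lemma coinE_smul (s : ℝ) (A : Finset V) (a : ℝ) (g : 𝓕 V) : coinE s A (fun c => a * g c) = a * coinE s A g := wEx_smul a _

lemma coinE_nonneg (s : ℝ) (A : Finset V) {g : 𝓕 V} (h : ∀ c, 0 ≤ g c) : 0 ≤ coinE s A g :=
  (coinE_const s A 0).symm.trans_le (coinE_mono s A h)

variable {β : ℝ} {γ : Measure Ω}

/-- Probability of an arm from the origin to distance `n`, as a function of the log-odds of the coins. -/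
def armProb (γ : Measure Ω) (n : ℕ) (s : ℝ) : ℝ := coinE s (boxAt 0 n) fun c => ∫ σ, ind (arm 0 n c σ) ∂γ

lemma integral_ind_nonneg (γ : Measure Ω) (P : Ω → Prop) : 0 ≤ ∫ σ, ind (P σ) ∂γ := integral_nonneg fun _ => ind_nonneg _

lemma integral_ind_le_one [IsProbabilityMeasure γ] (P : Ω → Prop) : ∫ σ, ind (P σ) ∂γ ≤ 1 := by
  by_cases h : Integrable (fun σ => ind (P σ)) γ
  · exact (integral_mono h (integrable_const 1) fun _ => ind_le_one _).trans (by simp)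
  grind [integral_undef]

lemma armProb_nonneg (n : ℕ) (s : ℝ) : 0 ≤ armProb γ n s := coinE_nonneg _ _ fun _ => integral_ind_nonneg _ _

lemma armProb_le_one [IsProbabilityMeasure γ] (n : ℕ) (s : ℝ) : armProb γ n s ≤ 1 :=
  (coinE_mono _ _ fun _ => integral_ind_le_one _).trans_eq (coinE_const _ _ _)

def armFun (γ : Measure Ω) (n : ℕ) (η : ↥(boxAt 0 n) → Bool) : ℝ := ∫ σ, ind (arm 0 n (spatch (boxAt 0 n) η ⊥) σ) ∂γ

def armProb' (γ : Measure Ω) (n : ℕ) (s : ℝ) : ℝ := ∑ e, wCov (coinW s) (armFun γ n) (cInd e)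

lemma armFun_mono [IsProbabilityMeasure γ] (n : ℕ) : Monotone (armFun γ n) := fun η η' h => by
  refine integral_mono (dep_arm_spins _ _ _).integrable (dep_arm_spins _ _ _).integrable fun σ =>
    ind_mono (arm_mono (fun p hp hc => ?_) fun _ _ h => h)
  rw [spatch_of_mem hp] at hc ⊢
  have := h ⟨p, hp⟩
  rw [hc] at this
  exact top_le_iff.1 this

lemma wCov_sum_coord {E : Type} [Fintype E] [DecidableEq E] {w : 𝓕 E} (f : 𝓕 E) :
    wCov w f (fun ω => ∑ e, cInd e ω) = ∑ e, wCov w f (cInd e) := by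
  have h1 : f * (fun ω => ∑ e, cInd e ω) = fun ω => ∑ e, (f * (cInd e : 𝓕 E)) ω := by ext ω; simp [mul_sum]
  simp [wCov]
  rw [h1, wEx_sum, wEx_sum univ (fun e : E => (cInd e : 𝓕 E)), mul_sum, ← sum_sub_distrib]

lemma hasDerivAt_armProb (γ : Measure Ω) (n : ℕ) (s : ℝ) : HasDerivAt (armProb γ n) (armProb' γ n s) s := by
  have := hasDerivAt_wEx_tilt (v := fun _ : ↥(boxAt 0 n) → Bool => (1 : ℝ)) (fun _ => one_pos) (fun ω => ∑ e, cInd e ω) (armFun γ n) s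
  rw [armProb', ← wCov_sum_coord]
  exact this

lemma armProb_mono [IsProbabilityMeasure γ] (n : ℕ) : Monotone (armProb γ n) :=
  monotone_of_deriv_nonneg (fun s => (hasDerivAt_armProb γ n s).differentiableAt) fun s => by
    rw [(hasDerivAt_armProb γ n s).deriv]
    exact sum_nonneg fun e _ => wCov_coord_nonneg' (coinW_latticeWeight s) (armFun_mono n) e

lemma tendsto_armProb [IsProbabilityMeasure γ] (hF : ∀ᵐ σ ∂γ, σ ∈ finStar true) (s : ℝ) :
    Tendsto (fun n => armProb γ n s) atTop (𝓝 0) := by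
  set D : ℕ → Ω → Prop := fun n σ => ∃ y, nrm y = n ∧ starReach true σ 0 y with hD
  have hDm : ∀ n, Measurable fun σ => ind (D n σ) := fun n => by
    have : MeasurableSet {σ | D n σ} := by
      have e : {σ | D n σ} = ⋃ y : V, ⋃ _ : nrm y = n, {σ | starReach true σ 0 y} := by ext σ; simp [hD]
      rw [e]
      exact MeasurableSet.iUnion fun y => MeasurableSet.iUnion fun _ => (isOpen_starReach _ _ _).measurableSet
    exact Measurable.ite this measurable_const measurable_const
  have key : Tendsto (fun n => ∫ σ, ind (D n σ) ∂γ) atTop (𝓝 (∫ _, (0 : ℝ) ∂γ)) := by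
    refine tendsto_integral_of_dominated_convergence (fun _ => 1) (fun n => (hDm n).aestronglyMeasurable)
      (integrable_const _) (fun n => Eventually.of_forall fun σ => ?_) ?_
    · exact abs_ind_le _
    · filter_upwards [hF] with σ hσ
      have hfin := (hσ 0).image nrm
      obtain ⟨M, hM⟩ := hfin.bddAbove
      refine tendsto_const_nhds.congr' ?_
      filter_upwards [eventually_gt_atTop M] with n hn
      refine (ind_not ?_).symm
      rintro ⟨y, hy, hr⟩
      exact absurd (hM ⟨y, hr, hy⟩) (by omega)
  rw [integral_zero] at key
  refine squeeze_zero (fun n => armProb_nonneg n s) (fun n => ?_) key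
  refine (coinE_mono _ _ fun c => ?_).trans_eq (coinE_const s _ _)
  refine integral_mono (dep_arm_spins _ _ _).integrable (integrable_of_bounded (hDm n) fun _ => abs_ind_le _) fun σ => ind_mono ?_
  rintro ⟨y, hy, hp⟩
  exact ⟨y, by grind, hp.lift id fun u v h => ⟨link_starAdj h.1, h.2.2.2⟩⟩

lemma coinE_arm_le (hβ : 0 ≤ β) (hm : NoMag β) (hγ : IsGibbsIsing β γ) (s : ℝ) (A : Finset V)
    (u : V) (d : ℕ) : coinE s A (fun c => ∫ σ, ind (arm u d c σ) ∂γ) ≤ armProb γ d s := by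
  have := hγ.1
  have hdep : ∀ u : V, SpinDep (boxAt u d) fun c => ∫ σ, ind (arm u d c σ) ∂γ := fun u c c' h => by grind [ind_congr, arm_congr]
  have hdepA : SpinDep A fun c => ∫ σ, ind (arm u d (spatch A (fun a => c a) ⊥) σ) ∂γ := fun c c' h => by grind
  have hsh : γ.map (shiftBy u) = γ := (hγ.shift u).unique hβ hm hγ
  calc coinE s A (fun c => ∫ σ, ind (arm u d c σ) ∂γ)
      = ∫ c, ∫ σ, ind (arm u d (spatch A (fun a => c a) ⊥) σ) ∂γ ∂coinM s := coinE_eq_integral _ _ _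
    _ ≤ ∫ c, ∫ σ, ind (arm u d c σ) ∂γ ∂coinM s := by
        refine integral_mono hdepA.integrable (hdep u).integrable fun c => ?_
        refine integral_mono (dep_arm_spins _ _ _).integrable (dep_arm_spins _ _ _).integrable fun σ =>
          ind_mono (arm_mono (fun p _ hc => ?_) fun _ _ h => h)
        by_cases hp : p ∈ A
        · grind [spatch_of_mem]
        simp_all [spatch_notMem]
    _ ≤ ∫ c, ∫ σ, ind (arm 0 d (shiftBy u c) σ) ∂γ ∂coinM s := by
        refine integral_mono (hdep u).integrable (integrable_of_bounded
          ((hdep 0).continuous.comp (continuous_shiftBy u)).measurable (C := 1) fun c => ?_) fun c => ?_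
        · simp_all [abs_of_nonneg, integral_ind_nonneg, integral_ind_le_one]
        calc ∫ σ, ind (arm u d c σ) ∂γ ≤ ∫ σ, ind (arm 0 d (shiftBy u c) (shiftBy u σ)) ∂γ := by
              refine integral_mono (dep_arm_spins _ _ _).integrable (integrable_of_bounded
                ((dep_arm_spins _ _ _).continuous.comp (continuous_shiftBy u)).measurable (C := 1)
                fun _ => abs_ind_le _) fun σ => ind_mono arm_shift
          _ = ∫ σ, ind (arm 0 d (shiftBy u c) σ) ∂(γ.map (shiftBy u)) :=
              (integral_map (continuous_shiftBy u).measurable.aemeasurable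
                (dep_arm_spins _ _ _).continuous.measurable.aestronglyMeasurable).symm
          _ = _ := by rw [hsh]
    _ = ∫ c, ∫ σ, ind (arm 0 d c σ) ∂γ ∂((coinM s).map (shiftBy u)) :=
        (integral_map (continuous_shiftBy u).measurable.aemeasurable (hdep 0).continuous.measurable.aestronglyMeasurable).symm
    _ = ∫ c, ∫ σ, ind (arm 0 d c σ) ∂γ ∂coinM s := by rw [coinM_shift]
    _ = armProb γ d s := by
        rw [armProb, coinE_eq_integral]
        refine integral_congr_ae (Eventually.of_forall fun c => hdep 0 _ _ fun x hx => ?_)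
        rw [spatch_of_mem hx]

end

/-- `u` is joined inside the box of radius `n` to a plus site at distance `k` from the origin. -/
def rch (n k : ℕ) (c : V → Bool) (σ : Ω) (u : V) : Prop :=
  ∃ z, nrm z = k ∧ (z ∈ boxAt 0 n ∧ σ z = true) ∧ ReflTransGen (hop c fun u => u ∈ boxAt 0 n ∧ σ u = true) z u

lemma rch_mono {n k : ℕ} {c c' : V → Bool} {σ σ' : Ω} (hc : ∀ p, c p = true → c' p = true)
    (hσ : ∀ u, σ u = true → σ' u = true) {u : V} (h : rch n k c σ u) : rch n k c' σ' u := by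
  obtain ⟨z, h1, h2, h3⟩ := h
  exact ⟨z, h1, ⟨h2.1, hσ _ h2.2⟩, h3.lift id fun u v h => ⟨link_mono (hc _) h.1, ⟨h.2.1.1, hσ _ h.2.1.2⟩, h.2.2.1, hσ _ h.2.2.2⟩⟩

def spinQuery (n k : ℕ) (c : V → Bool) (σ : Ω) (y : V) : Prop := y ∈ boxAt 0 n ∧ (nrm y = k ∨ ∃ u, rch n k c σ u ∧ starAdj u y)

def coinQuery (n k : ℕ) (c : V → Bool) (σ : Ω) (p : V) : Prop := ∃ u v, rch n k c σ u ∧ v ∈ boxAt 0 n ∧ starAdj u v ∧ u ⊓ v = p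

lemma spinQuery_mono {n k : ℕ} {c c' : V → Bool} {σ σ' : Ω} (hc : ∀ p, c p = true → c' p = true)
    (hσ : ∀ u, σ u = true → σ' u = true) {y : V} (h : spinQuery n k c σ y) : spinQuery n k c' σ' y :=
  ⟨h.1, h.2.imp id fun ⟨u, h1, h2⟩ => ⟨u, rch_mono hc hσ h1, h2⟩⟩

lemma coinQuery_mono {n k : ℕ} {c c' : V → Bool} {σ σ' : Ω} (hc : ∀ p, c p = true → c' p = true)
    (hσ : ∀ u, σ u = true → σ' u = true) {y : V} (h : coinQuery n k c σ y) : coinQuery n k c' σ' y := by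
  obtain ⟨u, v, h1, h2⟩ := h
  exact ⟨u, v, rch_mono hc hσ h1, h2⟩

lemma rch_mem {n k : ℕ} {c : V → Bool} {σ : Ω} {u : V} (h : rch n k c σ u) : u ∈ boxAt 0 n := by
  obtain ⟨z, -, h2, h3⟩ := h
  rcases h3.cases_tail with rfl | ⟨w, -, h⟩
  exacts [h2.1, h.2.2.1]

/-- The exploration determines the arm event. -/
lemma arm_iff_of_explored {n k : ℕ} (hk : 1 ≤ k) (hkn : k ≤ n) {c c' : V → Bool} {σ σ' : Ω}
    (hc : ∀ p, c p = true → c' p = true) (hσ : ∀ u, σ u = true → σ' u = true)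
    (hs : ∀ y, spinQuery n k c σ y → σ y = σ' y) (hq : ∀ p, coinQuery n k c σ p → c p = c' p) :
    arm 0 n c' σ' ↔ arm 0 n c σ := by
  refine ⟨?_, arm_mono (fun p _ => hc p) fun u _ => hσ u⟩
  rintro ⟨y, hy, hp⟩
  obtain ⟨z, hz, hpz⟩ := exists_arm_of_path (r := k) (by omega) hp
  rw [sub_zero] at hz
  have hpz' := hop_path_symm (hpz.lift (p := hop c' fun u => u ∈ boxAt 0 n ∧ σ' u = true) id fun u v h => ⟨h.1, h.2.1.2, h.2.2.2⟩)
  have hzP : z ∈ boxAt 0 n ∧ σ' z = true := by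
    rcases hpz'.cases_head with h | ⟨w, h, -⟩
    · subst h; simp [nrm] at hz; omega
    · exact h.2.1
  have hzσ : σ z = true := (hs z ⟨hzP.1, Or.inl hz⟩).trans hzP.2
  have key : ∀ u, ReflTransGen (hop c' fun u => u ∈ boxAt 0 n ∧ σ' u = true) z u →
      ReflTransGen (hop c fun u => u ∈ boxAt 0 n ∧ σ u = true) z u := by
    intro u hu
    induction hu with
    | refl => exact .refl
    | @tail u v _ h ih =>
      have hr : rch n k c σ u := ⟨z, hz, ⟨hzP.1, hzσ⟩, ih⟩
      have ha := link_starAdj h.1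
      refine ih.tail ⟨h.1.imp id fun hh => ⟨hh.1, ?_⟩, ⟨h.2.1.1, ?_⟩, h.2.2.1, ?_⟩
      · rw [hq _ ⟨u, v, hr, h.2.2.1, ha, rfl⟩]; exact hh.2
      · rw [hs u ⟨h.2.1.1, Or.inr ⟨u, hr, by simp [starAdj]⟩⟩]; exact h.2.1.2
      · rw [hs v ⟨h.2.2.1, Or.inr ⟨u, hr, ha⟩⟩]; exact h.2.2.2
  exact ⟨y, hy, (hop_path_symm (key _ hpz')).trans (key _ (hpz'.trans hp))⟩

lemma arm_zero (u : V) (c : V → Bool) (σ : Ω) : arm u 0 c σ := ⟨u, by simp [nrm], .refl⟩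

lemma arm_of_rch {n k : ℕ} {c : V → Bool} {σ : Ω} {u : V} (h : rch n k c σ u) : arm u (max (nrm u - k) (k - nrm u)) c σ := by
  obtain ⟨z, h1, -, h3⟩ := h
  have hd : max (nrm u - k) (k - nrm u) ≤ nrm (z - u) := by
    have h1' := nrm_le_add z u
    have h2 := nrm_le_add u z
    have h4 : nrm (u - z) = nrm (z - u) := by simp [nrm]; omega
    omega
  obtain ⟨y, hy, hp⟩ := exists_arm_of_path hd (hop_path_symm h3)
  exact ⟨y, hy, hp.lift id fun a b h => ⟨h.1, ⟨h.2.1.1, h.2.1.2.2⟩, h.2.2.1, h.2.2.2.2⟩⟩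

def nbhd (n : ℕ) (y : V) : Finset V := boxAt y 1 ∩ boxAt 0 n

lemma card_nbhd_le (n : ℕ) (y : V) : (nbhd n y).card ≤ 9 := by
  refine (card_le_card Finset.inter_subset_left).trans ?_
  have : boxAt y 1 ⊆ (Icc (y.1 - 1) (y.1 + 1)) ×ˢ (Icc (y.2 - 1) (y.2 + 1)) := fun v hv => by grind [mem_boxAt]
  refine (card_le_card this).trans ?_
  grind [card_product, Int.card_Icc]

lemma exists_arm_of_spinQuery {n k : ℕ} {c : V → Bool} {σ : Ω} {y : V} (h : spinQuery n k c σ y) :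
    ∃ u ∈ nbhd n y, arm u (max (nrm u - k) (k - nrm u)) c σ := by
  obtain ⟨h0, h | ⟨u, hu, ha⟩⟩ := h
  · refine ⟨y, mem_inter.2 ⟨by simp [mem_boxAt], h0⟩, ?_⟩
    simp_all [arm_zero]
  · refine ⟨u, mem_inter.2 ⟨?_, rch_mem hu⟩, arm_of_rch hu⟩
    grind [mem_boxAt_iff, starAdj_iff, starAdj_symm]

lemma exists_arm_of_coinQuery {n k : ℕ} {c : V → Bool} {σ : Ω} {p : V} (h : coinQuery n k c σ p) :
    ∃ u ∈ nbhd n p, arm u (max (nrm u - k) (k - nrm u)) c σ := by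
  obtain ⟨u, v, hu, hv, ha, rfl⟩ := h
  refine ⟨u, mem_inter.2 ⟨?_, rch_mem hu⟩, arm_of_rch hu⟩
  grind [starAdj, mem_boxAt, Prod.fst_inf, Prod.snd_inf]

lemma wEx_sum_type {A B : Type} [Fintype A] [DecidableEq A] [Fintype B] [DecidableEq B] (u : 𝓕 A) (v : 𝓕 B) (G : (A → Bool) → 𝓕 B) :
    wEx (fun ω : A ⊕ B → Bool => u (fun a => ω (.inl a)) * v (fun b => ω (.inr b)))
      (fun ω => G (fun a => ω (.inl a)) (fun b => ω (.inr b))) = wEx v fun b => wEx u fun a => G a b := by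
  have key : ∀ H : (A → Bool) → 𝓕 B, ∑ ω : A ⊕ B → Bool, H (fun a => ω (.inl a)) (fun b => ω (.inr b)) = ∑ b, ∑ a, H a b := fun H => by
    rw [← sum_comm, ← Fintype.sum_prod_type']
    exact (Equiv.sumArrowEquivProdArrow A B Bool).sum_comp fun p => H p.1 p.2
  simp [wEx]
  rw [key fun a b => u a * v b * G a b, key fun a b => u a * v b]
  have h1 : ∀ b, ∑ a, u a * v b = (∑ a, u a) * v b := fun b => by rw [sum_mul]
  have h2 : ∀ b, ∑ a, u a * v b * G a b = v b * ∑ a, u a * G a b := fun b => by rw [mul_sum]; grind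
  simp_all [mul_sum, mul_div_assoc, sum_div, div_div]

section Joint

variable (β s : ℝ) (N n : ℕ)

abbrev JVar : Type := ↥(boxAt 0 N) ⊕ ↥(boxAt 0 n)

def jw (ω : JVar N n → Bool) : ℝ := gw β (boxAt 0 N) ⊤ (fun a => ω (.inl a)) * coinW s (fun b => ω (.inr b))

variable {N n}

def jSpin (ω : JVar N n → Bool) : Ω := spatch (boxAt 0 N) (fun a => ω (.inl a)) ⊤

def jCoin (ω : JVar N n → Bool) : V → Bool := spatch (boxAt 0 n) (fun a => ω (.inr a)) ⊥

variable {β}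

lemma jw_latticeWeight (hβ : 0 ≤ β) : LatWeight (jw β s N n) where
  pos ω := mul_pos (gw_pos _ _ _ _) (coinW_pos _ _)
  lattice a b := by
    have h1 := (gw_latticeWeight hβ (boxAt 0 N) ⊤).lattice (fun x => a (.inl x)) fun x => b (.inl x)
    have h2 := (coinW_latticeWeight (E := ↥(boxAt 0 n)) s).lattice (fun x => a (.inr x)) fun x => b (.inr x)
    have h := mul_le_mul h1 h2 (mul_pos (coinW_pos _ _) (coinW_pos _ _)).le (mul_pos (gw_pos _ _ _ _) (gw_pos _ _ _ _)).le
    calc jw β s N n a * jw β s N n b = _ := mul_mul_mul_comm _ _ _ _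
      _ ≤ _ := h
      _ = _ := mul_mul_mul_comm _ _ _ _

lemma wEx_jw (G : (V → Bool) → Ω → ℝ) : wEx (jw β s N n) (fun ω => G (jCoin ω) (jSpin ω)) =
      coinE s (boxAt 0 n) fun c => PiOp β (boxAt 0 N) (G c) ⊤ :=
  wEx_sum_type (gw β (boxAt 0 N) ⊤) (coinW s) (fun a b => G (spatch (boxAt 0 n) b ⊥) (spatch (boxAt 0 N) a ⊤))

lemma jSpin_mono {a b : JVar N n → Bool} (h : a ≤ b) (u : V) (hu : jSpin a u = true) : jSpin b u = true := by
  have := spatch_mono (Λ := boxAt 0 N) (σ := ⊤) (σ' := ⊤) (fun x => h (.inl x)) le_rfl u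
  exact top_le_iff.1 (hu.symm.le.trans this)

lemma jCoin_mono {a b : JVar N n → Bool} (h : a ≤ b) (u : V) (hu : jCoin a u = true) : jCoin b u = true := by
  have := spatch_mono (Λ := boxAt 0 n) (σ := ⊥) (σ' := ⊥) (fun x => h (.inr x)) le_rfl u
  exact top_le_iff.1 (hu.symm.le.trans this)

/-- The variables examined by the exploration from distance `k`. -/
def jQuery (k : ℕ) (ω : JVar N n → Bool) : JVar N n → Prop
  | .inl y => spinQuery n k (jCoin ω) (jSpin ω) y
  | .inr p => coinQuery n k (jCoin ω) (jSpin ω) p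

def hideOutside (F : Finset (JVar N n)) (ξ : JVar N n → Bool) : JVar N n → Bool := fun e => decide (e ∈ F) && ξ e

lemma hideOutside_le {F : Finset (JVar N n)} {ξ ω : JVar N n → Bool} (h : agreeOn F ξ ω) : hideOutside F ξ ≤ ω := by
  intro e
  by_cases he : e ∈ F
  · simp [hideOutside, he, h e he]
  · simp [hideOutside, he]

lemma jQuery_mono {k : ℕ} {a b : JVar N n → Bool} (h : a ≤ b) {e : JVar N n} (hq : jQuery k a e) : jQuery k b e := by
  rcases e with y | p
  · exact spinQuery_mono (jCoin_mono h) (jSpin_mono h) hq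
  · exact coinQuery_mono (jCoin_mono h) (jSpin_mono h) hq

lemma arm_iff_hideOutside (hnN : n ≤ N) {k : ℕ} (hk : 1 ≤ k) (hkn : k ≤ n) {F : Finset (JVar N n)}
    {ξ ω : JVar N n → Bool} (hd : ∀ e, e ∉ F → ¬jQuery k (hideOutside F ξ) e) (h : agreeOn F ξ ω) :
    arm 0 n (jCoin ω) (jSpin ω) ↔ arm 0 n (jCoin (hideOutside F ξ)) (jSpin (hideOutside F ξ)) := by
  have hval : ∀ e, jQuery k (hideOutside F ξ) e → hideOutside F ξ e = ω e := fun e he => by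
    have heF : e ∈ F := by grind
    simp [hideOutside, heF, h e heF]
  refine arm_iff_of_explored hk hkn (jCoin_mono (hideOutside_le h)) (jSpin_mono (hideOutside_le h)) (fun y hy => ?_) fun p hp => ?_
  · have hyN := boxAt_mono 0 hnN hy.1
    have := hval (.inl ⟨y, hyN⟩) hy
    rw [jSpin, jSpin, spatch_of_mem hyN, spatch_of_mem hyN, this]
  · have hpn : p ∈ boxAt 0 n := by
      obtain ⟨u, v, h1, h2, -, rfl⟩ := hp
      exact inf_mem_boxAt (rch_mem h1) h2
    have := hval (.inr ⟨p, hpn⟩) hp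
    rw [jCoin, jCoin, spatch_of_mem hpn, spatch_of_mem hpn, this]

/-- Revealment bound for a site. -/
def ringSum (β s : ℝ) (N n : ℕ) (y : V) : ℝ := ∑ k ∈ Icc 1 n, ∑ u ∈ nbhd n y,
    coinE s (boxAt 0 n) fun c => PiOp β (boxAt 0 N) (fun σ => ind (arm u (max (nrm u - k) (k - nrm u)) c σ)) ⊤

lemma wEx_jQuery_le (hβ : 0 ≤ β) {k : ℕ} {e : JVar N n} {y : V}
    (h : ∀ ω, jQuery k ω e → ∃ u ∈ nbhd n y, arm u (max (nrm u - k) (k - nrm u)) (jCoin ω) (jSpin ω)) :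
    wEx (jw β s N n) ({ω | jQuery k ω e}.indicator 1) ≤ ∑ u ∈ nbhd n y,
      coinE s (boxAt 0 n) fun c => PiOp β (boxAt 0 N) (fun σ => ind (arm u (max (nrm u - k) (k - nrm u)) c σ)) ⊤ := by
  simp [← wEx_jw]
  rw [← wEx_sum (v := jw β s N n) (nbhd n y) fun u ω => ind (arm u (max (nrm u - k) (k - nrm u)) (jCoin ω) (jSpin ω))]
  refine wEx_mono (jw_latticeWeight s hβ).pos fun ω => ?_
  by_cases hω : jQuery k ω e
  · rw [indicator_of_mem (by exact hω)]
    obtain ⟨u, hu, ha⟩ := h ω hω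
    refine le_trans ?_ (single_le_sum (fun u _ => ind_nonneg _) hu)
    rw [ind_of ha]; rfl
  grind [Set.indicator_of_notMem, sum_nonneg, ind_nonneg]

/-- Covariance of the arm event with a spin variable in the large box. -/
def jSpinCov (β s : ℝ) (N n : ℕ) (y : V) : ℝ :=
  (coinE s (boxAt 0 n) fun c => PiOp β (boxAt 0 N) (fun σ => ind (arm 0 n c σ) * ind (σ y = true)) ⊤) -
    (coinE s (boxAt 0 n) fun c => PiOp β (boxAt 0 N) (fun σ => ind (arm 0 n c σ)) ⊤) *
      coinE s (boxAt 0 n) fun _ => PiOp β (boxAt 0 N) (fun σ => ind (σ y = true)) ⊤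

def jCoinCov (β s : ℝ) (N n : ℕ) (p : V) : ℝ :=
  (coinE s (boxAt 0 n) fun c => PiOp β (boxAt 0 N) (fun σ => ind (arm 0 n c σ) * ind (c p = true)) ⊤) -
    (coinE s (boxAt 0 n) fun c => PiOp β (boxAt 0 N) (fun σ => ind (arm 0 n c σ)) ⊤) *
      coinE s (boxAt 0 n) fun c => PiOp β (boxAt 0 N) (fun _ => ind (c p = true)) ⊤

def jArm (ω : JVar N n → Bool) : ℝ := ind (arm 0 n (jCoin ω) (jSpin ω))

lemma jArm_mono : Monotone (jArm : (JVar N n → Bool) → ℝ) := fun _ _ h =>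
  ind_mono (arm_mono (fun p _ => jCoin_mono h p) fun u _ => jSpin_mono h u)

lemma wCov_jArm_spin {y : V} (hy : y ∈ boxAt 0 N) : wCov (jw β s N n) jArm (cInd (.inl ⟨y, hy⟩)) = jSpinCov β s N n y := by
  have h1 : (cInd (.inl ⟨y, hy⟩) : (JVar N n → Bool) → ℝ) = fun ω => ind (jSpin ω y = true) := by
    ext ω; rw [cInd, jSpin, spatch_of_mem hy, ind]; congr
  have h2 : (jArm * fun ω => ind (jSpin ω y = true) : (JVar N n → Bool) → ℝ) =
      fun ω => ind (arm 0 n (jCoin ω) (jSpin ω)) * ind (jSpin ω y = true) := rfl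
  have h3 : (jArm : (JVar N n → Bool) → ℝ) = fun ω => ind (arm 0 n (jCoin ω) (jSpin ω)) := rfl
  rw [wCov, h1, h2, h3, wEx_jw s fun c σ => ind (arm 0 n c σ) * ind (σ y = true),
    wEx_jw s fun c σ => ind (arm 0 n c σ), wEx_jw s fun _ σ => ind (σ y = true), jSpinCov]

lemma wCov_jArm_coin {p : V} (hp : p ∈ boxAt 0 n) : wCov (jw β s N n) jArm (cInd (.inr ⟨p, hp⟩)) = jCoinCov β s N n p := by
  have h1 : (cInd (.inr ⟨p, hp⟩) : (JVar N n → Bool) → ℝ) = fun ω => ind (jCoin ω p = true) := by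
    ext ω; rw [cInd, jCoin, spatch_of_mem hp, ind]; congr
  have h2 : (jArm * fun ω => ind (jCoin ω p = true) : (JVar N n → Bool) → ℝ) =
      fun ω => ind (arm 0 n (jCoin ω) (jSpin ω)) * ind (jCoin ω p = true) := rfl
  have h3 : (jArm : (JVar N n → Bool) → ℝ) = fun ω => ind (arm 0 n (jCoin ω) (jSpin ω)) := rfl
  rw [wCov, h1, h2, h3, wEx_jw s fun c σ => ind (arm 0 n c σ) * ind (c p = true),
    wEx_jw s fun c σ => ind (arm 0 n c σ), wEx_jw s fun c _ => ind (c p = true), jCoinCov]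

theorem joint_osss (hβ : 0 ≤ β) (hnN : n ≤ N) : n * ((coinE s (boxAt 0 n) fun c => PiOp β (boxAt 0 N) (fun σ => ind (arm 0 n c σ)) ⊤) *
      (1 - coinE s (boxAt 0 n) fun c => PiOp β (boxAt 0 N) (fun σ => ind (arm 0 n c σ)) ⊤)) ≤
      ∑ y ∈ boxAt 0 n, ringSum β s N n y * jSpinCov β s N n y +
        ∑ p ∈ boxAt 0 n, ringSum β s N n p * jCoinCov β s N n p := by
  classical
  set w := jw β s N n with hw
  have hlw : LatWeight w := jw_latticeWeight s hβ
  set f : (JVar N n → Bool) → ℝ := jArm with hf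
  have hfm : Monotone f := jArm_mono
  have hsq : (fun ω => f ω ^ 2) = f := by ext ω; exact ind_sq _
  have hcov : ∀ e, 0 ≤ wCov w f (cInd e) := fun e => wCov_coord_nonneg' hlw hfm e
  have hfe : wEx w f = coinE s (boxAt 0 n) fun c => PiOp β (boxAt 0 N) (fun σ => ind (arm 0 n c σ)) ⊤ :=
    wEx_jw s fun c σ => ind (arm 0 n c σ)
  have hcs : ∀ y (hy : y ∈ boxAt 0 N), wCov w f (cInd (.inl ⟨y, hy⟩)) = jSpinCov β s N n y := fun y hy => wCov_jArm_spin s hy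
  have hcc : ∀ p (hp : p ∈ boxAt 0 n), wCov w f (cInd (.inr ⟨p, hp⟩)) = jCoinCov β s N n p := fun p hp => wCov_jArm_coin s hp
  have key : ∀ k ∈ Icc 1 n, wEx w f * (1 - wEx w f) ≤ ∑ e, wEx w ({ω | jQuery k ω e}.indicator 1) * wCov w f (cInd e) := by
    intro k hk
    rw [mem_Icc] at hk
    have := osss' hlw hfm (fun ω => ind_nonneg _) (fun ω => ind_le_one _) (fun e => {ω | jQuery k ω e})
      (fun F ξ e => jQuery k (hideOutside F ξ) e)
      (fun F ξ e _ hq ω hω => jQuery_mono (hideOutside_le hω) hq)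
      (fun F ξ hd ω hω => ind_congr ((arm_iff_hideOutside hnN hk.1 hk.2 hd hω).trans
        (arm_iff_hideOutside hnN hk.1 hk.2 hd fun _ _ => rfl).symm))
    grind
  have hsum := sum_le_sum key
  rw [sum_const, Nat.card_Icc, Nat.add_sub_cancel, nsmul_eq_mul, sum_comm] at hsum
  rw [← hfe]
  refine hsum.trans ?_
  rw [Fintype.sum_sum_type]
  refine add_le_add ?_ ?_
  · have hz : ∀ y (hy : y ∈ boxAt 0 N), ∑ k ∈ Icc 1 n, wEx w ({ω | jQuery k ω (.inl ⟨y, hy⟩)}.indicator 1) *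
        wCov w f (cInd (.inl ⟨y, hy⟩)) ≤ if y ∈ boxAt 0 n then ringSum β s N n y * jSpinCov β s N n y else 0 := by
      intro y hy
      rw [← sum_mul]
      split_ifs with hyn
      · rw [← hcs y hy]
        exact mul_le_mul_of_nonneg_right (sum_le_sum fun k _ => wEx_jQuery_le s hβ fun ω hq => exists_arm_of_spinQuery hq) (hcov _)
      · have : ∀ k, {ω : JVar N n → Bool | jQuery k ω (.inl ⟨y, hy⟩)} = ∅ := fun k => by
          ext ω; simp
          exact fun h => hyn h.1
        have h0 : wEx w ((∅ : Set (JVar N n → Bool)).indicator 1) = 0 := by rw [Set.indicator_empty]; exact wEx_const hlw.pos 0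
        simp_rw [this]
        rw [h0]; simp
    calc _ ≤ ∑ y : ↥(boxAt 0 N), if y.1 ∈ boxAt 0 n then ringSum β s N n y * jSpinCov β s N n y else 0 :=
          sum_le_sum fun y _ => hz y.1 y.2
      _ = ∑ y ∈ boxAt 0 N, if y ∈ boxAt 0 n then ringSum β s N n y * jSpinCov β s N n y else 0 :=
          sum_coe_sort (boxAt 0 N) fun y => if y ∈ boxAt 0 n then ringSum β s N n y * jSpinCov β s N n y else 0
      _ = _ := by rw [Finset.sum_ite_mem, Finset.inter_eq_right.2 (boxAt_mono 0 hnN)]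
  · calc _ ≤ ∑ p : ↥(boxAt 0 n), ringSum β s N n p * jCoinCov β s N n p := by
          refine sum_le_sum fun p _ => ?_
          rw [← sum_mul, hcc p.1 p.2]
          refine mul_le_mul_of_nonneg_right (sum_le_sum fun k _ => wEx_jQuery_le s hβ fun ω hq => exists_arm_of_coinQuery hq) ?_
          grind
      _ = _ := sum_coe_sort (boxAt 0 n) fun p => ringSum β s N n p * jCoinCov β s N n p

lemma jSpinCov_nonneg (hβ : 0 ≤ β) {y : V} (hy : y ∈ boxAt 0 N) : 0 ≤ jSpinCov β s N n y := by
  rw [← wCov_jArm_spin s hy]; exact wCov_coord_nonneg' (jw_latticeWeight s hβ) jArm_mono _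

end Joint

section

variable {β : ℝ} {γ : Measure Ω}

lemma tendsto_coinE (hβ : 0 ≤ β) (hm : NoMag β) (hγ : IsGibbsIsing β γ) (s : ℝ) (A : Finset V)
    {G : (V → Bool) → Ω → ℝ} {B : Finset V} (hG : ∀ c, SpinDep B (G c)) :
    Tendsto (fun N : ℕ => coinE s A fun c => PiOp β (boxAt 0 N) (G c) ⊤) atTop
      (𝓝 (coinE s A fun c => ∫ σ, G c σ ∂γ)) := by
  exact (tendsto_finsetSum _ fun η _ => (hγ.local_limit hβ hm (hG _)).const_mul _).div_const _

lemma IsGibbsIsing.integral_spin (hβ : 0 ≤ β) (hm : NoMag β) (hγ : IsGibbsIsing β γ) (x : V) : ∫ σ, spinVal (σ x) ∂γ = 0 := by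
  have h := (hγ.flip true).unique hβ hm hγ
  have h1 : ∫ σ, spinVal (σ x) ∂γ = ∫ σ, -spinVal (σ x) ∂γ := by
    conv_lhs => rw [← h]
    rw [integral_map (continuous_flipBy _).measurable.aemeasurable (measurable_spin x).aestronglyMeasurable]
    simp_all [_root_.flipBy, spinVal_not]
  grind [integral_neg]

lemma ind_spin (b : Bool) : ind (b = true) = (1 + spinVal b) / 2 := by grind [ind, spinVal]

def armCorr (γ : Measure Ω) (n : ℕ) (s : ℝ) (y : V) : ℝ := coinE s (boxAt 0 n) fun c => ∫ σ, ind (arm 0 n c σ) * spinVal (σ y) ∂γ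

lemma dependsOn_spin {A : Finset V} {y : V} (hy : y ∈ A) : SpinDep A fun σ => spinVal (σ y) := fun σ τ h => by grind

lemma SpinDep.mul {A : Finset V} {f g : Ω → ℝ} (hf : SpinDep A f) (hg : SpinDep A g) :
    SpinDep A fun σ => f σ * g σ := fun σ τ h => by beta_reduce; rw [hf σ τ h, hg σ τ h]

lemma tendsto_jSpinCov (hβ : 0 ≤ β) (hm : NoMag β) (hγ : IsGibbsIsing β γ) (s : ℝ) {n : ℕ} {y : V} (hy : y ∈ boxAt 0 n) :
    Tendsto (fun N => jSpinCov β s N n y) atTop (𝓝 (armCorr γ n s y / 2)) := by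
  have := hγ.1
  have hdi : SpinDep (boxAt 0 n) fun σ => ind (σ y = true) := fun σ τ h => by grind
  have h1 := tendsto_coinE hβ hm hγ s (boxAt 0 n) (G := fun c σ => ind (arm 0 n c σ) * ind (σ y = true))
    fun c => (dep_arm_spins 0 n c).mul hdi
  have h2 := tendsto_coinE hβ hm hγ s (boxAt 0 n) (G := fun c σ => ind (arm 0 n c σ)) (dep_arm_spins 0 n)
  have h3 := tendsto_coinE hβ hm hγ s (boxAt 0 n) (G := fun _ σ => ind (σ y = true)) fun _ => hdi
  have h := h1.sub (h2.mul h3)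
  refine h.trans (le_of_eq (congrArg 𝓝 ?_))
  have e1 : ∫ σ, ind (σ y = true) ∂γ = 1 / 2 := by
    simp only [ind_spin, add_div]
    rw [integral_add (integrable_const _) ((dependsOn_spin hy).integrable.div_const _), integral_div,
      integral_div, hγ.integral_spin hβ hm]
    simp
  have e2 : ∀ c, ∫ σ, ind (arm 0 n c σ) * ind (σ y = true) ∂γ =
      (1 / 2) * ∫ σ, ind (arm 0 n c σ) ∂γ + (1 / 2) * ∫ σ, ind (arm 0 n c σ) * spinVal (σ y) ∂γ := fun c => by
    rw [← integral_const_mul, ← integral_const_mul, ← integral_add ((dep_arm_spins 0 n c).integrable.const_mul _)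
      (((dep_arm_spins 0 n c).mul (dependsOn_spin hy)).integrable.const_mul _)]
    grind [ind_spin]
  simp [e1, e2]
  rw [coinE_add, coinE_smul, coinE_smul, coinE_const, armCorr]
  ring

lemma tendsto_jCoinCov (hβ : 0 ≤ β) (hm : NoMag β) (hγ : IsGibbsIsing β γ) (s : ℝ) {n : ℕ} (p : ↥(boxAt 0 n)) :
    Tendsto (fun N => jCoinCov β s N n p) atTop (𝓝 (wCov (coinW s) (armFun γ n) (cInd p))) := by
  have := hγ.1
  have hdi : ∀ c : V → Bool, SpinDep (boxAt 0 n) fun _ => ind (c p = true) := fun c σ τ h => rfl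
  have h1 := tendsto_coinE hβ hm hγ s (boxAt 0 n) (G := fun c σ => ind (arm 0 n c σ) * ind (c p = true))
    fun c => (dep_arm_spins 0 n c).mul (hdi c)
  have h2 := tendsto_coinE hβ hm hγ s (boxAt 0 n) (G := fun c σ => ind (arm 0 n c σ)) (dep_arm_spins 0 n)
  have h3 := tendsto_coinE hβ hm hγ s (boxAt 0 n) (G := fun c _ => ind (c p = true)) hdi
  refine (h1.sub (h2.mul h3)).trans (le_of_eq (congrArg 𝓝 ?_))
  have e : ∀ η : ↥(boxAt 0 n) → Bool, ind (spatch (boxAt 0 n) η ⊥ p = true) = cInd p η := fun η => by grind [spatch_of_mem, cInd, ind]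
  simp [integral_mul_const]
  simp [coinE, e]
  rfl

lemma sum_range_succ_armProb_le [IsProbabilityMeasure γ] (n : ℕ) (s : ℝ) :
    ∑ d ∈ range (n + 1), armProb γ d s ≤ 1 + ∑ d ∈ range n, armProb γ d s := by
  grind [sum_range_succ, armProb_le_one]

lemma sum_ring_arm_le (hβ : 0 ≤ β) (hm : NoMag β) (hγ : IsGibbsIsing β γ) (s : ℝ) (n : ℕ)
    (y : V) : ∑ k ∈ Icc 1 n, ∑ u ∈ nbhd n y, coinE s (boxAt 0 n) (fun c => ∫ σ, ind (arm u (max (nrm u - k) (k - nrm u)) c σ) ∂γ) ≤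
      18 * (1 + ∑ d ∈ range n, armProb γ d s) := by
  have := hγ.1
  have hS : 0 ≤ ∑ d ∈ range n, armProb γ d s := sum_nonneg fun d _ => armProb_nonneg d s
  rw [sum_comm]
  calc _ ≤ ∑ u ∈ nbhd n y, 2 * (1 + ∑ d ∈ range n, armProb γ d s) := by
        refine sum_le_sum fun u hu => ?_
        have hun := mem_boxAt_zero.1 (mem_inter.1 hu).2
        refine (sum_le_sum fun k _ => coinE_arm_le hβ hm hγ s _ u _).trans ?_
        refine (sum_ring_le (fun d => armProb_nonneg d s) n (nrm u) (by omega)).trans ?_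
        simp_all [sum_range_succ_armProb_le]
    _ ≤ _ := by
        rw [sum_const, nsmul_eq_mul]
        have h9 : ((nbhd n y).card : ℝ) ≤ 9 := by simp_all [card_nbhd_le]
        nlinarith

lemma armCorr_nonneg (hβ : 0 ≤ β) (hm : NoMag β) (hγ : IsGibbsIsing β γ) (s : ℝ) {n : ℕ}
    {y : V} (hy : y ∈ boxAt 0 n) : 0 ≤ armCorr γ n s y := by
  have := ge_of_tendsto (tendsto_jSpinCov hβ hm hγ s hy) (b := 0) ?_
  · linarith
  · filter_upwards [eventually_ge_atTop n] with N hN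
    exact jSpinCov_nonneg s hβ (boxAt_mono 0 hN hy)

/-- The OSSS inequality for the arm event. -/
theorem armProb_ineq (hβ : 0 ≤ β) (hm : NoMag β) (hγ : IsGibbsIsing β γ) (s : ℝ) (n : ℕ) :
    n * (armProb γ n s * (1 - armProb γ n s)) ≤ 18 * (1 + ∑ d ∈ range n, armProb γ d s) *
      (∑ y ∈ boxAt 0 n, armCorr γ n s y + armProb' γ n s) := by
  have := hγ.1
  set R : V → ℝ := fun y => ∑ k ∈ Icc 1 n, ∑ u ∈ nbhd n y, coinE s (boxAt 0 n)
      (fun c => ∫ σ, ind (arm u (max (nrm u - k) (k - nrm u)) c σ) ∂γ) with hR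
  have hRt : ∀ y, Tendsto (fun N => ringSum β s N n y) atTop (𝓝 (R y)) := fun y =>
    tendsto_finsetSum _ fun k _ => tendsto_finsetSum _ fun u _ => tendsto_coinE hβ hm hγ s _ (dep_arm_spins u _)
  have h0 := tendsto_coinE hβ hm hγ s (boxAt 0 n) (G := fun c σ => ind (arm 0 n c σ)) (dep_arm_spins 0 n)
  have hlim := le_of_tendsto_of_tendsto ((h0.mul (h0.const_sub 1)).const_mul (n : ℝ))
    ((tendsto_finsetSum (boxAt 0 n).attach fun y _ => (hRt y).mul (tendsto_jSpinCov hβ hm hγ s y.2)).add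
      (tendsto_finsetSum (boxAt 0 n).attach fun p _ => (hRt p).mul (tendsto_jCoinCov hβ hm hγ s p))) ?_
  · refine hlim.trans ?_
    rw [mul_add]
    refine add_le_add ?_ ?_
    · rw [← sum_attach (boxAt 0 n) fun y => armCorr γ n s y, mul_sum]
      refine sum_le_sum fun y _ => ?_
      have h1 := armCorr_nonneg hβ hm hγ s y.2
      exact mul_le_mul (sum_ring_arm_le hβ hm hγ s n y) (by linarith) (by linarith)
        (mul_nonneg (by norm_num) (add_nonneg zero_le_one (sum_nonneg fun d _ => armProb_nonneg d s)))
    · rw [armProb', mul_sum, ← Finset.univ_eq_attach]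
      exact sum_le_sum fun p _ => mul_le_mul_of_nonneg_right (sum_ring_arm_le hβ hm hγ s n p)
        (wCov_coord_nonneg' (coinW_latticeWeight s) (armFun_mono n) p)
  · filter_upwards [eventually_ge_atTop n] with N hN
    refine (joint_osss s hβ hN).trans_eq ?_
    grind [sum_attach]

end

section

variable {β : ℝ} {γ : Measure Ω}

theorem IsGibbsIsing.fkg (hβ : 0 ≤ β) (hm : NoMag β) (hγ : IsGibbsIsing β γ) {A B : Finset V}
    {f g : Ω → ℝ} (hf : SpinDep A f) (hg : SpinDep B g) (hfm : Monotone f) (hgm : Monotone g) :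
    (∫ σ, f σ ∂γ) * ∫ σ, g σ ∂γ ≤ ∫ σ, f σ * g σ ∂γ :=
  le_of_tendsto_of_tendsto' ((hγ.local_limit hβ hm hf).mul (hγ.local_limit hβ hm hg))
    (hγ.local_limit hβ hm ((hf.mono subset_union_left).mul (hg.mono Finset.subset_union_right)))
    fun _ => PiOp_fkg hβ _ hfm hgm _

lemma IsGibbsIsing.integral_mul_spin_nonneg (hβ : 0 ≤ β) (hm : NoMag β) (hγ : IsGibbsIsing β γ)
    {A : Finset V} {f : Ω → ℝ} (hf : SpinDep A f) (hfm : Monotone f) (y : V) :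
    0 ≤ ∫ σ, f σ * spinVal (σ y) ∂γ := by
  have := hγ.fkg hβ hm hf (dependsOn_spin (mem_singleton_self y)) hfm (spin_monotone y)
  rwa [hγ.integral_spin hβ hm, mul_zero] at this

def sph (x : V) (r : ℕ) : Finset V := (boxAt x r).filter fun y => nrm (y - x) = r

lemma mem_sph {x y : V} {r : ℕ} : y ∈ sph x r ↔ nrm (y - x) = r := by grind [sph, mem_boxAt_iff]

lemma mem_sph_comm {x y : V} {r : ℕ} : y ∈ sph x r ↔ x ∈ sph y r := by grind [mem_sph, nrm, fst_sub, snd_sub]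

lemma card_Icc_center (a : ℤ) (r : ℕ) : (Icc (a - r) (a + r)).card = 2 * r + 1 := by rw [Int.card_Icc]; omega

lemma card_boxAt (x : V) (r : ℕ) : (boxAt x r).card = (2 * r + 1) ^ 2 := by
  rw [boxAt, card_product, card_Icc_center, card_Icc_center, sq]

lemma card_sph_le (x : V) (r : ℕ) : (sph x r).card ≤ 4 * (2 * r + 1) := by
  have hsub : sph x r ⊆ ({x.1 - r, x.1 + r} : Finset ℤ) ×ˢ Icc (x.2 - r) (x.2 + r) ∪
      Icc (x.1 - r) (x.1 + r) ×ˢ ({x.2 - r, x.2 + r} : Finset ℤ) := by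
    intro y hy
    have := mem_sph.1 hy
    simp [nrm] at this
    grind
  refine (card_le_card hsub).trans ((Finset.card_union_le _ _).trans ?_)
  rw [card_product, card_product, card_Icc_center, card_Icc_center]
  grind

lemma PiOp_box_spin_dependsOn (β : ℝ) (x : V) (L : ℕ) : SpinDep (sph x (L + 1)) (PiOp β (boxAt x L) fun τ => spinVal (τ x)) := by
  intro σ τ h
  have hx : x ∈ boxAt x L := mem_boxAt_iff.2 (by simp [nrm])
  refine PiOp_local (fun y hy i hi => h _ (mem_sph.2 ?_)) fun η => by grind [spatch_of_mem]
  rw [mem_boxAt_iff] at hy hi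
  have := nrm_add_dir (y - x) i
  grind [sub_add_eq_add_sub]

lemma abs_PiOp_box_spin_le (hβ : 0 ≤ β) (x : V) (L : ℕ) (σ : Ω) :
    |PiOp β (boxAt x L) (fun τ => spinVal (τ x)) σ| ≤ mag β L := by
  have h1 := PiOp_mono_bc hβ (boxAt x L) (spin_monotone x) (_root_.le_top : σ ≤ ⊤)
  have h2 := PiOp_mono_bc hβ (boxAt x L) (spin_monotone x) (_root_.bot_le : ⊥ ≤ σ)
  simp_all [PiOp_spin_bot, PiOp_boxAt_spin, abs_le]

/-- Correlations with the spin at the centre of a box are controlled by those with the spins around the box. -/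
lemma integral_mul_spin_le (hβ : 0 ≤ β) (hm : NoMag β) (hγ : IsGibbsIsing β γ) {A : Finset V}
    {f : Ω → ℝ} (hf : SpinDep A f) (hfm : Monotone f) (x : V) (L : ℕ)
    (hfL : ∀ η σ, f (spatch (boxAt x L) η σ) = f σ) :
    ∫ σ, f σ * spinVal (σ x) ∂γ ≤ mag β L * ∑ y ∈ sph x (L + 1), ∫ σ, f σ * spinVal (σ y) ∂γ := by
  have := hγ.1
  set p : Ω → ℝ := PiOp β (boxAt x L) fun τ => spinVal (τ x) with hp
  have hpd : SpinDep (sph x (L + 1)) p := PiOp_box_spin_dependsOn β x L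
  have hpn : SpinDep (sph x (L + 1)) fun σ => -p σ := fun σ τ h => congrArg Neg.neg (hpd σ τ h)
  have hfA : SpinDep (A ∪ {x}) f := hf.mono subset_union_left
  have hfx : SpinDep (A ∪ {x}) fun σ => f σ * spinVal (σ x) := hfA.mul (dependsOn_spin (mem_union_right _ (mem_singleton_self x)))
  have e1 : ∫ σ, f σ * spinVal (σ x) ∂γ = ∫ σ, f σ * p σ ∂γ := by
    obtain ⟨C', hC'⟩ := continuous_bounded _ hfx.continuous
    rw [hγ.integral_eq (boxAt x L) hfx.continuous.measurable hC']
    grind [PiOp_eq_sum_gp, mul_sum]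
  have hgm := monotone_of_dominated hpn (C := mag β L) fun σ => by grind [abs_PiOp_box_spin_le]
  have hgd : SpinDep (sph x (L + 1)) fun σ => mag β L * ∑ y ∈ sph x (L + 1), spinVal (σ y) + -p σ := fun σ τ h => by
    beta_reduce
    rw [hpd σ τ h, sum_congr rfl fun y hy => congrArg spinVal (h y hy)]
  have hsp : ∀ y ∈ sph x (L + 1), Integrable (fun σ => spinVal (σ y)) γ := fun y hy => (dependsOn_spin hy).integrable
  have e0 : ∫ σ, (mag β L * ∑ y ∈ sph x (L + 1), spinVal (σ y) + -p σ) ∂γ = 0 := by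
    have hpi : ∫ σ, p σ ∂γ = 0 := by
      rw [← hγ.integral_spin hβ hm x]
      exact (hγ.integral_eq _ (measurable_spin x) (C := 1) fun σ => (spinVal_abs _).le).symm
    rw [integral_add ((integrable_finsetSum _ hsp).const_mul _) hpn.integrable, integral_neg, hpi,
      integral_const_mul, integral_finsetSum _ hsp]
    simp [hγ.integral_spin hβ hm]
  have hk := hγ.fkg hβ hm hf hgd hfm hgm
  rw [e0, mul_zero] at hk
  have hfy : ∀ y ∈ sph x (L + 1), Integrable (fun σ => f σ * spinVal (σ y)) γ := fun y hy =>
    ((hf.mono subset_union_left).mul (dependsOn_spin (mem_union_right A hy))).integrable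
  have hfp : Integrable (fun σ => f σ * p σ) γ :=
    ((hf.mono subset_union_left).mul (hpd.mono (Finset.subset_union_right (s₁ := A)))).integrable
  have e2 : ∫ σ, f σ * (mag β L * ∑ y ∈ sph x (L + 1), spinVal (σ y) + -p σ) ∂γ =
      mag β L * ∑ y ∈ sph x (L + 1), ∫ σ, f σ * spinVal (σ y) ∂γ - ∫ σ, f σ * p σ ∂γ := by
    rw [← integral_finsetSum _ hfy, ← integral_const_mul, ← integral_sub ((integrable_finsetSum _ hfy).const_mul _) hfp]
    refine integral_congr_ae (Eventually.of_forall fun σ => ?_)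
    simp [mul_sum, mul_add]
    grind
  grind

/-- The spins in the box of radius `L` around `x` are pivotal for the arm event. -/
def boxPivotal (n L : ℕ) (c : V → Bool) (x : V) (σ : Ω) : Prop :=
  ¬arm 0 n c (spatch (boxAt x L) (fun _ => false) σ) ∧ arm 0 n c (spatch (boxAt x L) (fun _ => true) σ)

lemma dependsOn_boxPivotal (n L : ℕ) (c : V → Bool) (x : V) : SpinDep (boxAt 0 n) fun σ => ind (boxPivotal n L c x σ) := by
  intro σ τ h
  have key : ∀ b : Bool, arm 0 n c (spatch (boxAt x L) (fun _ => b) σ) ↔ arm 0 n c (spatch (boxAt x L) (fun _ => b) τ) :=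
    fun b => arm_congr (fun _ _ => rfl) fun u hu => by grind [boxAt, spatch_of_mem, spatch_notMem]
  simp_all [boxPivotal]

lemma not_boxPivotal {n L : ℕ} {c : V → Bool} {x : V} (hx : x ∉ boxAt 0 (n + L)) (σ : Ω) :
    ¬boxPivotal n L c x σ := fun ⟨h1, h2⟩ => h1 (arm_mono (fun _ _ h => h) (fun u hu h => by
  have hux : u ∉ boxAt x L := fun hux => by
    rw [mem_boxAt_iff] at hux
    rw [mem_boxAt_zero] at hu hx
    simp [nrm] at hux hu hx
    omega
  grind [spatch_notMem]) h2)

lemma arm_ind_monotone (x : V) (r : ℕ) (c : V → Bool) : Monotone fun σ => ind (arm x r c σ) := fun _ _ h =>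
  ind_mono (arm_mono (fun _ _ h => h) fun u _ hu => _root_.le_antisymm (Bool.le_true _) (hu ▸ h u))

/-- One step of the recursion for the correlations of the arm event. -/
lemma integral_arm_spin_le (hβ : 0 ≤ β) (hm : NoMag β) (hγ : IsGibbsIsing β γ) (n L : ℕ)
    (hL : mag β L * (4 * (2 * (L + 1) + 1)) ≤ 1 / 2) (c : V → Bool) (x : V) :
    ∫ σ, ind (arm 0 n c σ) * spinVal (σ x) ∂γ ≤ 3 / 2 * ∫ σ, ind (boxPivotal n L c x σ) ∂γ +
      mag β L * ∑ y ∈ sph x (L + 1), ∫ σ, ind (arm 0 n c σ) * spinVal (σ y) ∂γ := by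
  have := hγ.1
  set f : Ω → ℝ := fun σ => ind (arm 0 n c σ)
  set g : Ω → ℝ := fun σ => ind (arm 0 n c (spatch (boxAt x L) (fun _ => false) σ))
  have hmono : ∀ σ, spatch (boxAt x L) (fun _ => false) σ ≤ σ ∧ σ ≤ spatch (boxAt x L) (fun _ => true) σ := fun σ => by
    constructor <;> intro u <;> by_cases hu : u ∈ boxAt x L
    · grind [spatch_of_mem, Bool.false_le]
    · rw [spatch_notMem hu]
    · grind [spatch_of_mem, Bool.le_true]
    · rw [spatch_notMem hu]
  have hfd : SpinDep (boxAt 0 n) f := dep_arm_spins 0 n c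
  have hgd : SpinDep (boxAt 0 n) g := fun σ τ h => hfd _ _ fun u hu => by
      by_cases hux : u ∈ boxAt x L
      · simp_all [spatch_of_mem]
      simp_all [spatch_notMem]
  have hgm : Monotone g := fun σ τ h => arm_ind_monotone 0 n c (spatch_mono le_rfl h)
  have hgf : ∀ σ, g σ ≤ f σ := fun σ => arm_ind_monotone 0 n c (hmono σ).1
  have hfg : ∀ σ, f σ - g σ ≤ ind (boxPivotal n L c x σ) := fun σ => by
    have h1 : f σ ≤ ind (arm 0 n c (spatch (boxAt x L) (fun _ => true) σ)) := arm_ind_monotone 0 n c (hmono σ).2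
    by_cases hp : arm 0 n c (spatch (boxAt x L) (fun _ => false) σ)
    · have : g σ = 1 := ind_of hp
      linarith [ind_le_one (arm 0 n c σ), ind_nonneg (boxPivotal n L c x σ)]
    · have h0 : g σ = 0 := ind_not hp
      rw [h0, sub_zero]
      exact h1.trans (ind_mono fun h => ⟨hp, h⟩)
  have hint : ∀ (h : Ω → ℝ) (y : V), SpinDep (boxAt 0 n) h → Integrable (fun σ => h σ * spinVal (σ y)) γ :=
    fun h y hd => ((hd.mono subset_union_left).mul (dependsOn_spin (mem_union_right (boxAt 0 n) (mem_singleton_self y)))).integrable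
  have hpi : Integrable (fun σ => ind (boxPivotal n L c x σ)) γ := (dependsOn_boxPivotal n L c x).integrable
  have hdiff : ∀ y, |∫ σ, f σ * spinVal (σ y) ∂γ - ∫ σ, g σ * spinVal (σ y) ∂γ| ≤ ∫ σ, ind (boxPivotal n L c x σ) ∂γ := by
    intro y
    rw [← integral_sub (hint f y hfd) (hint g y hgd)]
    refine (abs_integral_le_integral_abs).trans (integral_mono ((hint f y hfd).sub (hint g y hgd)).abs hpi fun σ => ?_)
    rw [← sub_mul, abs_mul, spinVal_abs, mul_one, abs_of_nonneg (sub_nonneg.2 (hgf σ))]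
    exact hfg σ
  have hbox := integral_mul_spin_le hβ hm hγ hgd hgm x L fun η σ => ind_congr (by
    rw [spatch_congr (σ := spatch (boxAt x L) η σ) (σ' := σ) fun u hu => spatch_notMem hu])
  have hP : 0 ≤ ∫ σ, ind (boxPivotal n L c x σ) ∂γ := integral_ind_nonneg _ _
  have hsum : ∑ y ∈ sph x (L + 1), ∫ σ, g σ * spinVal (σ y) ∂γ ≤ ∑ y ∈ sph x (L + 1), ∫ σ, f σ * spinVal (σ y) ∂γ +
        (4 * (2 * (L + 1) + 1)) * ∫ σ, ind (boxPivotal n L c x σ) ∂γ := by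
    calc _ ≤ ∑ y ∈ sph x (L + 1), (∫ σ, f σ * spinVal (σ y) ∂γ + ∫ σ, ind (boxPivotal n L c x σ) ∂γ) :=
          sum_le_sum fun y _ => by simp_all [abs_le]
      _ ≤ _ := by
          rw [sum_add_distrib, sum_const, nsmul_eq_mul]
          gcongr
          exact_mod_cast card_sph_le x (L + 1)
  have h1 := (abs_le.1 (hdiff x)).2
  have h2 := mul_le_mul_of_nonneg_left hsum (mag_nonneg hβ L)
  have h3 := mul_le_mul_of_nonneg_right hL hP
  grind

/-- A bounded-growth sequence contracting up to a constant stays below the fixed point. -/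
lemma le_of_contraction {a : ℕ → ℝ} {P C : ℝ} (h : ∀ k, a k ≤ 3 / 2 * P + 1 / 2 * a (k + 1))
    (hC : ∀ k : ℕ, a k ≤ C * ((k : ℝ) + 1) ^ 2) : a 0 ≤ 3 * P := by
  have h1 : ∀ k, a 0 - 3 * P ≤ (1 / 2) ^ k * (a k - 3 * P) := by
    intro k
    induction k with
    | zero => simp
    | succ k ih =>
      refine ih.trans ?_
      rw [pow_succ, mul_assoc]
      exact mul_le_mul_of_nonneg_left (by grind) (by positivity)
  have ht : Tendsto (fun k : ℕ => C * (2 * (((k : ℝ) + 1) ^ 2 * (1 / 2) ^ (k + 1))) - (1 / 2) ^ k * (3 * P)) atTop (𝓝 0) := by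
    have e1 := (tendsto_add_atTop_iff_nat 1).2 (tendsto_pow_const_mul_const_pow_of_abs_lt_one 2 (r := (1 / 2 : ℝ)) (by grind))
    have e2 := tendsto_pow_atTop_nhds_zero_of_lt_one (r := (1 / 2 : ℝ)) (by norm_num) (by norm_num)
    have := ((e1.const_mul 2).const_mul C).sub (e2.mul_const (3 * P))
    grind
  have h2 : ∀ k : ℕ, a 0 - 3 * P ≤ C * (2 * (((k : ℝ) + 1) ^ 2 * (1 / 2) ^ (k + 1))) - (1 / 2) ^ k * (3 * P) := fun k => by
    have h3 := mul_le_mul_of_nonneg_left (hC k) (show (0 : ℝ) ≤ (1 / 2) ^ k by positivity)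
    rw [pow_succ (1 / 2 : ℝ) k]
    grind
  linarith [ge_of_tendsto' ht h2]

/-- Summed correlations of the arm event are controlled by the pivotality of boxes. -/
theorem sum_armCorr_le (hβ : 0 ≤ β) (hm : NoMag β) (hγ : IsGibbsIsing β γ) (n L : ℕ)
    (hL : mag β L * (4 * (2 * (L + 1) + 1)) ≤ 1 / 2) (s : ℝ) :
    ∑ y ∈ boxAt 0 n, armCorr γ n s y ≤
      3 * ∑ x ∈ boxAt 0 (n + L), coinE s (boxAt 0 n) fun c => ∫ σ, ind (boxPivotal n L c x σ) ∂γ := by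
  have := hγ.1
  simp [armCorr]
  rw [← coinE_sum, ← coinE_sum, ← coinE_smul]
  refine coinE_mono s _ fun c => ?_
  set a : V → ℝ := fun y => ∫ σ, ind (arm 0 n c σ) * spinVal (σ y) ∂γ with ha
  have ha0 : ∀ y, 0 ≤ a y := hγ.integral_mul_spin_nonneg hβ hm (dep_arm_spins 0 n c) (arm_ind_monotone 0 n c)
  have ha1 : ∀ y, a y ≤ 1 := fun y => by
    have hi : Integrable (fun σ => ind (arm 0 n c σ) * spinVal (σ y)) γ := (((dep_arm_spins 0 n c).mono subset_union_left).mul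
        (dependsOn_spin (mem_union_right (boxAt 0 n) (mem_singleton_self y)))).integrable
    refine (integral_mono hi (integrable_const (1 : ℝ)) fun σ => ?_).trans_eq (by simp)
    refine (le_abs_self _).trans ?_
    grind [spinVal_abs, abs_ind_le]
  set P := ∑ x ∈ boxAt 0 (n + L), ∫ σ, ind (boxPivotal n L c x σ) ∂γ with hP
  have hPR : ∀ R, n + L ≤ R → ∑ x ∈ boxAt 0 R, ∫ σ, ind (boxPivotal n L c x σ) ∂γ = P := fun R hR =>
    (Finset.sum_subset (boxAt_mono 0 hR) fun x _ hx => by simp [ind_not (not_boxPivotal hx _)]).symm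
  have hdouble : ∀ R, ∑ x ∈ boxAt 0 R, ∑ y ∈ sph x (L + 1), a y ≤ (4 * (2 * (L + 1) + 1)) * ∑ y ∈ boxAt 0 (R + (L + 1)), a y := by
    intro R
    rw [Finset.sum_comm' (t' := boxAt 0 (R + (L + 1))) (s' := fun y => (boxAt 0 R).filter (· ∈ sph y (L + 1))), mul_sum]
    · refine sum_le_sum fun y _ => ?_
      rw [sum_const, nsmul_eq_mul]
      refine mul_le_mul_of_nonneg_right ?_ (ha0 y)
      have : ((boxAt 0 R).filter (· ∈ sph y (L + 1))).card ≤ 4 * (2 * (L + 1) + 1) :=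
        (card_le_card fun z hz => (mem_filter.1 hz).2).trans (card_sph_le y (L + 1))
      exact_mod_cast this
    · intro x y
      rw [mem_filter, mem_sph_comm]
      refine ⟨fun h => ⟨h, ?_⟩, fun h => h.1⟩
      have h2 := mem_sph.1 (mem_sph_comm.1 h.2)
      have := nrm_le_add y x
      grind [mem_boxAt_zero]
  have hrec : ∀ R, n + L ≤ R → ∑ x ∈ boxAt 0 R, a x ≤ 3 / 2 * P + 1 / 2 * ∑ y ∈ boxAt 0 (R + (L + 1)), a y := by
    intro R hR
    calc _ ≤ ∑ x ∈ boxAt 0 R, (3 / 2 * ∫ σ, ind (boxPivotal n L c x σ) ∂γ +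
          mag β L * ∑ y ∈ sph x (L + 1), a y) :=
          sum_le_sum fun x _ => integral_arm_spin_le hβ hm hγ n L hL c x
      _ = 3 / 2 * P + mag β L * ∑ x ∈ boxAt 0 R, ∑ y ∈ sph x (L + 1), a y := by rw [sum_add_distrib, ← mul_sum, ← mul_sum, hPR R hR]
      _ ≤ _ := by
          have h1 := mul_le_mul_of_nonneg_left (hdouble R) (mag_nonneg hβ L)
          have h2 := mul_le_mul_of_nonneg_right hL (sum_nonneg fun y (_ : y ∈ boxAt 0 (R + (L + 1))) => ha0 y)
          linarith
  calc ∑ y ∈ boxAt 0 n, a y ≤ ∑ y ∈ boxAt 0 (n + L), a y :=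
        Finset.sum_le_sum_of_subset_of_nonneg (boxAt_mono 0 (Nat.le_add_right n L)) fun y _ _ => ha0 y
    _ ≤ 3 * P := by
        have := le_of_contraction (a := fun k => ∑ y ∈ boxAt 0 (n + L + k * (L + 1)), a y) (P := P)
          (C := (2 * (n + L) + 2 * L + 3) ^ 2) (fun k => ?_) fun k => ?_
        · grind
        · grind
        · refine (sum_le_sum fun y _ => ha1 y).trans ?_
          rw [sum_const, nsmul_eq_mul, mul_one, card_boxAt, ← mul_pow]
          push_cast
          have hk : (0 : ℝ) ≤ k := cast_nonneg k
          have hn : (0 : ℝ) ≤ n := cast_nonneg n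
          have hl : (0 : ℝ) ≤ L := cast_nonneg L
          nlinarith [mul_nonneg hk hn, mul_nonneg hk hl]

end

section

variable {β : ℝ} {γ : Measure Ω}

lemma abs_hamiltonian_le (Λ : Finset V) (σ : Ω) : |hamiltonian Λ σ| ≤ 4 * Λ.card := by
  rw [hamiltonian, abs_neg]
  have hcard : (dualEdges Λ).card ≤ 4 * Λ.card := by
    refine Finset.card_image_le.trans ?_
    rw [card_product, card_univ, Fintype.card_fin, mul_comm]
  calc _ ≤ ∑ e ∈ dualEdges Λ, |pairEnergy σ e| := Finset.abs_sum_le_sum_abs _ _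
    _ ≤ ∑ e ∈ dualEdges Λ, (1 : ℝ) := sum_le_sum fun e _ => by
        induction e using Sym2.inductionOn with
        | hf x y => grind [pairEnergy_mk, spinVal_abs]
    _ ≤ _ := by
        rw [sum_const, nsmul_eq_mul, mul_one]
        exact_mod_cast hcard

lemma one_le_gp (β : ℝ) (Λ : Finset V) (η : ↥Λ → Bool) (σ : Ω) : 1 ≤ 2 ^ Λ.card * exp (8 * |β| * Λ.card) * gp β Λ η σ := by
  have hb : ∀ η : ↥Λ → Bool, |-β * hamiltonian Λ (spatch Λ η σ)| ≤ 4 * |β| * Λ.card := fun η => by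
    rw [abs_mul, abs_neg]
    have := mul_le_mul_of_nonneg_left (abs_hamiltonian_le Λ (spatch Λ η σ)) (abs_nonneg β)
    linarith
  have hZ : Zpart β Λ σ ≤ 2 ^ Λ.card * exp (4 * |β| * Λ.card) := by
    refine (sum_le_sum fun η _ => exp_le_exp.2 (abs_le.1 (hb η)).2).trans_eq ?_
    simp_all
  have hg : exp (-(4 * |β| * Λ.card)) ≤ gw β Λ σ η := exp_le_exp.2 (abs_le.1 (hb η)).1
  rw [gp, ← mul_div_assoc, le_div_iff₀ (Zpart_pos _ _ _), one_mul]
  refine hZ.trans (le_trans (le_of_eq ?_) (mul_le_mul_of_nonneg_left hg (by positivity)))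
  rw [mul_assoc (2 ^ Λ.card : ℝ), ← exp_add]
  grind

lemma SpinDep.spatch {A U : Finset V} {f : Ω → ℝ} (h : SpinDep A f) (ξ : ↥U → Bool) :
    SpinDep A fun σ => f (spatch U ξ σ) := fun σ τ hs => h _ _ fun u hu => by
  by_cases hU : u ∈ U
  · grind [spatch_of_mem]
  grind [spatch_notMem]

lemma IsGibbsIsing.integral_spatch_le (hγ : IsGibbsIsing β γ) {A U : Finset V} {f : Ω → ℝ}
    (hf : SpinDep A f) (h0 : ∀ σ, 0 ≤ f σ) (ξ : ↥U → Bool) :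
    ∫ σ, f (spatch U ξ σ) ∂γ ≤ 2 ^ U.card * exp (8 * |β| * U.card) * ∫ σ, f σ ∂γ := by
  have := hγ.1
  obtain ⟨C, hC⟩ := continuous_bounded f hf.continuous
  rw [hγ.integral_eq U hf.continuous.measurable hC, ← integral_const_mul]
  refine integral_mono (hf.spatch ξ).integrable ((integrable_of_bounded (measurable_PiOp hf.continuous.measurable)
    fun σ => abs_PiOp_le U hC σ).const_mul _) fun σ => ?_
  rw [PiOp_eq_sum_gp]
  have h1 := single_le_sum (f := fun η => gp β U η σ * f (_root_.spatch U η σ))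
    (fun η _ => mul_nonneg (gp_nonneg β U η σ) (h0 _)) (mem_univ ξ)
  refine le_trans ?_ (mul_le_mul_of_nonneg_left h1 (by positivity))
  rw [← mul_assoc]
  grind [le_mul_of_one_le_left, one_le_gp]

lemma coinE_update_le (s : ℝ) {A : Finset V} {p : V} (hp : p ∈ A) (b : Bool) {G : 𝓕 V} (hG : ∀ c, 0 ≤ G c) :
    coinE s A (fun c => G (update c p b)) ≤ (1 + exp |s|) * coinE s A G := by
  have := wEx_coin_flip_le s (⟨p, hp⟩ : ↥A) b (G := fun η => G (spatch A η ⊥)) fun η => hG _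
  refine le_trans (le_of_eq ?_) this
  rw [coinE]
  refine congrArg _ (funext fun η => congrArg G (funext fun u => ?_))
  by_cases hu : u = p
  · grind [spatch_of_mem]
  · by_cases huA : u ∈ A
    · simp_all [spatch_of_mem]
    grind [spatch_notMem]

lemma coinE_spatch_le (s : ℝ) {A : Finset V} (c₀ : V → Bool) (W : Finset V) : W ⊆ A → ∀ {G : 𝓕 V}, (∀ c, 0 ≤ G c) →
    coinE s A (fun c => G (spatch W (fun p => c₀ p) c)) ≤ (1 + exp |s|) ^ W.card * coinE s A G := by
  classical
  induction W using induction_on with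
  | empty =>
    have e : ∀ c : V → Bool, spatch ∅ (fun p => c₀ p) c = c := fun c => funext fun u => spatch_notMem (by simp)
    simp_all
  | insert p W hp ih =>
    intro hW G hG
    have e : ∀ c : V → Bool, spatch (insert p W) (fun q => c₀ q) c = spatch W (fun q => c₀ q) (update c p (c₀ p)) := fun c => by
      grind [spatch]
    simp [e]
    refine (coinE_update_le s (hW (mem_insert_self p W)) (c₀ p) (G := fun c => G (spatch W (fun q => c₀ q) c)) fun c => hG _).trans ?_
    rw [Finset.card_insert_of_notMem hp, pow_succ', mul_assoc]
    exact mul_le_mul_of_nonneg_left (ih ((Finset.subset_insert p W).trans hW) hG) (by positivity)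

/-- Insertion tolerance: local modifications of an event are not much more likely than the event. -/
lemma coinE_integral_spatch_le (hγ : IsGibbsIsing β γ) (s : ℝ) {A B U W : Finset V} (hW : W ⊆ A)
    {G : (V → Bool) → Ω → ℝ} (hd : ∀ c, SpinDep B (G c)) (h0 : ∀ c σ, 0 ≤ G c σ)
    (ζ : ↥W → Bool) (ξ : ↥U → Bool) :
    coinE s A (fun c => ∫ σ, G (spatch W ζ c) (spatch U ξ σ) ∂γ) ≤
      2 ^ U.card * exp (8 * |β| * U.card) * (1 + exp |s|) ^ W.card * coinE s A fun c => ∫ σ, G c σ ∂γ := by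
  refine (coinE_mono s A fun c => hγ.integral_spatch_le (hd _) (h0 _) ξ).trans ?_
  rw [coinE_smul, mul_assoc (2 ^ U.card * exp (8 * |β| * U.card))]
  refine mul_le_mul_of_nonneg_left ?_ (by positivity)
  have := coinE_spatch_le s (spatch W ζ (⊥ : V → Bool)) W hW (G := fun c => ∫ σ, G c σ ∂γ) fun c => integral_nonneg (h0 c)
  have hζ : (fun p : ↥W => spatch W ζ (⊥ : V → Bool) p) = ζ := funext fun p => spatch_of_mem p.2
  grind

def coinPivotal (n : ℕ) (p : V) (c : V → Bool) (σ : Ω) : Prop := ¬arm 0 n (update c p false) σ ∧ arm 0 n (update c p true) σ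

lemma ind_coinPivotal (n : ℕ) (p : V) (c : V → Bool) (σ : Ω) : ind (coinPivotal n p c σ) =
    ind (arm 0 n (update c p true) σ) - ind (arm 0 n (update c p false) σ) := by
  by_cases h1 : arm 0 n (update c p false) σ
  · have h2 : arm 0 n (update c p true) σ := arm_mono (fun q _ h => by grind) (fun _ _ h => h) h1
    rw [ind_of h1, ind_of h2, ind_not fun h => h.1 h1, sub_self]
  · rw [ind_not h1, sub_zero]
    exact ind_congr ⟨fun h => h.2, fun h => ⟨h1, h⟩⟩

lemma dependsOn_coinPivotal (n : ℕ) (p : V) (c : V → Bool) : SpinDep (boxAt 0 n) fun σ => ind (coinPivotal n p c σ) := fun σ τ h => by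
  simp [ind_coinPivotal]
  exact congrArg₂ (· - ·) (dep_arm_spins 0 n _ σ τ h) (dep_arm_spins 0 n _ σ τ h)

lemma coinE_coinPivotal [IsProbabilityMeasure γ] (s : ℝ) {n : ℕ} (p : ↥(boxAt 0 n)) :
    coinE s (boxAt 0 n) (fun c => ∫ σ, ind (coinPivotal n p c σ) ∂γ) =
      (1 + exp s) * (1 + exp (-s)) * wCov (coinW s) (armFun γ n) (cInd p) := by
  rw [← wEx_pivotal_eq, coinE]
  refine congrArg _ (funext fun η => ?_)
  have e : ∀ b, update (spatch (boxAt 0 n) η ⊥) p b = spatch (boxAt 0 n) (update η p b) ⊥ := fun b => by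
    ext u
    by_cases hu : u = p
    · grind [spatch_of_mem]
    · by_cases huA : u ∈ boxAt 0 n
      · grind [spatch_of_mem]
      grind [spatch_notMem]
  simp [ind_coinPivotal, e]
  exact integral_sub (dep_arm_spins _ _ _).integrable (dep_arm_spins _ _ _).integrable

lemma ind_le_sum {ι : Type*} {I : Finset ι} {P : Prop} {Q : ι → Prop} (h : P → ∃ i ∈ I, Q i) : ind P ≤ ∑ i ∈ I, ind (Q i) := by
  grind [single_le_sum, ind, sum_nonneg]

lemma coinE_le_of_modification (hγ : IsGibbsIsing β γ) (s : ℝ) {A B U W : Finset V} (hWU : W ⊆ U) (hWA : W ⊆ A)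
    {P : (V → Bool) → Ω → Prop} {Q : V → (V → Bool) → Ω → Prop}
    (hP : ∀ c, SpinDep B fun σ => ind (P c σ)) (hQ : ∀ p c, SpinDep B fun σ => ind (Q p c σ))
    (hPQ : ∀ c σ, P c σ → ∃ c' σ', (∀ p ∉ W, c' p = c p) ∧ (∀ u ∉ U, σ' u = σ u) ∧ ∃ p ∈ W, Q p c' σ') :
    coinE s A (fun c => ∫ σ, ind (P c σ) ∂γ) ≤
      4 ^ U.card * (2 ^ U.card * exp (8 * |β| * U.card) * (1 + exp |s|) ^ U.card) *
        ∑ p ∈ W, coinE s A fun c => ∫ σ, ind (Q p c σ) ∂γ := by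
  have := hγ.1
  have hcard := card_le_card hWU
  set K := 2 ^ U.card * exp (8 * |β| * U.card) * (1 + exp |s|) ^ U.card with hK
  have hK0 : 0 < K := by positivity
  have hpt : ∀ c σ, ind (P c σ) ≤ ∑ i ∈ W ×ˢ (univ : Finset ((↥W → Bool) × (↥U → Bool))),
      ind (Q i.1 (spatch W i.2.1 c) (spatch U i.2.2 σ)) := fun c σ => by
    refine ind_le_sum (Q := fun i : V × ((↥W → Bool) × (↥U → Bool)) => Q i.1 (spatch W i.2.1 c) (spatch U i.2.2 σ)) fun h => ?_
    obtain ⟨c', σ', hc, hσ, p, hp, hq⟩ := hPQ c σ h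
    refine ⟨(p, fun q => c' q, fun u => σ' u), mem_product.2 ⟨hp, mem_univ _⟩, ?_⟩
    simp_all [spatch_restrict]
  have hint : ∀ (c : V → Bool) (p : V) (ξ : ↥U → Bool), Integrable (fun σ => ind (Q p c (spatch U ξ σ))) γ :=
    fun c p ξ => ((hQ p c).spatch ξ).integrable
  have hP0 : ∀ p, 0 ≤ coinE s A fun c => ∫ σ, ind (Q p c σ) ∂γ := fun p => coinE_nonneg _ _ fun c => integral_ind_nonneg _ _
  calc _ ≤ coinE s A (fun c => ∑ i ∈ W ×ˢ (univ : Finset ((↥W → Bool) × (↥U → Bool))),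
        ∫ σ, ind (Q i.1 (spatch W i.2.1 c) (spatch U i.2.2 σ)) ∂γ) := by
        refine coinE_mono _ _ fun c => ?_
        refine (integral_mono (hP c).integrable (integrable_finsetSum _ fun i _ => hint _ _ _) (hpt c)).trans_eq ?_
        simp_all [integral_finsetSum]
    _ = ∑ i ∈ W ×ˢ (univ : Finset ((↥W → Bool) × (↥U → Bool))), coinE s A fun c =>
        ∫ σ, ind (Q i.1 (spatch W i.2.1 c) (spatch U i.2.2 σ)) ∂γ := coinE_sum _ _ _ _
    _ ≤ ∑ i ∈ W ×ˢ (univ : Finset ((↥W → Bool) × (↥U → Bool))), K * coinE s A fun c =>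
        ∫ σ, ind (Q i.1 c σ) ∂γ := by
        refine sum_le_sum fun i _ => ?_
        refine (coinE_integral_spatch_le hγ s hWA (hQ i.1) (fun c σ => ind_nonneg _) i.2.1 i.2.2).trans
          (mul_le_mul_of_nonneg_right ?_ (hP0 _))
        refine mul_le_mul_of_nonneg_left (pow_le_pow_right₀ ?_ hcard) (by positivity)
        grind [exp_pos]
    _ = (2 ^ W.card * 2 ^ U.card) * K * ∑ p ∈ W, coinE s A fun c => ∫ σ, ind (Q p c σ) ∂γ := by
        rw [sum_product]
        simp
        grind [mul_sum]
    _ ≤ _ := by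
        refine mul_le_mul_of_nonneg_right (mul_le_mul_of_nonneg_right ?_ hK0.le) (sum_nonneg fun p _ => hP0 p)
        rw [show (4 : ℝ) = 2 * 2 by norm_num, mul_pow]
        simp_all [pow_le_pow_right₀]

lemma coinE_boxPivotal_le (hγ : IsGibbsIsing β γ) (s : ℝ) {n L : ℕ} (hL : 1 ≤ L) (hLn : L ≤ n) {x : V}
    (hx : x ∈ boxAt 0 (n + L)) (h0 : (0 : V) ∉ boxAt x (3 * L + 2)) {M : ℕ} (hM : (boxAt x (3 * L + 2)).card = M) :
    coinE s (boxAt 0 n) (fun c => ∫ σ, ind (boxPivotal n L c x σ) ∂γ) ≤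
      4 ^ M * (2 ^ M * exp (8 * |β| * M) * (1 + exp |s|) ^ M) *
        ∑ p ∈ boxAt x (3 * L + 2) ∩ boxAt 0 n, coinE s (boxAt 0 n) fun c => ∫ σ, ind (coinPivotal n p c σ) ∂γ := by
  rw [← hM]
  exact coinE_le_of_modification hγ s Finset.inter_subset_left Finset.inter_subset_right
    (fun c => dependsOn_boxPivotal n L c x) (dependsOn_coinPivotal n)
    fun c σ h => exists_pivotal_face hL hLn hx h0 h.1 h.2

lemma coinE_boxPivotal_le_armProb (hγ : IsGibbsIsing β γ) (s : ℝ) (n L : ℕ) (x : V) :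
    coinE s (boxAt 0 n) (fun c => ∫ σ, ind (boxPivotal n L c x σ) ∂γ) ≤
      2 ^ (boxAt x L).card * exp (8 * |β| * (boxAt x L).card) * armProb γ n s := by
  have := hγ.1
  rw [armProb, ← coinE_smul]
  refine coinE_mono _ _ fun c => ?_
  refine le_trans ?_ (hγ.integral_spatch_le (dep_arm_spins 0 n c) (fun _ => ind_nonneg _) fun _ : ↥(boxAt x L) => true)
  exact integral_mono (dependsOn_boxPivotal n L c x).integrable ((dep_arm_spins 0 n c).spatch _).integrable
    fun σ => ind_mono fun h => h.2

/-- Pivotality of boxes is controlled by the derivative of the arm probability in the coin parameter. -/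
theorem exists_sum_boxPivotal_le (hγ : IsGibbsIsing β γ) {L : ℕ} (hL : 1 ≤ L) : ∃ C, 0 < C ∧ ∀ n, L ≤ n →
    ∀ s ∈ Set.Icc (-1 : ℝ) 1, ∑ x ∈ boxAt 0 (n + L), coinE s (boxAt 0 n) (fun c => ∫ σ, ind (boxPivotal n L c x σ) ∂γ) ≤
      C * (armProb' γ n s + armProb γ n s) := by
  have := hγ.1
  obtain ⟨M, hM⟩ : ∃ M, ∀ x : V, (boxAt x (3 * L + 2)).card = M := ⟨_, fun x => card_boxAt x _⟩
  obtain ⟨K₁, hK₁⟩ : ∃ K : ℝ, K = 4 ^ M * (2 ^ M * exp (8 * |β| * M) * (1 + exp 1) ^ M) := ⟨_, rfl⟩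
  obtain ⟨M', hM'⟩ : ∃ M', ∀ x : V, (boxAt x L).card = M' := ⟨_, fun x => card_boxAt x _⟩
  obtain ⟨K₂, hK₂⟩ : ∃ K : ℝ, K = 2 ^ M' * exp (8 * |β| * M') := ⟨_, rfl⟩
  have hk1 : 0 < K₁ := by rw [hK₁]; positivity
  have hk2 : 0 < K₂ := by rw [hK₂]; positivity
  refine ⟨M * (K₁ * ((1 + exp 1) * (1 + exp 1))) + M * K₂, by
    have : 0 < M := by rw [← hM 0, card_boxAt]; positivity
    positivity, fun n hn s hs => ?_⟩
  have hs1 : |s| ≤ 1 := abs_le.2 hs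
  set q : V → ℝ := fun p => coinE s (boxAt 0 n) fun c => ∫ σ, ind (coinPivotal n p c σ) ∂γ with hq
  have hq0 : ∀ p, 0 ≤ q p := fun p => coinE_nonneg _ _ fun c => integral_ind_nonneg _ _
  have hθ := armProb_nonneg (γ := γ) n s
  have hqsum : ∑ p ∈ boxAt 0 n, q p ≤ (1 + exp 1) * (1 + exp 1) * armProb' γ n s := by
    rw [← sum_attach, armProb', mul_sum, ← Finset.univ_eq_attach]
    refine sum_le_sum fun p _ => ?_
    refine (coinE_coinPivotal s p).trans_le ?_
    refine mul_le_mul_of_nonneg_right ?_ (wCov_coord_nonneg' (coinW_latticeWeight s) (armFun_mono n) p)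
    have h1 : exp s ≤ exp 1 := exp_le_exp.2 hs.2
    have h2 : exp (-s) ≤ exp 1 := exp_le_exp.2 (by grind)
    gcongr
  have hθ' : 0 ≤ armProb' γ n s := sum_nonneg fun p _ => wCov_coord_nonneg' (coinW_latticeWeight s) (armFun_mono n) p
  have hx : ∀ x ∈ boxAt 0 (n + L), coinE s (boxAt 0 n) (fun c => ∫ σ, ind (boxPivotal n L c x σ) ∂γ) ≤
      K₁ * ∑ p ∈ boxAt x (3 * L + 2) ∩ boxAt 0 n, q p + if x ∈ boxAt 0 (3 * L + 2) then K₂ * armProb γ n s else 0 := by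
    intro x hx
    by_cases h0 : (0 : V) ∈ boxAt x (3 * L + 2)
    · have h0' : x ∈ boxAt 0 (3 * L + 2) := by simp_all [mem_boxAt_iff, nrm]
      refine (coinE_boxPivotal_le_armProb hγ s n L x).trans (le_add_of_nonneg_of_le
        (mul_nonneg hk1.le (sum_nonneg fun p _ => hq0 p)) ?_)
      simp_all
    · refine (coinE_boxPivotal_le hγ s hL hn hx h0 (hM x)).trans (le_add_of_le_of_nonneg ?_ ?_)
      · refine mul_le_mul_of_nonneg_right ?_ (sum_nonneg fun p _ => hq0 p)
        rw [hK₁]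
        gcongr
      grind [mul_nonneg]
  refine (sum_le_sum hx).trans ?_
  rw [sum_add_distrib, ← mul_sum]
  have h1 : ∑ x ∈ boxAt 0 (n + L), ∑ p ∈ boxAt x (3 * L + 2) ∩ boxAt 0 n, q p ≤ M * ∑ p ∈ boxAt 0 n, q p := by
    rw [Finset.sum_comm' (t' := boxAt 0 n) (s' := fun p => (boxAt 0 (n + L)).filter fun x => p ∈ boxAt x (3 * L + 2)), mul_sum]
    · refine sum_le_sum fun p _ => ?_
      rw [sum_const, nsmul_eq_mul]
      refine mul_le_mul_of_nonneg_right ?_ (hq0 p)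
      have : ((boxAt 0 (n + L)).filter fun x => p ∈ boxAt x (3 * L + 2)).card ≤ (boxAt p (3 * L + 2)).card := by
        refine card_le_card fun x hx => ?_
        have := (mem_filter.1 hx).2
        rw [mem_boxAt] at this ⊢
        rwa [abs_sub_comm, abs_sub_comm x.2]
      rw [hM] at this
      exact_mod_cast this
    grind
  have h2 : ∑ x ∈ boxAt 0 (n + L), (if x ∈ boxAt 0 (3 * L + 2) then K₂ * armProb γ n s else 0) ≤ M * (K₂ * armProb γ n s) := by
    rw [← sum_filter, sum_const, nsmul_eq_mul]
    refine mul_le_mul_of_nonneg_right ?_ (mul_nonneg hk2.le hθ)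
    have : ((boxAt 0 (n + L)).filter (· ∈ boxAt 0 (3 * L + 2))).card ≤ (boxAt 0 (3 * L + 2)).card :=
      card_le_card fun x hx => (mem_filter.1 hx).2
    simp_all
  have h3 := mul_le_mul_of_nonneg_left (h1.trans (mul_le_mul_of_nonneg_left hqsum (cast_nonneg M))) hk1.le
  have hM0 : (0 : ℝ) ≤ M := cast_nonneg M
  have h4 : 0 ≤ M * (K₁ * ((1 + exp 1) * (1 + exp 1))) * armProb γ n s := by
    exact mul_nonneg (mul_nonneg hM0 (mul_nonneg hk1.le (by positivity))) hθ
  have h5 : 0 ≤ M * K₂ * armProb' γ n s := mul_nonneg (mul_nonneg hM0 hk2.le) hθ'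
  linarith

end

section NoCoexistence

variable {β : ℝ} {γ : Measure Ω}

lemma mag_zero (n : ℕ) : mag 0 n = 0 := by
  have h : ∀ η : ↥(boxAt 0 n) → Bool, spinVal (spatch (boxAt 0 n) η ⊤ 0) = spinVal (η ⟨0, zero_mem_boxAt n⟩) :=
    fun η => by grind [spatch_of_mem]
  have h2 : ∑ η : ↥(boxAt 0 n) → Bool, spinVal (η ⟨0, zero_mem_boxAt n⟩) = 0 := by
    have e := Equiv.sum_comp (arrowCongr (Equiv.refl ↥(boxAt 0 n)) boolNot) fun η => spinVal (η ⟨0, zero_mem_boxAt n⟩)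
    have e2 : ∀ η : ↥(boxAt 0 n) → Bool, spinVal (arrowCongr (Equiv.refl ↥(boxAt 0 n)) boolNot η ⟨0, zero_mem_boxAt n⟩) =
          -spinVal (η ⟨0, zero_mem_boxAt n⟩) := fun η => by
      simp [spinVal]
      grind
    grind [sum_neg_distrib]
  grind [mag, PiOp, Real.exp_zero]

lemma tendsto_mag_subcritical (h0 : 0 ≤ β) (h1 : β < betaC) : NoMag β := by
  rcases h0.eq_or_lt with rfl | h
  · simp only [funext mag_zero]; simp_all
  · exact tendsto_mag_of_lt h h1

lemma exists_mag_mul_le (h0 : 0 ≤ β) (h1 : β < betaC) : ∃ L : ℕ, 1 ≤ L ∧ mag β L * (4 * (2 * (L + 1) + 1)) ≤ 1 / 2 := by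
  have t1 := tendsto_mag_subcritical h0 h1
  have t2 : Tendsto (fun n : ℕ => (n : ℝ) * mag β n) atTop (𝓝 0) := by
    rcases h0.eq_or_lt with rfl | h
    · grind [mag_zero, tendsto_const_nhds]
    · exact tendsto_mul_mag_of_lt h h1
  have t : Tendsto (fun n : ℕ => 8 * ((n : ℝ) * mag β n) + 12 * mag β n) atTop (𝓝 (8 * 0 + 12 * 0)) :=
    (t2.const_mul 8).add (t1.const_mul 12)
  obtain ⟨L, hL, hL1⟩ := ((t.eventually (gt_mem_nhds (show (8 : ℝ) * 0 + 12 * 0 < 1 / 2 by norm_num))).and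
    (eventually_ge_atTop 1)).exists
  grind

/-- Stretched exponential decay of the arm probability with fewer coins. -/
lemma armProb_decay (h0 : 0 ≤ β) (h1 : β < betaC) (hγ : IsGibbsIsing β γ) (hF : ∀ᵐ σ ∂γ, σ ∈ finStar true) :
    ∃ K δ : ℝ, 0 < δ ∧ ∀ n : ℕ, armProb γ n (-1) ≤ K * exp (-δ * sqrt n) := by
  have := hγ.1
  have hm := tendsto_mag_subcritical h0 h1
  obtain ⟨L, hL1, hL⟩ := exists_mag_mul_le h0 h1
  obtain ⟨C, hC, hpiv⟩ := exists_sum_boxPivotal_le hγ hL1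
  have hb := tendsto_armProb hF 1
  obtain ⟨n₀, hn₀⟩ := eventually_atTop.1 (hb.eventually (gt_mem_nhds (show (0 : ℝ) < 1 / 2 by norm_num)))
  refine decay_of_diff_ineq (armProb γ) (armProb' γ) (b := 1) (c := 1 / (36 * (3 * C + 1))) (C := 1)
    (n₀ := max n₀ L) (by norm_num) (by positivity) zero_le_one (hasDerivAt_armProb γ) armProb_nonneg
    armProb_le_one armProb_mono (fun n hn s hs => ?_) hb
  have hhalf : armProb γ n s ≤ 1 / 2 := (armProb_mono n hs.2).trans (hn₀ n ((le_max_left _ _).trans hn)).le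
  have key := armProb_ineq h0 hm hγ s n
  have hsum := sum_armCorr_le h0 hm hγ n L hL s
  have hp' := hpiv n ((le_max_right _ _).trans hn) s hs
  have hS : 0 ≤ ∑ r ∈ range n, armProb γ r s := sum_nonneg fun r _ => armProb_nonneg r s
  have hθ := armProb_nonneg (γ := γ) n s
  have h3 : (n : ℝ) * (armProb γ n s * (1 / 2)) ≤ n * (armProb γ n s * (1 - armProb γ n s)) :=
    mul_le_mul_of_nonneg_left (mul_le_mul_of_nonneg_left (by linarith) hθ) (cast_nonneg n)
  generalize ∑ r ∈ range n, armProb γ r s = S at *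
  generalize ∑ y ∈ boxAt 0 n, armCorr γ n s y = q at *
  generalize armProb γ n s = t at *
  generalize armProb' γ n s = t' at *
  have h4 : 18 * (1 + S) * (q + t') ≤ 18 * (1 + S) * ((3 * C + 1) * (t' + t)) :=
    mul_le_mul_of_nonneg_left (by nlinarith) (by positivity)
  have h5 : 1 / (36 * (3 * C + 1)) * n / (1 + S) * t ≤ t' + t := by
    rw [div_mul_eq_mul_div, div_mul_eq_mul_div, one_mul, div_mul_eq_mul_div, div_div, div_le_iff₀ (by positivity)]
    linarith
  linarith

lemma summable_exp_neg_sqrt {δ : ℝ} (hδ : 0 < δ) : Summable fun n : ℕ => exp (-δ * sqrt n) := by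
  have hsq : Tendsto (fun m : ℕ => δ * sqrt (m : ℝ)) atTop atTop :=
    (Real.tendsto_sqrt_atTop.comp tendsto_natCast_atTop_atTop).const_mul_atTop hδ
  have t := (Real.tendsto_pow_mul_exp_neg_atTop_nhds_zero 4).comp hsq
  refine summable_of_isBigO_nat (g := fun n : ℕ => 1 / (n : ℝ) ^ 2) (Real.summable_one_div_nat_pow.2 one_lt_two) ?_
  obtain ⟨N, hN⟩ := eventually_atTop.1 (t.eventually (gt_mem_nhds (show (0 : ℝ) < 1 by norm_num)))
  refine Asymptotics.IsBigO.of_bound (1 / δ ^ 4) (eventually_atTop.2 ⟨max N 1, fun n hn => ?_⟩)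
  have h := (hN n ((le_max_left _ _).trans hn)).le
  have hn1 : (0 : ℝ) < n := by exact_mod_cast (le_max_right N 1).trans hn
  have e : sqrt n ^ 4 = (n : ℝ) ^ 2 := by grind
  simp [mul_pow, e] at h
  rw [Real.norm_of_nonneg (exp_pos _).le, Real.norm_of_nonneg (by positivity), div_mul_div_comm, one_mul,
    le_div_iff₀ (by positivity), neg_mul]
  linarith

lemma exists_arm_of_finStar {σ : Ω} (hσ : σ ∈ finStar false) (n : ℕ) : ∃ m : ℕ, n ≤ m ∧ ∃ i, arm (((m : ℤ) + 1, 0) + dir i) m ⊥ σ := by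
  obtain ⟨j, k, hj, hk, h⟩ := exists_plus_path hσ (n + 1)
  obtain ⟨m, rfl⟩ : ∃ m : ℕ, j = m + 1 := ⟨(j - 1).toNat, by omega⟩
  refine ⟨m, by omega, ?_⟩
  rcases h.cases_head with h | ⟨v, ⟨⟨i, rfl⟩, hv⟩, h⟩
  · grind
  · refine ⟨i, ?_⟩
    have hp : ∀ {a b : V}, ReflTransGen (fun u v => (∃ i, v = u + dir i) ∧ σ v = true) a b → σ a = true →
        ReflTransGen (hop ⊥ fun u => σ u = true) a b ∧ σ b = true := fun {a b} hab ha => by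
      induction hab with
      | refl => grind
      | tail _ h2 ih => exact ⟨ih.1.tail ⟨Or.inl h2.1, ih.2, h2.2⟩, h2.2⟩
    refine exists_arm_of_path ?_ (hp h hv).1
    rw [nrm]
    fin_cases i <;> simp [dir] <;> omega

/-- Below the critical point the absence of infinite star clusters of both signs is impossible. -/
theorem IsGibbsIsing.not_finStar_both (h0 : 0 ≤ β) (h1 : β < betaC) (hγ : IsGibbsIsing β γ)
    (hF : ∀ᵐ σ ∂γ, σ ∈ finStar false) (hF' : ∀ᵐ σ ∂γ, σ ∈ finStar true) : False := by
  have := hγ.1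
  have hm := tendsto_mag_subcritical h0 h1
  obtain ⟨K, δ, hδ, hK⟩ := armProb_decay h0 h1 hγ hF'
  have hint : ∀ u d, γ {σ | arm u d ⊥ σ} ≤ ENNReal.ofReal (K * exp (-δ * sqrt d)) := fun u d => by
    have a1 := mul_meas_ge_le_integral_of_nonneg (μ := γ) (Eventually.of_forall fun σ => ind_nonneg (arm u d ⊥ σ))
      (dep_arm_spins u d ⊥).integrable 1
    have a2 := coinE_arm_le h0 hm hγ (-1) ∅ u d
    have a3 := coinE_mono (-1) ∅ (g := fun _ => ∫ σ, ind (arm u d ⊥ σ) ∂γ) (g' := fun c => ∫ σ, ind (arm u d c σ) ∂γ)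
      fun c => integral_mono (dep_arm_spins u d _).integrable (dep_arm_spins u d _).integrable fun σ =>
        ind_mono fun h => arm_mono (fun p _ hp => absurd hp (by simp)) (fun _ _ h => h) h
    rw [coinE_const] at a3
    rw [one_mul] at a1
    rw [← ofReal_measureReal]
    refine ENNReal.ofReal_le_ofReal (le_trans (measureReal_mono fun σ hσ => ?_) (a1.trans (a3.trans (a2.trans (hK d)))))
    grind [ind_of]
  have hsum : ∑' m : ℕ, γ {σ | ∃ i, arm (((m : ℤ) + 1, 0) + dir i) m ⊥ σ} ≠ ⊤ := by
    have hs := ((summable_exp_neg_sqrt hδ).mul_left K).tsum_ofReal_ne_top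
    refine ne_top_of_le_ne_top (ENNReal.mul_ne_top (ENNReal.natCast_ne_top 4) hs) ?_
    rw [← ENNReal.tsum_mul_left]
    refine ENNReal.tsum_le_tsum fun m => ?_
    rw [show {σ | ∃ i, arm (((m : ℤ) + 1, 0) + dir i) m ⊥ σ} = ⋃ i, {σ | arm (((m : ℤ) + 1, 0) + dir i) m ⊥ σ} by ext; simp]
    refine (measure_iUnion_fintype_le γ _).trans ((sum_le_sum fun i _ => hint _ m).trans_eq ?_)
    simp
  obtain ⟨σ, hσ, hσ'⟩ := (hF.and (ae_eventually_notMem hsum)).exists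
  obtain ⟨N, hN⟩ := eventually_atTop.1 hσ'
  obtain ⟨m, hm', i, hi⟩ := exists_arm_of_finStar hσ N
  grind

end NoCoexistence

section Percolation

variable {β : ℝ} {γ : Measure Ω}

lemma ae_map_flipBy {κ : V → Bool} {b : Bool} (h : ∀ᵐ σ ∂γ, flipBy κ σ ∈ finStar b) : ∀ᵐ σ ∂γ.map (flipBy κ), σ ∈ finStar b :=
  (ae_map_iff (continuous_flipBy κ).aemeasurable (measurableSet_finStar b)).2 h

/-- Infinite star clusters cannot be absent for both signs in a ferromagnetic Gibbs measure off criticality. -/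
lemma IsGibbsIsing.not_finStar_both_of_ne (h0 : 0 ≤ β) (h1 : β ≠ betaC) (hγ : IsGibbsIsing β γ)
    (hF : ∀ᵐ σ ∂γ, σ ∈ finStar false) (hF' : ∀ᵐ σ ∂γ, σ ∈ finStar true) : False := by
  rcases h1.lt_or_gt with h | h
  · exact hγ.not_finStar_both h0 h hF hF'
  · obtain ⟨m, hm0, hm⟩ := exists_le_mag_of_gt h
    have h2 := hγ.le_integral_spin h0 hF hm
    have h3 := (hγ.flip true).le_integral_spin h0 (ae_map_flipBy (by simp_all [finStar_flip])) hm
    rw [integral_map (continuous_flipBy _).aemeasurable (measurable_spin 0).aestronglyMeasurable] at h3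
    have e : ∀ σ : Ω, spinVal (_root_.flipBy (fun _ => true) σ 0) = -spinVal (σ 0) := fun σ => by grind [_root_.flipBy, spinVal]
    grind [integral_neg]

lemma IsGibbsIsing.not_ae_finStar_false (h1 : β < betaC) (h2 : β ≠ -betaC) (hγ : IsGibbsIsing β γ)
    (hF : ∀ᵐ σ ∂γ, σ ∈ finStar false) : False := by
  rcases le_or_gt 0 β with h0 | h0
  · have e := (hγ.flip true).unique h0 (tendsto_mag_subcritical h0 h1) hγ
    refine hγ.not_finStar_both_of_ne h0 h1.ne hF ?_
    rw [← e]
    exact ae_map_flipBy (by simp_all [finStar_flip])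
  · have hκ : ∀ (p : Bool) (x : V) i, xor p (parity (x + dir i)) = !xor p (parity x) := fun p x i => by grind [parity_add_dir]
    have a := hγ.flip_mem_finStar (κ := fun x => xor false (parity x)) (hκ false) h0.le hF
    have b := hγ.flip_mem_finStar (κ := fun x => xor true (parity x)) (hκ true) h0.le hF
    refine (hγ.flip_parity false).not_finStar_both_of_ne (by linarith) (fun h => h2 (by linarith)) (ae_map_flipBy a)
      (ae_map_flipBy (b.mono fun σ h => ?_))
    have e : _root_.flipBy (fun x => xor true (parity x)) σ =
        _root_.flipBy (fun _ => true) (_root_.flipBy (fun x => xor false (parity x)) σ) := by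
      ext x; simp [_root_.flipBy]
    rwa [e, finStar_flip] at h

lemma IsGibbsIsing.measure_finStar (h1 : β < betaC) (h2 : β ≠ -betaC) (hγ : IsGibbsIsing β γ) (b : Bool) : γ (finStar b) = 0 := by
  by_contra h
  have hc := hγ.cond (measurableSet_finStar b) (isTail_finStar b) h
  have hF : ∀ᵐ σ ∂ProbabilityTheory.cond γ (finStar b), σ ∈ finStar b := ProbabilityTheory.ae_cond_mem (measurableSet_finStar b)
  cases b
  · exact hc.not_ae_finStar_false h1 h2 hF
  · exact (hc.flip true).not_ae_finStar_false h1 h2 (ae_map_flipBy (by simp_all [finStar_flip]))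

end Percolation

/-- For every `β < β_c = (1/2) log(1+√2)` with `β ≠ -β_c` and every Gibbs measure `γ`
for the Ising model on the dual lattice with parameter `β`, the contours `Γ(σ)` almost
surely percolate. -/
theorem ising_contours_percolate (β : ℝ)
    (hβ : β < (1 / 2) * Real.log (1 + Real.sqrt 2))
    (hβ' : β ≠ -((1 / 2) * Real.log (1 + Real.sqrt 2)))
    (γ : Measure SpinConfig) (hγ : IsGibbsIsing β γ) :
    γ {σ : SpinConfig | HasInfiniteCluster (contour σ)} = 1 := by
  have := hγ.1
  have h : ∀ b, ∀ᵐ σ ∂γ, σ ∉ finStar b := fun b =>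
    measure_eq_zero_iff_ae_notMem.1 (hγ.measure_finStar hβ hβ' b)
  have hp : ∀ᵐ σ ∂γ, HasInfiniteCluster (contour σ) := by
    filter_upwards [h true, h false] with σ ht hf
    grind [finStar_of_not_percolate]
  refine le_antisymm prob_le_one ?_
  rw [← measure_univ (μ := γ)]
  exact measure_mono_ae (hp.mono fun σ hσ _ => hσ)

end
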